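/- cat(SO(10)) = 21, and this equals the F_2-cup-length of SO(10). -/

import Mathlib

/-!
STATEMENT 14: cat(SO(10)) = 21, and this equals the F₂-cup-length of SO(10),
where cup(SO(10); F₂) is computed from
H^*(SO(10); F₂) ≅ F₂[x₁,x₃,x₅,x₇,x₉]/(x₁¹⁶, x₃⁴, x₅², x₇², x₉²).
-/

open MvPolynomial

noncomputable section

/-- A subset `U` of `X` is contractible in `X` if the inclusion `U ↪ X` is homotopic to a
constant map. -/
def ContractibleIn {X : Type*} [TopologicalSpace X] (U : Set X) : Prop :=
  ∃ (x0 : X) (H : C(U × unitInterval, X)),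
    (∀ u : U, H (u, 0) = (u : X)) ∧ (∀ u : U, H (u, 1) = x0)

/-- `catLE X n` : the (normalized) Lusternik–Schnirelmann category of `X` is at most `n`,
i.e. `X` has an open cover by `n+1` sets each contractible in `X`. -/
def catLE (X : Type*) [TopologicalSpace X] (n : ℕ) : Prop :=
  ∃ U : Fin (n + 1) → Set X,
    (∀ i, IsOpen (U i)) ∧ (∀ x, ∃ i, x ∈ U i) ∧ ∀ i, ContractibleIn (U i)

/-- The (normalized) Lusternik–Schnirelmann category of `X`, with `cat(point) = 0`. -/
def catNat (X : Type*) [TopologicalSpace X] : ℕ := sInf {n | catLE X n}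

/-- The special orthogonal group SO(10) as a topological space. -/
abbrev SO10 : Type := ↥(Matrix.specialOrthogonalGroup (Fin 10) ℝ)

/-- The weights recording the cohomological degrees of x₁, x₃, x₅, x₇, x₉. -/
def degWeight : Fin 5 → ℕ := ![1, 3, 5, 7, 9]

/-- The ideal of relations (x₁¹⁶, x₃⁴, x₅², x₇², x₉²). -/
def relIdeal : Ideal (MvPolynomial (Fin 5) (ZMod 2)) :=
  Ideal.span {X 0 ^ 16, X 1 ^ 4, X 2 ^ 2, X 3 ^ 2, X 4 ^ 2}

/-- The mod 2 cohomology algebra `H^*(SO(10); F₂)`. -/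
abbrev CohSO10 : Type := MvPolynomial (Fin 5) (ZMod 2) ⧸ relIdeal

/-- The quotient map. -/
def toCoh : MvPolynomial (Fin 5) (ZMod 2) →+* CohSO10 := Ideal.Quotient.mk relIdeal

/-- Homogeneous elements of positive degree in the quotient algebra. -/
def IsHomogPos (a : CohSO10) : Prop :=
  ∃ (p : MvPolynomial (Fin 5) (ZMod 2)) (n : ℕ), 0 < n ∧
    p.IsWeightedHomogeneous degWeight n ∧ toCoh p = a

theorem relIdeal_eq_span_monomial :
    relIdeal = Ideal.span ((fun s => monomial s (1 : ZMod 2)) ''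
      {Finsupp.single 0 16, Finsupp.single 1 4, Finsupp.single 2 2, Finsupp.single 3 2,
        Finsupp.single 4 2}) := by
  simp only [relIdeal, Set.image_insert_eq, Set.image_singleton, X_pow_eq_monomial]

theorem isGreatest_cupLength_CohSO10 :
    IsGreatest {k : ℕ | ∃ a : Fin k → CohSO10,
      (∀ i, IsHomogPos (a i)) ∧ ∏ i, a i ≠ 0} 21 := by
  constructor
  · let f : Fin 21 → Fin 5 :=
      ![0, 0, 0, 0, 0, 0, 0, 0, 0, 0, 0, 0, 0, 0, 0, 1, 1, 1, 2, 3, 4]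
    refine ⟨fun i => toCoh (X (f i)), fun i => ⟨X (f i), degWeight (f i), ?_,
      isWeightedHomogeneous_X _ _ _, rfl⟩, ?_⟩
    · generalize f i = j
      fin_cases j <;> simp [degWeight]
    · rw [← map_prod, toCoh, Ne, Ideal.Quotient.eq_zero_iff_mem, relIdeal_eq_span_monomial,
        mem_ideal_span_monomial_image]
      have h : ∏ i, (X (f i) : MvPolynomial (Fin 5) (ZMod 2)) =
          monomial (∑ i, Finsupp.single (f i) 1) 1 := by
        rw [monomial_sum_one]; rfl
      rw [h, support_monomial, if_neg one_ne_zero]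
      intro H
      obtain ⟨s, hs, hle⟩ := H _ (Finset.mem_singleton_self _)
      have e : ∀ j, (∑ i, Finsupp.single (f i) 1 : Fin 5 →₀ ℕ) j = ![15, 3, 1, 1, 1] j := by
        intro j
        rw [Finsupp.finsetSum_apply]
        fin_cases j <;> simp [Finsupp.single_apply, f] <;> decide
      simp only [Set.mem_insert_iff, Set.mem_singleton_iff] at hs
      rcases hs with rfl | rfl | rfl | rfl | rfl
      · simpa [e] using hle 0
      · simpa [e] using hle 1
      · simpa [e] using hle 2
      · simpa [e] using hle 3
      · simpa [e] using hle 4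
  · rintro k ⟨a, ha, hne⟩
    by_contra! hk
    apply hne
    choose p n hn hp hpa using ha
    simp only [← hpa, ← map_prod]
    rw [toCoh, Ideal.Quotient.eq_zero_iff_mem]
    have hmem : ∀ i, p i ∈ idealOfVars (Fin 5) (ZMod 2) := by
      intro i
      rw [← pow_one (idealOfVars _ _), mem_pow_idealOfVars_iff]
      intro x hx
      by_contra! hdeg
      have hx0 : x = 0 := by
        rw [← Finsupp.degree_eq_zero_iff]
        omega
      have := hp i (mem_support_iff.mp hx)
      rw [hx0] at this
      simp at this
      exact (hn i).ne this
    have hprod : ∏ i, p i ∈ idealOfVars (Fin 5) (ZMod 2) ^ k := by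
      have := Ideal.prod_mem_prod (s := Finset.univ) (x := p) fun i _ => hmem i
      simpa using this
    rw [relIdeal_eq_span_monomial, mem_ideal_span_monomial_image]
    intro x hx
    have hdeg := (mem_pow_idealOfVars_iff _ _).mp hprod x hx
    rw [Finsupp.degree_eq_sum, Fin.sum_univ_five] at hdeg
    have key : 16 ≤ x 0 ∨ 4 ≤ x 1 ∨ 2 ≤ x 2 ∨ 2 ≤ x 3 ∨ 2 ≤ x 4 := by omega
    rcases key with h | h | h | h | h
    exacts [⟨_, by simp, Finsupp.single_le_iff.mpr h⟩, ⟨_, by simp, Finsupp.single_le_iff.mpr h⟩,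
      ⟨_, by simp, Finsupp.single_le_iff.mpr h⟩, ⟨_, by simp, Finsupp.single_le_iff.mpr h⟩,
      ⟨_, by simp, Finsupp.single_le_iff.mpr h⟩]

namespace AlexanderSpanier

variable {X Y Z : Type*}

/-- The mod 2 coboundary of a function on finite sequences of points. -/
def cobdry : (List X → ZMod 2) → List X → ZMod 2
  | _, [] => 0
  | c, x :: l => c l + cobdry (fun m => c (x :: m)) l

/-- The cup product: sum over all ways to split a sequence at a shared vertex. -/
def cup : (List X → ZMod 2) → (List X → ZMod 2) → List X → ZMod 2
  | _, _, [] => 0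
  | c, d, x :: l => c [x] * d (x :: l) + cup (fun m => c (x :: m)) d l

/-- The prism operator of a pair of maps. -/
def prism (f g : Y → X) : (List X → ZMod 2) → List Y → ZMod 2
  | _, [] => 0
  | c, y :: l => c (f y :: g y :: l.map g) + prism f g (fun m => c (f y :: m)) l

/-- The unit cochain. -/
def unitCochain : List X → ZMod 2
  | [_] => 1
  | _ => 0

@[simp] theorem cobdry_nil (c : List X → ZMod 2) : cobdry c [] = 0 := rfl

theorem cobdry_cons (c : List X → ZMod 2) (x : X) (l : List X) :
    cobdry c (x :: l) = c l + cobdry (fun m => c (x :: m)) l := rfl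

@[simp] theorem cup_nil (c d : List X → ZMod 2) : cup c d [] = 0 := rfl

theorem cup_cons (c d : List X → ZMod 2) (x : X) (l : List X) :
    cup c d (x :: l) = c [x] * d (x :: l) + cup (fun m => c (x :: m)) d l := rfl

@[simp] theorem prism_nil (f g : Y → X) (c : List X → ZMod 2) : prism f g c [] = 0 := rfl

theorem prism_cons (f g : Y → X) (c : List X → ZMod 2) (y : Y) (l : List Y) :
    prism f g c (y :: l) =
      c (f y :: g y :: l.map g) + prism f g (fun m => c (f y :: m)) l := rfl

theorem add_self_zmod_two (a : ZMod 2) : a + a = 0 := CharTwo.add_self_eq_zero a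

theorem cobdry_add (c d : List X → ZMod 2) (l : List X) :
    cobdry (fun m => c m + d m) l = cobdry c l + cobdry d l := by
  induction l generalizing c d with
  | nil => simp
  | cons x l ih => simp only [cobdry_cons, ih]; ring

theorem cobdry_mul_left (a : ZMod 2) (c : List X → ZMod 2) (l : List X) :
    cobdry (fun m => a * c m) l = a * cobdry c l := by
  induction l generalizing c with
  | nil => simp
  | cons x l ih => simp only [cobdry_cons, ih]; ring

theorem cobdry_cobdry (c : List X → ZMod 2) (l : List X) : cobdry (cobdry c) l = 0 := by
  induction l generalizing c with
  | nil => simp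
  | cons x l ih =>
    simp only [cobdry_cons, cobdry_add, ih, add_zero]
    exact add_self_zmod_two _

theorem cobdry_map (f : Y → X) (c : List X → ZMod 2) (l : List Y) :
    cobdry (fun m => c (m.map f)) l = cobdry c (l.map f) := by
  induction l generalizing c with
  | nil => simp
  | cons x l ih => simp only [cobdry_cons, List.map_cons, ← ih]

theorem cup_add_left (c c' d : List X → ZMod 2) (l : List X) :
    cup (fun m => c m + c' m) d l = cup c d l + cup c' d l := by
  induction l generalizing c c' with
  | nil => simp
  | cons x l ih => simp only [cup_cons, ih]; ring

theorem cup_mul_left (a : ZMod 2) (c d : List X → ZMod 2) (l : List X) :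
    cup (fun m => a * c m) d l = a * cup c d l := by
  induction l generalizing c with
  | nil => simp
  | cons x l ih => simp only [cup_cons, ih]; ring

theorem cup_add_right (c d d' : List X → ZMod 2) (l : List X) :
    cup c (fun m => d m + d' m) l = cup c d l + cup c d' l := by
  induction l generalizing c with
  | nil => simp
  | cons x l ih => simp only [cup_cons, ih]; ring

theorem cup_zero_left (d : List X → ZMod 2) (l : List X) : cup (fun _ => 0) d l = 0 := by
  induction l with
  | nil => simp
  | cons x l ih => simp [cup_cons, ih]

theorem cup_assoc (c d e : List X → ZMod 2) (l : List X) :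
    cup (cup c d) e l = cup c (cup d e) l := by
  induction l generalizing c with
  | nil => simp
  | cons x l ih => simp only [cup_cons, cup_add_left, cup_mul_left, ih, cup_nil]; ring

theorem cup_map (f : Y → X) (c d : List X → ZMod 2) (l : List Y) :
    cup (fun m => c (m.map f)) (fun m => d (m.map f)) l = cup c d (l.map f) := by
  induction l generalizing c with
  | nil => simp
  | cons x l ih => simp only [cup_cons, List.map_cons, List.map_nil, ← ih]

theorem unitCochain_cup (d : List X → ZMod 2) (hd : d [] = 0) (l : List X) :
    cup unitCochain d l = d l := by
  cases l with
  | nil => simp [hd]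
  | cons x l =>
    cases l with
    | nil => simp [cup_cons, unitCochain]
    | cons y l =>
      simp [cup_cons, unitCochain, cup_zero_left]

theorem cup_unitCochain_cons (c : List X → ZMod 2) (x : X) (l : List X) :
    cup c unitCochain (x :: l) = c (x :: l) := by
  induction l generalizing c x with
  | nil => simp [cup_cons, unitCochain]
  | cons y l ih => rw [cup_cons, ih]; simp [unitCochain]

theorem cobdry_cup (c d : List X → ZMod 2) (hd : d [] = 0) (l : List X) :
    cobdry (cup c d) l = cup (cobdry c) d l + cup c (cobdry d) l + c [] * d l := by
  induction l generalizing c with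
  | nil => simp [hd]
  | cons x l ih =>
    simp only [cup_cons, cobdry_cons, cobdry_nil, cobdry_add, cobdry_mul_left, cup_add_left, ih]
    linear_combination (-c [] * d (x :: l)) * (by decide : (2 : ZMod 2) = 0)

theorem prism_add (f g : Y → X) (c d : List X → ZMod 2) (l : List Y) :
    prism f g (fun m => c m + d m) l = prism f g c l + prism f g d l := by
  induction l generalizing c d with
  | nil => simp
  | cons x l ih => simp only [prism_cons, ih]; ring

theorem prism_mul_left (f g : Y → X) (a : ZMod 2) (c : List X → ZMod 2) (l : List Y) :
    prism f g (fun m => a * c m) l = a * prism f g c l := by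
  induction l generalizing c with
  | nil => simp
  | cons x l ih => simp only [prism_cons, ih]; ring

theorem cobdry_prism (f g : Y → X) (c : List X → ZMod 2) (l : List Y) :
    cobdry (prism f g c) l + prism f g (cobdry c) l = c (l.map f) + c (l.map g) := by
  induction l generalizing c with
  | nil => simp [add_self_zmod_two]
  | cons y l ih =>
    have h := ih (fun m => c (f y :: m))
    have h' := cobdry_map g (fun m => c (f y :: g y :: m)) l
    simp only [prism_cons, cobdry_cons, cobdry_add, prism_add, h', List.map_cons] at h ⊢
    linear_combination h + (prism f g c l + c (f y :: l.map g) +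
      cobdry (fun m => c (f y :: g y :: m)) (l.map g)) * (by decide : (2 : ZMod 2) = 0)

theorem prism_cup (f g : Y → X) (c d : List X → ZMod 2) (l : List Y) :
    prism f g (cup c d) l =
      cup (prism f g c) (fun m => d (m.map g)) l + cup (fun m => c (m.map f)) (prism f g d) l := by
  induction l generalizing c with
  | nil => simp
  | cons y l ih =>
    have h := cup_map g (fun m => c (f y :: g y :: m)) d l
    simp only [prism_cons, cup_cons, prism_add, prism_mul_left, cup_add_left, ih,
      List.map_cons, List.map_nil, h, prism_nil]
    ring

theorem prism_map {W : Type*} (f g : Y → X) (u : W → Y) (c : List X → ZMod 2) (l : List W) :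
    prism f g c (l.map u) = prism (f ∘ u) (g ∘ u) c l := by
  induction l generalizing c with
  | nil => simp
  | cons y l ih => simp [prism_cons, ih]

theorem prism_comap {W : Type*} (f g : Y → X) (u : X → W) (c : List W → ZMod 2) (l : List Y) :
    prism f g (fun m => c (m.map u)) l = prism (u ∘ f) (u ∘ g) c l := by
  induction l generalizing c with
  | nil => simp
  | cons y l ih => simp [prism_cons, ih (fun m => c (u (f y) :: m))]

/-- A cochain is normalized if it vanishes on sequences with a repeated consecutive term. -/
def Normalized (c : List X → ZMod 2) : Prop := ∀ l x l', c (l ++ x :: x :: l') = 0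

theorem Normalized.cons {c : List X → ZMod 2} (hc : Normalized c) (x : X) :
    Normalized fun m => c (x :: m) := fun l y l' => hc (x :: l) y l'

theorem Normalized.cup {c d : List X → ZMod 2} (hc : Normalized c) (hd : Normalized d) :
    Normalized (cup c d) := by
  intro l x l'
  induction l generalizing c with
  | nil =>
    simp only [List.nil_append, cup_cons]
    have h1 : d (x :: x :: l') = 0 := hd [] x l'
    have h2 : c [x, x] = 0 := hc [] x []
    have h3 : (fun m => c (x :: x :: m)) = fun _ => 0 := funext fun m => hc [] x m
    rw [h1, h2, h3, cup_zero_left]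
    ring
  | cons y l ih =>
    simp only [List.cons_append, cup_cons]
    rw [ih (hc.cons y), ← List.cons_append, hd (y :: l) x l']
    ring

theorem prism_of_normalized (f : Y → X) (c : List X → ZMod 2) (hc : Normalized c)
    (l : List Y) : prism f f c l = 0 := by
  induction l generalizing c with
  | nil => simp
  | cons y l ih =>
    rw [prism_cons, ih _ (hc.cons _), add_zero]
    exact hc [] _ _

/-- Support of a prism: if `c` vanishes on sequences inside `N`, its prism vanishes on sequences
that both maps send into `N`. -/
theorem prism_eq_zero (f g : Y → X) (c : List X → ZMod 2) (N : Set X)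
    (hc : ∀ l, l ≠ [] → (∀ x ∈ l, x ∈ N) → c l = 0) (l : List Y)
    (hl : ∀ y ∈ l, f y ∈ N ∧ g y ∈ N) : prism f g c l = 0 := by
  induction l generalizing c with
  | nil => simp
  | cons y l ih =>
    have hy := hl y (by simp)
    have hl' : ∀ z ∈ l, f z ∈ N ∧ g z ∈ N := fun z hz => hl z (by simp [hz])
    rw [prism_cons, hc _ (by simp), ih _ _ hl', add_zero]
    · intro m _ hm
      exact hc _ (by simp) (by simpa using ⟨hy.1, hm⟩)
    · intro x hx
      simp only [List.mem_cons, List.mem_map] at hx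
      rcases hx with rfl | rfl | ⟨z, hz, rfl⟩
      exacts [hy.1, hy.2, (hl' z hz).2]

theorem cobdry_eq_zero (c : List X → ZMod 2) (N : Set X)
    (hc : ∀ l, (∀ x ∈ l, x ∈ N) → c l = 0) (l : List X) (hl : ∀ x ∈ l, x ∈ N) :
    cobdry c l = 0 := by
  induction l generalizing c with
  | nil => simp
  | cons y l ih =>
    rw [cobdry_cons, hc _ (fun x hx => hl x (by simp [hx])), ih, add_zero]
    · exact fun m hm => hc _ (by simpa using ⟨hl y (by simp), hm⟩)
    · exact fun x hx => hl x (by simp [hx])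

theorem cup_eq_zero_left (c d : List X → ZMod 2) (N : Set X)
    (hc : ∀ l, l ≠ [] → (∀ x ∈ l, x ∈ N) → c l = 0) (l : List X) (hl : ∀ x ∈ l, x ∈ N) :
    cup c d l = 0 := by
  induction l generalizing c with
  | nil => simp
  | cons y l ih =>
    rw [cup_cons, hc [y] (by simp) (by simpa using hl y (by simp)), zero_mul, ih, add_zero]
    · exact fun m _ hm => hc _ (by simp) (by simpa using ⟨hl y (by simp), hm⟩)
    · exact fun x hx => hl x (by simp [hx])

theorem cup_eq_zero_right (c d : List X → ZMod 2) (N : Set X)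
    (hd : ∀ l, (∀ x ∈ l, x ∈ N) → d l = 0) (l : List X) (hl : ∀ x ∈ l, x ∈ N) :
    cup c d l = 0 := by
  induction l generalizing c with
  | nil => simp
  | cons y l ih =>
    rw [cup_cons, hd _ hl, mul_zero, ih, add_zero]
    exact fun x hx => hl x (by simp [hx])

end AlexanderSpanier

namespace AlexanderSpanier

/-- Families of mod 2 cochains, indexed by a subdivision parameter. -/
def cochSubgroup (X : Type*) : AddSubgroup (ℕ → List X → ZMod 2) where
  carrier := {c | ∀ M, c M [] = 0}
  add_mem' := fun {a b} ha hb M => by simp [ha M, hb M]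
  zero_mem' := fun _ => rfl
  neg_mem' := fun {a} ha M => by simp [ha M]

/-- Families of mod 2 cochains on `X`, made into a ring with the cup product. -/
def Coch (X : Type*) : Type _ := cochSubgroup X

namespace Coch

variable {X Y Z : Type*}

instance : AddCommGroup (Coch X) := inferInstanceAs (AddCommGroup (cochSubgroup X))

/-- Evaluation of a cochain. -/
def ev (c : Coch X) (M : ℕ) (l : List X) : ZMod 2 := c.1 M l

/-- Cochains from functions vanishing on the empty sequence. -/
def mk (f : ℕ → List X → ZMod 2) (hf : ∀ M, f M [] = 0) : Coch X := ⟨f, hf⟩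

@[simp] theorem ev_mk (f : ℕ → List X → ZMod 2) (hf) (M : ℕ) (l : List X) :
    (mk f hf).ev M l = f M l := rfl

@[simp] theorem ev_nil (c : Coch X) (M : ℕ) : c.ev M [] = 0 := c.2 M

@[simp] theorem ev_add (c d : Coch X) (M : ℕ) (l : List X) :
    (c + d).ev M l = c.ev M l + d.ev M l := rfl

@[simp] theorem ev_zero (M : ℕ) (l : List X) : (0 : Coch X).ev M l = 0 := rfl

@[ext] theorem ext {c d : Coch X} (h : ∀ M l, c.ev M l = d.ev M l) : c = d :=
  Subtype.ext (funext fun M => funext fun l => h M l)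

instance : Mul (Coch X) := ⟨fun c d => mk (fun M => cup (c.ev M) (d.ev M)) fun _ => rfl⟩

instance : One (Coch X) := ⟨mk (fun _ => unitCochain) fun _ => rfl⟩

theorem ev_mul (c d : Coch X) (M : ℕ) (l : List X) :
    (c * d).ev M l = cup (c.ev M) (d.ev M) l := rfl

theorem ev_one (M : ℕ) (l : List X) : (1 : Coch X).ev M l = unitCochain l := rfl

instance : Ring (Coch X) :=
  { (inferInstance : AddCommGroup (Coch X)), (inferInstance : Mul (Coch X)),
    (inferInstance : One (Coch X)) with
    left_distrib := fun a b c => ext fun M l => cup_add_right _ _ _ l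
    right_distrib := fun a b c => ext fun M l => cup_add_left _ _ _ l
    zero_mul := fun a => ext fun M l => cup_zero_left _ l
    mul_zero := fun a => ext fun M l =>
      cup_eq_zero_right _ _ Set.univ (fun _ _ => rfl) l (by simp)
    mul_assoc := fun a b c => ext fun M l => cup_assoc _ _ _ l
    one_mul := fun a => ext fun M l => unitCochain_cup _ (ev_nil _ _) l
    mul_one := fun a => ext fun M l => by
      cases l with
      | nil => simp
      | cons x l => exact cup_unitCochain_cons _ x l }

theorem add_self (c : Coch X) : c + c = 0 := ext fun _ _ => add_self_zmod_two _

theorem eq_of_add_eq_zero {c d : Coch X} (h : c + d = 0) : c = d := by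
  rw [← add_zero c, ← add_self d, ← add_assoc, h, zero_add]

/-- The coboundary. -/
def bd : Coch X →+ Coch X where
  toFun c := mk (fun M => cobdry (c.ev M)) fun _ => rfl
  map_zero' := ext fun _ l => cobdry_eq_zero _ Set.univ (fun _ _ => rfl) l (by simp)
  map_add' c d := ext fun _ l => cobdry_add _ _ l

theorem ev_bd (c : Coch X) (M : ℕ) (l : List X) : (bd c).ev M l = cobdry (c.ev M) l := rfl

@[simp] theorem bd_bd (c : Coch X) : bd (bd c) = 0 := ext fun _ l => cobdry_cobdry _ l

theorem bd_mul (c d : Coch X) : bd (c * d) = bd c * d + c * bd d := ext fun M l => by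
  have := cobdry_cup (c.ev M) (d.ev M) (ev_nil _ _) l
  rw [ev_nil, zero_mul, add_zero] at this
  exact this

@[simp] theorem bd_one : bd (1 : Coch X) = 0 := by
  have h := bd_mul (1 : Coch X) 1
  simpa using h

/-- Pullback along a map. -/
def comap (f : Y → X) : Coch X →+* Coch Y where
  toFun c := mk (fun M l => c.ev M (l.map f)) fun M => by simp
  map_zero' := rfl
  map_add' _ _ := rfl
  map_one' := ext fun _ l => by
    change unitCochain _ = unitCochain _
    match l with
    | [] => rfl
    | [_] => rfl
    | _ :: _ :: _ => rfl
  map_mul' c d := ext fun _ l => (cup_map f _ _ l).symm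

@[simp] theorem ev_comap (f : Y → X) (c : Coch X) (M : ℕ) (l : List Y) :
    (comap f c).ev M l = c.ev M (l.map f) := rfl

theorem comap_comap (f : Y → X) (g : Z → Y) (c : Coch X) :
    comap g (comap f c) = comap (f ∘ g) c := ext fun M l => by simp

theorem comap_id (c : Coch X) : comap id c = c := ext fun M l => by simp

theorem bd_comap (f : Y → X) (c : Coch X) : bd (comap f c) = comap f (bd c) :=
  ext fun _ l => cobdry_map f _ l

/-- Homogeneous cochains of degree `n`. -/
def Deg (n : ℕ) (c : Coch X) : Prop := ∀ M l, l.length ≠ n + 1 → c.ev M l = 0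

theorem Deg.add {n : ℕ} {c d : Coch X} (hc : Deg n c) (hd : Deg n d) : Deg n (c + d) :=
  fun M l hl => by simp [hc M l hl, hd M l hl]

theorem Deg.comap {n : ℕ} {c : Coch X} (hc : Deg n c) (f : Y → X) : Deg n (comap f c) :=
  fun M l hl => hc M _ (by simpa using hl)

theorem cobdry_deg {n : ℕ} {c : List X → ZMod 2} (hc : ∀ l, l.length ≠ n → c l = 0)
    (l : List X) (hl : l.length ≠ n + 1) : cobdry c l = 0 := by
  induction l generalizing c n with
  | nil => simp
  | cons x l ih =>
    rw [cobdry_cons, hc l (by simpa using hl), zero_add]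
    cases n with
    | zero =>
      exact cobdry_eq_zero _ Set.univ (fun m _ => hc _ (by simp)) l (by simp)
    | succ n => exact ih (fun m hm => hc _ (by simpa using hm)) (by simpa using hl)

theorem Deg.bd {n : ℕ} {c : Coch X} (hc : Deg n c) : Deg (n + 1) (bd c) :=
  fun M l hl => cobdry_deg (hc M) l hl

theorem cup_deg {n m : ℕ} {c d : List X → ZMod 2} (hc : ∀ l, l.length ≠ n + 1 → c l = 0)
    (hd : ∀ l, l.length ≠ m + 1 → d l = 0) (l : List X) (hl : l.length ≠ n + m + 1) :
    cup c d l = 0 := by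
  induction l generalizing c n with
  | nil => simp
  | cons x l ih =>
    rw [cup_cons]
    cases n with
    | zero =>
      rw [hd (x :: l) (by simpa using hl), mul_zero, zero_add]
      exact cup_eq_zero_left _ _ Set.univ
        (fun m hm _ => hc _ (by simpa using hm)) l (by simp)
    | succ n =>
      rw [hc [x] (by simp), zero_mul, zero_add]
      refine ih (n := n) (fun m hm => hc _ (by simpa using hm)) ?_
      simp only [List.length_cons] at hl
      omega

theorem Deg.mul {n m : ℕ} {c d : Coch X} (hc : Deg n c) (hd : Deg m d) : Deg (n + m) (c * d) :=
  fun M l hl => cup_deg (hc M) (hd M) l hl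

theorem Deg.one : Deg 0 (1 : Coch X) := fun M l hl => by
  match l with
  | [] => rfl
  | [_] => simp at hl
  | _ :: _ :: _ => rfl

theorem Deg.pow {n : ℕ} {c : Coch X} (hc : Deg n c) (k : ℕ) : Deg (n * k) (c ^ k) := by
  induction k with
  | zero => simpa using Deg.one
  | succ k ih => rw [pow_succ]; exact ih.mul hc

/-- Families of normalized cochains. -/
def Norm (c : Coch X) : Prop := ∀ M, Normalized (c.ev M)

theorem Norm.mul {c d : Coch X} (hc : Norm c) (hd : Norm d) : Norm (c * d) :=
  fun M => (hc M).cup (hd M)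

theorem Norm.one : Norm (1 : Coch X) := fun M l x l' => by
  match l with
  | [] => rfl
  | [_] => rfl
  | _ :: _ :: _ => rfl

theorem Norm.pow {c : Coch X} (hc : Norm c) (k : ℕ) : Norm (c ^ k) := by
  induction k with
  | zero => simpa using Norm.one
  | succ k ih => rw [pow_succ]; exact ih.mul hc

/-- The degree zero cochain of a function. -/
def fn (s : X → ZMod 2) : Coch X := mk (fun _ l => match l with | [x] => s x | _ => 0) fun _ => rfl

theorem fn_deg (s : X → ZMod 2) : Deg 0 (fn s) := fun M l hl => by
  match l with
  | [] => rfl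
  | [_] => simp at hl
  | _ :: _ :: _ => rfl

@[simp] theorem ev_fn_singleton (s : X → ZMod 2) (M : ℕ) (x : X) : (fn s).ev M [x] = s x := rfl

@[simp] theorem ev_fn_cons_cons (s : X → ZMod 2) (M : ℕ) (x y : X) (l : List X) :
    (fn s).ev M (x :: y :: l) = 0 := rfl

theorem ext_deg {n : ℕ} {c d : Coch X} (hc : Deg n c) (hd : Deg n d)
    (h : ∀ M l, l.length = n + 1 → c.ev M l = d.ev M l) : c = d := ext fun M l => by
  by_cases hl : l.length = n + 1
  · exact h M l hl
  · rw [hc M l hl, hd M l hl]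

theorem fn_add (s t : X → ZMod 2) : fn (s + t) = fn s + fn t :=
  ext_deg (fn_deg _) ((fn_deg _).add (fn_deg _)) fun M l hl => by
    obtain ⟨x, rfl⟩ := List.length_eq_one_iff.mp hl
    simp

theorem fn_one : fn (fun _ : X => (1 : ZMod 2)) = 1 :=
  ext_deg (fn_deg _) Deg.one fun M l hl => by
    obtain ⟨x, rfl⟩ := List.length_eq_one_iff.mp hl
    rfl

theorem comap_fn (f : Y → X) (s : X → ZMod 2) : comap f (fn s) = fn (s ∘ f) :=
  ext_deg ((fn_deg _).comap f) (fn_deg _) fun M l hl => by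
    obtain ⟨x, rfl⟩ := List.length_eq_one_iff.mp hl
    simp

theorem ev_bd_fn (s : X → ZMod 2) (M : ℕ) (x y : X) :
    (bd (fn s)).ev M [x, y] = s x + s y := by
  simp [ev_bd, cobdry_cons, add_comm]

theorem bd_fn_deg (s : X → ZMod 2) : Deg 1 (bd (fn s)) := (fn_deg s).bd

theorem bd_fn_norm (s : X → ZMod 2) : Norm (bd (fn s)) := fun M l x l' => by
  by_cases h : (l ++ x :: x :: l').length = 2
  · have hl : l = [] := List.length_eq_zero_iff.mp (by simp at h; omega)
    have hl' : l' = [] := List.length_eq_zero_iff.mp (by simp at h; omega)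
    subst hl; subst hl'
    rw [List.nil_append, ev_bd_fn, add_self_zmod_two]
  · exact bd_fn_deg s M _ h

/-- Pointwise product, which witnesses the commutativity of the cup product in degree one. -/
def pmul (c d : Coch X) : Coch X := mk (fun M l => c.ev M l * d.ev M l) fun M => by simp

theorem bd_fn_mul_comm (s t : X → ZMod 2) :
    bd (fn s) * bd (fn t) + bd (fn t) * bd (fn s) = bd (pmul (bd (fn s)) (bd (fn t))) := by
  have hp : Deg 1 (pmul (bd (fn s)) (bd (fn t))) := fun M l hl => by
    change (bd (fn s)).ev M l * _ = 0
    rw [bd_fn_deg s M l hl, zero_mul]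
  refine ext_deg (n := 2) (((bd_fn_deg s).mul (bd_fn_deg t)).add ((bd_fn_deg t).mul (bd_fn_deg s)))
    hp.bd fun M l hl => ?_
  obtain ⟨x, y, z, rfl⟩ := List.length_eq_three.mp hl
  simp only [ev_add, ev_mul, ev_bd, cup_cons, cobdry_cons, cup_nil, cobdry_nil, pmul, ev_mk,
    ev_fn_singleton, ev_fn_cons_cons, ev_nil]
  generalize s x = a, s y = b, s z = c, t x = a', t y = b', t z = c'
  revert a b c a' b' c'
  decide

end Coch

end AlexanderSpanier

namespace AlexanderSpanier

namespace Coch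

open Filter Topology

variable {X Y Z : Type*} [TopologicalSpace X] [TopologicalSpace Y] [TopologicalSpace Z]

/-- The family `c` eventually vanishes on short sequences near `x`. -/
def ZeroNear (c : Coch X) (x : X) : Prop :=
  ∃ N ∈ 𝓝 x, ∀ᶠ M in atTop, ∀ l, (∀ y ∈ l, y ∈ N) → c.ev M l = 0

theorem ZeroNear.zero (x : X) : ZeroNear (0 : Coch X) x :=
  ⟨Set.univ, univ_mem, Eventually.of_forall fun _ _ _ => rfl⟩

theorem ZeroNear.add {c d : Coch X} {x : X} (hc : ZeroNear c x) (hd : ZeroNear d x) :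
    ZeroNear (c + d) x := by
  obtain ⟨N, hN, h⟩ := hc
  obtain ⟨N', hN', h'⟩ := hd
  refine ⟨N ∩ N', inter_mem hN hN', ?_⟩
  filter_upwards [h, h'] with M h1 h2 l hl
  rw [ev_add, h1 l fun y hy => (hl y hy).1, h2 l fun y hy => (hl y hy).2, add_zero]

theorem ZeroNear.mul_left {c : Coch X} {x : X} (hc : ZeroNear c x) (d : Coch X) :
    ZeroNear (d * c) x := by
  obtain ⟨N, hN, h⟩ := hc
  refine ⟨N, hN, ?_⟩
  filter_upwards [h] with M h1 l hl
  exact cup_eq_zero_right _ _ N h1 l hl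

theorem ZeroNear.mul_right {c : Coch X} {x : X} (hc : ZeroNear c x) (d : Coch X) :
    ZeroNear (c * d) x := by
  obtain ⟨N, hN, h⟩ := hc
  refine ⟨N, hN, ?_⟩
  filter_upwards [h] with M h1 l hl
  exact cup_eq_zero_left _ _ N (fun m _ hm => h1 m hm) l hl

theorem ZeroNear.bd {c : Coch X} {x : X} (hc : ZeroNear c x) : ZeroNear (bd c) x := by
  obtain ⟨N, hN, h⟩ := hc
  refine ⟨N, hN, ?_⟩
  filter_upwards [h] with M h1 l hl
  exact cobdry_eq_zero _ N h1 l hl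

theorem ZeroNear.comap {c : Coch X} {f : Y → X} {y : Y} (hf : ContinuousAt f y)
    (hc : ZeroNear c (f y)) : ZeroNear (comap f c) y := by
  obtain ⟨N, hN, h⟩ := hc
  refine ⟨f ⁻¹' N, hf hN, ?_⟩
  filter_upwards [h] with M h1 l hl
  refine h1 _ fun z hz => ?_
  obtain ⟨w, hw, rfl⟩ := List.mem_map.mp hz
  exact hl w hw

/-- The family `c` is locally zero. -/
def LZ (c : Coch X) : Prop := ∀ x, ZeroNear c x

theorem LZ.zero : LZ (0 : Coch X) := fun x => ZeroNear.zero x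

theorem LZ.add {c d : Coch X} (hc : LZ c) (hd : LZ d) : LZ (c + d) := fun x => (hc x).add (hd x)

theorem LZ.mul_left {c : Coch X} (hc : LZ c) (d : Coch X) : LZ (d * c) :=
  fun x => (hc x).mul_left d

theorem LZ.mul_right {c : Coch X} (hc : LZ c) (d : Coch X) : LZ (c * d) :=
  fun x => (hc x).mul_right d

theorem LZ.comap {c : Coch X} (hc : LZ c) {f : Y → X} (hf : Continuous f) : LZ (comap f c) :=
  fun _ => (hc _).comap hf.continuousAt

/-- Cochains invariant under a set of self-maps. -/
def invariants {X : Type*} (Γ : Set (X → X)) : Subring (Coch X) where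
  carrier := {c | ∀ g ∈ Γ, Coch.comap g c = c}
  mul_mem' ha hb g hg := by rw [map_mul, ha g hg, hb g hg]
  one_mem' g _ := map_one _
  add_mem' ha hb g hg := by rw [map_add, ha g hg, hb g hg]
  zero_mem' g _ := map_zero _
  neg_mem' ha g hg := by rw [map_neg, ha g hg]

/-- Invariant Alexander–Spanier cocycles. -/
def cocycles (Γ : Set (X → X)) : Subring (Coch X) where
  carrier := {c | c ∈ invariants Γ ∧ LZ (Coch.bd c)}
  mul_mem' ha hb := ⟨mul_mem ha.1 hb.1, by
    rw [bd_mul]; exact (ha.2.mul_right _).add (hb.2.mul_left _)⟩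
  one_mem' := ⟨one_mem _, by rw [bd_one]; exact LZ.zero⟩
  add_mem' ha hb := ⟨add_mem ha.1 hb.1, by rw [map_add]; exact ha.2.add hb.2⟩
  zero_mem' := ⟨zero_mem _, by rw [map_zero]; exact LZ.zero⟩
  neg_mem' {a} ha := ⟨neg_mem ha.1, by
    rw [← eq_of_add_eq_zero (c := a) (d := -a) (by simp)]; exact ha.2⟩

theorem fn_mem_invariants {X : Type*} {Γ : Set (X → X)} {s : X → ZMod 2}
    (hs : ∀ g ∈ Γ, ∀ x, s (g x) = s x) : fn s ∈ invariants Γ := fun g hg => by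
  rw [comap_fn]; congr 1; exact funext (hs g hg)

/-- Two cochains are cohomologous. -/
def Cohomologous (Γ : Set (X → X)) (c d : Coch X) : Prop :=
  ∃ b ∈ invariants Γ, LZ (c + d + Coch.bd b)

theorem Cohomologous.of_lz {Γ : Set (X → X)} {c d : Coch X} (h : LZ (c + d)) :
    Cohomologous Γ c d := ⟨0, zero_mem _, by rwa [map_zero, add_zero]⟩

theorem Cohomologous.of_eq {Γ : Set (X → X)} {c d b : Coch X} (hb : b ∈ invariants Γ)
    (h : c + d = Coch.bd b) : Cohomologous Γ c d :=
  ⟨b, hb, by rw [h, add_self]; exact LZ.zero⟩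

theorem Cohomologous.refl (Γ : Set (X → X)) (c : Coch X) : Cohomologous Γ c c :=
  Cohomologous.of_lz (by rw [add_self]; exact LZ.zero)

theorem Cohomologous.symm {Γ : Set (X → X)} {c d : Coch X} (h : Cohomologous Γ c d) :
    Cohomologous Γ d c := by
  obtain ⟨b, hb, h⟩ := h
  exact ⟨b, hb, by rwa [add_comm d c]⟩

theorem add_add_add_self {X : Type*} (a b c d e : Coch X) : a + c + (d + e) = (a + b + d) + (b + c + e) := by
  have := add_self b
  calc a + c + (d + e) = a + c + (d + e) + (b + b) := by rw [this, add_zero]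
    _ = _ := by abel

theorem Cohomologous.trans {Γ : Set (X → X)} {c d e : Coch X} (h : Cohomologous Γ c d)
    (h' : Cohomologous Γ d e) : Cohomologous Γ c e := by
  obtain ⟨b, hb, h⟩ := h
  obtain ⟨b', hb', h'⟩ := h'
  refine ⟨b + b', add_mem hb hb', ?_⟩
  rw [map_add, add_add_add_self _ d]
  exact h.add h'

theorem Cohomologous.add {Γ : Set (X → X)} {c d c' d' : Coch X} (h : Cohomologous Γ c d)
    (h' : Cohomologous Γ c' d') : Cohomologous Γ (c + c') (d + d') := by
  obtain ⟨b, hb, h⟩ := h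
  obtain ⟨b', hb', h'⟩ := h'
  refine ⟨b + b', add_mem hb hb', ?_⟩
  rw [map_add, show c + c' + (d + d') + (Coch.bd b + Coch.bd b') =
    (c + d + Coch.bd b) + (c' + d' + Coch.bd b') by abel]
  exact h.add h'

theorem Cohomologous.mul_left {Γ : Set (X → X)} {c d : Coch X} (h : Cohomologous Γ c d)
    {e : Coch X} (he : e ∈ cocycles Γ) : Cohomologous Γ (e * c) (e * d) := by
  obtain ⟨b, hb, h⟩ := h
  refine ⟨e * b, mul_mem he.1 hb, ?_⟩
  rw [bd_mul, show e * c + e * d + (Coch.bd e * b + e * Coch.bd b) =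
    e * (c + d + Coch.bd b) + Coch.bd e * b by noncomm_ring]
  exact (h.mul_left _).add (he.2.mul_right _)

theorem Cohomologous.mul_right {Γ : Set (X → X)} {c d : Coch X} (h : Cohomologous Γ c d)
    {e : Coch X} (he : e ∈ cocycles Γ) : Cohomologous Γ (c * e) (d * e) := by
  obtain ⟨b, hb, h⟩ := h
  refine ⟨b * e, mul_mem hb he.1, ?_⟩
  rw [bd_mul, show c * e + d * e + (Coch.bd b * e + b * Coch.bd e) =
    (c + d + Coch.bd b) * e + b * Coch.bd e by noncomm_ring]
  exact (h.mul_right _).add (he.2.mul_left _)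

/-- The congruence of being cohomologous. -/
def cohCon (Γ : Set (X → X)) : RingCon (cocycles Γ) where
  r c d := Cohomologous Γ c d
  iseqv := ⟨fun c => Cohomologous.refl Γ c, Cohomologous.symm, Cohomologous.trans⟩
  add' := Cohomologous.add
  mul' {_ x y _} h h' := (h.mul_right y.2).trans (h'.mul_left x.2)

/-- Equivariant Alexander–Spanier cohomology, as an ungraded ring. -/
abbrev Coh (Γ : Set (X → X)) : Type _ := (cohCon Γ).Quotient

/-- The class of a cocycle. -/
def cl {Γ : Set (X → X)} (c : Coch X) (hc : c ∈ cocycles Γ) : Coh Γ := (cohCon Γ).mk' ⟨c, hc⟩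

theorem cl_eq_iff {Γ : Set (X → X)} {c d : Coch X} {hc : c ∈ cocycles Γ} {hd : d ∈ cocycles Γ} :
    cl c hc = cl d hd ↔ Cohomologous Γ c d := (cohCon Γ).eq

theorem cl_surjective {Γ : Set (X → X)} (x : Coh Γ) : ∃ c hc, x = cl (Γ := Γ) c hc := by
  obtain ⟨⟨c, hc⟩, rfl⟩ := (cohCon Γ).mk'_surjective x
  exact ⟨c, hc, rfl⟩

theorem cl_mul {Γ : Set (X → X)} {c d : Coch X} (hc : c ∈ cocycles Γ) (hd : d ∈ cocycles Γ) :
    cl c hc * cl d hd = cl (c * d) (mul_mem hc hd) := rfl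

theorem cl_add {Γ : Set (X → X)} {c d : Coch X} (hc : c ∈ cocycles Γ) (hd : d ∈ cocycles Γ) :
    cl c hc + cl d hd = cl (c + d) (add_mem hc hd) := rfl

theorem cl_pow {Γ : Set (X → X)} {c : Coch X} (hc : c ∈ cocycles Γ) (n : ℕ) :
    cl c hc ^ n = cl (c ^ n) (pow_mem hc n) := rfl

theorem cl_one {Γ : Set (X → X)} : cl (1 : Coch X) (one_mem (cocycles Γ)) = 1 := rfl

theorem cl_zero {Γ : Set (X → X)} : cl (0 : Coch X) (zero_mem (cocycles Γ)) = 0 := rfl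

theorem Coh.add_self {Γ : Set (X → X)} (x : Coh Γ) : x + x = 0 := by
  obtain ⟨c, hc, rfl⟩ := cl_surjective x
  rw [cl_add, ← cl_zero, cl_eq_iff, Coch.add_self]
  exact Cohomologous.refl _ _

/-- The condition under which pullback along `f` preserves invariance. -/
def Compat {X Y : Type*} (Γ : Set (X → X)) (Δ : Set (Y → Y)) (f : Y → X) : Prop :=
  ∀ h ∈ Δ, f ∘ h = f ∨ ∃ g ∈ Γ, f ∘ h = g ∘ f

theorem Compat.comap_mem {X Y : Type*} {Γ : Set (X → X)} {Δ : Set (Y → Y)} {f : Y → X}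
    (hf : Compat Γ Δ f) {c : Coch X} (hc : c ∈ invariants Γ) :
    Coch.comap f c ∈ invariants Δ := fun h hh => by
  rw [comap_comap]
  rcases hf h hh with e | ⟨g, hg, e⟩
  · rw [e]
  · rw [e, ← comap_comap, hc g hg]

theorem comap_mem_cocycles {Γ : Set (X → X)} {Δ : Set (Y → Y)} {f : Y → X} (hf : Continuous f)
    (hc : Compat Γ Δ f) {c : Coch X} (h : c ∈ cocycles Γ) : Coch.comap f c ∈ cocycles Δ :=
  ⟨hc.comap_mem h.1, by rw [bd_comap]; exact h.2.comap hf⟩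

theorem Cohomologous.comap {Γ : Set (X → X)} {Δ : Set (Y → Y)} {f : Y → X} (hf : Continuous f)
    (hc : Compat Γ Δ f) {c d : Coch X} (h : Cohomologous Γ c d) :
    Cohomologous Δ (Coch.comap f c) (Coch.comap f d) := by
  obtain ⟨b, hb, h⟩ := h
  exact ⟨Coch.comap f b, hc.comap_mem hb, by
    rw [bd_comap, ← map_add, ← map_add]; exact h.comap hf⟩

/-- Pullback on cohomology. -/
def pull {Γ : Set (X → X)} {Δ : Set (Y → Y)} (f : Y → X) (hf : Continuous f)
    (hc : Compat Γ Δ f) : Coh Γ →+* Coh Δ :=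
  (cohCon Γ).lift ((cohCon Δ).mk'.comp (((Coch.comap f).comp (cocycles Γ).subtype).codRestrict _
    fun c => comap_mem_cocycles hf hc c.2)) fun _ _ h => (cohCon Δ).eq.mpr (h.comap hf hc)

theorem pull_cl {Γ : Set (X → X)} {Δ : Set (Y → Y)} {f : Y → X} (hf : Continuous f)
    (hc : Compat Γ Δ f) {c : Coch X} (h : c ∈ cocycles Γ) :
    pull f hf hc (cl c h) = cl (Coch.comap f c) (comap_mem_cocycles hf hc h) := rfl

end Coch

end AlexanderSpanier

namespace AlexanderSpanier

namespace Coch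

open Filter Topology

section Homotopy

variable {X Y W : Type*}

/-- The homotopy operator of a one-parameter family of maps, subdividing the unit interval. -/
def htpy (h : ℝ → Y → X) : Coch X →+ Coch Y where
  toFun c := mk (fun M l => ∑ j ∈ Finset.range (M + 1),
    prism (h (j / (M + 1))) (h ((j + 1) / (M + 1))) (c.ev M) l) fun M => by simp
  map_zero' := ext fun M l => by
    rw [ev_mk, ev_zero]
    exact Finset.sum_eq_zero fun j _ =>
      prism_eq_zero _ _ _ Set.univ (fun _ _ _ => rfl) l (by simp)
  map_add' c d := ext fun M l => by
    simp only [ev_mk, ev_add, ← Finset.sum_add_distrib]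
    exact Finset.sum_congr rfl fun j _ => prism_add _ _ _ _ l

theorem ev_htpy (h : ℝ → Y → X) (c : Coch X) (M : ℕ) (l : List Y) :
    (htpy h c).ev M l = ∑ j ∈ Finset.range (M + 1),
      prism (h (j / (M + 1))) (h ((j + 1) / (M + 1))) (c.ev M) l := rfl

theorem cobdry_sum {ι : Type*} (s : Finset ι) (f : ι → List Y → ZMod 2) (l : List Y) :
    cobdry (fun m => ∑ j ∈ s, f j m) l = ∑ j ∈ s, cobdry (f j) l := by
  classical
  induction s using Finset.induction_on with
  | empty => simpa using cobdry_eq_zero _ Set.univ (fun _ _ => rfl) l (by simp)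
  | insert a s ha ih => simp only [Finset.sum_insert ha, cobdry_add, ih]

theorem bd_htpy (h : ℝ → Y → X) (c : Coch X) :
    bd (htpy h c) + htpy h (bd c) = comap (h 0) c + comap (h 1) c := ext fun M l => by
  have h1 : (bd (htpy h c)).ev M l = ∑ j ∈ Finset.range (M + 1),
      cobdry (prism (h (j / (M + 1))) (h ((j + 1) / (M + 1))) (c.ev M)) l :=
    cobdry_sum (Finset.range (M + 1))
      (fun j => prism (h (j / (M + 1))) (h ((j + 1) / (M + 1))) (c.ev M)) l
  have h2 : (htpy h (bd c)).ev M l = ∑ j ∈ Finset.range (M + 1),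
      prism (h (j / (M + 1))) (h ((j + 1) / (M + 1))) (cobdry (c.ev M)) l := rfl
  rw [ev_add, h1, h2, ← Finset.sum_add_distrib,
    Finset.sum_congr rfl fun j _ => cobdry_prism _ _ _ l]
  have h3 : ∀ j : ℕ, c.ev M (l.map (h (j / (M + 1)))) + c.ev M (l.map (h ((j + 1) / (M + 1)))) =
      c.ev M (l.map (h ((j + 1 : ℕ) / (M + 1)))) - c.ev M (l.map (h (j / (M + 1)))) := by
    intro j
    rw [CharTwo.sub_eq_add, add_comm]
    push_cast
    rfl
  have hM : (M + 1 : ℝ) ≠ 0 := by positivity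
  rw [Finset.sum_congr rfl fun j _ => h3 j,
    Finset.sum_range_sub (fun j : ℕ => c.ev M (l.map (h (j / (M + 1)))))]
  simp [CharTwo.sub_eq_add, hM, add_comm]

theorem htpy_deg (h : ℝ → Y → X) {n : ℕ} {c : Coch X} (hc : Deg (n + 1) c) :
    Deg n (htpy h c) := fun M l hl => by
  rw [ev_htpy]
  refine Finset.sum_eq_zero fun j _ => ?_
  generalize h (j / (M + 1)) = f, h ((j + 1) / (M + 1)) = g
  have : ∀ n (c : List X → ZMod 2), (∀ l, l.length ≠ n → c l = 0) → l.length + 1 ≠ n →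
      prism f g c l = 0 := by
    clear hl
    induction l with
    | nil => simp
    | cons y l ih =>
      intro n c hc hl
      rw [prism_cons, hc _ (by simpa using hl), zero_add]
      cases n with
      | zero => exact prism_eq_zero f g _ Set.univ (fun m _ _ => hc _ (by simp)) l (by simp)
      | succ n => exact ih n _ (fun m hm => hc _ (by simpa using hm)) (by simpa using hl)
  exact this _ _ (hc M) (by simpa using hl)

theorem comap_htpy (h : ℝ → Y → X) (u : W → Y) (c : Coch X) :
    comap u (htpy h c) = htpy (fun t => h t ∘ u) c := ext fun M l => by
  rw [ev_comap, ev_htpy, ev_htpy]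
  exact Finset.sum_congr rfl fun _ _ => prism_map _ _ u _ l

theorem htpy_comap (h : ℝ → Y → X) (u : X → W) (c : Coch W) :
    htpy h (comap u c) = htpy (fun t => u ∘ h t) c := ext fun M l => by
  rw [ev_htpy, ev_htpy]
  exact Finset.sum_congr rfl fun _ _ => prism_comap _ _ u (c.ev M) l

theorem htpy_mul_comap (h : ℝ → Y → X) (u : X → W) (v : Y → W) (huv : ∀ t, u ∘ h t = v)
    (c : Coch X) (d : Coch W) (hd : Norm d) :
    htpy h (c * comap u d) = htpy h c * comap v d := ext fun M l => by
  have h0 : ∀ j, prism (h (j / (M + 1))) (h ((j + 1) / (M + 1))) ((comap u d).ev M) =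
      fun _ : List Y => 0 := fun j => funext fun m => by
    have := prism_comap (h (j / (M + 1))) (h ((j + 1) / (M + 1))) u (d.ev M) m
    rw [huv, huv, prism_of_normalized _ _ (hd M)] at this
    exact this
  have h1 : ∀ t, (fun m : List Y => (comap u d).ev M (m.map (h t))) = (comap v d).ev M :=
    fun t => funext fun m => by simp [← huv t]
  have h2 : ∀ c' : List Y → ZMod 2, cup c' (fun _ => 0) l = 0 := fun c' =>
    cup_eq_zero_right _ _ Set.univ (fun _ _ => rfl) l (by simp)
  have h3 : ∀ s : Finset ℕ, ∀ f : ℕ → List Y → ZMod 2, ∑ j ∈ s, cup (f j) ((comap v d).ev M) l =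
      cup (fun m => ∑ j ∈ s, f j m) ((comap v d).ev M) l := by
    intro s f
    induction s using Finset.induction_on with
    | empty => simp [cup_zero_left]
    | insert a s ha ih => simp only [Finset.sum_insert ha, cup_add_left, ih]
  rw [ev_htpy, ev_mul]
  change _ = cup (fun m => ∑ j ∈ Finset.range (M + 1), _) _ l
  rw [← h3]
  refine Finset.sum_congr rfl fun j _ => ?_
  change prism _ _ (cup (c.ev M) ((comap u d).ev M)) l = _
  rw [prism_cup, h0, h1, h2, add_zero]

end Homotopy

variable {X Y W : Type*} [TopologicalSpace X] [TopologicalSpace Y] [TopologicalSpace W]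

theorem ZeroNear.htpy {h : ℝ → Y → X} (hh : Continuous fun p : ℝ × Y => h p.1 p.2) {c : Coch X}
    {y : Y} (hc : ∀ t, ZeroNear c (h t y)) : ZeroNear (htpy h c) y := by
  have key : ∃ A ∈ 𝓝 y, ∀ᶠ M : ℕ in atTop, ∀ t ∈ Set.Icc (0 : ℝ) 1, ∀ t',
      |t' - t| ≤ 1 / ((M : ℝ) + 1) → ∀ l, (∀ z ∈ l, z ∈ A) → prism (h t) (h t') (c.ev M) l = 0 := by
    refine isCompact_Icc.induction_on (p := fun s => ∃ A ∈ 𝓝 y, ∀ᶠ M : ℕ in atTop, ∀ t ∈ s, ∀ t',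
      |t' - t| ≤ 1 / ((M : ℝ) + 1) → ∀ l, (∀ z ∈ l, z ∈ A) → prism (h t) (h t') (c.ev M) l = 0)
      ⟨Set.univ, univ_mem, by simp⟩ ?_ ?_ ?_
    · rintro s s' hs ⟨A, hA, H⟩
      exact ⟨A, hA, H.mono fun M hM t ht => hM t (hs ht)⟩
    · rintro s s' ⟨A, hA, H⟩ ⟨A', hA', H'⟩
      refine ⟨A ∩ A', inter_mem hA hA', ?_⟩
      filter_upwards [H, H'] with M h1 h2 t ht t' htt' l hl
      rcases ht with ht | ht
      · exact h1 t ht t' htt' l fun z hz => (hl z hz).1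
      · exact h2 t ht t' htt' l fun z hz => (hl z hz).2
    · intro t _
      obtain ⟨N, hN, H⟩ := hc t
      have hpre : (fun p : ℝ × Y => h p.1 p.2) ⁻¹' N ∈ 𝓝 (t, y) := hh.continuousAt hN
      rw [nhds_prod_eq] at hpre
      obtain ⟨B, hB, A, hA, hBA⟩ := mem_prod_iff.mp hpre
      obtain ⟨ε, hε, hεB⟩ := Metric.mem_nhds_iff.mp hB
      refine ⟨Metric.ball t (ε / 2), mem_nhdsWithin_of_mem_nhds (Metric.ball_mem_nhds t (by positivity)),
        A, hA, ?_⟩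
      have hsmall : ∀ᶠ M : ℕ in atTop, 1 / ((M : ℝ) + 1) < ε / 2 :=
        tendsto_one_div_add_atTop_nhds_zero_nat.eventually (gt_mem_nhds (by positivity))
      filter_upwards [H, hsmall] with M h1 h2 s hs s' hss' l hl
      refine prism_eq_zero _ _ _ N (fun m _ hm => h1 m hm) l fun z hz => ?_
      rw [Metric.mem_ball, Real.dist_eq] at hs
      have hs' : |s' - t| < ε := by
        calc |s' - t| = |(s' - s) + (s - t)| := by ring_nf
          _ ≤ |s' - s| + |s - t| := abs_add_le _ _
          _ < ε := by linarith
      refine ⟨hBA (Set.mk_mem_prod (hεB ?_) (hl z hz)), hBA (Set.mk_mem_prod (hεB ?_) (hl z hz))⟩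
      · rw [Metric.mem_ball, Real.dist_eq]; linarith
      · rw [Metric.mem_ball, Real.dist_eq]; exact hs'
  obtain ⟨A, hA, H⟩ := key
  refine ⟨A, hA, ?_⟩
  filter_upwards [H] with M hM l hl
  rw [ev_htpy]
  refine Finset.sum_eq_zero fun j hj => hM _ ?_ _ ?_ l hl
  · have hj : (j : ℝ) ≤ M := by exact_mod_cast Nat.lt_succ_iff.mp (Finset.mem_range.mp hj)
    exact ⟨by positivity, (div_le_one (by positivity)).mpr (by linarith)⟩
  · rw [← sub_div, add_sub_cancel_left, abs_of_pos (by positivity)]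

theorem LZ.htpy {h : ℝ → Y → X} (hh : Continuous fun p : ℝ × Y => h p.1 p.2) {c : Coch X}
    (hc : LZ c) : LZ (htpy h c) := fun _ => ZeroNear.htpy hh fun _ => hc _

end Coch

end AlexanderSpanier

namespace AlexanderSpanier

namespace Coch

open Filter Topology

theorem cobdry_replicate {X : Type*} (c : List X → ZMod 2) (x : X) (m : ℕ) :
    cobdry c (List.replicate (m + 1) x) = (m + 1) * c (List.replicate m x) := by
  induction m generalizing c with
  | zero => simp [cobdry_cons]
  | succ m ih =>
    rw [List.replicate_succ, cobdry_cons, ih]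
    simp only [← List.replicate_succ]
    push_cast
    ring

variable {X Y : Type*} [TopologicalSpace X] [TopologicalSpace Y]

theorem Compat.empty {Γ : Set (X → X)} (f : Y → X) : Compat Γ (∅ : Set (Y → Y)) f :=
  fun _ hg => hg.elim

theorem lz_comap_const {c : Coch X} {n : ℕ} (hn : Odd n) (hc : Deg n c) (hz : LZ (bd c)) (x : X) :
    LZ (comap (fun _ : Y => x) c) := fun y => by
  obtain ⟨N, hN, h⟩ := hz x
  refine ⟨Set.univ, univ_mem, ?_⟩
  filter_upwards [h] with M hM l _
  rw [ev_comap, List.map_const']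
  by_cases hl : l.length = n + 1
  · have h1 := hM (List.replicate (n + 1 + 1) x) fun y hy => by
      rw [List.eq_of_mem_replicate hy]; exact mem_of_mem_nhds hN
    rw [ev_bd, cobdry_replicate] at h1
    have h2 : ((n + 1 : ℕ) + 1 : ZMod 2) = 1 := by
      obtain ⟨k, rfl⟩ := hn
      push_cast
      linear_combination (k + 1 : ZMod 2) * (by decide : (2 : ZMod 2) = 0)
    rw [hl]
    rwa [h2, one_mul] at h1
  · exact hc M _ (by simpa using hl)

theorem pull_eq_zero_of_nullhomotopic {c : Coch X} {n : ℕ} (hn : Odd n) (hd : Deg n c)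
    (hc : c ∈ cocycles (∅ : Set (X → X))) {f : Y → X} (hf : Continuous f)
    (h : ℝ → Y → X) (hh : Continuous fun p : ℝ × Y => h p.1 p.2) (h0 : h 0 = f) (x : X)
    (h1 : h 1 = fun _ => x) :
    pull f hf (Compat.empty f) (cl c hc) = 0 := by
  rw [pull_cl, ← cl_zero, cl_eq_iff]
  refine ⟨htpy h c, fun _ hg => hg.elim, ?_⟩
  have e := bd_htpy h c
  rw [h0, h1] at e
  have e' : comap f c + 0 + bd (htpy h c) = comap (fun _ => x) c + htpy h (bd c) := by
    have e2 : comap f c = bd (htpy h c) + htpy h (bd c) + comap (fun _ => x) c := by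
      rw [e, add_assoc, add_self, add_zero]
    rw [e2, add_zero]
    calc _ = comap (fun _ => x) c + htpy h (bd c) + (bd (htpy h c) + bd (htpy h c)) := by abel
      _ = _ := by rw [add_self, add_zero]
  rw [e']
  exact (lz_comap_const hn hd hc.2 x).add (hc.2.htpy hh)

open Classical in
/-- Extension by zero of a cochain on a subset. -/
def extend {X : Type*} {U : Set X} (b : Coch U) : Coch X :=
  mk (fun M l => if h : ∃ l' : List U, l'.map (↑) = l then b.ev M h.choose else 0) fun M => by
    split_ifs with h
    · rw [List.map_eq_nil_iff.mp h.choose_spec, ev_nil]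
    · rfl

theorem comap_extend {X : Type*} {U : Set X} (b : Coch U) : comap (↑) (extend b) = b :=
  ext fun M l => by
    have h : ∃ l' : List U, l'.map ((↑) : U → X) = l.map (↑) := ⟨l, rfl⟩
    have h' : h.choose = l := List.map_injective_iff.mpr Subtype.val_injective h.choose_spec
    rw [ev_comap, extend, ev_mk, dif_pos h, h']

theorem ZeroNear.of_comap {U : Set X} (hU : IsOpen U) {c : Coch X} (x : U)
    (h : ZeroNear (Coch.comap ((↑) : U → X) c) x) : ZeroNear c (x : X) := by
  obtain ⟨N, hN, h⟩ := h
  refine ⟨(↑) '' N, hU.isOpenEmbedding_subtypeVal.image_mem_nhds.mpr hN, ?_⟩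
  filter_upwards [h] with M hM l hl
  have : ∃ l' : List U, (∀ y ∈ l', y ∈ N) ∧ l'.map ((↑) : U → X) = l := by
    clear hM
    induction l with
    | nil => exact ⟨[], by simp, rfl⟩
    | cons a l ih =>
      obtain ⟨l', h1, h2⟩ := ih fun y hy => hl y (by simp [hy])
      obtain ⟨z, hz, hza⟩ := hl a (by simp)
      exact ⟨z :: l', List.forall_mem_cons.mpr ⟨hz, h1⟩, by simp [hza, h2]⟩
  obtain ⟨l', h1, rfl⟩ := this
  exact hM l' h1

theorem zeroNear_list_prod {L : List (Coch X)} {x : X} (h : ∃ c ∈ L, ZeroNear c x) :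
    ZeroNear L.prod x := by
  induction L with
  | nil => simp at h
  | cons d L ih =>
    rw [List.prod_cons]
    obtain ⟨c, hc, hz⟩ := h
    rcases List.mem_cons.mp hc with rfl | hc
    · exact hz.mul_right _
    · exact (ih ⟨c, hc, hz⟩).mul_left _

theorem prod_eq_zero_of_cover {m : ℕ} {U : Fin m → Set X} (hU : ∀ i, IsOpen (U i))
    (hcov : ∀ x, ∃ i, x ∈ U i) (y : Fin m → Coh (∅ : Set (X → X)))
    (hy : ∀ i, pull ((↑) : U i → X) continuous_subtype_val (Compat.empty _) (y i) = 0) : (List.ofFn y).prod = 0 := by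
  have key : ∀ i, ∃ (c : Coch X) (hc : c ∈ cocycles (∅ : Set (X → X))), y i = cl c hc ∧
      ∀ x ∈ U i, ZeroNear c x := by
    intro i
    obtain ⟨c, hc, hyc⟩ := cl_surjective (y i)
    have h := hy i
    rw [hyc, pull_cl, ← cl_zero, cl_eq_iff] at h
    obtain ⟨b, -, hb⟩ := h
    have hc' : c + bd (extend b) ∈ cocycles (∅ : Set (X → X)) :=
      ⟨fun _ hg => hg.elim, by rw [map_add, bd_bd, add_zero]; exact hc.2⟩
    refine ⟨c + bd (extend b), hc', ?_, fun x hx => ?_⟩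
    · rw [hyc, cl_eq_iff]
      exact Cohomologous.of_eq (b := extend b) (fun _ hg => hg.elim)
        (by rw [← add_assoc, add_self, zero_add])
    · refine ZeroNear.of_comap (hU i) ⟨x, hx⟩ ?_
      rw [map_add, ← bd_comap, comap_extend]
      simpa using hb ⟨x, hx⟩
  choose c hc hyc hz using key
  have hL : ∀ L : List (Fin m), ∃ h, (L.map y).prod =
      cl (Γ := (∅ : Set (X → X))) (L.map c).prod h := by
    intro L
    induction L with
    | nil => exact ⟨one_mem _, by simp [cl_one]⟩
    | cons i L ih =>
      obtain ⟨h, e⟩ := ih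
      exact ⟨mul_mem (hc i) h, by rw [List.map_cons, List.prod_cons, e, hyc, cl_mul]; rfl⟩
  rw [List.ofFn_eq_map]
  obtain ⟨h, e⟩ := hL (List.finRange m)
  rw [e, ← cl_zero, cl_eq_iff]
  refine Cohomologous.of_lz fun x => ?_
  rw [add_zero]
  obtain ⟨i, hi⟩ := hcov x
  exact zeroNear_list_prod ⟨c i, by simp, hz i x hi⟩

/-! ### Integration along punctured Euclidean spaces -/

/-- Nonzero vectors in `ℝⁿ⁺¹`. -/
abbrev Sph (n : ℕ) : Type := {c : Fin (n + 1) → ℝ // c ≠ 0}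

/-- The antipodal map. -/
def antipode {n : ℕ} (c : Sph n) : Sph n := ⟨-c.1, neg_ne_zero.mpr c.2⟩

@[simp] theorem antipode_antipode {n : ℕ} (c : Sph n) : antipode (antipode c) = c :=
  Subtype.ext (neg_neg _)

theorem continuous_antipode {n : ℕ} : Continuous (antipode (n := n)) :=
  Continuous.subtype_mk (continuous_subtype_val.neg) _

/-- The straight cone on the equator with apex the last basis vector. -/
def cone {n : ℕ} (t : ℝ) (c : Sph n) : Sph (n + 1) :=
  ⟨Fin.snoc (α := fun _ => ℝ) ((1 - t) • c.1) t, fun h => by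
    have h1 : t = 0 := by simpa using congrFun h (Fin.last _)
    refine c.2 (funext fun i => ?_)
    have h2 := congrFun h (Fin.castSucc i)
    rw [Fin.snoc_castSucc] at h2
    simpa [h1] using h2⟩

theorem continuous_cone {n : ℕ} : Continuous fun p : ℝ × Sph n => cone p.1 p.2 := by
  refine Continuous.subtype_mk ?_ _
  refine Continuous.finSnoc ?_ continuous_fst
  exact (continuous_const.sub continuous_fst).smul (continuous_subtype_val.comp continuous_snd)

theorem cone_zero_antipode {n : ℕ} (c : Sph n) : cone 0 (antipode c) = antipode (cone 0 c) := by
  refine Subtype.ext (funext fun i => ?_)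
  refine Fin.lastCases ?_ (fun i => ?_) i <;> simp [cone, antipode]

theorem cone_one {n : ℕ} (c d : Sph n) : cone 1 c = cone 1 d := by
  refine Subtype.ext (funext fun i => ?_)
  refine Fin.lastCases ?_ (fun i => ?_) i <;> simp [cone]

/-- Extend a set of symmetries of `Y` to `Y × Sph n`, adding the antipodal map. -/
def fibSymm (Δ : Set (Y → Y)) (n : ℕ) : Set (Y × Sph n → Y × Sph n) :=
  insert (Prod.map id antipode) ((fun g => Prod.map g id) '' Δ)

/-- One step of the integration along the fibre. -/
def step {n : ℕ} : Coch (Y × Sph (n + 1)) →+ Coch (Y × Sph n) :=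
  htpy (fun t => Prod.map id (cone t)) +
    ((comap (Prod.map id antipode)).toAddMonoidHom.comp (htpy (fun t => Prod.map id (cone t))))

end Coch

end AlexanderSpanier

namespace AlexanderSpanier

namespace Coch

open Filter Topology

set_option linter.unusedSectionVars false

section Step

variable {Y : Type*} [TopologicalSpace Y] {n : ℕ}

theorem step_apply (c : Coch (Y × Sph (n + 1))) :
    step c = htpy (fun t => Prod.map id (cone t)) c +
      comap (Prod.map id antipode) (htpy (fun t => Prod.map id (cone t)) c) := rfl

theorem antipode_mem_symm {Y : Type*} (Δ : Set (Y → Y)) (n : ℕ) :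
    (Prod.map id antipode : Y × Sph n → Y × Sph n) ∈ fibSymm Δ n := Set.mem_insert _ _

theorem prod_mem_symm {Y : Type*} {Δ : Set (Y → Y)} {g : Y → Y} (hg : g ∈ Δ) (n : ℕ) :
    (Prod.map g id : Y × Sph n → Y × Sph n) ∈ fibSymm Δ n :=
  Set.mem_insert_of_mem _ ⟨g, hg, rfl⟩

theorem antipode_comp {Y : Type*} {n : ℕ} :
    (Prod.map id antipode : Y × Sph n → Y × Sph n) ∘ Prod.map id antipode = id := by
  ext1 x; simp [Prod.map]

theorem continuous_map_cone : Continuous fun p : ℝ × (Y × Sph n) => Prod.map id (cone p.1) p.2 :=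
  (continuous_fst.comp continuous_snd).prodMk
    (continuous_cone.comp (continuous_fst.prodMk (continuous_snd.comp continuous_snd)))

theorem step_mem_invariants {Y : Type*} [TopologicalSpace Y] {Δ : Set (Y → Y)}
    {c : Coch (Y × Sph (n + 1))}
    (hc : ∀ g ∈ Δ, comap (Prod.map g id) c = c) : step c ∈ invariants (fibSymm Δ n) := by
  rintro _ (rfl | ⟨g, hg, rfl⟩)
  · rw [step_apply, map_add, comap_comap, antipode_comp, comap_id, add_comm]
  · have e : comap (Prod.map g id) (htpy (fun t => Prod.map id (cone t)) c) =
        htpy (fun t => Prod.map id (cone (n := n) t)) c := by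
      conv_rhs => rw [← hc g hg, htpy_comap]
      rw [comap_htpy]
      rfl
    rw [step_apply, map_add, e, comap_comap]
    conv_rhs => rw [← e, comap_comap]
    rw [e]
    rfl

theorem bd_step (c : Coch (Y × Sph (n + 1))) :
    bd (step c) + step (bd c) = comap (Prod.map id (cone 0)) c +
      comap (Prod.map id (cone 0)) (comap (Prod.map id antipode) c) := by
  have h := bd_htpy (fun t => Prod.map (id : Y → Y) (cone (n := n) t)) c
  have h' := congrArg (comap (Prod.map id antipode)) h
  rw [map_add, map_add, comap_comap, comap_comap] at h'
  have e0 : Prod.map (id : Y → Y) (cone (n := n) 0) ∘ Prod.map id antipode =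
      Prod.map id antipode ∘ Prod.map id (cone 0) := by
    ext1 x; simp [Prod.map, cone_zero_antipode]
  have e1 : Prod.map (id : Y → Y) (cone (n := n) 1) ∘ Prod.map id antipode =
      Prod.map id (cone 1) := by
    ext1 x; simp [Prod.map, cone_one x.2 (antipode x.2)]
  rw [e0, e1, ← bd_comap, ← comap_comap] at h'
  rw [step_apply, step_apply, map_add]
  calc _ = (bd (htpy (fun t => Prod.map (id : Y → Y) (cone (n := n) t)) c) +
        htpy (fun t => Prod.map (id : Y → Y) (cone (n := n) t)) (bd c)) +
        (bd (comap (Prod.map id antipode) (htpy (fun t => Prod.map id (cone t)) c)) +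
        comap (Prod.map id antipode) (htpy (fun t => Prod.map id (cone t)) (bd c))) := by abel
    _ = comap (Prod.map id (cone 0)) c +
      comap (Prod.map id (cone 0)) (comap (Prod.map id antipode) c) +
      (comap (Prod.map id (cone 1)) c + comap (Prod.map id (cone 1)) c) := by rw [h, h']; abel
    _ = _ := by rw [add_self, add_zero]

theorem bd_step_of_invariant {Δ : Set (Y → Y)} {c : Coch (Y × Sph (n + 1))}
    (hc : c ∈ invariants (fibSymm Δ (n + 1))) : bd (step c) = step (bd c) := by
  refine eq_of_add_eq_zero ?_
  rw [bd_step, hc _ (antipode_mem_symm Δ _), add_self]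

theorem LZ.step {c : Coch (Y × Sph (n + 1))} (hc : LZ c) : LZ (step c) := by
  have h : LZ (Coch.htpy (fun t => Prod.map (id : Y → Y) (cone (n := n) t)) c) :=
    hc.htpy continuous_map_cone
  exact h.add (h.comap (continuous_id.prodMap continuous_antipode))

theorem step_deg {m : ℕ} {c : Coch (Y × Sph (n + 1))} (hc : Deg (m + 1) c) : Deg m (step c) :=
  (htpy_deg _ hc).add ((htpy_deg _ hc).comap _)

theorem step_mul_comap (c : Coch (Y × Sph (n + 1))) {a : Coch Y} (ha : Norm a) :
    step (c * comap Prod.fst a) = step c * comap Prod.fst a := by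
  rw [step_apply, htpy_mul_comap (fun t => Prod.map id (cone t)) Prod.fst Prod.fst
    (fun t => rfl) c a ha, map_mul, step_apply, add_mul,
    comap_comap]
  rfl

theorem comap_step {Y' : Type*} [TopologicalSpace Y'] (f : Y' → Y) (c : Coch (Y × Sph (n + 1))) :
    comap (Prod.map f id) (step c) = step (comap (Prod.map f id) c) := by
  rw [step_apply, step_apply, map_add, comap_htpy, htpy_comap, comap_comap, comap_htpy, comap_htpy]
  rfl

theorem step_mul_bd_fn {Δ : Set (Y → Y)} {c : Coch (Y × Sph (n + 1))}
    (hc : c ∈ cocycles (fibSymm Δ (n + 1))) {s : Sph (n + 1) → ZMod 2}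
    (hs : ∀ x, s (antipode x) = s x + 1) :
    Cohomologous (fibSymm Δ n) (step (c * bd (fn (s ∘ Prod.snd))))
      (comap (Prod.map id (cone 0)) c) := by
  set u := c * fn (s ∘ Prod.snd : Y × Sph (n + 1) → ZMod 2) with hu
  refine ⟨step u, step_mem_invariants fun g hg => ?_, ?_⟩
  · rw [hu, map_mul, hc.1 _ (prod_mem_symm hg _), comap_fn]
    rfl
  · have h := bd_step u
    have e : comap (Prod.map id antipode) u = u + c := by
      rw [hu, map_mul, hc.1 _ (antipode_mem_symm Δ _), comap_fn]
      have : (s ∘ Prod.snd : Y × Sph (n + 1) → ZMod 2) ∘ Prod.map id antipode =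
          s ∘ Prod.snd + fun _ => 1 := funext fun x => hs x.2
      rw [this, fn_add, fn_one, mul_add, mul_one]
    rw [e, map_add, ← add_assoc, add_self, zero_add] at h
    have h2 : step (bd u) = step (bd c * fn (s ∘ Prod.snd)) + step (c * bd (fn (s ∘ Prod.snd))) := by
      rw [hu, bd_mul, map_add]
    have : step (c * bd (fn (s ∘ Prod.snd))) + comap (Prod.map id (cone 0)) c + bd (step u) =
        step (bd c * fn (s ∘ Prod.snd)) := by
      rw [← h, h2]
      generalize step (bd c * fn (s ∘ Prod.snd)) = p
      generalize step (c * bd (fn (s ∘ Prod.snd))) = q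
      calc _ = p + (q + q) + (bd (step u) + bd (step u)) := by abel
        _ = p := by rw [add_self, add_self, add_zero, add_zero]
    rw [this]
    exact (hc.2.mul_right _).step

theorem step_mem_cocycles {Δ : Set (Y → Y)} {c : Coch (Y × Sph (n + 1))}
    (hc : c ∈ cocycles (fibSymm Δ (n + 1))) : step c ∈ cocycles (fibSymm Δ n) :=
  ⟨step_mem_invariants fun _ hg => hc.1 _ (prod_mem_symm hg _), by
    rw [bd_step_of_invariant hc.1]; exact hc.2.step⟩

theorem Cohomologous.step {Δ : Set (Y → Y)} {c d : Coch (Y × Sph (n + 1))}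
    (h : Cohomologous (fibSymm Δ (n + 1)) c d) :
    Cohomologous (fibSymm Δ n) (step c) (step d) := by
  obtain ⟨b, hb, h⟩ := h
  refine ⟨Coch.step b, step_mem_invariants fun _ hg => hb _ (prod_mem_symm hg _), ?_⟩
  rw [bd_step_of_invariant hb, ← map_add, ← map_add]
  exact h.step

/-- One step of the integration along the fibre, on cohomology. -/
def stepCoh (Δ : Set (Y → Y)) (n : ℕ) : Coh (fibSymm Δ (n + 1)) →+ Coh (fibSymm Δ n) :=
  AddMonoidHom.mk' (fun x => cl (step (cl_surjective x).choose)
    (step_mem_cocycles (cl_surjective x).choose_spec.choose)) fun x y => by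
  rw [cl_add, cl_eq_iff, ← map_add]
  refine Cohomologous.step ?_
  have hx := (cl_surjective x).choose_spec
  have hy := (cl_surjective y).choose_spec
  have hxy := (cl_surjective (x + y)).choose_spec
  rw [← cl_eq_iff (hc := hxy.choose) (hd := add_mem hx.choose hy.choose), ← hxy.choose_spec,
    ← cl_add hx.choose hy.choose, ← hx.choose_spec, ← hy.choose_spec]

theorem stepCoh_cl {Δ : Set (Y → Y)} {c : Coch (Y × Sph (n + 1))}
    (hc : c ∈ cocycles (fibSymm Δ (n + 1))) :
    stepCoh Δ n (cl c hc) = cl (step c) (step_mem_cocycles hc) :=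
  cl_eq_iff.mpr (Cohomologous.step (cl_eq_iff.mp (cl_surjective (cl c hc)).choose_spec.choose_spec.symm))

/-- Classes represented by cochains of degree `m`. -/
def HasDeg {X : Type*} [TopologicalSpace X] {Γ : Set (X → X)} (m : ℕ) (x : Coh Γ) : Prop :=
  ∃ c hc, x = cl c hc ∧ Deg m c

/-- Classes represented by normalized cochains. -/
def HasNorm {X : Type*} [TopologicalSpace X] {Γ : Set (X → X)} (x : Coh Γ) : Prop :=
  ∃ c hc, x = cl c hc ∧ Norm c

variable {X Z : Type*} [TopologicalSpace X] [TopologicalSpace Z]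

theorem HasDeg.mul {Γ : Set (X → X)} {m k : ℕ} {x y : Coh Γ} (hx : HasDeg m x) (hy : HasDeg k y) :
    HasDeg (m + k) (x * y) := by
  obtain ⟨c, hc, rfl, h⟩ := hx
  obtain ⟨d, hd, rfl, h'⟩ := hy
  exact ⟨_, _, cl_mul hc hd, h.mul h'⟩

theorem HasDeg.pow {Γ : Set (X → X)} {m : ℕ} {x : Coh Γ} (hx : HasDeg m x) (k : ℕ) :
    HasDeg (m * k) (x ^ k) := by
  obtain ⟨c, hc, rfl, h⟩ := hx
  exact ⟨_, _, cl_pow hc k, h.pow k⟩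

theorem HasNorm.pow {Γ : Set (X → X)} {x : Coh Γ} (hx : HasNorm x) (k : ℕ) :
    HasNorm (x ^ k) := by
  obtain ⟨c, hc, rfl, h⟩ := hx
  exact ⟨_, _, cl_pow hc k, h.pow k⟩

theorem pull_pull {Γ : Set (X → X)} {Δ : Set (Y → Y)} {Λ : Set (Z → Z)} {f : Y → X} {g : Z → Y}
    (hf : Continuous f) (hg : Continuous g) (hc : Compat Γ Δ f) (hd : Compat Δ Λ g)
    (hfg : Compat Γ Λ (f ∘ g)) (x : Coh Γ) :
    pull g hg hd (pull f hf hc x) = pull (f ∘ g) (hf.comp hg) hfg x := by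
  obtain ⟨c, h, rfl⟩ := cl_surjective x
  rw [pull_cl, pull_cl, pull_cl, cl_eq_iff, comap_comap]
  exact Cohomologous.refl _ _

theorem compat_fst {Y : Type*} (Δ : Set (Y → Y)) (n : ℕ) :
    Compat Δ (fibSymm Δ n) (Prod.fst : Y × Sph n → Y) := by
  rintro _ (rfl | ⟨g, hg, rfl⟩)
  · exact .inl rfl
  · exact .inr ⟨g, hg, rfl⟩

theorem compat_map {Y Y' : Type*} {Δ : Set (Y → Y)} {Δ' : Set (Y' → Y')} {f : Y' → Y}
    (hf : Compat Δ Δ' f) (n : ℕ) : Compat (fibSymm Δ n) (fibSymm Δ' n) (Prod.map f id) := by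
  rintro _ (rfl | ⟨g, hg, rfl⟩)
  · exact .inr ⟨_, antipode_mem_symm Δ n, rfl⟩
  · rcases hf g hg with e | ⟨g', hg', e⟩
    · refine .inl ?_
      rw [Prod.map_comp_map, e]
      rfl
    · refine .inr ⟨_, prod_mem_symm hg' n, ?_⟩
      rw [Prod.map_comp_map, e]
      rfl

theorem compat_cone {Y : Type*} (Δ : Set (Y → Y)) (n : ℕ) :
    Compat (fibSymm Δ (n + 1)) (fibSymm Δ n) (Prod.map id (cone 0)) := by
  rintro _ (rfl | ⟨g, hg, rfl⟩)
  · exact .inr ⟨_, antipode_mem_symm Δ _, by ext1 x; simp [Prod.map, cone_zero_antipode]⟩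
  · exact .inr ⟨_, prod_mem_symm hg _, rfl⟩

theorem compat_mk {Y : Type*} (Δ : Set (Y → Y)) {n : ℕ} (e : Sph n) :
    Compat (fibSymm Δ n) Δ fun y => (y, e) :=
  fun g hg => .inr ⟨_, prod_mem_symm hg n, rfl⟩

theorem continuous_map_cone_zero :
    Continuous (Prod.map id (cone 0) : Y × Sph n → Y × Sph (n + 1)) :=
  continuous_id.prodMap (continuous_cone.comp (continuous_const.prodMk continuous_id))

theorem stepCoh_mul_pull {Δ : Set (Y → Y)} (x : Coh (fibSymm Δ (n + 1))) {a : Coh Δ} (ha : HasNorm a) :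
    stepCoh Δ n (x * pull Prod.fst continuous_fst (compat_fst Δ _) a) =
      stepCoh Δ n x * pull Prod.fst continuous_fst (compat_fst Δ _) a := by
  obtain ⟨c, hc, rfl⟩ := cl_surjective x
  obtain ⟨d, hd, rfl, hn⟩ := ha
  rw [pull_cl, cl_mul, stepCoh_cl, pull_cl, stepCoh_cl, cl_mul, cl_eq_iff, step_mul_comap c hn]
  exact Cohomologous.refl _ _

theorem stepCoh_hasDeg {Δ : Set (Y → Y)} {x : Coh (fibSymm Δ (n + 1))} {m : ℕ}
    (hx : HasDeg (m + 1) x) : HasDeg m (stepCoh Δ n x) := by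
  obtain ⟨c, hc, rfl, h⟩ := hx
  exact ⟨_, _, stepCoh_cl hc, step_deg h⟩

theorem pull_stepCoh {Y' : Type*} [TopologicalSpace Y'] {Δ : Set (Y → Y)} {Δ' : Set (Y' → Y')}
    {f : Y' → Y} (hf : Continuous f) (hc : Compat Δ Δ' f) (x : Coh (fibSymm Δ (n + 1))) :
    pull (Prod.map f id) (hf.prodMap continuous_id) (compat_map hc n) (stepCoh Δ n x) =
      stepCoh Δ' n (pull (Prod.map f id) (hf.prodMap continuous_id) (compat_map hc _) x) := by
  obtain ⟨c, h, rfl⟩ := cl_surjective x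
  rw [pull_cl, stepCoh_cl, pull_cl, stepCoh_cl, cl_eq_iff, comap_step]
  exact Cohomologous.refl _ _

end Step

end Coch

end AlexanderSpanier

namespace AlexanderSpanier

namespace Coch

open Filter Topology

set_option linter.unusedSectionVars false

variable {X Y Z : Type*} [TopologicalSpace X] [TopologicalSpace Y] [TopologicalSpace Z] {n : ℕ}

/-- Functions which every symmetry either preserves or shifts by one. -/
def IsParity {X : Type*} (Γ : Set (X → X)) (r : X → ZMod 2) : Prop :=
  ∀ g ∈ Γ, (∀ x, r (g x) = r x) ∨ ∀ x, r (g x) = r x + 1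

theorem IsParity.add {Γ : Set (X → X)} {r s : X → ZMod 2} (hr : IsParity Γ r)
    (hs : IsParity Γ s) : IsParity Γ (r + s) := fun g hg => by
  have h2 : (1 : ZMod 2) + 1 = 0 := rfl
  rcases hr g hg with h | h <;> rcases hs g hg with h' | h'
  · exact .inl fun x => by simp [h, h']
  · exact .inr fun x => by simp [h, h', add_assoc]
  · exact .inr fun x => by simp only [Pi.add_apply, h, h']; ring
  · exact .inl fun x => by simp only [Pi.add_apply, h, h']; linear_combination h2

theorem IsParity.comp {Γ : Set (X → X)} {Δ : Set (Y → Y)} {r : X → ZMod 2} (hr : IsParity Γ r)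
    {f : Y → X} (hf : Compat Γ Δ f) : IsParity Δ (r ∘ f) := fun h hh => by
  rcases hf h hh with e | ⟨g, hg, e⟩
  · exact .inl fun x => congrArg r (congrFun e x)
  · rcases hr g hg with h' | h'
    · exact .inl fun x => (congrArg r (congrFun e x)).trans (h' _)
    · exact .inr fun x => (congrArg r (congrFun e x)).trans (h' _)

theorem IsParity.bd_fn_mem {Γ : Set (X → X)} {r : X → ZMod 2} (hr : IsParity Γ r) :
    bd (fn r) ∈ invariants Γ := fun g hg => by
  rw [← bd_comap, comap_fn]
  rcases hr g hg with h | h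
  · rw [funext h (f := r ∘ g)]
  · rw [show r ∘ g = r + fun _ => 1 from funext h, fn_add, fn_one, map_add, bd_one, add_zero]

theorem IsParity.bd_fn_mem_cocycles {Γ : Set (X → X)} {r : X → ZMod 2} (hr : IsParity Γ r) :
    bd (fn r) ∈ cocycles Γ := ⟨hr.bd_fn_mem, by rw [bd_bd]; exact LZ.zero⟩

/-- The degree one class of a parity function. -/
def chr {Γ : Set (X → X)} (r : X → ZMod 2) (hr : IsParity Γ r) : Coh Γ :=
  cl (bd (fn r)) hr.bd_fn_mem_cocycles

theorem chr_add {Γ : Set (X → X)} {r s : X → ZMod 2} (hr : IsParity Γ r) (hs : IsParity Γ s) :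
    chr (r + s) (hr.add hs) = chr r hr + chr s hs := by
  rw [chr, chr, chr, cl_add, cl_eq_iff, fn_add, map_add]
  exact Cohomologous.refl _ _

theorem Cohomologous.bd_fn {Γ : Set (X → X)} {r s : X → ZMod 2}
    (h : ∀ g ∈ Γ, ∀ x, r (g x) + s (g x) = r x + s x) : 
    Cohomologous Γ (bd (fn r)) (bd (fn s)) :=
  Cohomologous.of_eq (b := fn (r + s)) (fn_mem_invariants h) (by rw [fn_add, map_add])

theorem chr_eq {Γ : Set (X → X)} {r s : X → ZMod 2} (hr : IsParity Γ r) (hs : IsParity Γ s)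
    (h : ∀ g ∈ Γ, ∀ x, r (g x) + s (g x) = r x + s x) : chr r hr = chr s hs :=
  cl_eq_iff.mpr (Cohomologous.bd_fn h)

theorem chr_mul_comm {Γ : Set (X → X)} {r s : X → ZMod 2} (hr : IsParity Γ r)
    (hs : IsParity Γ s) : Commute (chr r hr) (chr s hs) := by
  rw [commute_iff_eq, chr, chr, cl_mul, cl_mul, cl_eq_iff]
  refine Cohomologous.of_eq (b := pmul (bd (fn r)) (bd (fn s))) (fun g hg => ?_)
    (bd_fn_mul_comm r s)
  conv_rhs => rw [← hr.bd_fn_mem g hg, ← hs.bd_fn_mem g hg]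
  rfl

theorem pull_chr {Γ : Set (X → X)} {Δ : Set (Y → Y)} {f : Y → X} (hf : Continuous f)
    (hc : Compat Γ Δ f) {r : X → ZMod 2} (hr : IsParity Γ r) :
    pull f hf hc (chr r hr) = chr (r ∘ f) (hr.comp hc) := by
  rw [chr, chr, pull_cl, cl_eq_iff, ← bd_comap, comap_fn]
  exact Cohomologous.refl _ _

theorem chr_hasDeg {Γ : Set (X → X)} {r : X → ZMod 2} (hr : IsParity Γ r) : HasDeg 1 (chr r hr) :=
  ⟨_, _, rfl, bd_fn_deg r⟩

theorem chr_hasNorm {Γ : Set (X → X)} {r : X → ZMod 2} (hr : IsParity Γ r) : HasNorm (chr r hr) :=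
  ⟨_, _, rfl, bd_fn_norm r⟩

theorem toLex_neg_lt_zero {a : Fin (n + 1) → ℝ} (ha : a ≠ 0) :
    toLex (-a) < 0 ↔ ¬ toLex a < 0 := by
  rw [show toLex (-a) = -toLex a from rfl, neg_lt_zero]
  refine ⟨fun h => lt_asymm h, fun h => ?_⟩
  rcases lt_trichotomy (toLex a) 0 with h' | h' | h'
  · exact (h h').elim
  · exact (ha (toLex.injective h')).elim
  · exact h'

open Classical in
/-- A sign function on nonzero vectors. -/
def sgn (c : Sph n) : ZMod 2 := if toLex c.1 < 0 then 1 else 0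

theorem sgn_antipode (c : Sph n) : sgn (antipode c) = sgn c + 1 := by
  have h : toLex (antipode c).1 < 0 ↔ ¬ toLex c.1 < 0 := toLex_neg_lt_zero c.2
  unfold sgn
  by_cases h' : toLex c.1 < 0
  · rw [if_pos h', if_neg (by rwa [h, not_not])]; decide
  · rw [if_neg h', if_pos (h.mpr h')]; decide

theorem isParity_sgn {Y : Type*} (Δ : Set (Y → Y)) (n : ℕ) :
    IsParity (fibSymm Δ n) (sgn ∘ Prod.snd) := by
  rintro _ (rfl | ⟨g, hg, rfl⟩)
  · exact .inr fun x => sgn_antipode x.2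
  · exact .inl fun x => rfl

/-- The tautological degree one class. -/
def taut (Δ : Set (Y → Y)) (n : ℕ) : Coh (fibSymm Δ n) := chr _ (isParity_sgn Δ n)

theorem pull_map_taut {Δ : Set (Y → Y)} {Δ' : Set (Z → Z)} {f : Z → Y} (hf : Continuous f)
    (hc : Compat Δ Δ' f) (n : ℕ) :
    pull (Prod.map f id) (hf.prodMap continuous_id) (compat_map hc n) (taut Δ n) = taut Δ' n := by
  rw [taut, pull_chr]
  rfl

theorem pull_cone_taut (Δ : Set (Y → Y)) (n : ℕ) :
    pull _ continuous_map_cone_zero (compat_cone Δ n) (taut Δ (n + 1)) = taut Δ n := by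
  rw [taut, pull_chr]
  refine chr_eq _ _ ?_
  rintro _ (rfl | ⟨g, hg, rfl⟩) x
  · simp only [Function.comp_apply, Prod.map_snd, cone_zero_antipode, sgn_antipode]
    linear_combination (by decide : (1 : ZMod 2) + 1 = 0)
  · rfl

theorem stepCoh_mul_taut {Δ : Set (Y → Y)} (x : Coh (fibSymm Δ (n + 1))) :
    stepCoh Δ n (x * taut Δ (n + 1)) = pull _ continuous_map_cone_zero (compat_cone Δ n) x := by
  obtain ⟨c, hc, rfl⟩ := cl_surjective x
  rw [taut, chr, cl_mul, stepCoh_cl, pull_cl, cl_eq_iff]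
  exact step_mul_bd_fn hc sgn_antipode

/-- A base point. -/
def basePt (n : ℕ) : Sph n := ⟨Pi.single 0 1, fun h => by simpa using congrFun h 0⟩

/-- Integration along the fibre. -/
def fib (Δ : Set (Y → Y)) : ∀ n, Coh (fibSymm Δ n) →+ Coh Δ
  | 0 => (pull (fun y => (y, basePt 0)) (by fun_prop) (compat_mk Δ _)).toAddMonoidHom
  | n + 1 => (fib Δ n).comp (stepCoh Δ n)

/-- Pullback along the projection. -/
def proj (Δ : Set (Y → Y)) (n : ℕ) : Coh Δ →+* Coh (fibSymm Δ n) :=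
  pull Prod.fst continuous_fst (compat_fst Δ n)

theorem fib_zero {Δ : Set (Y → Y)} (x : Coh (fibSymm Δ 0)) :
    fib Δ 0 x = pull (fun y => (y, basePt 0)) (by fun_prop) (compat_mk Δ _) x := rfl

theorem fib_succ {Δ : Set (Y → Y)} (x : Coh (fibSymm Δ (n + 1))) :
    fib Δ (n + 1) x = fib Δ n (stepCoh Δ n x) := rfl

theorem pull_cone_proj {Δ : Set (Y → Y)} (a : Coh Δ) :
    pull _ continuous_map_cone_zero (compat_cone Δ n) (proj Δ (n + 1) a) = proj Δ n a := by
  obtain ⟨c, hc, rfl⟩ := cl_surjective a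
  rw [proj, proj, pull_cl, pull_cl, pull_cl, cl_eq_iff, comap_comap]
  exact Cohomologous.refl _ _

theorem pull_mk_proj {Δ : Set (Y → Y)} (e : Sph n) (a : Coh Δ) :
    pull (fun y => (y, e)) (by fun_prop) (compat_mk Δ e) (proj Δ n a) = a := by
  obtain ⟨c, hc, rfl⟩ := cl_surjective a
  rw [proj, pull_cl, pull_cl, cl_eq_iff, comap_comap]
  exact (comap_id c).symm ▸ Cohomologous.refl _ _

theorem fib_mul_proj {Δ : Set (Y → Y)} (x : Coh (fibSymm Δ n)) {a : Coh Δ} (ha : HasNorm a) :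
    fib Δ n (x * proj Δ n a) = fib Δ n x * a := by
  induction n with
  | zero => rw [fib_zero, map_mul, fib_zero, pull_mk_proj]
  | succ n ih => rw [fib_succ, proj, stepCoh_mul_pull x ha]; exact ih _

theorem fib_proj_mul_taut_pow {Δ : Set (Y → Y)} (a : Coh Δ) :
    fib Δ n (proj Δ n a * taut Δ n ^ n) = a := by
  induction n with
  | zero => rw [pow_zero, mul_one, fib_zero, pull_mk_proj]
  | succ n ih =>
    rw [fib_succ, pow_succ, ← mul_assoc, stepCoh_mul_taut, map_mul, map_pow, pull_cone_taut,
      pull_cone_proj, ih]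

theorem HasDeg.pull {Γ : Set (X → X)} {Δ : Set (Y → Y)} {f : Y → X} (hf : Continuous f)
    (hc : Compat Γ Δ f) {m : ℕ} {x : Coh Γ} (hx : HasDeg m x) : HasDeg m (pull f hf hc x) := by
  obtain ⟨c, h, rfl, hm⟩ := hx
  exact ⟨_, _, pull_cl hf hc h, hm.comap f⟩

theorem fib_hasDeg {Δ : Set (Y → Y)} {m : ℕ} {x : Coh (fibSymm Δ n)} (hx : HasDeg (m + n) x) :
    HasDeg m (fib Δ n x) := by
  induction n with
  | zero => exact hx.pull (by fun_prop) (compat_mk Δ _)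
  | succ n ih => exact ih (stepCoh_hasDeg hx)

theorem pull_fib {Δ : Set (Y → Y)} {Δ' : Set (Z → Z)} {f : Z → Y} (hf : Continuous f)
    (hc : Compat Δ Δ' f) (x : Coh (fibSymm Δ n)) :
    pull f hf hc (fib Δ n x) =
      fib Δ' n (pull (Prod.map f id) (hf.prodMap continuous_id) (compat_map hc n) x) := by
  induction n with
  | zero =>
    have h : Compat (fibSymm Δ 0) Δ' fun z => (f z, basePt 0) := fun g hg => by
      rcases hc g hg with e | ⟨g', hg', e⟩
      · exact .inl (by ext1 z; exact congrArg (·, basePt 0) (congrFun e z))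
      · exact .inr ⟨_, prod_mem_symm hg' _, by ext1 z; exact congrArg (·, basePt 0) (congrFun e z)⟩
    rw [fib_zero, fib_zero, pull_pull _ _ _ _ h, pull_pull _ _ _ _ h]
    rfl
  | succ n ih => rw [fib_succ, ih, pull_stepCoh hf hc, fib_succ]

end Coch

end AlexanderSpanier

namespace AlexanderSpanier

namespace Coch

open Filter Topology

set_option linter.unusedSectionVars false

variable {X Y Z : Type*} [TopologicalSpace X] [TopologicalSpace Y] [TopologicalSpace Z] {n m : ℕ}

/-- Real functions which each symmetry preserves or negates, according to the parity `r`. -/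
def IsOdd {Z : Type*} (Γ : Set (Z → Z)) (r : Z → ZMod 2) (φ : Z → ℝ) : Prop :=
  ∀ g ∈ Γ, (∀ z, φ (g z) = φ z ∧ r (g z) = r z) ∨ ∀ z, φ (g z) = -φ z ∧ r (g z) = r z + 1

open Classical in
/-- The sign of `φ`, completed by the parity `r` on the zero set. -/
def sg {Z : Type*} (r : Z → ZMod 2) (φ : Z → ℝ) (z : Z) : ZMod 2 :=
  if φ z = 0 then r z else if φ z < 0 then 1 else 0

theorem sg_invariant {Γ : Set (Z → Z)} {r : Z → ZMod 2} {φ : Z → ℝ} (h : IsOdd Γ r φ) :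
    ∀ g ∈ Γ, ∀ z, sg r φ (g z) + r (g z) = sg r φ z + r z := fun g hg z => by
  have h2 : (1 : ZMod 2) + 1 = 0 := by decide
  rcases h g hg with h | h
  · obtain ⟨h1, h3⟩ := h z
    simp only [sg, h1, h3]
  · obtain ⟨h1, h3⟩ := h z
    simp only [sg, h1, h3, neg_eq_zero, neg_lt_zero]
    rcases lt_trichotomy (φ z) 0 with h' | h' | h'
    · simp only [h'.ne, h', h'.not_gt, if_true, if_false]; ring
    · simp only [h', if_true]; linear_combination h2
    · simp only [h'.ne', h', h'.not_gt, if_true, if_false]; linear_combination h2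

theorem isParity_of_add {Z : Type*} {Γ : Set (Z → Z)} {r s : Z → ZMod 2} (hr : IsParity Γ r)
    (h : ∀ g ∈ Γ, ∀ z, s (g z) + r (g z) = s z + r z) : IsParity Γ s := fun g hg => by
  rcases hr g hg with h' | h'
  · exact .inl fun z => by simpa [h' z] using h g hg z
  · refine .inr fun z => ?_
    have := h g hg z
    rw [h' z] at this
    linear_combination this - (by decide : (1 : ZMod 2) + 1 = 0)

theorem IsOdd.isParity {Z : Type*} {Γ : Set (Z → Z)} {r : Z → ZMod 2} {φ : Z → ℝ}
    (h : IsOdd Γ r φ) : IsParity Γ r := fun g hg => by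
  rcases h g hg with h | h
  · exact .inl fun z => (h z).2
  · exact .inr fun z => (h z).2

/-- The degree one cocycle of the sign of `φ`, which vanishes locally where `φ` does not. -/
def cs {Z : Type*} (r : Z → ZMod 2) (φ : Z → ℝ) : Coch Z := bd (fn (sg r φ))

theorem bd_cs {Z : Type*} (r : Z → ZMod 2) (φ : Z → ℝ) : bd (cs r φ) = 0 := bd_bd _

theorem IsOdd.cs_mem {Γ : Set (Z → Z)} {r : Z → ZMod 2} {φ : Z → ℝ} (h : IsOdd Γ r φ) :
    cs r φ ∈ cocycles Γ := (isParity_of_add h.isParity (sg_invariant h)).bd_fn_mem_cocycles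

theorem IsOdd.cl_cs {Γ : Set (Z → Z)} {r : Z → ZMod 2} {φ : Z → ℝ} (h : IsOdd Γ r φ) :
    cl (cs r φ) h.cs_mem = chr r h.isParity :=
  chr_eq (isParity_of_add h.isParity (sg_invariant h)) _ (sg_invariant h)

theorem comap_cs {Y Z : Type*} (u : Y → Z) (r : Z → ZMod 2) (φ : Z → ℝ) :
    comap u (cs r φ) = cs (r ∘ u) (φ ∘ u) := by
  rw [cs, ← bd_comap, comap_fn]; rfl

theorem eventually_sg {r : Z → ZMod 2} {φ : Z → ℝ} (hφ : Continuous φ) {z : Z} (hz : φ z ≠ 0) :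
    ∀ᶠ z' in 𝓝 z, sg r φ z' = if φ z < 0 then 1 else 0 := by
  rcases hz.lt_or_gt with h | h
  · filter_upwards [hφ.continuousAt.eventually (gt_mem_nhds h)] with y hy
    simp [sg, h, hy, hy.ne]
  · filter_upwards [hφ.continuousAt.eventually (lt_mem_nhds h)] with y hy
    simp [sg, h.not_gt, hy.not_gt, hy.ne']

theorem zeroNear_fn {s : Z → ZMod 2} {z : Z} (h : ∀ᶠ y in 𝓝 z, s y = 0) : ZeroNear (fn s) z := by
  refine ⟨_, h, .of_forall fun M l hl => ?_⟩
  match l, hl with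
  | [], _ => rfl
  | [x], hl => exact hl x (by simp)
  | _ :: _ :: _, _ => rfl

theorem zeroNear_cs {r : Z → ZMod 2} {φ : Z → ℝ} (hφ : Continuous φ) {z : Z} (hz : φ z ≠ 0) :
    ZeroNear (cs r φ) z := by
  have h : cs r φ = bd (fn (sg r φ + fun _ => if φ z < 0 then 1 else 0)) := by
    rw [fn_add, map_add, cs]
    by_cases h : φ z < 0
    · simp [h, fn_one]
    · have : fn (fun _ : Z => (0 : ZMod 2)) = 0 := by
        rw [← add_self (fn fun _ : Z => (0 : ZMod 2)), ← fn_add]; congr 1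
      simp [h, this]
  rw [h]
  refine (zeroNear_fn ?_).bd
  filter_upwards [eventually_sg (r := r) hφ hz] with y hy
  rw [Pi.add_apply, hy, add_self_zmod_two]

/-- Product of the sign cocycles of the coordinates. -/
def prodCs {Z : Type*} (r : Z → ZMod 2) : ∀ m, (Fin m → Z → ℝ) → Coch Z
  | 0, _ => 1
  | m + 1, f => cs r (f 0) * prodCs r m (Fin.tail f)

/-- The difference cochain of two vector valued odd functions. -/
def diff {Z : Type*} (r : Z → ZMod 2) : ∀ m, (Fin m → Z → ℝ) → (Fin m → Z → ℝ) → Coch Z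
  | 0, _, _ => 0
  | m + 1, f, g => fn (sg r (f 0) + sg r (g 0)) * prodCs r m (Fin.tail f) +
      cs r (g 0) * diff r m (Fin.tail f) (Fin.tail g)

theorem bd_prodCs {Z : Type*} (r : Z → ZMod 2) (f : Fin m → Z → ℝ) : bd (prodCs r m f) = 0 := by
  induction m with
  | zero => exact bd_one
  | succ m ih => rw [prodCs, bd_mul, ih, bd_cs, zero_mul, mul_zero, add_zero]

theorem bd_diff {Z : Type*} (r : Z → ZMod 2) (f g : Fin m → Z → ℝ) :
    bd (diff r m f g) = prodCs r m f + prodCs r m g := by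
  induction m with
  | zero => exact (map_zero bd).trans (add_self _).symm
  | succ m ih =>
    rw [diff, map_add, bd_mul, bd_mul, bd_prodCs, bd_cs, ih, fn_add, map_add, prodCs, prodCs,
      mul_zero, zero_mul, add_zero, zero_add, mul_add, add_mul, cs, cs]
    generalize bd (fn (sg r (g 0))) * prodCs r m (Fin.tail f) = p
    rw [add_assoc, ← add_assoc p p, add_self, zero_add]

theorem comap_prodCs {Y Z : Type*} (u : Y → Z) (r : Z → ZMod 2) (f : Fin m → Z → ℝ) :
    comap u (prodCs r m f) = prodCs (r ∘ u) m (fun i => f i ∘ u) := by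
  induction m with
  | zero => exact map_one _
  | succ m ih => rw [prodCs, map_mul, comap_cs, ih]; rfl

theorem comap_diff {Y Z : Type*} (u : Y → Z) (r : Z → ZMod 2) (f g : Fin m → Z → ℝ) :
    comap u (diff r m f g) = diff (r ∘ u) m (fun i => f i ∘ u) (fun i => g i ∘ u) := by
  induction m with
  | zero => exact map_zero _
  | succ m ih =>
    rw [diff, map_add, map_mul, map_mul, comap_cs, ih, comap_prodCs, comap_fn]; rfl

theorem zeroNear_prodCs {r : Z → ZMod 2} {f : Fin m → Z → ℝ} (hf : ∀ i, Continuous (f i)) {z : Z}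
    (hz : ∃ i, f i z ≠ 0) : ZeroNear (prodCs r m f) z := by
  induction m with
  | zero => exact hz.choose.elim0
  | succ m ih =>
    by_cases h : f 0 z = 0
    · refine ZeroNear.mul_left (ih (fun i => hf i.succ) ?_) _
      obtain ⟨i, hi⟩ := hz
      rcases Fin.eq_zero_or_eq_succ i with rfl | ⟨j, rfl⟩
      · exact (hi h).elim
      · exact ⟨j, hi⟩
    · exact (zeroNear_cs (hf 0) h).mul_right _

theorem zeroNear_diff {r : Z → ZMod 2} {f g : Fin m → Z → ℝ} (hf : ∀ i, Continuous (f i))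
    (hg : ∀ i, Continuous (g i)) {z : Z} (hz : ∃ i, f i z ≠ 0) (hfg : ∀ i, f i z = g i z) :
    ZeroNear (diff r m f g) z := by
  induction m with
  | zero => exact hz.choose.elim0
  | succ m ih =>
    by_cases h : f 0 z = 0
    · have h' : ∃ i, Fin.tail f i z ≠ 0 := by
        obtain ⟨i, hi⟩ := hz
        rcases Fin.eq_zero_or_eq_succ i with rfl | ⟨j, rfl⟩
        · exact (hi h).elim
        · exact ⟨j, hi⟩
      exact (ZeroNear.mul_left (zeroNear_prodCs (fun i => hf i.succ) h') _).add
        (ZeroNear.mul_left (ih (fun i => hf i.succ) (fun i => hg i.succ) h' fun i => hfg _) _)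
    · have h' : g 0 z ≠ 0 := by rwa [← hfg]
      refine (ZeroNear.mul_right (zeroNear_fn ?_) _).add ((zeroNear_cs (hg 0) h').mul_right _)
      filter_upwards [eventually_sg (r := r) (hf 0) h, eventually_sg (r := r) (hg 0) h'] with y h1 h2
      rw [Pi.add_apply, h1, h2, hfg, add_self_zmod_two]

/-- Odd continuous functions to the punctured Euclidean space. -/
structure OddMap (Γ : Set (Z → Z)) (r : Z → ZMod 2) (f : Fin m → Z → ℝ) : Prop where
  continuous (i : Fin m) : Continuous (f i)
  odd (i : Fin m) : IsOdd Γ r (f i)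
  ne_zero (z : Z) : ∃ i, f i z ≠ 0

variable {Γ : Set (Z → Z)} {r : Z → ZMod 2}

theorem prodCs_mem {f : Fin m → Z → ℝ} (hf : ∀ i, IsOdd Γ r (f i)) :
    prodCs r m f ∈ cocycles Γ := by
  induction m with
  | zero => exact one_mem _
  | succ m ih => exact mul_mem (hf 0).cs_mem (ih fun i => hf i.succ)

theorem cl_prodCs {f : Fin m → Z → ℝ} (hr : IsParity Γ r) (hf : ∀ i, IsOdd Γ r (f i)) :
    cl (prodCs r m f) (prodCs_mem hf) = chr r hr ^ m := by
  induction m with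
  | zero => rw [pow_zero]; rfl
  | succ m ih =>
    rw [pow_succ', ← ih fun i => hf i.succ, ← (hf 0).cl_cs, cl_mul]
    rfl

theorem sg_add_sg_mem {φ ψ : Z → ℝ} (hφ : IsOdd Γ r φ) (hψ : IsOdd Γ r ψ) :
    fn (sg r φ + sg r ψ) ∈ invariants Γ := fn_mem_invariants fun g hg z => by
  have h1 := sg_invariant hφ g hg z
  have h2 := sg_invariant hψ g hg z
  simp only [Pi.add_apply]
  have h3 := add_self_zmod_two (r z)
  have h4 := add_self_zmod_two (r (g z))
  linear_combination h1 + h2 + h3 - h4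

theorem diff_mem_invariants {f g : Fin m → Z → ℝ} (hf : ∀ i, IsOdd Γ r (f i))
    (hg : ∀ i, IsOdd Γ r (g i)) : diff r m f g ∈ invariants Γ := by
  induction m with
  | zero => exact zero_mem _
  | succ m ih =>
    exact add_mem (mul_mem (sg_add_sg_mem (hf 0) (hg 0)) (prodCs_mem fun i => hf i.succ).1)
      (mul_mem (hg 0).cs_mem.1 (ih (fun i => hf i.succ) fun i => hg i.succ))

theorem diff_mem {f g : Fin m → Z → ℝ} (hf : OddMap Γ r f) (hg : OddMap Γ r g) :
    diff r m f g ∈ cocycles Γ :=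
  ⟨diff_mem_invariants hf.odd hg.odd, fun z => by
    rw [bd_diff]
    exact (zeroNear_prodCs hf.continuous (hf.ne_zero z)).add
      (zeroNear_prodCs hg.continuous (hg.ne_zero z))⟩

theorem exists_diff_add {f g h : Fin m → Z → ℝ} (hf : ∀ i, IsOdd Γ r (f i))
    (hg : ∀ i, IsOdd Γ r (g i)) (hh : ∀ i, IsOdd Γ r (h i)) : ∃ b ∈ invariants Γ,
      diff r m f h + diff r m f g + diff r m g h = bd b := by
  induction m with
  | zero => exact ⟨0, zero_mem _, by simp [diff]⟩
  | succ m ih =>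
    obtain ⟨b, hb, e⟩ := ih (fun i => hf i.succ) (fun i => hg i.succ) (fun i => hh i.succ)
    refine ⟨fn (sg r (g 0) + sg r (h 0)) * diff r m (Fin.tail f) (Fin.tail g) + cs r (h 0) * b,
      add_mem (mul_mem (sg_add_sg_mem (hg 0) (hh 0))
        (diff_mem_invariants (fun i => hf i.succ) fun i => hg i.succ))
        (mul_mem (hh 0).cs_mem.1 hb), ?_⟩
    have e' : bd b = diff r m (Fin.tail f) (Fin.tail h) + diff r m (Fin.tail f) (Fin.tail g) +
      diff r m (Fin.tail g) (Fin.tail h) := e.symm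
    rw [map_add, bd_mul, bd_mul, bd_cs, bd_diff, e', zero_mul, zero_add]
    simp only [diff, fn_add, map_add, cs]
    refine eq_of_add_eq_zero ?_
    noncomm_ring
    have h2 : ∀ c : Coch Z, (2 : ℤ) • c = 0 := fun c => by rw [two_zsmul, add_self]
    simp only [h2, add_zero]

/-- The difference class of two odd maps. -/
def diffCl {f g : Fin m → Z → ℝ} (hf : OddMap Γ r f) (hg : OddMap Γ r g) : Coh Γ :=
  cl (diff r m f g) (diff_mem hf hg)

theorem diffCl_add {f g h : Fin m → Z → ℝ} (hf : OddMap Γ r f) (hg : OddMap Γ r g)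
    (hh : OddMap Γ r h) : diffCl hf hh = diffCl hf hg + diffCl hg hh := by
  obtain ⟨b, hb, e⟩ := exists_diff_add hf.odd hg.odd hh.odd
  rw [diffCl, diffCl, diffCl, cl_add, cl_eq_iff]
  exact Cohomologous.of_eq hb (by rw [← e, add_assoc])

theorem diffCl_mul_chr {f g : Fin m → Z → ℝ} (hf : OddMap Γ r f) (hg : OddMap Γ r g)
    {s : Z → ZMod 2} {φ : Z → ℝ} (hφ : IsOdd Γ s φ) (hc : Continuous φ)
    (h : ∀ z, φ z = 0 → ∀ i, f i z = g i z) : diffCl hf hg * chr s hφ.isParity = 0 := by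
  rw [← hφ.cl_cs, diffCl, cl_mul, ← cl_zero, cl_eq_iff]
  refine Cohomologous.of_lz fun z => ?_
  rw [add_zero]
  by_cases hz : φ z = 0
  · exact (zeroNear_diff hf.continuous hg.continuous (hf.ne_zero z) (h z hz)).mul_right _
  · exact (zeroNear_cs hc hz).mul_left _

theorem prodCs_deg {Z : Type*} (r : Z → ZMod 2) (f : Fin m → Z → ℝ) : Deg m (prodCs r m f) := by
  induction m with
  | zero => exact Deg.one
  | succ m ih =>
    have h := (bd_fn_deg (sg r (f 0))).mul (ih (Fin.tail f))
    rwa [add_comm] at h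

theorem diff_deg {Z : Type*} (r : Z → ZMod 2) (f g : Fin (m + 1) → Z → ℝ) :
    Deg m (diff r (m + 1) f g) := by
  induction m with
  | zero =>
    have h0 : diff r 0 (Fin.tail f) (Fin.tail g) = 0 := rfl
    rw [diff, h0, mul_zero, add_zero]
    exact (fn_deg _).mul Deg.one
  | succ m ih =>
    rw [diff]
    have h1 := (fn_deg (sg r (f 0) + sg r (g 0))).mul (prodCs_deg r (Fin.tail f))
    have h2 := (bd_fn_deg (sg r (g 0))).mul (ih (Fin.tail f) (Fin.tail g))
    rw [zero_add] at h1
    rw [add_comm] at h2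
    exact h1.add h2

theorem diffCl_hasDeg {f g : Fin (m + 1) → Z → ℝ} (hf : OddMap Γ r f) (hg : OddMap Γ r g) :
    HasDeg m (diffCl hf hg) := ⟨_, _, rfl, diff_deg r f g⟩

theorem pull_diffCl {Δ : Set (Y → Y)} {u : Y → Z} (hu : Continuous u) (hc : Compat Γ Δ u)
    {f g : Fin m → Z → ℝ} (hf : OddMap Γ r f) (hg : OddMap Γ r g) {s : Y → ZMod 2}
    {f' g' : Fin m → Y → ℝ} (hf' : OddMap Δ s f') (hg' : OddMap Δ s g') (hs : r ∘ u = s)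
    (hff : ∀ i, f i ∘ u = f' i) (hgg : ∀ i, g i ∘ u = g' i) :
    pull u hu hc (diffCl hf hg) = diffCl hf' hg' := by
  obtain rfl : (fun i => f i ∘ u) = f' := funext hff
  obtain rfl : (fun i => g i ∘ u) = g' := funext hgg
  subst hs
  rw [diffCl, diffCl, pull_cl, cl_eq_iff, comap_diff]
  exact Cohomologous.refl _ _

theorem chr_pow_eq_zero {f : Fin m → Z → ℝ} (hr : IsParity Γ r) (hf : OddMap Γ r f) :
    chr r hr ^ m = 0 := by
  rw [← cl_prodCs hr hf.odd, ← cl_zero, cl_eq_iff]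
  refine Cohomologous.of_lz fun z => ?_
  rw [add_zero]
  exact zeroNear_prodCs hf.continuous (hf.ne_zero z)

/-- Two odd maps differing by the sign of the first coordinate. -/
theorem diffCl_of_reflect {f g : Fin (m + 1) → Z → ℝ} (hr : IsParity Γ r) (hf : OddMap Γ r f)
    (hg : OddMap Γ r g) (h0 : ∀ z, g 0 z = -f 0 z) (hs : ∀ (i : Fin m) z, g i.succ z = f i.succ z) :
    diffCl hf hg = chr r hr ^ m := by
  have hself : ∀ (m : ℕ) (f : Fin m → Z → ℝ), diff r m f f = 0 := by
    intro m
    induction m with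
    | zero => exact fun _ => rfl
    | succ m ih =>
      intro f
      rw [diff, ih, mul_zero, add_zero, fn_add, add_self, zero_mul]
  have ht : Fin.tail g = Fin.tail f := funext fun i => funext fun z => hs i z
  rw [← cl_prodCs hr fun i : Fin m => hf.odd i.succ, diffCl, cl_eq_iff]
  refine Cohomologous.of_lz fun z => ?_
  rw [diff, ht, hself, mul_zero, add_zero]
  change ZeroNear (fn (sg r (f 0) + sg r (g 0)) * prodCs r m (Fin.tail f) +
    prodCs r m (Fin.tail f)) z
  by_cases hz : f 0 z = 0
  · have h' : ZeroNear (prodCs r m (Fin.tail f)) z := by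
      refine zeroNear_prodCs (fun i => hf.continuous i.succ) ?_
      obtain ⟨i, hi⟩ := hf.ne_zero z
      rcases Fin.eq_zero_or_eq_succ i with rfl | ⟨j, rfl⟩
      · exact (hi hz).elim
      · exact ⟨j, hi⟩
    exact (h'.mul_left _).add h'
  · have e : fn (sg r (f 0) + sg r (g 0)) * prodCs r m (Fin.tail f) + prodCs r m (Fin.tail f) =
        fn (sg r (f 0) + sg r (g 0) + fun _ => 1) * prodCs r m (Fin.tail f) := by
      rw [fn_add _ (fun _ => 1), fn_one, add_mul, one_mul]
    rw [e]
    refine ZeroNear.mul_right (zeroNear_fn ?_) _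
    have hz' : g 0 z ≠ 0 := by rwa [h0, neg_ne_zero]
    filter_upwards [eventually_sg (r := r) (hf.continuous 0) hz,
      eventually_sg (r := r) (hg.continuous 0) hz'] with y h1 h2
    rw [Pi.add_apply, Pi.add_apply, h1, h2, h0]
    rcases lt_or_gt_of_ne hz with h | h
    · simp [h, h.not_gt, add_self_zmod_two]
    · simp [h, h.not_gt, add_self_zmod_two]

end Coch

end AlexanderSpanier

namespace AlexanderSpanier

section Algebra

variable {R : Type*} [CommRing R]

theorem sum_pow_two_mul {ι : Type*} (h2 : ∀ a : R, a + a = 0) (s : Finset ι) (w : ι → R) (j : ℕ) :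
    ∑ k ∈ s, w k ^ (j * 2) = (∑ k ∈ s, w k ^ j) ^ 2 := by
  classical
  induction s using Finset.induction_on with
  | empty => simp
  | insert a s ha ih =>
    rw [Finset.sum_insert ha, Finset.sum_insert ha, ih, pow_mul]
    linear_combination -h2 (w a ^ j * ∑ k ∈ s, w k ^ j)

theorem prod_pow_mul_power_sum {w : ℕ → R} (hw : ∀ k, w k ^ (k + 1) = 0) {m n : ℕ} (hmn : m < n)
    (hm : 0 < m) :
    (∏ k ∈ Finset.Ico (m + 1) n, w k ^ k) * ∑ k ∈ Finset.range n, w k ^ m =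
      ∏ k ∈ Finset.Ico m n, w k ^ k := by
  rw [Finset.prod_eq_prod_Ico_succ_bot hmn, mul_comm (w m ^ m), Finset.mul_sum]
  refine Finset.sum_eq_single m (fun k hk hkm => ?_) fun h => (h (Finset.mem_range.mpr hmn)).elim
  rcases lt_or_gt_of_ne hkm with h | h
  · rw [pow_eq_zero_of_le h (hw k), mul_zero]
  · rw [← Finset.mul_prod_erase _ _ (Finset.mem_Ico.mpr ⟨h, Finset.mem_range.mp hk⟩),
      mul_right_comm, ← pow_add, pow_eq_zero_of_le (show k + 1 ≤ k + m by omega) (hw k), zero_mul]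

theorem power_sum_product {w : ℕ → R} (h2 : ∀ a : R, a + a = 0) (hw : ∀ k, w k ^ (k + 1) = 0) :
    (∑ k ∈ Finset.range 10, w k ^ 1) ^ 15 * (∑ k ∈ Finset.range 10, w k ^ 3) ^ 3 *
      (∑ k ∈ Finset.range 10, w k ^ 5) * (∑ k ∈ Finset.range 10, w k ^ 7) *
      (∑ k ∈ Finset.range 10, w k ^ 9) = ((List.range 10).map fun k => w k ^ k).prod := by
  have h : ((List.range 10).map fun k => w k ^ k).prod = ∏ k ∈ Finset.Ico 1 10, w k ^ k := by
    simp [List.range_succ, Finset.prod_Ico_succ_top, mul_assoc]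
  have e (m : ℕ) (h1 : 0 < m) (h2 : m < 10) := prod_pow_mul_power_sum hw h2 h1
  have s2 : ∑ k ∈ Finset.range 10, w k ^ 2 = _ := sum_pow_two_mul h2 (Finset.range 10) w 1
  have s4 : ∑ k ∈ Finset.range 10, w k ^ 4 = _ := sum_pow_two_mul h2 (Finset.range 10) w 2
  have s6 : ∑ k ∈ Finset.range 10, w k ^ 6 = _ := sum_pow_two_mul h2 (Finset.range 10) w 3
  have s8 : ∑ k ∈ Finset.range 10, w k ^ 8 = _ := sum_pow_two_mul h2 (Finset.range 10) w 4
  rw [h, ← e 1 (by simp) (by simp), ← e 2 (by simp) (by simp), ← e 3 (by simp) (by simp),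
    ← e 4 (by simp) (by simp), ← e 5 (by simp) (by simp), ← e 6 (by simp) (by simp),
    ← e 7 (by simp) (by simp), ← e 8 (by simp) (by simp), ← e 9 (by simp) (by simp),
    s8, s6, s4, s2, Finset.Ico_self, Finset.prod_empty]
  ring

open scoped IsMulCommutative in
theorem power_sum_product_of_commute {R : Type*} [Ring R] {w : ℕ → R} (h2 : ∀ a : R, a + a = 0)
    (hw : ∀ k, w k ^ (k + 1) = 0) (hc : ∀ j k, Commute (w j) (w k)) :
    (∑ k ∈ Finset.range 10, w k ^ 1) ^ 15 * (∑ k ∈ Finset.range 10, w k ^ 3) ^ 3 *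
      (∑ k ∈ Finset.range 10, w k ^ 5) * (∑ k ∈ Finset.range 10, w k ^ 7) *
      (∑ k ∈ Finset.range 10, w k ^ 9) = ((List.range 10).map fun k => w k ^ k).prod := by
  have _ : IsMulCommutative (Subring.closure (Set.range w)) := Subring.isMulCommutative_closure (by
    rintro _ ⟨j, rfl⟩ _ ⟨k, rfl⟩; exact hc j k)
  let v : ℕ → Subring.closure (Set.range w) := fun k => ⟨w k, Subring.subset_closure ⟨k, rfl⟩⟩
  have h := congrArg (Subring.closure (Set.range w)).subtype
    (power_sum_product (w := v) (fun a => Subtype.ext (h2 a)) fun k => Subtype.ext (hw k))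
  have hv (k : ℕ) : (Subring.closure (Set.range w)).subtype (v k) = w k := rfl
  simpa only [map_mul, map_pow, map_sum, map_list_prod, List.map_map, Function.comp_def, hv]
    using h

end Algebra

namespace Coch

open Filter Topology

set_option linter.unusedSectionVars false

section DegZero

variable {X : Type*} [TopologicalSpace X] [PreconnectedSpace X] {Γ : Set (X → X)}

theorem compat_const {X : Type*} {Γ : Set (X → X)} (p : X) :
    Compat Γ (∅ : Set (Unit → Unit)) fun _ => p := fun _ hg => hg.elim

theorem ev_bd_singleton {X : Type*} (b : Coch X) (M : ℕ) (x : X) : (bd b).ev M [x] = 0 := by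
  simp [ev_bd, cobdry_cons]

theorem one_ne_zero_point : (1 : Coh (∅ : Set (Unit → Unit))) ≠ 0 := by
  rw [← cl_one, ← cl_zero, Ne, cl_eq_iff]
  rintro ⟨b, -, h⟩
  obtain ⟨N, hN, h⟩ := h ()
  obtain ⟨M, hM⟩ := h.exists
  have h := hM [()] fun _ _ => mem_of_mem_nhds hN
  rw [ev_add, ev_bd_singleton, ev_add, ev_one, ev_zero, add_zero, add_zero] at h
  exact absurd h (by simp [unitCochain])

theorem eq_one_of_hasDeg_zero {x : Coh Γ} (hx : HasDeg 0 x) (p : X)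
    (hp : pull (fun _ : Unit => p) continuous_const (compat_const p) x = 1) : x = 1 := by
  obtain ⟨c, hc, rfl, hd⟩ := hx
  have hloc : ∀ y, ∃ N ∈ 𝓝 y, ∀ᶠ M in atTop, ∀ a ∈ N, ∀ b ∈ N, c.ev M [a] = c.ev M [b] := by
    intro y
    obtain ⟨N, hN, h⟩ := hc.2 y
    refine ⟨N, hN, h.mono fun M hM a ha b hb => ?_⟩
    have := hM [a, b] (by simp [ha, hb])
    rw [ev_bd] at this
    simp only [cobdry_cons, cobdry_nil, add_zero] at this
    linear_combination this - (add_self_zmod_two (c.ev M [b]))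
  set S := {y | ∀ᶠ M in atTop, c.ev M [y] = 1}
  have hS : IsClopen S := by
    constructor
    · refine ⟨isOpen_iff_mem_nhds.mpr fun y hy => ?_⟩
      obtain ⟨N, hN, h⟩ := hloc y
      refine mem_of_superset hN fun z hz hzS => hy ?_
      filter_upwards [h, hzS] with M h1 h2
      rw [h1 y (mem_of_mem_nhds hN) z hz, h2]
    · refine isOpen_iff_mem_nhds.mpr fun y hy => ?_
      obtain ⟨N, hN, h⟩ := hloc y
      refine mem_of_superset hN fun z hz => ?_
      filter_upwards [h, show ∀ᶠ M in atTop, c.ev M [y] = 1 from hy] with M h1 h2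
      rw [h1 z hz y (mem_of_mem_nhds hN), h2]
  have hpS : p ∈ S := by
    rw [pull_cl, ← cl_one, cl_eq_iff] at hp
    obtain ⟨b, -, h⟩ := hp
    obtain ⟨N, hN, h⟩ := h ()
    filter_upwards [h] with M hM
    have h := hM [()] fun _ _ => mem_of_mem_nhds hN
    rw [ev_add, ev_bd_singleton, ev_add, ev_one, add_zero, ev_comap] at h
    simp only [List.map_cons, List.map_nil, unitCochain] at h
    linear_combination h - (by decide : (1 : ZMod 2) + 1 = 0)
  have hU : S = Set.univ := hS.eq_univ ⟨p, hpS⟩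
  rw [← cl_one, cl_eq_iff]
  refine Cohomologous.of_lz fun y => ?_
  obtain ⟨N, hN, h⟩ := hloc y
  have hy : ∀ᶠ M in atTop, c.ev M [y] = 1 := show y ∈ S by rw [hU]; trivial
  refine ⟨N, hN, ?_⟩
  filter_upwards [h, hy] with M h1 h2 l hl
  rw [ev_add, ev_one]
  match l, hl with
  | [], _ => simp [unitCochain]
  | [a], hl =>
    rw [h1 a (hl a (by simp)) y (mem_of_mem_nhds hN), h2]
    exact (by decide : (1 : ZMod 2) + 1 = 0)
  | a :: b :: l, _ =>
    rw [hd M _ (by simp)]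
    simp [unitCochain]

end DegZero

/-! ### The test space -/

/-- The iterated product of punctured Euclidean spaces. -/
def Tower : ℕ → Type
  | 0 => Unit
  | n + 1 => Tower n × Sph (n + 1)

instance instTopologicalSpaceTower : ∀ n, TopologicalSpace (Tower n)
  | 0 => inferInstanceAs (TopologicalSpace Unit)
  | n + 1 => letI := instTopologicalSpaceTower n; inferInstanceAs (TopologicalSpace (Tower n × Sph (n + 1)))

theorem preconnectedSpace_sph (n : ℕ) : PreconnectedSpace (Sph (n + 1)) := by
  have h : IsPreconnected ({0}ᶜ : Set (Fin (n + 2) → ℝ)) := by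
    refine (isConnected_compl_singleton_of_one_lt_rank ?_ 0).isPreconnected
    rw [rank_fin_fun]
    exact_mod_cast (by omega : 1 < n + 2)
  exact isPreconnected_iff_preconnectedSpace.mp h

instance instPreconnectedSpaceTower : ∀ n, PreconnectedSpace (Tower n)
  | 0 => inferInstanceAs (PreconnectedSpace Unit)
  | n + 1 =>
    haveI := instPreconnectedSpaceTower n
    haveI := preconnectedSpace_sph n
    inferInstanceAs (PreconnectedSpace (Tower n × Sph (n + 1)))

/-- The antipodal maps of the factors. -/
def towerSymm : ∀ n, Set (Tower n → Tower n)
  | 0 => (∅ : Set (Unit → Unit))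
  | n + 1 => fibSymm (towerSymm n) (n + 1)

/-- The sign of the `k`-th factor. -/
def towerSgn : ∀ n, ℕ → Tower n → ZMod 2
  | 0, _, _ => 0
  | n + 1, k, x => if k = n + 1 then sgn x.2 else towerSgn n k x.1

/-- The `k`-th factor as a vector, or the first basis vector if there is no such factor. -/
def towerVec : ∀ n, ℕ → Tower n → ℕ → ℝ
  | 0, _, _, i => if i = 0 then 1 else 0
  | n + 1, k, x, i =>
    if k = n + 1 then if h : i < n + 2 then x.2.1 ⟨i, h⟩ else 0 else towerVec n k x.1 i

theorem continuous_towerVec (n k i : ℕ) : Continuous fun x => towerVec n k x i := by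
  induction n with
  | zero => exact continuous_const
  | succ n ih =>
    by_cases hk : k = n + 1
    · by_cases h : i < n + 2
      · simp only [towerVec, hk, if_true, h, dif_pos]
        exact (continuous_apply _).comp (continuous_subtype_val.comp continuous_snd)
      · simp only [towerVec, hk, if_true, h, dif_neg, not_false_eq_true]
        exact continuous_const
    · simp only [towerVec, hk, if_false]
      exact ih.comp continuous_fst

theorem towerVec_symm {n : ℕ} (k : ℕ) {g : Tower n → Tower n} (hg : g ∈ towerSymm n) :
    (∀ x, towerVec n k (g x) = towerVec n k x ∧ towerSgn n k (g x) = towerSgn n k x) ∨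
      ∀ x, towerVec n k (g x) = -towerVec n k x ∧ towerSgn n k (g x) = towerSgn n k x + 1 := by
  induction n with
  | zero => exact hg.elim
  | succ n ih =>
    by_cases hk : k = n + 1
    · rcases hg with rfl | ⟨g, hg, rfl⟩
      · refine .inr ?_
        rintro ⟨x, s⟩
        refine ⟨funext fun i => ?_, ?_⟩
        · by_cases h : i < n + 2 <;> simp [towerVec, hk, h, antipode]
        · simp only [towerSgn, hk, if_true]
          exact sgn_antipode s
      · refine .inl ?_
        rintro ⟨x, s⟩
        exact ⟨funext fun i => by simp [towerVec, hk], by simp [towerSgn, hk]⟩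
    · rcases hg with rfl | ⟨g, hg, rfl⟩
      · refine .inl ?_
        rintro ⟨x, s⟩
        exact ⟨funext fun i => by simp [towerVec, hk], by simp [towerSgn, hk]⟩
      · refine (ih hg).imp (fun h => ?_) fun h => ?_
        · rintro ⟨x, s⟩
          exact ⟨funext fun i => by simpa [towerVec, hk] using congrFun (h x).1 i,
            by simpa [towerSgn, hk] using (h x).2⟩
        · rintro ⟨x, s⟩
          exact ⟨funext fun i => by simpa [towerVec, hk] using congrFun (h x).1 i,
            by simpa [towerSgn, hk] using (h x).2⟩

theorem towerVec_ne_zero (n k : ℕ) (x : Tower n) : ∃ i ≤ n, towerVec n k x i ≠ 0 := by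
  induction n with
  | zero => exact ⟨0, le_rfl, by simp [towerVec]⟩
  | succ n ih =>
    by_cases hk : k = n + 1
    · obtain ⟨i, hi⟩ := Function.ne_iff.mp x.2.2
      exact ⟨i, by omega, by simpa [towerVec, hk] using hi⟩
    · obtain ⟨i, hi, h⟩ := ih x.1
      exact ⟨i, by omega, by simpa [towerVec, hk] using h⟩

theorem isParity_towerSgn (n k : ℕ) : IsParity (towerSymm n) (towerSgn n k) := fun _ hg =>
  (towerVec_symm k hg).imp (fun h x => (h x).2) fun h x => (h x).2

/-- A base point of the test space. -/
def towerPt : ∀ n, Tower n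
  | 0 => ()
  | n + 1 => (towerPt n, basePt (n + 1))

theorem towerVec_towerPt (n k i : ℕ) : towerVec n k (towerPt n) i = if i = 0 then 1 else 0 := by
  induction n with
  | zero => rfl
  | succ n ih =>
    by_cases hk : k = n + 1
    · by_cases h : i < n + 2
      · simp [towerVec, hk, h, towerPt, basePt, Pi.single_apply, Fin.ext_iff]
      · simp only [towerVec, hk, if_true, h, dif_neg, not_false_eq_true, if_neg (by omega : i ≠ 0)]
    · simp [towerVec, hk, towerPt, ih]

/-- The degree one class of the `k`-th factor. -/
def towerCl (n k : ℕ) : Coh (towerSymm n) := chr _ (isParity_towerSgn n k)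

/-- The pullback from a test space to the next one. -/
def towerProj (n : ℕ) : Coh (towerSymm n) →+* Coh (towerSymm (n + 1)) := proj (towerSymm n) (n + 1)

theorem towerCl_self_eq (n : ℕ) : towerCl (n + 1) (n + 1) = taut (towerSymm n) (n + 1) := by
  refine chr_eq _ (isParity_sgn (towerSymm n) (n + 1)) fun g _ x => ?_
  simp [towerSgn, add_self_zmod_two]

theorem towerCl_of_ne {n k : ℕ} (h : k ≠ n + 1) :
    towerCl (n + 1) k = towerProj n (towerCl n k) := by
  refine Eq.trans ?_ (pull_chr continuous_fst (compat_fst (towerSymm n) (n + 1))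
    (isParity_towerSgn n k)).symm
  refine chr_eq _ ((isParity_towerSgn n k).comp (compat_fst _ _)) fun g _ x => ?_
  simp [towerSgn, h, add_self_zmod_two]

theorem towerCl_eq_zero {n k : ℕ} (h : k = 0 ∨ n < k) : towerCl n k = 0 := by
  induction n with
  | zero =>
    rw [towerCl, chr, ← cl_zero, cl_eq_iff]
    have : fn (towerSgn 0 k) = 0 := by
      rw [← add_self (fn (towerSgn 0 k)), ← fn_add]; congr 1
    rw [this, map_zero]
    exact Cohomologous.refl _ _
  | succ n ih => rw [towerCl_of_ne (by omega), ih (by omega), map_zero]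

theorem taut_pow_eq_zero {Y : Type*} [TopologicalSpace Y] (Δ : Set (Y → Y)) (n : ℕ) :
    taut Δ n ^ (n + 1) = 0 := by
  refine chr_pow_eq_zero (f := fun i z => z.2.1 i) _ ⟨fun i => ?_, ?_, fun z => ?_⟩
  · exact (continuous_apply i).comp (continuous_subtype_val.comp continuous_snd)
  · rintro i _ (rfl | ⟨g, hg, rfl⟩)
    · exact .inr fun z => ⟨rfl, sgn_antipode z.2⟩
    · exact .inl fun z => ⟨rfl, rfl⟩
  · exact Function.ne_iff.mp z.2.2

theorem towerCl_self_pow (n : ℕ) : towerCl (n + 1) (n + 1) ^ (n + 2) = 0 := by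
  rw [towerCl_self_eq]
  exact taut_pow_eq_zero (towerSymm n) (n + 1)

theorem towerCl_pow (n k : ℕ) : towerCl n k ^ (k + 1) = 0 := by
  induction n with
  | zero => rw [towerCl_eq_zero (by omega), zero_pow (by omega)]
  | succ n ih =>
    by_cases h : k = n + 1
    · rw [h, towerCl_self_pow]
    · rw [towerCl_of_ne h, ← map_pow, ih, map_zero]

theorem eq_zero_of_towerProj_mul (n : ℕ) {a : Coh (towerSymm n)}
    (h : towerProj n a * towerCl (n + 1) (n + 1) ^ (n + 1) = 0) : a = 0 := by
  rw [towerCl_self_eq] at h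
  rw [← fib_proj_mul_taut_pow (n := n + 1) a]
  exact (congrArg _ h).trans (map_zero _)

theorem towerCl_prod_ne_zero (n : ℕ) :
    ((List.range (n + 1)).map fun k => towerCl n k ^ k).prod ≠ 0 := by
  induction n with
  | zero =>
    intro h
    rw [zero_add, List.range_one, List.map_singleton, List.prod_singleton, pow_zero] at h
    exact one_ne_zero_point h
  | succ n ih =>
    intro h
    rw [List.range_succ, List.map_append, List.prod_append, List.map_singleton,
      List.prod_singleton] at h
    have e : ((List.range (n + 1)).map fun k => towerCl (n + 1) k ^ k) =
        ((List.range (n + 1)).map fun k => towerCl n k ^ k).map (towerProj n) := by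
      rw [List.map_map]
      refine List.map_congr_left fun k hk => ?_
      rw [towerCl_of_ne (List.mem_range.mp hk).ne, Function.comp_apply, map_pow]
    rw [e, ← map_list_prod] at h
    exact ih (eq_zero_of_towerProj_mul n h)

end Coch

end AlexanderSpanier

open Matrix

namespace Matrix

variable {ι : Type*} [Fintype ι] [DecidableEq ι]

/-- The orthogonal reflection in the hyperplane perpendicular to `v`. -/
def householder (v : ι → ℝ) : Matrix ι ι ℝ := 1 - (2 / (v ⬝ᵥ v)) • vecMulVec v v

theorem householder_neg (v : ι → ℝ) : householder (-v) = householder v := by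
  simp [householder, neg_vecMulVec, vecMulVec_neg]

theorem transpose_householder (v : ι → ℝ) : (householder v)ᵀ = householder v := by
  simp [householder, transpose_vecMulVec]

theorem householder_mulVec (v w : ι → ℝ) :
    householder v *ᵥ w = w - (2 / (v ⬝ᵥ v) * (v ⬝ᵥ w)) • v := by
  rw [householder, sub_mulVec, one_mulVec, smul_mulVec, vecMulVec_mulVec, op_smul_eq_smul,
    smul_smul]

theorem householder_mul_self {v : ι → ℝ} (hv : v ≠ 0) : householder v * householder v = 1 := by
  have h : v ⬝ᵥ v ≠ 0 := fun h => hv (dotProduct_self_eq_zero.mp h)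
  refine ext_of_mulVec_single fun i => ?_
  rw [← mulVec_mulVec, householder_mulVec, householder_mulVec, one_mulVec]
  simp only [dotProduct_sub, dotProduct_smul, smul_eq_mul]
  rw [sub_sub, ← add_smul, sub_eq_self, smul_eq_zero]
  left
  field_simp
  ring

theorem det_householder {v : ι → ℝ} (hv : v ≠ 0) : (householder v).det = -1 := by
  have h : v ⬝ᵥ v ≠ 0 := fun h => hv (dotProduct_self_eq_zero.mp h)
  have e : householder v =
      1 + replicateCol Unit (-(2 / (v ⬝ᵥ v)) • v) * replicateRow Unit v := by
    rw [householder, sub_eq_add_neg, ← neg_smul, ← vecMulVec_eq, smul_vecMulVec]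
  rw [e, det_one_add_replicateCol_mul_replicateRow, dotProduct_smul, smul_eq_mul]
  field_simp
  ring

theorem householder_mem_orthogonalGroup {v : ι → ℝ} (hv : v ≠ 0) :
    householder v ∈ orthogonalGroup ι ℝ := by
  rw [mem_orthogonalGroup_iff, transpose_householder, householder_mul_self hv]

end Matrix

namespace AlexanderSpanier

namespace Coch

set_option linter.unusedSectionVars false

/-- The `k`-th factor of the test space as a vector in ten-dimensional space. -/
def tVec (k : ℕ) (x : Tower 9) : Fin 10 → ℝ := fun i => towerVec 9 k x i

theorem tVec_ne_zero (k : ℕ) (x : Tower 9) : tVec k x ≠ 0 := by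
  obtain ⟨i, hi, h⟩ := towerVec_ne_zero 9 k x
  exact fun h0 => h (congrFun h0 ⟨i, by omega⟩)

theorem continuous_tVec (k : ℕ) : Continuous (tVec k) :=
  continuous_pi fun i => continuous_towerVec 9 k i

/-- The product of the reflections in the first `k` factors of the test space. -/
def tMat : ℕ → Tower 9 → Matrix (Fin 10) (Fin 10) ℝ
  | 0, _ => 1
  | k + 1, x => householder (tVec k x) * tMat k x

theorem tMat_succ (k : ℕ) (x : Tower 9) : tMat (k + 1) x = householder (tVec k x) * tMat k x := rfl

theorem continuous_tMat (k : ℕ) : Continuous (tMat k) := by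
  induction k with
  | zero => exact continuous_const
  | succ k ih =>
    have h := continuous_tVec k
    have h' : Continuous fun x => tVec k x ⬝ᵥ tVec k x := h.dotProduct h
    refine Continuous.mul (continuous_const.sub (Continuous.smul
      (continuous_const.div h' fun x h0 => ?_) (h.matrix_vecMulVec h))) ih
    exact tVec_ne_zero k x (dotProduct_self_eq_zero.mp h0)

theorem tMat_mem (k : ℕ) (x : Tower 9) : tMat k x ∈ orthogonalGroup (Fin 10) ℝ := by
  induction k with
  | zero => exact one_mem _
  | succ k ih => exact mul_mem (householder_mem_orthogonalGroup (tVec_ne_zero k x)) ih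

theorem det_tMat (k : ℕ) (x : Tower 9) : (tMat k x).det = (-1) ^ k := by
  induction k with
  | zero => exact det_one
  | succ k ih => rw [tMat_succ, det_mul, ih, det_householder (tVec_ne_zero k x), pow_succ']

theorem tMat_symm (k : ℕ) {g : Tower 9 → Tower 9} (hg : g ∈ towerSymm 9) (x : Tower 9) :
    tMat k (g x) = tMat k x := by
  induction k with
  | zero => rfl
  | succ k ih =>
    rw [tMat_succ, tMat_succ, ih]
    rcases towerVec_symm k hg with h | h
    · rw [show tVec k (g x) = tVec k x from funext fun i => congrFun (h x).1 i]
    · rw [show tVec k (g x) = -tVec k x from funext fun i => congrFun (h x).1 i, householder_neg]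

/-- The test map to the rotation group. -/
def testMap (x : Tower 9) : specialOrthogonalGroup (Fin 10) ℝ :=
  ⟨tMat 10 x, mem_specialOrthogonalGroup_iff.mpr ⟨tMat_mem 10 x, by rw [det_tMat]; norm_num⟩⟩

theorem continuous_testMap : Continuous testMap := (continuous_tMat 10).subtype_mk _

theorem compat_testMap :
    Compat (∅ : Set (specialOrthogonalGroup (Fin 10) ℝ → specialOrthogonalGroup (Fin 10) ℝ))
      (towerSymm 9) testMap :=
  fun _ hg => .inl (funext fun x => Subtype.ext (tMat_symm 10 hg x))

section OddMap

variable {Y : Type*} [TopologicalSpace Y] {Δ : Set (Y → Y)} {n : ℕ}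

/-- The coordinates of a family of matrices acting on the sphere. -/
def act (A : Y → Matrix (Fin (n + 1)) (Fin (n + 1)) ℝ) (i : Fin (n + 1)) (z : Y × Sph n) : ℝ :=
  (A z.1 *ᵥ z.2.1) i

theorem oddMap_act {A : Y → Matrix (Fin (n + 1)) (Fin (n + 1)) ℝ} (hc : Continuous A)
    (hg : ∀ g ∈ Δ, ∀ y, A (g y) = A y) (hA : ∀ y, A y ∈ orthogonalGroup (Fin (n + 1)) ℝ) :
    OddMap (fibSymm Δ n) (sgn ∘ Prod.snd) (act A) where
  continuous i := (continuous_apply i).comp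
    ((hc.comp continuous_fst).matrix_mulVec (continuous_subtype_val.comp continuous_snd))
  odd i := by
    rintro _ (rfl | ⟨g, h, rfl⟩)
    · refine .inr fun z => ⟨?_, sgn_antipode z.2⟩
      exact congrFun (mulVec_neg (z.2.1) (A z.1)) i
    · refine .inl fun z => ⟨?_, rfl⟩
      exact congrArg (fun B => (B *ᵥ z.2.1) i) (hg g h z.1)
  ne_zero z := by
    by_contra! h
    have h : A z.1 *ᵥ z.2.1 = 0 := funext h
    have e := congrArg ((A z.1)ᵀ *ᵥ ·) h
    simp only [mulVec_mulVec, mulVec_zero, (mem_orthogonalGroup_iff' _ _).mp (hA z.1),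
      one_mulVec] at e
    exact z.2.2 e

theorem pull_diffCl_act {Z : Type*} [TopologicalSpace Z] {Γ : Set (Z → Z)} {u : Y → Z}
    (hu : Continuous u) (hc : Compat Γ Δ u) {A B : Z → Matrix (Fin (n + 1)) (Fin (n + 1)) ℝ}
    (hA : OddMap (fibSymm Γ n) (sgn ∘ Prod.snd) (act A))
    (hB : OddMap (fibSymm Γ n) (sgn ∘ Prod.snd) (act B))
    {A' B' : Y → Matrix (Fin (n + 1)) (Fin (n + 1)) ℝ}
    (hA' : OddMap (fibSymm Δ n) (sgn ∘ Prod.snd) (act A'))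
    (hB' : OddMap (fibSymm Δ n) (sgn ∘ Prod.snd) (act B')) (ha : A ∘ u = A') (hb : B ∘ u = B') :
    pull (Prod.map u id) (hu.prodMap continuous_id) (compat_map hc n) (diffCl hA hB) =
      diffCl hA' hB' := by
  subst ha hb
  exact pull_diffCl _ _ hA hB hA' hB' rfl (fun _ => rfl) fun _ => rfl

end OddMap

theorem diffCl_self {Z : Type*} [TopologicalSpace Z] {Γ : Set (Z → Z)} {r : Z → ZMod 2} {m : ℕ}
    {f : Fin m → Z → ℝ} (hf : OddMap Γ r f) : diffCl hf hf = 0 := by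
  simpa using diffCl_add hf hf hf

theorem oddMap_tMat (k : ℕ) : OddMap (fibSymm (towerSymm 9) 9) (sgn ∘ Prod.snd) (act (tMat k)) :=
  oddMap_act (continuous_tMat k) (fun _ hg => tMat_symm k hg) (tMat_mem k)

/-- The class of the `k`-th reflection. -/
def tDiff (k : ℕ) : Coh (fibSymm (towerSymm 9) 9) := diffCl (oddMap_tMat k) (oddMap_tMat (k + 1))

theorem diffCl_tMat (k : ℕ) :
    diffCl (oddMap_tMat 0) (oddMap_tMat k) = ∑ j ∈ Finset.range k, tDiff j := by
  induction k with
  | zero => exact diffCl_self _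
  | succ k ih => rw [Finset.sum_range_succ, ← ih]; exact diffCl_add _ _ _

theorem Coh.eq_of_add_eq_zero {X : Type*} [TopologicalSpace X] {Γ : Set (X → X)} {x y : Coh Γ}
    (h : x + y = 0) : y = x := by
  rw [← add_zero x, ← Coh.add_self y, ← add_assoc, h, zero_add]

theorem tDiff_mul_taut (k : ℕ) : tDiff k * taut (towerSymm 9) 9 =
    tDiff k * proj (towerSymm 9) 9 (towerCl 9 k) := by
  have hφ : IsOdd (fibSymm (towerSymm 9) 9) (towerSgn 9 k ∘ Prod.fst + sgn ∘ Prod.snd)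
      fun z => tVec k z.1 ⬝ᵥ (tMat k z.1 *ᵥ z.2.1) := by
    rintro _ (rfl | ⟨g, hg, rfl⟩)
    · refine .inr fun z => ⟨?_, ?_⟩
      · simp [antipode, mulVec_neg]
      · simp [sgn_antipode, add_assoc]
    · refine (towerVec_symm k hg).imp (fun h z => ⟨?_, ?_⟩) fun h z => ⟨?_, ?_⟩
      · have e : tVec k (g z.1) = tVec k z.1 := funext fun i => congrFun (h z.1).1 i
        simp [e, tMat_symm k hg]
      · simp [(h z.1).2]
      · have e : tVec k (g z.1) = -tVec k z.1 := funext fun i => congrFun (h z.1).1 i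
        simp [e, tMat_symm k hg]
      · simp [(h z.1).2, add_right_comm]
  have h := diffCl_mul_chr (oddMap_tMat k) (oddMap_tMat (k + 1)) hφ ?_ fun z hz i => ?_
  · rw [chr_add ((isParity_towerSgn 9 k).comp (compat_fst _ 9)) (isParity_sgn _ 9), mul_add] at h
    rw [proj, towerCl, pull_chr]
    exact Coh.eq_of_add_eq_zero h
  · exact ((continuous_tVec k).comp continuous_fst).dotProduct
      (((continuous_tMat k).comp continuous_fst).matrix_mulVec
        (continuous_subtype_val.comp continuous_snd))
  · rw [act, act, tMat_succ, ← mulVec_mulVec, householder_mulVec, hz, mul_zero, zero_smul, sub_zero]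

theorem tDiff_mul_taut_pow (k j : ℕ) : tDiff k * taut (towerSymm 9) 9 ^ j =
    tDiff k * proj (towerSymm 9) 9 (towerCl 9 k) ^ j := by
  have hc : Commute (taut (towerSymm 9) 9) (proj (towerSymm 9) 9 (towerCl 9 k)) := by
    rw [proj, towerCl, pull_chr]
    exact chr_mul_comm _ _
  induction j with
  | zero => rw [pow_zero, pow_zero]
  | succ j ih => rw [pow_succ, ← mul_assoc, ih, mul_assoc, ← (hc.pow_right j).eq, ← mul_assoc,
      tDiff_mul_taut, mul_assoc, pow_succ']

theorem tVec_towerPt (k : ℕ) : tVec k (towerPt 9) = Pi.single 0 1 := by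
  ext i
  rw [tVec, towerVec_towerPt, Pi.single_apply]
  simp only [Fin.ext_iff, Fin.val_zero]

theorem fib_taut_pow {Y : Type*} [TopologicalSpace Y] (Δ : Set (Y → Y)) (n : ℕ) :
    fib Δ n (taut Δ n ^ n) = 1 := by
  rw [← fib_proj_mul_taut_pow (n := n) (1 : Coh Δ), map_one, one_mul]

theorem fib_tDiff (k : ℕ) : fib (towerSymm 9) 9 (tDiff k) = 1 := by
  refine eq_one_of_hasDeg_zero (fib_hasDeg (diffCl_hasDeg _ _)) (towerPt 9) ?_
  have h (k : ℕ) : OddMap (fibSymm (∅ : Set (Unit → Unit)) 9) (sgn ∘ Prod.snd)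
      (act fun _ => tMat k (towerPt 9)) :=
    oddMap_act continuous_const (fun _ hg => hg.elim) fun _ => tMat_mem k _
  rw [pull_fib, tDiff, pull_diffCl_act continuous_const (compat_const _) _ _ (h k) (h (k + 1)) rfl
    rfl, diffCl_of_reflect (isParity_sgn _ 9)]
  · exact fib_taut_pow _ 9
  · intro z
    simp [act, tMat_succ, ← mulVec_mulVec, householder_mulVec, tVec_towerPt]
    ring
  · intro i z
    simp [act, tMat_succ, ← mulVec_mulVec, householder_mulVec, tVec_towerPt]

theorem fib_tDiff_mul (k j : ℕ) :
    fib (towerSymm 9) 9 (tDiff k * taut (towerSymm 9) 9 ^ j) = towerCl 9 k ^ j := by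
  rw [tDiff_mul_taut_pow, ← map_pow, fib_mul_proj (a := towerCl 9 k ^ j) _
    ((chr_hasNorm (isParity_towerSgn 9 k)).pow j), fib_tDiff, one_mul]

theorem oddMap_val : OddMap (fibSymm (∅ : Set (specialOrthogonalGroup (Fin 10) ℝ → _)) 9)
    (sgn ∘ Prod.snd) (act Subtype.val) :=
  oddMap_act continuous_subtype_val (fun _ hg => hg.elim) fun A =>
    (mem_specialOrthogonalGroup_iff.mp A.2).1

theorem oddMap_one : OddMap (fibSymm (∅ : Set (specialOrthogonalGroup (Fin 10) ℝ → _)) 9)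
    (sgn ∘ Prod.snd) (act fun _ => 1) :=
  oddMap_act continuous_const (fun _ hg => hg.elim) fun _ => one_mem _

/-- The generators of the cohomology of the rotation group. -/
def gen (j : ℕ) : Coh (∅ : Set (specialOrthogonalGroup (Fin 10) ℝ → _)) :=
  fib ∅ 9 (diffCl oddMap_one oddMap_val * taut ∅ 9 ^ j)

theorem gen_hasDeg (j : ℕ) : HasDeg j (gen j) := by
  refine fib_hasDeg ?_
  have h := (diffCl_hasDeg oddMap_one oddMap_val).mul ((chr_hasDeg (isParity_sgn _ 9)).pow j)
  rwa [show 9 + 1 * j = j + 9 by ring] at h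

theorem pull_gen (j : ℕ) : pull testMap continuous_testMap compat_testMap (gen j) =
    ∑ k ∈ Finset.range 10, towerCl 9 k ^ j := by
  rw [gen, pull_fib continuous_testMap compat_testMap, map_mul, map_pow,
    pull_map_taut continuous_testMap compat_testMap,
    pull_diffCl_act (B := Subtype.val) continuous_testMap compat_testMap _ _ (oddMap_tMat 0)
      (oddMap_tMat 10) rfl rfl, diffCl_tMat, Finset.sum_mul, map_sum]
  exact Finset.sum_congr rfl fun k _ => fib_tDiff_mul k j

/-- The exponents of a maximal nonvanishing product. -/
def topDeg (i : Fin 21) : ℕ :=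
  if i.1 < 15 then 1 else if i.1 < 18 then 3 else if i.1 = 18 then 5 else if i.1 = 19 then 7 else 9

theorem odd_topDeg (i : Fin 21) : Odd (topDeg i) := by
  unfold topDeg
  split_ifs <;> decide

theorem gen_prod_ne_zero : (List.ofFn fun i : Fin 21 => gen (topDeg i)).prod ≠ 0 := by
  have e : (List.ofFn fun i : Fin 21 => gen (topDeg i)).prod =
      gen 1 ^ 15 * gen 3 ^ 3 * gen 5 * gen 7 * gen 9 := by
    simp only [List.ofFn_succ, List.ofFn_zero, List.prod_cons, List.prod_nil]
    simp only [topDeg, Fin.val_succ, Fin.val_zero]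
    norm_num [pow_succ, mul_assoc]
  rw [e]
  intro h
  have h := congrArg (pull testMap continuous_testMap compat_testMap) h
  rw [map_zero, map_mul, map_mul, map_mul, map_mul, map_pow, map_pow] at h
  simp only [pull_gen] at h
  rw [power_sum_product_of_commute Coh.add_self (towerCl_pow 9) fun _ _ => chr_mul_comm _ _] at h
  exact towerCl_prod_ne_zero 9 h

end Coch

end AlexanderSpanier

open AlexanderSpanier Coch in
theorem not_catLE_SO10 {n : ℕ} (hn : n ≤ 20) : ¬ catLE SO10 n := by
  rintro ⟨U, hU, hcov, hcon⟩
  let V : Fin 21 → Set SO10 := fun i => U ⟨min i.1 n, by omega⟩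
  refine gen_prod_ne_zero (prod_eq_zero_of_cover (U := V) (fun i => hU _) (fun x => ?_) _
    fun i => ?_)
  · obtain ⟨i, hi⟩ := hcov x
    refine ⟨⟨i.1, by omega⟩, ?_⟩
    have : (⟨min i.1 n, by omega⟩ : Fin (n + 1)) = i := Fin.ext (by simp; omega)
    simpa only [V, this] using hi
  · obtain ⟨x, H, h0, h1⟩ := hcon ⟨min i.1 n, by omega⟩
    obtain ⟨c, hc, e, hd⟩ := gen_hasDeg (topDeg i)
    rw [e]
    refine pull_eq_zero_of_nullhomotopic (odd_topDeg i) hd hc continuous_subtype_val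
      (fun t u => H (u, Set.projIcc 0 1 zero_le_one t)) ?_ ?_ x ?_
    · exact H.continuous.comp (continuous_snd.prodMk (continuous_projIcc.comp continuous_fst))
    · exact funext fun u => by simpa using h0 u
    · exact funext fun u => by simpa using h1 u

section Contracts

variable {X Y : Type*} [TopologicalSpace X] [TopologicalSpace Y]

/-- `W` can be deformed inside `X` to the point `x₀`. -/
def ContractsTo (W : Set X) (x₀ : X) : Prop :=
  ∃ h : X → ℝ → X, ContinuousOn (Function.uncurry h) (W ×ˢ Set.Icc 0 1) ∧
    ∀ x ∈ W, h x 0 = x ∧ h x 1 = x₀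

theorem ContractsTo.contractibleIn {W : Set X} {x₀ : X} (hW : ContractsTo W x₀) :
    ContractibleIn W := by
  obtain ⟨h, hc, hh⟩ := hW
  refine ⟨x₀, ⟨fun p => h p.1 p.2, ?_⟩, fun u => (hh u u.2).1, fun u => (hh u u.2).2⟩
  exact hc.comp_continuous (f := fun p : W × unitInterval => ((p.1 : X), (p.2 : ℝ)))
    (by fun_prop) fun p => ⟨p.1.2, p.2.2⟩

theorem ContractsTo.union {U V : Set X} {x₀ : X} (hU : ContractsTo U x₀) (hV : ContractsTo V x₀)
    (oU : IsOpen U) (oV : IsOpen V) (hd : Disjoint U V) : ContractsTo (U ∪ V) x₀ := by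
  classical
  obtain ⟨f, hf, hf'⟩ := hU
  obtain ⟨g, hg, hg'⟩ := hV
  have hVU : ∀ x ∈ V, x ∉ U := fun x hx hx' => Set.disjoint_left.1 hd hx' hx
  refine ⟨fun x t => if x ∈ U then f x t else g x t, ?_, ?_⟩
  · rw [Set.union_prod]
    rintro ⟨x, t⟩ (⟨hx, ht⟩ | ⟨hx, ht⟩)
    · have h1 : ContinuousWithinAt (Function.uncurry f) (U ×ˢ Set.Icc 0 1) (x, t) := hf _ ⟨hx, ht⟩
      have h2 : ContinuousWithinAt (Function.uncurry fun x t => if x ∈ U then f x t else g x t)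
          (U ×ˢ Set.Icc 0 1) (x, t) :=
        h1.congr (fun p hp => by simp only [Function.uncurry, if_pos hp.1])
          (by simp only [Function.uncurry, if_pos hx])
      refine h2.mono_of_mem_nhdsWithin ?_
      have : U ×ˢ (Set.univ : Set ℝ) ∈ nhds (x, t) := (oU.prod isOpen_univ).mem_nhds ⟨hx, trivial⟩
      filter_upwards [mem_nhdsWithin_of_mem_nhds this, self_mem_nhdsWithin] with p hp hp'
      exact ⟨hp.1, hp'.elim (fun h => h.2) fun h => h.2⟩
    · have h1 : ContinuousWithinAt (Function.uncurry g) (V ×ˢ Set.Icc 0 1) (x, t) := hg _ ⟨hx, ht⟩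
      have h2 : ContinuousWithinAt (Function.uncurry fun x t => if x ∈ U then f x t else g x t)
          (V ×ˢ Set.Icc 0 1) (x, t) :=
        h1.congr (fun p hp => by simp only [Function.uncurry, if_neg (hVU _ hp.1)])
          (by simp only [Function.uncurry, if_neg (hVU _ hx)])
      refine h2.mono_of_mem_nhdsWithin ?_
      have : V ×ˢ (Set.univ : Set ℝ) ∈ nhds (x, t) := (oV.prod isOpen_univ).mem_nhds ⟨hx, trivial⟩
      filter_upwards [mem_nhdsWithin_of_mem_nhds this, self_mem_nhdsWithin] with p hp hp'
      exact ⟨hp.1, hp'.elim (fun h => h.2) fun h => h.2⟩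
  · rintro x (hx | hx)
    · simpa only [if_pos hx] using hf' x hx
    · simpa only [if_neg (hVU x hx)] using hg' x hx

/-- The category is a homeomorphism invariant. -/
theorem catLE_of_homeomorph (e : X ≃ₜ Y) {n : ℕ} (h : catLE X n) : catLE Y n := by
  obtain ⟨U, hU, hc, hk⟩ := h
  refine ⟨fun i => e.symm ⁻¹' U i, fun i => (hU i).preimage e.symm.continuous,
    fun y => hc (e.symm y), fun i => ?_⟩
  obtain ⟨x₀, H, h0, h1⟩ := hk i
  refine ⟨e x₀, ⟨fun p => e (H (⟨e.symm p.1, p.1.2⟩, p.2)), ?_⟩, fun u => ?_, fun u => ?_⟩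
  · fun_prop
  · simp [h0]
  · simp [h1]

end Contracts

namespace Matrix

variable {ι 𝕜 : Type*} [Fintype ι] [DecidableEq ι] [RCLike 𝕜]

/-- The Cayley path from `B` (at `0`) to `A` (at `1`). -/
def cayleyPath (A B : Matrix ι ι 𝕜) (s : ℝ) : Matrix ι ι 𝕜 :=
  ((s : 𝕜) • A + ((2 - s : ℝ) : 𝕜) • B) * (((2 - s : ℝ) : 𝕜) • A + (s : 𝕜) • B)⁻¹ * A

theorem star_mulVec_dotProduct_mulVec {A : Matrix ι ι 𝕜} (hA : Aᴴ * A = 1) (x y : ι → 𝕜) :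
    star (A *ᵥ x) ⬝ᵥ (A *ᵥ y) = star x ⬝ᵥ y := by
  rw [star_mulVec, dotProduct_mulVec, vecMul_vecMul, hA, vecMul_one]

theorem det_cayley_ne_zero {A B : Matrix ι ι 𝕜} (hA : Aᴴ * A = 1) (hB : Bᴴ * B = 1)
    (h : (A + B).det ≠ 0) {s : ℝ} (hs : s ∈ Set.Icc (0 : ℝ) 1) :
    (((2 - s : ℝ) : 𝕜) • A + (s : 𝕜) • B).det ≠ 0 := by
  rcases eq_or_lt_of_le hs.2 with rfl | h1
  · convert h using 2; norm_num
  · intro h0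
    obtain ⟨v, hv, hv0⟩ := exists_mulVec_eq_zero_iff.2 h0
    rw [add_mulVec, smul_mulVec, smul_mulVec] at hv0
    have e : ((2 - s : ℝ) : 𝕜) • (A *ᵥ v) = -((s : 𝕜) • (B *ᵥ v)) := eq_neg_of_add_eq_zero_left hv0
    have h2 := congrArg (fun w => star w ⬝ᵥ w) e
    simp only [star_smul, star_neg, smul_dotProduct, dotProduct_smul, neg_dotProduct,
      dotProduct_neg, star_mulVec_dotProduct_mulVec hA, star_mulVec_dotProduct_mulVec hB,
      RCLike.star_def, RCLike.conj_ofReal, smul_eq_mul, mul_neg, neg_neg] at h2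
    have h3 : star v ⬝ᵥ v ≠ 0 := by
      open scoped ComplexOrder in exact fun h => hv (dotProduct_star_self_eq_zero.1 h)
    have h4 : ((2 - s : ℝ) : 𝕜) * ((2 - s : ℝ) : 𝕜) = (s : 𝕜) * s :=
      mul_right_cancel₀ h3 (by simpa only [mul_assoc] using h2)
    have h5 : (2 - s) * (2 - s) = s * s := by exact_mod_cast h4
    nlinarith [hs.1]

theorem cayleyPath_zero {A B : Matrix ι ι 𝕜} (hA : Aᴴ * A = 1) : cayleyPath A B 0 = B := by
  have hu : IsUnit A.det := isUnit_det_of_left_inverse hA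
  have h2 : ((2 : 𝕜) • A)⁻¹ = (2 : 𝕜)⁻¹ • A⁻¹ := by
    rw [show (2 : 𝕜) • A = (Units.mk0 (2 : 𝕜) two_ne_zero) • A from rfl, inv_smul' _ _ hu]; rfl
  have h3 : ((2 - 0 : ℝ) : 𝕜) = 2 := by rw [sub_zero]; exact RCLike.ofReal_ofNat 2
  rw [cayleyPath, h3, RCLike.ofReal_zero, zero_smul, zero_smul, zero_add, add_zero, h2]
  simp [smul_smul, mul_assoc, nonsing_inv_mul A hu]

theorem cayleyPath_one {A B : Matrix ι ι 𝕜} (h : (A + B).det ≠ 0) : cayleyPath A B 1 = A := by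
  have : (2 - 1 : ℝ) = 1 := by norm_num
  simp [cayleyPath, this, mul_nonsing_inv (A + B) h.isUnit]

theorem conjTranspose_cayleyPath_mul {A B : Matrix ι ι 𝕜} (hA : Aᴴ * A = 1) (hB : Bᴴ * B = 1)
    (h : (A + B).det ≠ 0) {s : ℝ} (hs : s ∈ Set.Icc (0 : ℝ) 1) :
    (cayleyPath A B s)ᴴ * cayleyPath A B s = 1 := by
  have hd := (det_cayley_ne_zero hA hB h hs).isUnit
  have hA' : A * Aᴴ = 1 := mul_eq_one_comm.1 hA
  set P := (s : 𝕜) • A + ((2 - s : ℝ) : 𝕜) • B with hP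
  set Q := ((2 - s : ℝ) : 𝕜) • A + (s : 𝕜) • B with hQ
  have hPQ : Pᴴ * P = Qᴴ * Q := by
    simp only [hP, hQ, conjTranspose_add, conjTranspose_smul, RCLike.star_def, RCLike.conj_ofReal,
      add_mul, mul_add, smul_mul_assoc, mul_smul_comm, hA, hB]
    module
  have hc : cayleyPath A B s = P * Q⁻¹ * A := rfl
  have hQi : Q * Q⁻¹ = 1 := mul_nonsing_inv _ hd
  have h1 : (Q⁻¹)ᴴ * Qᴴ = 1 := by rw [← conjTranspose_mul, hQi, conjTranspose_one]
  rw [hc]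
  simp only [conjTranspose_mul]
  calc _ = Aᴴ * ((Q⁻¹)ᴴ * (Pᴴ * P) * Q⁻¹) * A := by simp only [mul_assoc]
    _ = Aᴴ * (((Q⁻¹)ᴴ * Qᴴ) * (Q * Q⁻¹)) * A := by rw [hPQ]; simp only [mul_assoc]
    _ = 1 := by rw [h1, hQi]; simp [hA]

theorem continuousOn_cayleyPath {Z : Type*} [TopologicalSpace Z] {S : Set Z}
    {A B : Z → Matrix ι ι 𝕜} {s : Z → ℝ} (cA : ContinuousOn A S) (cB : ContinuousOn B S)
    (cs : ContinuousOn s S) (hA : ∀ z ∈ S, (A z)ᴴ * A z = 1) (hB : ∀ z ∈ S, (B z)ᴴ * B z = 1)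
    (h : ∀ z ∈ S, (A z + B z).det ≠ 0) (hs : ∀ z ∈ S, s z ∈ Set.Icc (0 : ℝ) 1) :
    ContinuousOn (fun z => cayleyPath (A z) (B z) (s z)) S := by
  have c1 : ContinuousOn (fun z => ((s z : ℝ) : 𝕜)) S := RCLike.continuous_ofReal.comp_continuousOn cs
  have c2 : ContinuousOn (fun z => ((2 - s z : ℝ) : 𝕜)) S :=
    RCLike.continuous_ofReal.comp_continuousOn (continuousOn_const.sub cs)
  have c3 : ContinuousOn (fun z => ((2 - s z : ℝ) : 𝕜) • A z + ((s z : ℝ) : 𝕜) • B z) S :=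
    (c2.smul cA).add (c1.smul cB)
  have c4 : ContinuousOn (fun z => (((2 - s z : ℝ) : 𝕜) • A z + ((s z : ℝ) : 𝕜) • B z)⁻¹) S := by
    intro z hz
    have hd := det_cayley_ne_zero (hA z hz) (hB z hz) (h z hz) (hs z hz)
    simp only [inv_def, Ring.inverse_eq_inv']
    refine ContinuousWithinAt.smul (M := 𝕜) (X := Matrix ι ι 𝕜) (ContinuousWithinAt.inv₀ ?_ hd) ?_
    · exact (Continuous.matrix_det continuous_id).continuousAt.comp_continuousWithinAt (c3 z hz)
    · exact (Continuous.matrix_adjugate continuous_id).continuousAt.comp_continuousWithinAt (c3 z hz)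
  unfold cayleyPath
  exact (((c1.smul cA).add (c2.smul cB)).mul c4).mul cA

end Matrix

namespace Matrix

variable {ι : Type*} [Fintype ι] [DecidableEq ι]

theorem householder_smul {c : ℝ} (hc : c ≠ 0) (v : ι → ℝ) :
    householder (c • v) = householder v := by
  simp only [householder, smul_dotProduct, dotProduct_smul, smul_vecMulVec, vecMulVec_smul,
    smul_smul, smul_eq_mul]
  congr 2
  by_cases h : v ⬝ᵥ v = 0
  · simp [h]
  · field_simp

theorem exists_prod_householder_fix {A : Matrix ι ι ℝ} (hA : Aᵀ * A = 1) (S : Finset ι) :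
    ∃ L : List (ι → ℝ), (∀ v ∈ L, v ≠ 0) ∧
      ∀ j ∈ S, ((L.map householder).prod * A) *ᵥ Pi.single j 1 = Pi.single j 1 := by
  classical
  induction S using Finset.induction_on with
  | empty => exact ⟨[], by simp, by simp⟩
  | insert i S hi ih =>
    obtain ⟨L, hL, hS⟩ := ih
    set B := (L.map householder).prod * A with hB
    have hBo : Bᵀ * B = 1 := by
      have : ∀ L : List (ι → ℝ), (∀ v ∈ L, v ≠ 0) →
          ((L.map householder).prod)ᵀ * (L.map householder).prod = 1 := by
        intro L
        induction L with
        | nil => simp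
        | cons a L ih =>
          intro h
          rw [List.map_cons, List.prod_cons, transpose_mul, transpose_householder, mul_assoc,
            ← mul_assoc (householder a), householder_mul_self (h a (by simp)), one_mul,
            ih fun v hv => h v (by simp [hv])]
      rw [hB, transpose_mul, mul_assoc, ← mul_assoc _ _ A, this L hL, one_mul, hA]
    have hdot : ∀ x y : ι → ℝ, (B *ᵥ x) ⬝ᵥ (B *ᵥ y) = x ⬝ᵥ y := by
      intro x y
      rw [dotProduct_mulVec, ← mulVec_transpose, mulVec_mulVec, hBo, one_mulVec]
    by_cases hv : B *ᵥ Pi.single i 1 - Pi.single i 1 = 0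
    · refine ⟨L, hL, fun j hj => ?_⟩
      rcases Finset.mem_insert.1 hj with rfl | hj
      · exact sub_eq_zero.1 hv
      · exact hS j hj
    · set v := B *ᵥ Pi.single i 1 - Pi.single i 1 with hvd
      refine ⟨v :: L, by simpa [hv] using hL, fun j hj => ?_⟩
      rw [List.map_cons, List.prod_cons, mul_assoc, ← hB, ← mulVec_mulVec]
      have hvv : v ⬝ᵥ v ≠ 0 := fun h => hv (dotProduct_self_eq_zero.1 h)
      rcases Finset.mem_insert.1 hj with rfl | hj
      · have h1 : v ⬝ᵥ (B *ᵥ Pi.single j 1) = v ⬝ᵥ v / 2 := by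
          have h2 := hdot (Pi.single j 1) (Pi.single j 1)
          simp only [hvd, sub_dotProduct, dotProduct_sub]
          rw [h2, dotProduct_comm (B *ᵥ Pi.single j 1) (Pi.single j 1)]
          ring
        rw [householder_mulVec, h1]
        rw [show 2 / (v ⬝ᵥ v) * (v ⬝ᵥ v / 2) = 1 by field_simp, one_smul, hvd]
        abel
      · have h1 : v ⬝ᵥ (B *ᵥ Pi.single j 1) = 0 := by
          have h2 := hdot (Pi.single i 1) (Pi.single j 1)
          rw [hvd, sub_dotProduct, h2, hS j hj, sub_self]
        rw [householder_mulVec, h1, mul_zero, zero_smul, sub_zero, hS j hj]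

/-- The special orthogonal group is generated by products of two reflections. -/
theorem special_orthogonal_induction {P : Matrix ι ι ℝ → Prop} (h1 : P 1)
    (h2 : ∀ u v A, u ⬝ᵥ u = 1 → v ⬝ᵥ v = 1 → P A → P (householder u * householder v * A))
    {A : Matrix ι ι ℝ} (hA : Aᵀ * A = 1) (hd : A.det = 1) : P A := by
  have h2' : ∀ u v A, u ≠ 0 → v ≠ 0 → P A → P (householder u * householder v * A) := by
    intro u v A hu hv hP
    have key : ∀ u : ι → ℝ, u ≠ 0 → ∃ w : ι → ℝ, w ⬝ᵥ w = 1 ∧ householder w = householder u := by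
      intro u hu
      have hp : 0 < u ⬝ᵥ u := lt_of_le_of_ne (Finset.sum_nonneg fun i _ => mul_self_nonneg _)
        fun h => hu (dotProduct_self_eq_zero.1 h.symm)
      refine ⟨(Real.sqrt (u ⬝ᵥ u))⁻¹ • u, ?_,
        householder_smul (inv_ne_zero (Real.sqrt_pos.2 hp).ne') u⟩
      rw [smul_dotProduct, dotProduct_smul, smul_smul, ← mul_inv, Real.mul_self_sqrt hp.le,
        smul_eq_mul, inv_mul_cancel₀ hp.ne']
    obtain ⟨u', hu', e1⟩ := key u hu
    obtain ⟨v', hv', e2⟩ := key v hv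
    rw [← e1, ← e2]
    exact h2 u' v' A hu' hv' hP
  have main : ∀ n, ∀ L : List (ι → ℝ), L.length = 2 * n → (∀ v ∈ L, v ≠ 0) →
      ∀ B : Matrix ι ι ℝ, (L.map householder).prod * B = 1 → P B := by
    intro n
    induction n with
    | zero =>
      intro L hl _ B hB
      rw [mul_zero, List.length_eq_zero_iff] at hl
      subst hl
      simp only [List.map_nil, List.prod_nil, one_mul] at hB
      exact hB ▸ h1
    | succ n ih =>
      intro L hl hL B hB
      rcases L.eq_nil_or_concat with rfl | ⟨L, u, rfl⟩
      · simp at hl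
      rcases L.eq_nil_or_concat with rfl | ⟨L, v, rfl⟩
      · simp at hl; omega
      have hu : u ≠ 0 := hL u (by simp)
      have hv : v ≠ 0 := hL v (by simp)
      have := ih L (by simp at hl; omega) (fun v hv => hL v (by simp [hv]))
        (householder v * householder u * B) (by simpa [mul_assoc] using hB)
      have h3 := h2' u v _ hu hv this
      rwa [show householder u * householder v * (householder v * householder u * B) =
        householder u * (householder v * householder v) * householder u * B by
          simp only [mul_assoc], householder_mul_self hv, mul_one, householder_mul_self hu,
        one_mul] at h3
  obtain ⟨L, hL, hS⟩ := exists_prod_householder_fix hA Finset.univ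
  have e : (L.map householder).prod * A = 1 := by
    ext i j
    have := congrFun (hS j (Finset.mem_univ j)) i
    rw [mulVec_single_one, col_apply] at this
    rw [this, one_apply, Pi.single_apply]
  have hdet : ((L.map householder).prod).det = (-1) ^ L.length := by
    clear hS e
    induction L with
    | nil => simp
    | cons a L ih =>
      rw [List.map_cons, List.prod_cons, det_mul, det_householder (hL a (by simp)),
        ih fun v hv => hL v (by simp [hv]), List.length_cons, pow_succ]
      ring
  have h3 := congrArg det e
  rw [det_mul, hdet, hd, mul_one, det_one] at h3
  have hev : Even L.length := by
    by_contra h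
    rw [Nat.not_even_iff_odd] at h
    rw [h.neg_one_pow] at h3
    norm_num at h3
  obtain ⟨n, hn⟩ := hev
  exact main n L (by omega) hL A e

theorem continuousAt_householder {v : ι → ℝ} (hv : v ≠ 0) :
    ContinuousAt (householder : (ι → ℝ) → Matrix ι ι ℝ) v := by
  have hvv : v ⬝ᵥ v ≠ 0 := fun h => hv (dotProduct_self_eq_zero.1 h)
  unfold householder
  refine continuousAt_const.sub (ContinuousAt.smul (f := fun v : ι → ℝ => 2 / (v ⬝ᵥ v))
    (ContinuousAt.div (f := fun _ => (2 : ℝ)) (g := fun v : ι → ℝ => v ⬝ᵥ v)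
      continuousAt_const ?_ hvv) ?_)
  · exact (Continuous.dotProduct continuous_id continuous_id).continuousAt
  · exact (Continuous.matrix_vecMulVec continuous_id continuous_id).continuousAt

theorem exists_path_to_one {A : Matrix ι ι ℝ} (hA : Aᵀ * A = 1) (hd : A.det = 1) :
    ∃ γ : ℝ → Matrix ι ι ℝ, ContinuousOn γ (Set.Icc 0 1) ∧ γ 0 = 1 ∧ γ 1 = A ∧
      ∀ t ∈ Set.Icc (0 : ℝ) 1, (γ t)ᵀ * γ t = 1 := by
  refine special_orthogonal_induction (P := fun A => ∃ γ : ℝ → Matrix ι ι ℝ,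
    ContinuousOn γ (Set.Icc 0 1) ∧ γ 0 = 1 ∧ γ 1 = A ∧
      ∀ t ∈ Set.Icc (0 : ℝ) 1, (γ t)ᵀ * γ t = 1)
    ⟨fun _ => 1, continuousOn_const, rfl, rfl, by simp⟩ ?_ hA hd
  rintro u v B hu hv ⟨γ, hγ, h0, h1, ho⟩
  have hw : ∃ w : ι → ℝ, w ⬝ᵥ w = 1 ∧ householder w = householder v ∧ 0 ≤ u ⬝ᵥ w := by
    rcases le_total 0 (u ⬝ᵥ v) with h | h
    · exact ⟨v, hv, rfl, h⟩
    · exact ⟨-v, by simp [hv], householder_neg v, by simpa using h⟩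
  obtain ⟨w, hww, hwv, huw⟩ := hw
  rw [← hwv]
  have hu0 : u ≠ 0 := by rintro rfl; simp at hu
  have hne : ∀ t ∈ Set.Icc (0 : ℝ) 1, (1 - t) • u + t • w ≠ 0 := by
    intro t ht h
    have h2 := congrArg (fun z => (u + w) ⬝ᵥ z) h
    simp only [add_dotProduct, dotProduct_add, dotProduct_smul, hu, hww, dotProduct_comm w u,
      smul_eq_mul, dotProduct_zero] at h2
    nlinarith
  refine ⟨fun t => householder u * householder ((1 - t) • u + t • w) * γ t, ?_, ?_, ?_, ?_⟩
  · refine ContinuousOn.mul (ContinuousOn.mul continuousOn_const ?_) hγ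
    intro t ht
    have := (continuousAt_householder (hne t ht)).comp_of_eq
      (f := fun t : ℝ => (1 - t) • u + t • w) (by fun_prop) rfl
    exact this.continuousWithinAt
  · simp [h0, householder_mul_self hu0]
  · simp [h1]
  · intro t ht
    simp only [transpose_mul, transpose_householder]
    calc _ = (γ t)ᵀ * (householder ((1 - t) • u + t • w) * (householder u * householder u) *
          householder ((1 - t) • u + t • w)) * γ t := by simp only [mul_assoc]
      _ = 1 := by
        rw [householder_mul_self hu0, mul_one, householder_mul_self (hne t ht), mul_one, ho t ht]

theorem contractsTo_of_orthogonal_homotopy {W : Set (specialOrthogonalGroup ι ℝ)}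
    {m : specialOrthogonalGroup ι ℝ → ℝ → Matrix ι ι ℝ} {D : Matrix ι ι ℝ}
    (hc : ContinuousOn (Function.uncurry m) (W ×ˢ Set.Icc 0 1))
    (ho : ∀ A ∈ W, ∀ t ∈ Set.Icc (0 : ℝ) 1, (m A t)ᵀ * m A t = 1)
    (hd : ∀ A ∈ W, ((A : Matrix ι ι ℝ) + m A 0).det ≠ 0) (h1 : ∀ A ∈ W, m A 1 = D) :
    ContractsTo W 1 := by
  classical
  rcases W.eq_empty_or_nonempty with rfl | ⟨A₀, hA₀⟩
  · exact ⟨fun A _ => A, by simp, by simp⟩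
  have hSO : ∀ A : specialOrthogonalGroup ι ℝ, (A : Matrix ι ι ℝ)ᵀ * (A : Matrix ι ι ℝ) = 1 :=
    fun A => (mem_orthogonalGroup_iff' _ _).1 (mem_specialOrthogonalGroup_iff.1 A.2).1
  have i0 : (0 : ℝ) ∈ Set.Icc (0 : ℝ) 1 := by simp
  have i1 : (1 : ℝ) ∈ Set.Icc (0 : ℝ) 1 := by simp
  have hdet : ∀ f : ℝ → Matrix ι ι ℝ, ContinuousOn f (Set.Icc 0 1) →
      (∀ t ∈ Set.Icc (0 : ℝ) 1, (f t)ᵀ * f t = 1) → (f 0).det = 1 →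
      ∀ t ∈ Set.Icc (0 : ℝ) 1, (f t).det = 1 := by
    intro f hf hfo h0 t ht
    have hsq : ∀ t ∈ Set.Icc (0 : ℝ) 1, (f t).det * (f t).det = 1 := by
      intro t ht
      have := congrArg det (hfo t ht)
      rwa [det_mul, det_transpose, det_one] at this
    have cd : ContinuousOn (fun t => (f t).det) (Set.Icc 0 1) :=
      (Continuous.matrix_det continuous_id).comp_continuousOn hf
    rcases mul_self_eq_one_iff.1 (hsq t ht) with h | h
    · exact h
    · have : (0 : ℝ) ∈ Set.Icc ((f t).det) ((f 0).det) := by rw [h, h0]; norm_num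
      obtain ⟨s, hs, hs0⟩ := isPreconnected_Icc.intermediate_value ht i0 cd this
      have := hsq s hs
      simp only at hs0
      rw [hs0] at this
      norm_num at this
  have hC : ∀ A ∈ W, ∀ t ∈ Set.Icc (0 : ℝ) 1,
      (cayleyPath (m A 0) (A : Matrix ι ι ℝ) t)ᵀ * cayleyPath (m A 0) (A : Matrix ι ι ℝ) t = 1 := by
    intro A hA t ht
    have := conjTranspose_cayleyPath_mul (𝕜 := ℝ) (A := m A 0) (B := (A : Matrix ι ι ℝ)) (s := t)
      (by rw [conjTranspose_eq_transpose_of_trivial]; exact ho A hA 0 i0)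
      (by rw [conjTranspose_eq_transpose_of_trivial]; exact hSO A)
      (by rw [add_comm]; exact hd A hA) ht
    rwa [conjTranspose_eq_transpose_of_trivial] at this
  have cm : ∀ {f : specialOrthogonalGroup ι ℝ × ℝ → ℝ}, Continuous f →
      Set.MapsTo f (W ×ˢ Set.Icc 0 1) (Set.Icc 0 1) →
      ContinuousOn (fun p : specialOrthogonalGroup ι ℝ × ℝ => m p.1 (f p)) (W ×ˢ Set.Icc 0 1) := by
    intro f hf hm
    exact hc.comp (f := fun p : specialOrthogonalGroup ι ℝ × ℝ => (p.1, f p))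
      (by fun_prop) fun p hp => ⟨hp.1, hm hp⟩
  have cm0 := cm (f := fun _ => 0) continuous_const fun p hp => i0
  have cC : ContinuousOn (fun p : specialOrthogonalGroup ι ℝ × ℝ =>
      cayleyPath (m p.1 0) (p.1 : Matrix ι ι ℝ) p.2) (W ×ˢ Set.Icc 0 1) := by
    refine continuousOn_cayleyPath (𝕜 := ℝ) cm0 (by fun_prop) (by fun_prop) ?_ ?_ ?_ ?_
    · intro p hp
      rw [conjTranspose_eq_transpose_of_trivial]; exact ho p.1 hp.1 0 i0
    · intro p hp
      rw [conjTranspose_eq_transpose_of_trivial]; exact hSO p.1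
    · intro p hp
      rw [add_comm]; exact hd p.1 hp.1
    · exact fun p hp => hp.2
  set M : specialOrthogonalGroup ι ℝ → ℝ → Matrix ι ι ℝ := fun A t =>
    m A t * (m A 0)ᵀ * cayleyPath (m A 0) (A : Matrix ι ι ℝ) t with hM
  have cM : ContinuousOn (Function.uncurry M) (W ×ˢ Set.Icc 0 1) := by
    refine ContinuousOn.mul (ContinuousOn.mul hc ?_) cC
    exact (Continuous.matrix_transpose continuous_id).comp_continuousOn cm0
  have hM0 : ∀ A ∈ W, M A 0 = A := by
    intro A hA
    simp only [hM]
    rw [mul_eq_one_comm.1 (ho A hA 0 i0), cayleyPath_zero, one_mul]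
    rw [conjTranspose_eq_transpose_of_trivial]; exact ho A hA 0 i0
  have hM1 : ∀ A ∈ W, M A 1 = D := by
    intro A hA
    simp only [hM]
    rw [cayleyPath_one (by rw [add_comm]; exact hd A hA), mul_assoc, ho A hA 0 i0, mul_one,
      h1 A hA]
  have hMo : ∀ A ∈ W, ∀ t ∈ Set.Icc (0 : ℝ) 1, (M A t)ᵀ * M A t = 1 := by
    intro A hA t ht
    simp only [hM, transpose_mul, transpose_transpose]
    calc _ = (cayleyPath (m A 0) (A : Matrix ι ι ℝ) t)ᵀ * (m A 0 * ((m A t)ᵀ * m A t) * (m A 0)ᵀ) *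
          cayleyPath (m A 0) (A : Matrix ι ι ℝ) t := by simp only [mul_assoc]
      _ = 1 := by rw [ho A hA t ht, mul_one, mul_eq_one_comm.1 (ho A hA 0 i0), mul_one, hC A hA t ht]
  have hslice : ∀ A ∈ W, ContinuousOn (M A) (Set.Icc 0 1) := by
    intro A hA
    exact cM.comp (f := fun t : ℝ => (A, t)) (by fun_prop) fun t ht => ⟨hA, ht⟩
  have hMd : ∀ A ∈ W, ∀ t ∈ Set.Icc (0 : ℝ) 1, (M A t).det = 1 := by
    intro A hA
    refine hdet _ (hslice A hA) (hMo A hA) ?_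
    rw [hM0 A hA]
    exact (mem_specialOrthogonalGroup_iff.1 A.2).2
  have hDo : Dᵀ * D = 1 := by have := hMo A₀ hA₀ 1 i1; rwa [hM1 A₀ hA₀] at this
  have hDd : D.det = 1 := by have := hMd A₀ hA₀ 1 i1; rwa [hM1 A₀ hA₀] at this
  obtain ⟨γ, cγ, hγ0, hγ1, hγo⟩ := exists_path_to_one (A := Dᵀ)
    (by rw [transpose_transpose]; exact mul_eq_one_comm.1 hDo) (by rw [det_transpose, hDd])
  have hγd : ∀ t ∈ Set.Icc (0 : ℝ) 1, (γ t).det = 1 := hdet γ cγ hγo (by rw [hγ0, det_one])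
  have hmem : ∀ A ∈ W, ∀ t ∈ Set.Icc (0 : ℝ) 1, γ t * M A t ∈ specialOrthogonalGroup ι ℝ := by
    intro A hA t ht
    rw [mem_specialOrthogonalGroup_iff, mem_orthogonalGroup_iff', det_mul, hγd t ht, hMd A hA t ht,
      transpose_mul, mul_assoc, ← mul_assoc _ (γ t), hγo t ht, one_mul, hMo A hA t ht]
    exact ⟨rfl, mul_one 1⟩
  refine ⟨fun A t => if h : γ t * M A t ∈ specialOrthogonalGroup ι ℝ then ⟨_, h⟩ else 1, ?_, ?_⟩
  · rw [Topology.IsInducing.subtypeVal.continuousOn_iff]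
    have : ContinuousOn (fun p : specialOrthogonalGroup ι ℝ × ℝ => γ p.2 * M p.1 p.2)
        (W ×ˢ Set.Icc 0 1) :=
      (cγ.comp continuous_snd.continuousOn fun p hp => hp.2).mul cM
    refine this.congr fun p hp => ?_
    simp only [Function.comp_apply, Function.uncurry, dif_pos (hmem p.1 hp.1 p.2 hp.2)]
  · intro A hA
    constructor
    · exact (dif_pos (hmem A hA 0 i0)).trans (Subtype.ext <| by simp only [hγ0, one_mul, hM0 A hA])
    · refine (dif_pos (hmem A hA 1 i1)).trans (Subtype.ext ?_)
      simp only [hγ1, hM1 A hA, hDo]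
      rfl

end Matrix

namespace Matrix

set_option linter.unusedDecidableInType false
set_option linter.unusedSectionVars false

variable {κ : Type*} [Fintype κ] [DecidableEq κ]

/-- The squared Euclidean norm of a complex vector. -/
def normSq (w : κ → ℂ) : ℝ := ∑ k, Complex.normSq (w k)

theorem star_dotProduct_self_eq (w : κ → ℂ) : star w ⬝ᵥ w = (normSq w : ℂ) := by
  simp [dotProduct, normSq, Complex.normSq_eq_conj_mul_self]

theorem normSq_pos {w : κ → ℂ} (hw : w ≠ 0) : 0 < normSq w := by
  obtain ⟨k, hk⟩ := Function.ne_iff.1 hw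
  exact Finset.sum_pos' (fun i _ => Complex.normSq_nonneg _)
    ⟨k, Finset.mem_univ k, Complex.normSq_pos.2 hk⟩

theorem normSq_mulVec {U : Matrix κ κ ℂ} (hU : Uᴴ * U = 1) (w : κ → ℂ) :
    normSq (U *ᵥ w) = normSq w := by
  have := star_mulVec_dotProduct_mulVec hU w w
  rw [star_dotProduct_self_eq, star_dotProduct_self_eq] at this
  exact_mod_cast this

theorem norm_eigenvalue {U : Matrix κ κ ℂ} (hU : Uᴴ * U = 1) {w : κ → ℂ} (hw : w ≠ 0) {μ : ℂ}
    (h : U *ᵥ w = μ • w) : star μ * μ = 1 := by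
  have := star_mulVec_dotProduct_mulVec hU w w
  rw [h, star_smul, smul_dotProduct, dotProduct_smul, smul_smul, smul_eq_mul] at this
  have hn : star w ⬝ᵥ w ≠ 0 := by
    rw [star_dotProduct_self_eq]; exact_mod_cast (normSq_pos hw).ne'
  exact mul_right_cancel₀ hn (this.trans (one_mul _).symm)

theorem star_dotProduct_eigenvector {U : Matrix κ κ ℂ} (hU : Uᴴ * U = 1) {v w : κ → ℂ}
    (hv : v ≠ 0) {μ ν : ℂ} (h1 : U *ᵥ v = μ • v) (h2 : U *ᵥ w = ν • w) (hne : μ ≠ ν) :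
    star v ⬝ᵥ w = 0 := by
  have h := star_mulVec_dotProduct_mulVec hU v w
  rw [h1, h2, star_smul, smul_dotProduct, dotProduct_smul, smul_smul, smul_eq_mul] at h
  by_contra h0
  have h3 : star μ * ν = 1 := mul_right_cancel₀ h0 (h.trans (one_mul _).symm)
  have h4 := norm_eigenvalue hU hv h1
  have : star μ ≠ 0 := fun h => by simp [h] at h4
  exact hne (mul_left_cancel₀ this (h4.trans h3.symm))

section Family

variable {I : Type*} [Fintype I] [DecidableEq I]

theorem normSq_sum_smul {x : I → κ → ℂ} (hx : ∀ i j, i ≠ j → star (x i) ⬝ᵥ x j = 0) (a : I → ℂ) :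
    normSq (∑ i, a i • x i) = ∑ i, Complex.normSq (a i) * normSq (x i) := by
  have : ((normSq (∑ i, a i • x i) : ℝ) : ℂ) =
      ((∑ i, Complex.normSq (a i) * normSq (x i) : ℝ) : ℂ) := by
    rw [← star_dotProduct_self_eq, star_sum, sum_dotProduct]
    push_cast
    refine Finset.sum_congr rfl fun i _ => ?_
    rw [dotProduct_sum, Finset.sum_eq_single i]
    · rw [star_smul, smul_dotProduct, dotProduct_smul, star_dotProduct_self_eq,
        Complex.normSq_eq_conj_mul_self, smul_smul, smul_eq_mul]
      rfl
    · intro j _ hj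
      rw [star_smul, smul_dotProduct, dotProduct_smul, hx i j hj.symm, smul_zero, smul_zero]
    · simp
  exact_mod_cast this

theorem eq_zero_of_sum_smul_eq_zero {x : I → κ → ℂ} (h0 : ∀ i, x i ≠ 0)
    (hx : ∀ i j, i ≠ j → star (x i) ⬝ᵥ x j = 0) {a : I → ℂ} (h : ∑ i, a i • x i = 0) : a = 0 := by
  have h1 := normSq_sum_smul hx a
  rw [h, show normSq (0 : κ → ℂ) = 0 by simp [normSq], eq_comm,
    Finset.sum_eq_zero_iff_of_nonneg fun i _ =>
      mul_nonneg (Complex.normSq_nonneg _) (normSq_pos (h0 i)).le] at h1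
  funext i
  have := (mul_eq_zero.1 (h1 i (Finset.mem_univ i))).resolve_right (normSq_pos (h0 i)).ne'
  exact Complex.normSq_eq_zero.1 this

theorem card_le_of_eigenvectors {U : Matrix κ κ ℂ} (hU : Uᴴ * U = 1) {x : I → κ → ℂ}
    (h0 : ∀ i, x i ≠ 0) {μ : I → ℂ} (hμ : Function.Injective μ)
    (hx : ∀ i, U *ᵥ x i = μ i • x i) : Fintype.card I ≤ Fintype.card κ := by
  let Φ : (I → ℂ) →ₗ[ℂ] (κ → ℂ) :=
    { toFun := fun a => ∑ i, a i • x i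
      map_add' := fun a b => by simp [add_smul, Finset.sum_add_distrib]
      map_smul' := fun c a => by simp [Finset.smul_sum, smul_smul] }
  have hΦ : Function.Injective Φ := by
    rw [← LinearMap.ker_eq_bot, LinearMap.ker_eq_bot']
    exact fun a ha => eq_zero_of_sum_smul_eq_zero h0
      (fun i j hij => star_dotProduct_eigenvector hU (h0 i) (hx i) (hx j) (hμ.ne hij)) ha
  simpa using LinearMap.finrank_le_finrank_of_injective hΦ

theorem card_add_card_le {J : Type*} [Fintype J] [DecidableEq J] {U τ : Matrix κ κ ℂ}
    (hU : Uᴴ * U = 1) (hτ : τᴴ * τ = 1) {c d : κ → ℂ} (hcd : τ = 1 + vecMulVec c d)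
    {x : I → κ → ℂ} (hx0 : ∀ i, x i ≠ 0) {μ : I → ℂ} (hμ : Function.Injective μ)
    (hx : ∀ i, U *ᵥ x i = μ i • x i)
    {y : J → κ → ℂ} (hy0 : ∀ j, y j ≠ 0) {ν : J → ℂ} (hν : Function.Injective ν)
    (hy : ∀ j, U *ᵥ y j = ν j • (τ *ᵥ y j)) {r : ℝ}
    (hμr : ∀ i, r < Complex.normSq (μ i + 1)) (hνr : ∀ j, Complex.normSq (ν j + 1) ≤ r) :
    Fintype.card I + Fintype.card J ≤ Fintype.card κ + 1 := by
  have hxo : ∀ i j, i ≠ j → star (x i) ⬝ᵥ x j = 0 := fun i j hij =>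
    star_dotProduct_eigenvector hU (hx0 i) (hx i) (hx j) (hμ.ne hij)
  have hτU : (τᴴ * U)ᴴ * (τᴴ * U) = 1 := by
    rw [conjTranspose_mul, conjTranspose_conjTranspose, mul_assoc, ← mul_assoc τ,
      mul_eq_one_comm.1 hτ, one_mul, hU]
  have hyo : ∀ i j, i ≠ j → star (y i) ⬝ᵥ y j = 0 := by
    have key : ∀ j, (τᴴ * U) *ᵥ y j = ν j • y j := fun j => by
      rw [← mulVec_mulVec, hy, mulVec_smul, mulVec_mulVec, hτ, one_mulVec]
    exact fun i j hij => star_dotProduct_eigenvector hτU (hy0 i) (key i) (key j) (hν.ne hij)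
  let Φ : ((I → ℂ) × (J → ℂ)) →ₗ[ℂ] ((κ → ℂ) × ℂ) :=
    { toFun := fun a => (∑ i, a.1 i • x i - ∑ j, a.2 j • y j, d ⬝ᵥ ∑ j, a.2 j • y j)
      map_add' := fun a b => by
        refine Prod.ext ?_ ?_
        · simp [add_smul, Finset.sum_add_distrib]; abel
        · simp [add_smul, Finset.sum_add_distrib, dotProduct_add]
      map_smul' := fun c a => by
        refine Prod.ext ?_ ?_
        · simp [Finset.smul_sum, smul_smul, smul_sub]
        · simp only [Prod.smul_snd, Pi.smul_apply, smul_eq_mul, RingHom.id_apply]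
          rw [← smul_eq_mul, ← dotProduct_smul, Finset.smul_sum]
          simp [smul_smul] }
  have hΦ : Function.Injective Φ := by
    rw [← LinearMap.ker_eq_bot, LinearMap.ker_eq_bot']
    rintro ⟨a, b⟩ hab
    have h1 : ∑ i, a i • x i = ∑ j, b j • y j := sub_eq_zero.1 (congrArg Prod.fst hab)
    have h2 : d ⬝ᵥ ∑ j, b j • y j = 0 := congrArg Prod.snd hab
    have hτy : τ *ᵥ (∑ j, b j • y j) = ∑ j, b j • y j := by
      rw [hcd, add_mulVec, one_mulVec, vecMulVec_mulVec, h2]; simp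
    have e1 : U *ᵥ (∑ i, a i • x i) + ∑ i, a i • x i = ∑ i, (a i * (μ i + 1)) • x i := by
      rw [mulVec_sum, ← Finset.sum_add_distrib]
      refine Finset.sum_congr rfl fun i _ => ?_
      rw [mulVec_smul, hx, smul_smul, mul_add, mul_one, add_smul]
    have e2 : U *ᵥ (∑ j, b j • y j) + ∑ j, b j • y j =
        τ *ᵥ ∑ j, (b j * (ν j + 1)) • y j := by
      have e0 : U *ᵥ (∑ j, b j • y j) + ∑ j, b j • y j =
          U *ᵥ (∑ j, b j • y j) + τ *ᵥ ∑ j, b j • y j := by rw [hτy]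
      rw [e0, mulVec_sum, mulVec_sum, mulVec_sum, ← Finset.sum_add_distrib]
      refine Finset.sum_congr rfl fun j _ => ?_
      rw [mulVec_smul, mulVec_smul, mulVec_smul, hy, smul_smul, mul_add, mul_one, add_smul]
    have e3 : normSq (∑ i, (a i * (μ i + 1)) • x i) = normSq (∑ j, (b j * (ν j + 1)) • y j) := by
      rw [← e1, h1, e2, normSq_mulVec hτ]
    rw [normSq_sum_smul hxo, normSq_sum_smul hyo] at e3
    have e4 : ∑ i, Complex.normSq (a i) * normSq (x i) = ∑ j, Complex.normSq (b j) * normSq (y j) := by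
      rw [← normSq_sum_smul hxo, ← normSq_sum_smul hyo, h1]
    have ha : a = 0 := by
      by_contra hne
      obtain ⟨i₀, hi₀⟩ := Function.ne_iff.1 hne
      have g1 : r * ∑ i, Complex.normSq (a i) * normSq (x i) <
          ∑ i, Complex.normSq (a i * (μ i + 1)) * normSq (x i) := by
        rw [Finset.mul_sum]
        refine Finset.sum_lt_sum (fun i _ => ?_) ⟨i₀, Finset.mem_univ _, ?_⟩
        · rw [Complex.normSq_mul, mul_comm (Complex.normSq (a i)) (Complex.normSq (μ i + 1)),
            mul_assoc]
          exact mul_le_mul_of_nonneg_right (hμr i).le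
            (mul_nonneg (Complex.normSq_nonneg _) (normSq_pos (hx0 i)).le)
        · rw [Complex.normSq_mul, mul_comm (Complex.normSq (a i₀)) (Complex.normSq (μ i₀ + 1)),
            mul_assoc]
          exact mul_lt_mul_of_pos_right (hμr i₀)
            (mul_pos (Complex.normSq_pos.2 hi₀) (normSq_pos (hx0 i₀)))
      have g2 : ∑ j, Complex.normSq (b j * (ν j + 1)) * normSq (y j) ≤
          r * ∑ j, Complex.normSq (b j) * normSq (y j) := by
        rw [Finset.mul_sum]
        refine Finset.sum_le_sum fun j _ => ?_
        rw [Complex.normSq_mul, mul_comm (Complex.normSq (b j)) (Complex.normSq (ν j + 1)), mul_assoc]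
        exact mul_le_mul_of_nonneg_right (hνr j)
          (mul_nonneg (Complex.normSq_nonneg _) (normSq_pos (hy0 j)).le)
      rw [e3, e4] at g1
      exact absurd g2 (not_le.2 g1)
    have hb : b = 0 := eq_zero_of_sum_smul_eq_zero hy0 hyo (by rw [← h1, ha]; simp)
    rw [ha, hb]; rfl
  simpa using LinearMap.finrank_le_finrank_of_injective hΦ

end Family

theorem norm_prod_sub_neg_one_pow_le (s : Multiset ℂ) {ε : ℝ} (hε : 0 ≤ ε)
    (hs : ∀ z ∈ s, ‖z + 1‖ ≤ ε) : ‖s.prod - (-1) ^ s.card‖ ≤ (1 + ε) ^ s.card - 1 := by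
  induction s using Multiset.induction_on with
  | empty => simp
  | cons z s ih =>
    have h1 := ih fun w hw => hs w (Multiset.mem_cons_of_mem hw)
    have h2 := hs z (Multiset.mem_cons_self z s)
    rw [Multiset.prod_cons, Multiset.card_cons, pow_succ, pow_succ]
    have e : z * s.prod - (-1) ^ s.card * -1 =
        z * (s.prod - (-1) ^ s.card) + (z + 1) * (-1) ^ s.card := by ring
    have h3 : ‖z‖ ≤ 1 + ε := by
      calc ‖z‖ = ‖(z + 1) - 1‖ := by ring_nf
        _ ≤ ‖z + 1‖ + ‖(1 : ℂ)‖ := norm_sub_le _ _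
        _ ≤ 1 + ε := by rw [norm_one]; linarith
    rw [e]
    refine (norm_add_le _ _).trans ?_
    rw [norm_mul, norm_mul, norm_pow, norm_neg, norm_one, one_pow, mul_one]
    have : ‖z‖ * ‖s.prod - (-1) ^ s.card‖ ≤ (1 + ε) * ((1 + ε) ^ s.card - 1) :=
      mul_le_mul h3 h1 (norm_nonneg _) (by linarith)
    linarith

/-- A special unitary matrix of size five cannot have too many coincidences with nearby scalars,
even after a perturbation by a rank-one unitary `τ`. -/
theorem false_of_six_coincidences (hκ : Fintype.card κ = 5) {U τ : Matrix κ κ ℂ} (hU : Uᴴ * U = 1)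
    (hτ : τᴴ * τ = 1) {I : Type*} [DecidableEq I] {P Q : Finset I} (hPQ : 6 ≤ P.card + Q.card)
    {ζ : I → ℂ} (hζ : Function.Injective ζ) {x : I → κ → ℂ} (hx0 : ∀ i, x i ≠ 0)
    (hP : ∀ i ∈ P, U *ᵥ x i = -ζ i • x i) (hQ : ∀ i ∈ Q, U *ᵥ x i = -ζ i • (τ *ᵥ x i))
    (hlt : ∀ i ∈ P, ∀ j ∈ Q, Complex.normSq (1 - ζ j) < Complex.normSq (1 - ζ i))
    (hsmall : ∀ i, Complex.normSq (1 - ζ i) ≤ 1 / 100)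
    (hdet : P.Nonempty → U.det = 1 ∧ ∃ c d, τ = 1 + vecMulVec c d) : False := by
  have hinj : ∀ S : Finset I, Function.Injective fun i : S => -ζ i := fun S i j h =>
    Subtype.ext (hζ (neg_injective h))
  have e : ∀ i, Complex.normSq (-ζ i + 1) = Complex.normSq (1 - ζ i) := fun i => by ring_nf
  rcases Q.eq_empty_or_nonempty with rfl | hQn
  · have := card_le_of_eigenvectors (I := P) hU (x := fun i => x i) (fun i => hx0 i) (hinj P)
      fun i => hP i i.2
    simp [hκ] at this hPQ
    omega
  rcases P.eq_empty_or_nonempty with rfl | hPn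
  · have hτU : (τᴴ * U)ᴴ * (τᴴ * U) = 1 := by
      rw [conjTranspose_mul, conjTranspose_conjTranspose, mul_assoc, ← mul_assoc τ,
        mul_eq_one_comm.1 hτ, one_mul, hU]
    have := card_le_of_eigenvectors (I := Q) hτU (x := fun i => x i) (fun i => hx0 i) (hinj Q)
      fun i => by rw [← mulVec_mulVec, hQ i i.2, mulVec_smul, mulVec_mulVec, hτ, one_mulVec]
    simp [hκ] at this hPQ
    omega
  obtain ⟨hd, c, d, hcd⟩ := hdet hPn
  obtain ⟨j₀, hj₀, hmax⟩ := Q.exists_max_image (fun j => Complex.normSq (1 - ζ j)) hQn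
  have hroot : ∀ μ ∈ U.charpoly.roots, ‖μ + 1‖ ≤ 1 / 10 := by
    intro μ hμ
    by_contra hlt'
    have hμ' : 1 / 100 < Complex.normSq (μ + 1) := by
      rw [Complex.normSq_eq_norm_sq]; nlinarith [not_le.1 hlt']
    have h0 : (scalar κ μ - U).det = 0 := by
      rw [← eval_charpoly]; exact (Polynomial.mem_roots'.1 hμ).2
    obtain ⟨v, hv, hv0⟩ := exists_mulVec_eq_zero_iff.2 h0
    have hUv : U *ᵥ v = μ • v := by
      rw [sub_mulVec, sub_eq_zero] at hv0
      rw [← hv0]; simp [scalar_apply, ← smul_one_eq_diagonal, smul_mulVec]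
    have := card_add_card_le (I := Option P) (J := Q) hU hτ hcd
      (x := fun o => o.elim v fun i => x i) (μ := fun o => o.elim μ fun i => -ζ i)
      (by rintro (_ | i); exacts [hv, hx0 i])
      (by
        rintro (_ | i) (_ | j) h
        · rfl
        · simp only [Option.elim] at h
          rw [h, e] at hμ'
          exact absurd (hsmall j) (not_le.2 hμ')
        · simp only [Option.elim] at h
          rw [← h, e] at hμ'
          exact absurd (hsmall i) (not_le.2 hμ')
        · exact congrArg some (hinj P h))
      (by rintro (_ | i); exacts [hUv, hP i i.2])
      (y := fun j => x j) (fun j => hx0 j) (hinj Q) (fun j => hQ j j.2)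
      (r := Complex.normSq (1 - ζ j₀))
      (by
        rintro (_ | i)
        · exact (hsmall j₀).trans_lt hμ'
        · simp only [Option.elim, e]
          exact hlt i i.2 j₀ hj₀)
      (fun j => by rw [e]; exact hmax j j.2)
    simp [hκ] at this
    omega
  have h1 := norm_prod_sub_neg_one_pow_le U.charpoly.roots (by norm_num) hroot
  have hcard : U.charpoly.roots.card = 5 := by
    rw [← hκ, ← charpoly_natDegree_eq_dim U]
    exact (IsAlgClosed.splits U.charpoly).natDegree_eq_card_roots.symm
  rw [← det_eq_prod_roots_charpoly, hd, hcard] at h1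
  norm_num at h1

end Matrix

namespace Matrix

section Octonion

variable {R : Type*} [CommRing R]

/-- Left multiplication by a quaternion. -/
def quatL (a : Fin 4 → R) : Matrix (Fin 4) (Fin 4) R :=
  !![a 0, -a 1, -a 2, -a 3; a 1, a 0, -a 3, a 2; a 2, a 3, a 0, -a 1; a 3, -a 2, a 1, a 0]

/-- Right multiplication by a quaternion. -/
def quatR (a : Fin 4 → R) : Matrix (Fin 4) (Fin 4) R :=
  !![a 0, -a 1, -a 2, -a 3; a 1, a 0, a 3, -a 2; a 2, -a 3, a 0, a 1; a 3, a 2, -a 1, a 0]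

/-- Quaternionic conjugation. -/
def quatK : Matrix (Fin 4) (Fin 4) R := !![1, 0, 0, 0; 0, -1, 0, 0; 0, 0, -1, 0; 0, 0, 0, -1]

theorem quatL_transpose_mul (a : Fin 4 → R) : (quatL a)ᵀ * quatL a = (a ⬝ᵥ a) • 1 := by
  ext i j
  fin_cases i <;> fin_cases j <;>
    simp [quatL, mul_apply, Fin.sum_univ_four, dotProduct] <;> ring

theorem quatL_mul_transpose (a : Fin 4 → R) : quatL a * (quatL a)ᵀ = (a ⬝ᵥ a) • 1 := by
  ext i j
  fin_cases i <;> fin_cases j <;>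
    simp [quatL, mul_apply, Fin.sum_univ_four, dotProduct] <;> ring

theorem quatR_transpose_mul (a : Fin 4 → R) : (quatR a)ᵀ * quatR a = (a ⬝ᵥ a) • 1 := by
  ext i j
  fin_cases i <;> fin_cases j <;>
    simp [quatR, mul_apply, Fin.sum_univ_four, dotProduct] <;> ring

theorem quatR_mul_transpose (a : Fin 4 → R) : quatR a * (quatR a)ᵀ = (a ⬝ᵥ a) • 1 := by
  ext i j
  fin_cases i <;> fin_cases j <;>
    simp [quatR, mul_apply, Fin.sum_univ_four, dotProduct] <;> ring

theorem quatL_mul_quatR (a b : Fin 4 → R) : quatL a * quatR b = quatR b * quatL a := by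
  ext i j
  fin_cases i <;> fin_cases j <;>
    simp [quatL, quatR, mul_apply, Fin.sum_univ_four] <;> ring

theorem quatL_transpose_mul_quatR (a b : Fin 4 → R) :
    (quatL a)ᵀ * quatR b = quatR b * (quatL a)ᵀ := by
  ext i j
  fin_cases i <;> fin_cases j <;>
    simp [quatL, quatR, mul_apply, Fin.sum_univ_four] <;> ring

theorem quatK_mul_quatL (a : Fin 4 → R) : quatK * quatL a = (quatR a)ᵀ * quatK := by
  ext i j
  fin_cases i <;> fin_cases j <;> simp [quatL, quatR, quatK, mul_apply, Fin.sum_univ_four]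

theorem quatK_mul_quatR (a : Fin 4 → R) : quatK * quatR a = (quatL a)ᵀ * quatK := by
  ext i j
  fin_cases i <;> fin_cases j <;> simp [quatL, quatR, quatK, mul_apply, Fin.sum_univ_four]

theorem quatK_mul_self : (quatK : Matrix (Fin 4) (Fin 4) R) * quatK = 1 := by
  ext i j
  fin_cases i <;> fin_cases j <;> simp [quatK, mul_apply, Fin.sum_univ_four]

theorem quatK_transpose : (quatK : Matrix (Fin 4) (Fin 4) R)ᵀ = quatK := by
  ext i j
  fin_cases i <;> fin_cases j <;> simp [quatK]

end Octonion
end Matrix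

namespace Matrix

section Octonion

set_option linter.unusedSimpArgs false

variable {R : Type*} [CommRing R]

/-- The matrix of `v ↦ G(v) s`, where `G` is octonionic Clifford multiplication. -/
def octB (s : Fin 4 ⊕ Fin 4 → R) : Matrix (Fin 4 ⊕ Fin 4) (Fin 4 ⊕ Fin 4) R :=
  fromBlocks (quatL (s ∘ Sum.inl))ᵀ (quatR (s ∘ Sum.inr))ᵀ
    (-quatR (s ∘ Sum.inr)) (quatL (s ∘ Sum.inl))

/-- Octonionic Clifford multiplication by `v`. -/
def octG (v : Fin 4 ⊕ Fin 4 → R) : Matrix (Fin 4 ⊕ Fin 4) (Fin 4 ⊕ Fin 4) R :=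
  fromBlocks (quatR (v ∘ Sum.inl) * quatK) (quatL (v ∘ Sum.inr) * quatK)
    (quatR (v ∘ Sum.inr)) (-quatL (v ∘ Sum.inl))

/-- The matrix of `v ↦ G(v)ᵀ s`. -/
def octD (s : Fin 4 ⊕ Fin 4 → R) : Matrix (Fin 4 ⊕ Fin 4) (Fin 4 ⊕ Fin 4) R :=
  fromBlocks (quatR (s ∘ Sum.inl))ᵀ (quatL (s ∘ Sum.inr) * quatK)
    (-(quatR (s ∘ Sum.inr) * quatK)) (quatL (s ∘ Sum.inl))ᵀ

theorem sum_smul_one_eq (s : Fin 4 ⊕ Fin 4 → R) :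
    (s ⬝ᵥ s) = (s ∘ Sum.inl ⬝ᵥ s ∘ Sum.inl) + (s ∘ Sum.inr ⬝ᵥ s ∘ Sum.inr) := by
  simp [dotProduct, Fintype.sum_sum_type]

theorem octB_mul_transpose (s : Fin 4 ⊕ Fin 4 → R) : octB s * (octB s)ᵀ = (s ⬝ᵥ s) • 1 := by
  rw [octB, fromBlocks_transpose, fromBlocks_multiply, ← fromBlocks_one, fromBlocks_smul,
    sum_smul_one_eq]
  simp only [transpose_transpose, transpose_neg, neg_mul, mul_neg, neg_neg, quatL_mul_transpose,
    quatR_mul_transpose, quatR_transpose_mul, quatL_transpose_mul, smul_zero]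
  congr 1
  · rw [add_smul]
  · rw [← transpose_mul, ← transpose_mul, quatL_mul_quatR, neg_add_cancel]
  · rw [quatL_mul_quatR, neg_add_cancel]
  · rw [add_smul, add_comm]

theorem octG_mulVec (v s : Fin 4 ⊕ Fin 4 → R) : octG v *ᵥ s = octB s *ᵥ v := by
  ext (i | i) <;> fin_cases i <;>
    simp [octG, octB, quatL, quatR, quatK, mulVec, dotProduct, Fintype.sum_sum_type,
      Fin.sum_univ_four] <;> ring

theorem octG_transpose_mulVec (v s : Fin 4 ⊕ Fin 4 → R) : (octG v)ᵀ *ᵥ s = octD s *ᵥ v := by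
  ext (i | i) <;> fin_cases i <;>
    simp [octG, octD, quatL, quatR, quatK, mulVec, dotProduct, Fintype.sum_sum_type,
      Fin.sum_univ_four] <;> ring

theorem quatK_mul_cancel (A : Matrix (Fin 4) (Fin 4) R) : quatK * (quatK * A) = A := by
  rw [← mul_assoc, quatK_mul_self, one_mul]

theorem quatK_mul_quatL_transpose (a : Fin 4 → R) : quatK * (quatL a)ᵀ = quatR a * quatK := by
  have h := congrArg (fun A => quatK * (A * quatK)) (quatK_mul_quatR a)
  simp only [mul_assoc, quatK_mul_self, mul_one, quatK_mul_cancel] at h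
  exact h.symm

theorem quatK_mul_quatR_transpose (a : Fin 4 → R) : quatK * (quatR a)ᵀ = quatL a * quatK := by
  have h := congrArg (fun A => quatK * (A * quatK)) (quatK_mul_quatL a)
  simp only [mul_assoc, quatK_mul_self, mul_one, quatK_mul_cancel] at h
  exact h.symm

theorem quatL_mul_quatR_transpose (a b : Fin 4 → R) :
    quatL a * (quatR b)ᵀ = (quatR b)ᵀ * quatL a := by
  have h := congrArg transpose (quatL_transpose_mul_quatR a b)
  rw [transpose_mul, transpose_mul, transpose_transpose] at h
  exact h.symm

theorem quatK_mul_quatL_mul_quatK (a : Fin 4 → R) : quatK * (quatL a * quatK) = (quatR a)ᵀ := by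
  rw [← mul_assoc, quatK_mul_quatL, mul_assoc, quatK_mul_self, mul_one]

theorem quatK_mul_quatR_mul_quatK (a : Fin 4 → R) : quatK * (quatR a * quatK) = (quatL a)ᵀ := by
  rw [← mul_assoc, quatK_mul_quatR, mul_assoc, quatK_mul_self, mul_one]

theorem octG_mul_transpose (v : Fin 4 ⊕ Fin 4 → R) : octG v * (octG v)ᵀ = (v ⬝ᵥ v) • 1 := by
  rw [octG, fromBlocks_transpose, fromBlocks_multiply, ← fromBlocks_one, fromBlocks_smul,
    sum_smul_one_eq]
  simp only [transpose_mul, transpose_neg, neg_mul, mul_neg, neg_neg, quatK_transpose, mul_assoc,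
    quatK_mul_cancel, quatL_mul_transpose, quatR_mul_transpose, quatK_mul_quatL_transpose,
    quatK_mul_quatR_transpose, quatK_mul_quatL_mul_quatK, quatK_mul_quatR_mul_quatK, smul_zero,
    add_smul]
  congr 1
  · rw [← mul_assoc, ← mul_assoc, quatL_mul_quatR, add_neg_cancel]
  · rw [← mul_assoc, ← mul_assoc, quatL_mul_quatR, add_neg_cancel]
  · rw [add_comm]

theorem octG_transpose_mul (v : Fin 4 ⊕ Fin 4 → R) : (octG v)ᵀ * octG v = (v ⬝ᵥ v) • 1 := by
  rw [octG, fromBlocks_transpose, fromBlocks_multiply, ← fromBlocks_one, fromBlocks_smul,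
    sum_smul_one_eq]
  have e1 : ∀ (a : Fin 4 → R) A, (quatR a)ᵀ * (quatR a * A) = (a ⬝ᵥ a) • A := fun a A => by
    rw [← mul_assoc, quatR_transpose_mul, smul_mul_assoc, one_mul]
  have e2 : ∀ (a : Fin 4 → R) A, (quatL a)ᵀ * (quatL a * A) = (a ⬝ᵥ a) • A := fun a A => by
    rw [← mul_assoc, quatL_transpose_mul, smul_mul_assoc, one_mul]
  have e3 : ∀ (a b : Fin 4 → R), quatK * ((quatR a)ᵀ * (quatL b * quatK)) =
      (quatR b)ᵀ * quatL a := fun a b => by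
    rw [← mul_assoc, quatK_mul_quatR_transpose, mul_assoc, ← mul_assoc quatK, quatK_mul_quatL,
      mul_assoc, quatK_mul_self, mul_one, quatL_mul_quatR_transpose]
  have e4 : ∀ (a b : Fin 4 → R), quatK * ((quatL b)ᵀ * (quatR a * quatK)) =
      (quatL a)ᵀ * quatR b := fun a b => by
    rw [← mul_assoc, quatK_mul_quatL_transpose, mul_assoc, ← mul_assoc quatK, quatK_mul_quatR,
      mul_assoc, quatK_mul_self, mul_one, quatL_transpose_mul_quatR]
  simp only [transpose_mul, transpose_neg, neg_mul, mul_neg, neg_neg, quatK_transpose, mul_assoc,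
    quatL_transpose_mul, quatR_transpose_mul, smul_zero, add_smul, e1, e2, e3, e4, mul_smul_comm,
    quatK_mul_self, add_neg_cancel]
  congr 1
  rw [add_comm]

theorem octD_mul_transpose (v : Fin 4 ⊕ Fin 4 → R) : octD v * (octD v)ᵀ = (v ⬝ᵥ v) • 1 := by
  rw [octD, fromBlocks_transpose, fromBlocks_multiply, ← fromBlocks_one, fromBlocks_smul,
    sum_smul_one_eq]
  simp only [transpose_mul, transpose_neg, transpose_transpose, neg_mul, mul_neg, neg_neg,
    quatK_transpose, mul_assoc, quatK_mul_cancel, quatL_mul_transpose, quatR_mul_transpose,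
    quatL_transpose_mul, quatR_transpose_mul, quatK_mul_quatL_transpose,
    quatK_mul_quatR_transpose, quatK_mul_quatL, quatK_mul_quatR, quatK_mul_quatL_mul_quatK,
    quatK_mul_quatR_mul_quatK, smul_zero, add_smul]
  congr 1
  · rw [← mul_assoc, ← mul_assoc, quatL_mul_quatR_transpose, neg_add_cancel]
  · rw [← mul_assoc, ← mul_assoc, quatL_transpose_mul_quatR, neg_add_cancel]
  · rw [add_comm]

theorem quatL_add (a b : Fin 4 → R) : quatL (a + b) = quatL a + quatL b := by
  ext i j
  fin_cases i <;> fin_cases j <;> simp [quatL, add_comm]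

theorem quatR_add (a b : Fin 4 → R) : quatR (a + b) = quatR a + quatR b := by
  ext i j
  fin_cases i <;> fin_cases j <;> simp [quatR, add_comm]

theorem quatL_smul (c : R) (a : Fin 4 → R) : quatL (c • a) = c • quatL a := by
  ext i j
  fin_cases i <;> fin_cases j <;> simp [quatL]

theorem quatR_smul (c : R) (a : Fin 4 → R) : quatR (c • a) = c • quatR a := by
  ext i j
  fin_cases i <;> fin_cases j <;> simp [quatR]

theorem octB_add (s t : Fin 4 ⊕ Fin 4 → R) : octB (s + t) = octB s + octB t := by
  simp only [octB, fromBlocks_add, Pi.add_comp, quatL_add, quatR_add, transpose_add, neg_add]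

theorem octB_smul (c : R) (s : Fin 4 ⊕ Fin 4 → R) : octB (c • s) = c • octB s := by
  simp only [octB, fromBlocks_smul, Pi.smul_comp, quatL_smul, quatR_smul, transpose_smul, smul_neg]

theorem ext_of_mulVec {m n : Type*} [Fintype n] [DecidableEq n] {A B : Matrix m n R}
    (h : ∀ v, A *ᵥ v = B *ᵥ v) : A = B :=
  Matrix.mulVec_injective (funext h)

theorem octG_add (s t : Fin 4 ⊕ Fin 4 → R) : octG (s + t) = octG s + octG t :=
  ext_of_mulVec fun v => by rw [add_mulVec]; simp only [octG_mulVec, mulVec_add]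

theorem octG_smul (c : R) (s : Fin 4 ⊕ Fin 4 → R) : octG (c • s) = c • octG s :=
  ext_of_mulVec fun v => by rw [smul_mulVec]; simp only [octG_mulVec, mulVec_smul]

theorem quatL_map {S : Type*} [CommRing S] (f : R →+* S) (a : Fin 4 → R) :
    quatL (f ∘ a) = (quatL a).map f := by
  ext i j
  fin_cases i <;> fin_cases j <;> simp [quatL]

theorem quatR_map {S : Type*} [CommRing S] (f : R →+* S) (a : Fin 4 → R) :
    quatR (f ∘ a) = (quatR a).map f := by
  ext i j
  fin_cases i <;> fin_cases j <;> simp [quatR]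

theorem quatK_map {S : Type*} [CommRing S] (f : R →+* S) : (quatK : Matrix _ _ R).map f = quatK := by
  ext i j
  fin_cases i <;> fin_cases j <;> simp [quatK]

theorem octB_map {S : Type*} [CommRing S] (f : R →+* S) (s : Fin 4 ⊕ Fin 4 → R) :
    octB (f ∘ s) = (octB s).map f := by
  simp only [octB, fromBlocks_map, Matrix.map_neg _ (map_neg f), Function.comp_assoc, quatL_map,
    quatR_map, transpose_map]

theorem octG_map {S : Type*} [CommRing S] (f : R →+* S) (s : Fin 4 ⊕ Fin 4 → R) :
    octG (f ∘ s) = (octG s).map f := by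
  simp only [octG, fromBlocks_map, Matrix.map_mul, quatK_map, Matrix.map_neg _ (map_neg f),
    Function.comp_assoc, quatL_map, quatR_map]

theorem octB_single : octB (Pi.single (Sum.inl 0) (1 : R)) = 1 := by
  ext (i | i) (j | j) <;> fin_cases i <;> fin_cases j <;> simp [octB, quatL, quatR]

theorem octB_add_transpose (s : Fin 4 ⊕ Fin 4 → R) :
    octB s + (octB s)ᵀ = (2 * s (Sum.inl 0)) • 1 := by
  ext (i | i) (j | j) <;> fin_cases i <;> fin_cases j <;>
    simp [octB, quatL, quatR] <;> ring

end Octonion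
end Matrix

/-- The index set of the octonions, seen as pairs of quaternions. -/
abbrev OctIdx : Type := Fin 4 ⊕ Fin 4

/-- The index set of the ten-dimensional space, an octonionic space plus a plane. -/
abbrev VecIdx : Type := OctIdx ⊕ Fin 2

namespace Matrix

open Complex

/-- Clifford multiplication `S⁺* → S⁺`. -/
def cliff (z : VecIdx → ℂ) : Matrix (OctIdx ⊕ OctIdx) (OctIdx ⊕ OctIdx) ℂ :=
  fromBlocks ((z (.inr 0) + I * z (.inr 1)) • 1) (octG (z ∘ Sum.inl)) (octG (z ∘ Sum.inl))ᵀ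
    ((-z (.inr 0) + I * z (.inr 1)) • 1)

/-- Clifford multiplication `S⁺ → S⁺*`. -/
def cliffStar (z : VecIdx → ℂ) : Matrix (OctIdx ⊕ OctIdx) (OctIdx ⊕ OctIdx) ℂ :=
  fromBlocks ((z (.inr 0) - I * z (.inr 1)) • 1) (octG (z ∘ Sum.inl)) (octG (z ∘ Sum.inl))ᵀ
    ((-z (.inr 0) - I * z (.inr 1)) • 1)

theorem vec_dotProduct {R : Type*} [CommRing R] (z w : VecIdx → R) : z ⬝ᵥ w =
    (z ∘ Sum.inl ⬝ᵥ w ∘ Sum.inl) + (z (.inr 0) * w (.inr 0) + z (.inr 1) * w (.inr 1)) := by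
  simp [dotProduct, Fintype.sum_sum_type]

theorem cliff_mul_cliffStar (z : VecIdx → ℂ) : cliff z * cliffStar z = (z ⬝ᵥ z) • 1 := by
  rw [cliff, cliffStar, fromBlocks_multiply,
    show (1 : Matrix (OctIdx ⊕ OctIdx) (OctIdx ⊕ OctIdx) ℂ) = fromBlocks 1 0 0 1 from
      fromBlocks_one.symm, fromBlocks_smul, vec_dotProduct]
  simp only [octG_mul_transpose, octG_transpose_mul, smul_mul_assoc, mul_smul_comm, one_mul,
    mul_one, smul_smul, ← add_smul, smul_zero]
  congr 2
  · ring_nf; rw [I_sq]; ring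
  · ring_nf; simp
  · ring_nf; simp
  · ring_nf; rw [I_sq]; ring

theorem cliffStar_mul_cliff (z : VecIdx → ℂ) : cliffStar z * cliff z = (z ⬝ᵥ z) • 1 := by
  rw [cliff, cliffStar, fromBlocks_multiply,
    show (1 : Matrix (OctIdx ⊕ OctIdx) (OctIdx ⊕ OctIdx) ℂ) = fromBlocks 1 0 0 1 from
      fromBlocks_one.symm, fromBlocks_smul, vec_dotProduct]
  simp only [octG_mul_transpose, octG_transpose_mul, smul_mul_assoc, mul_smul_comm, one_mul,
    mul_one, smul_smul, ← add_smul, smul_zero]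
  congr 2
  · ring_nf; rw [I_sq]; ring
  · ring_nf; simp
  · ring_nf; simp
  · ring_nf; rw [I_sq]; ring

theorem cliff_add (z w : VecIdx → ℂ) : cliff (z + w) = cliff z + cliff w := by
  simp only [cliff, fromBlocks_add, Pi.add_comp, octG_add, transpose_add, ← add_smul, Pi.add_apply]
  congr 2 <;> ring

theorem cliffStar_add (z w : VecIdx → ℂ) : cliffStar (z + w) = cliffStar z + cliffStar w := by
  simp only [cliffStar, fromBlocks_add, Pi.add_comp, octG_add, transpose_add, ← add_smul,
    Pi.add_apply]
  congr 2 <;> ring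

theorem cliff_smul (c : ℂ) (z : VecIdx → ℂ) : cliff (c • z) = c • cliff z := by
  simp only [cliff, fromBlocks_smul, Pi.smul_comp, octG_smul, transpose_smul, smul_smul,
    Pi.smul_apply, smul_eq_mul]
  congr 2 <;> ring

theorem cliffStar_smul (c : ℂ) (z : VecIdx → ℂ) : cliffStar (c • z) = c • cliffStar z := by
  simp only [cliffStar, fromBlocks_smul, Pi.smul_comp, octG_smul, transpose_smul, smul_smul,
    Pi.smul_apply, smul_eq_mul]
  congr 2 <;> ring

theorem cliff_transpose (z : VecIdx → ℂ) : (cliff z)ᵀ = cliff z := by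
  simp [cliff, fromBlocks_transpose]

theorem cliffStar_transpose (z : VecIdx → ℂ) : (cliffStar z)ᵀ = cliffStar z := by
  simp [cliffStar, fromBlocks_transpose]

theorem cliff_map_star (z : VecIdx → ℂ) : (cliff z).map star = cliffStar (star z) := by
  have h : octG (star z ∘ Sum.inl) = (octG (z ∘ Sum.inl)).map star :=
    octG_map (starRingEnd ℂ) (z ∘ Sum.inl)
  have h1 : ∀ c : ℂ, (c • (1 : Matrix OctIdx OctIdx ℂ)).map star = star c • 1 := fun c => by
    ext i j; by_cases hij : i = j <;> simp [one_apply, hij]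
  simp only [cliff, cliffStar, fromBlocks_map, h, transpose_map, h1]
  congr 2 <;> simp [sub_eq_add_neg]

theorem cliffStar_map_star (z : VecIdx → ℂ) : (cliffStar z).map star = cliff (star z) := by
  have := cliff_map_star (star z)
  rw [star_star] at this
  rw [← this]
  ext i j; simp

theorem conjTranspose_cliff (z : VecIdx → ℂ) : (cliff z)ᴴ = cliffStar (star z) := by
  rw [conjTranspose, cliff_transpose, cliff_map_star]

theorem conjTranspose_cliffStar (z : VecIdx → ℂ) : (cliffStar z)ᴴ = cliff (star z) := by
  rw [conjTranspose, cliffStar_transpose, cliffStar_map_star]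

theorem cliff_mul_cliffStar_add (z w : VecIdx → ℂ) :
    cliff z * cliffStar w + cliff w * cliffStar z = (2 * (z ⬝ᵥ w)) • 1 := by
  have h := cliff_mul_cliffStar (z + w)
  rw [cliff_add, cliffStar_add, mul_add, add_mul, add_mul, cliff_mul_cliffStar,
    cliff_mul_cliffStar, add_dotProduct, dotProduct_add, dotProduct_add, dotProduct_comm w z] at h
  have : (z ⬝ᵥ z + z ⬝ᵥ w + (z ⬝ᵥ w + w ⬝ᵥ w)) • (1 : Matrix (OctIdx ⊕ OctIdx) (OctIdx ⊕ OctIdx) ℂ)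
    = (z ⬝ᵥ z) • 1 + (2 * (z ⬝ᵥ w)) • 1 + (w ⬝ᵥ w) • 1 := by
    rw [← add_smul, ← add_smul]; ring_nf
  rw [this] at h
  rw [← sub_eq_zero] at h ⊢
  rw [← h]; abel

theorem cliffStar_mul_cliff_add (z w : VecIdx → ℂ) :
    cliffStar z * cliff w + cliffStar w * cliff z = (2 * (z ⬝ᵥ w)) • 1 := by
  have h := congrArg transpose (cliff_mul_cliffStar_add z w)
  simp only [transpose_add, transpose_mul, cliff_transpose, cliffStar_transpose, transpose_smul,
    transpose_one] at h
  rw [← h, add_comm]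

/-- `g` is a unitary on spinors covering the orthogonal matrix `B`. -/
structure IsLift (g : Matrix (OctIdx ⊕ OctIdx) (OctIdx ⊕ OctIdx) ℂ) (B : Matrix VecIdx VecIdx ℝ) :
    Prop where
  unitary : gᴴ * g = 1
  cliff_mulVec : ∀ z, g * cliff z * gᵀ = cliff (B.map ofReal *ᵥ z)

namespace IsLift

variable {g h : Matrix (OctIdx ⊕ OctIdx) (OctIdx ⊕ OctIdx) ℂ} {B C : Matrix VecIdx VecIdx ℝ}

theorem transpose_mul_map_star (hg : IsLift g B) : gᵀ * g.map star = 1 := by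
  have := congrArg transpose hg.unitary
  rw [transpose_mul, transpose_one] at this
  exact this

theorem cliffStar_mulVec (hg : IsLift g B) (z : VecIdx → ℂ) :
    g.map star * cliffStar z * gᴴ = cliffStar (B.map ofReal *ᵥ z) := by
  have := congrArg (fun A => A.map (starRingEnd ℂ)) (hg.cliff_mulVec (star z))
  simp only [Matrix.map_mul] at this
  have e : star (B.map ofReal *ᵥ star z) = B.map ofReal *ᵥ z := by
    ext i; simp [mulVec, dotProduct]
  have h1 := cliff_map_star (star z)
  have h2 := cliff_map_star (B.map ofReal *ᵥ star z)
  rw [star_star] at h1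
  rw [e] at h2
  rw [← h1, ← h2]
  exact this

theorem mul (hg : IsLift g B) (hh : IsLift h C) : IsLift (g * h) (B * C) where
  unitary := by
    rw [conjTranspose_mul, mul_assoc, ← mul_assoc gᴴ, hg.unitary, one_mul, hh.unitary]
  cliff_mulVec z := by
    have : (B * C).map ofReal = B.map ofReal * C.map ofReal := Matrix.map_mul (f := ofRealHom)
    rw [this, ← mulVec_mulVec, ← hg.cliff_mulVec, ← hh.cliff_mulVec, transpose_mul]
    simp only [mul_assoc]

theorem one : IsLift 1 1 where
  unitary := by simp
  cliff_mulVec z := by simp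

theorem inv (hg : IsLift g B) (hB : Bᵀ * B = 1) : IsLift gᴴ Bᵀ where
  unitary := by rw [conjTranspose_conjTranspose]; exact mul_eq_one_comm.1 hg.unitary
  cliff_mulVec z := by
    have h1 := hg.cliff_mulVec (Bᵀ.map ofReal *ᵥ z)
    have e : B.map ofReal * Bᵀ.map ofReal = 1 := by
      rw [show B.map ofReal * Bᵀ.map ofReal = (B * Bᵀ).map ofReal from
        (Matrix.map_mul (f := ofRealHom)).symm, mul_eq_one_comm.1 hB]
      exact Matrix.map_one _ ofReal_zero ofReal_one
    rw [mulVec_mulVec, e, one_mulVec] at h1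
    rw [← h1, mul_assoc, mul_assoc, mul_assoc, conjTranspose, transpose_map,
      transpose_transpose, hg.transpose_mul_map_star, mul_one, ← transpose_map, ← mul_assoc]
    change gᴴ * g * _ = _
    rw [hg.unitary, one_mul]

end IsLift

theorem cliffStar_mul_cliff_mul_cliffStar {v : VecIdx → ℂ} (hv : v ⬝ᵥ v = 1) (z : VecIdx → ℂ) :
    cliffStar v * cliff z * cliffStar v = -cliffStar (z - (2 * (v ⬝ᵥ z)) • v) := by
  have h := cliffStar_mul_cliff_add v z
  have h1 := cliff_mul_cliffStar v
  rw [hv, one_smul] at h1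
  rw [eq_sub_of_add_eq h, sub_mul, mul_assoc, h1, smul_mul_assoc, one_mul, mul_one,
    sub_eq_add_neg z, ← neg_smul, cliffStar_add, cliffStar_smul, neg_smul]
  abel

theorem cliff_mul_cliffStar_mul_cliff {v : VecIdx → ℂ} (hv : v ⬝ᵥ v = 1) (z : VecIdx → ℂ) :
    cliff v * cliffStar z * cliff v = -cliff (z - (2 * (v ⬝ᵥ z)) • v) := by
  have h := cliff_mul_cliffStar_add v z
  have h1 := cliffStar_mul_cliff v
  rw [hv, one_smul] at h1
  rw [eq_sub_of_add_eq h, sub_mul, mul_assoc, h1, smul_mul_assoc, one_mul, mul_one,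
    sub_eq_add_neg z, ← neg_smul, cliff_add, cliff_smul, neg_smul]
  abel

theorem ofReal_comp_dotProduct {ι : Type*} [Fintype ι] (u v : ι → ℝ) :
    (ofReal ∘ u) ⬝ᵥ (ofReal ∘ v) = ((u ⬝ᵥ v : ℝ) : ℂ) := by
  simp [dotProduct]

theorem householder_map_mulVec {v : VecIdx → ℝ} (hv : v ⬝ᵥ v = 1) (z : VecIdx → ℂ) :
    (householder v).map ofReal *ᵥ z = z - (2 * ((ofReal ∘ v) ⬝ᵥ z)) • (ofReal ∘ v) := by
  have h : ∀ i j, householder v i j = (1 : Matrix _ _ ℝ) i j - 2 * (v i * v j) := fun i j => by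
    have := congrFun (householder_mulVec v (Pi.single j 1)) i
    rw [hv] at this
    simpa [one_apply, Pi.single_apply, mul_comm, mul_left_comm, mul_assoc] using this
  ext i
  simp only [mulVec, dotProduct, map_apply, h, ofReal_sub, sub_mul, Finset.sum_sub_distrib]
  congr 1
  · simp [one_apply, apply_ite ofReal, -Fintype.sum_sum_type]
  · simp [-Fintype.sum_sum_type, Finset.mul_sum, Finset.sum_mul]
    exact Finset.sum_congr rfl fun _ _ => by ring

theorem isLift_householder {u v : VecIdx → ℝ} (hu : u ⬝ᵥ u = 1) (hv : v ⬝ᵥ v = 1) :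
    IsLift (cliff (ofReal ∘ u) * cliffStar (ofReal ∘ v)) (householder u * householder v) := by
  have hu' : (ofReal ∘ u) ⬝ᵥ (ofReal ∘ u) = 1 := by rw [ofReal_comp_dotProduct, hu, ofReal_one]
  have hv' : (ofReal ∘ v) ⬝ᵥ (ofReal ∘ v) = 1 := by rw [ofReal_comp_dotProduct, hv, ofReal_one]
  have hs : ∀ w : VecIdx → ℝ, star (ofReal ∘ w) = ofReal ∘ w := fun w => by ext i; simp
  constructor
  · rw [conjTranspose_mul, conjTranspose_cliff, conjTranspose_cliffStar, hs, hs, mul_assoc,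
      ← mul_assoc (cliffStar _) (cliff _), cliffStar_mul_cliff, hu', one_smul, one_mul,
      cliff_mul_cliffStar, hv', one_smul]
  · intro z
    have : (householder u * householder v).map ofReal =
      (householder u).map ofReal * (householder v).map ofReal := Matrix.map_mul (f := ofRealHom)
    rw [this, ← mulVec_mulVec, householder_map_mulVec hv, householder_map_mulVec hu,
      transpose_mul, cliff_transpose, cliffStar_transpose, ← mul_assoc,
      mul_assoc (cliff _), mul_assoc (cliff _), cliffStar_mul_cliff_mul_cliffStar hv', mul_neg,
      neg_mul, cliff_mul_cliffStar_mul_cliff hu', neg_neg]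

theorem exists_isLift {A : Matrix VecIdx VecIdx ℝ} (hA : Aᵀ * A = 1) (hd : A.det = 1) :
    ∃ g, IsLift g A := by
  refine special_orthogonal_induction (P := fun A => ∃ g, IsLift g A) ⟨1, .one⟩ ?_ hA hd
  rintro u v A hu hv ⟨g, hg⟩
  exact ⟨_, (isLift_householder hu hv).mul hg⟩

end Matrix

namespace Matrix

open Complex

/-- The product of the standard isotropic vectors acting on spinors is computed over the Gaussian
integers. -/
def gaussVec (j : Fin 4) : OctIdx → GaussianInt :=
  Sum.elim (fun i => if i = j then 1 else 0) (fun i => if i = j then ⟨0, 1⟩ else 0)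

/-- The standard pure spinor, over the Gaussian integers. -/
def gaussSpinor : OctIdx → GaussianInt :=
  Sum.elim (fun i => if i = 0 then 1 else 0) (fun i => if i = 0 then ⟨0, 1⟩ else 0)

set_option maxRecDepth 10000 in
theorem gauss_prod : ∀ i j, ((octG (gaussVec 0))ᵀ * octG (gaussVec 1) * ((octG (gaussVec 2))ᵀ *
    octG (gaussVec 3))) i j = -8 * (gaussSpinor i * gaussSpinor j) := by
  decide +kernel

/-- The standard isotropic vectors `e - i J e`. -/
def isoVec : Fin 4 ⊕ Fin 1 → VecIdx → ℂ :=
  Sum.elim (fun j => Sum.elim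
    (Sum.elim (fun i => if i = j then 1 else 0) (fun i => if i = j then I else 0)) 0)
    (fun _ => Sum.elim 0 ![1, I])

/-- The standard pure spinor. -/
def spinor₀ : OctIdx ⊕ OctIdx → ℂ :=
  Sum.elim 0 (Sum.elim (fun i => if i = 0 then 1 else 0) (fun i => if i = 0 then I else 0))

/-- The alternating product of five vectors acting on spinors. -/
def cliffProd (z : Fin 5 → VecIdx → ℂ) : Matrix (OctIdx ⊕ OctIdx) (OctIdx ⊕ OctIdx) ℂ :=
  cliff (z 0) * cliffStar (z 1) * cliff (z 2) * cliffStar (z 3) * cliff (z 4)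

/-- The standard isotropic vectors indexed by `Fin 5`. -/
def isoVec₅ (j : Fin 5) : VecIdx → ℂ := isoVec ((finSumFinEquiv (m := 4) (n := 1)).symm j)

/-- The square of the pure spinor associated with a rotation. -/
def spinT (A : Matrix VecIdx VecIdx ℝ) : Matrix (OctIdx ⊕ OctIdx) (OctIdx ⊕ OctIdx) ℂ :=
  (1 / 16 : ℂ) • cliffProd fun j => A.map ofReal *ᵥ isoVec₅ j

theorem IsLift.spinT_mul {g : Matrix (OctIdx ⊕ OctIdx) (OctIdx ⊕ OctIdx) ℂ}
    {B : Matrix VecIdx VecIdx ℝ} (hg : IsLift g B) (A : Matrix VecIdx VecIdx ℝ) :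
    spinT (B * A) = g * spinT A * gᵀ := by
  have h : (B * A).map ofReal = B.map ofReal * A.map ofReal := Matrix.map_mul (f := ofRealHom)
  have e1 : ∀ X, gᵀ * (g.map star * X) = X := fun X => by
    rw [← mul_assoc, hg.transpose_mul_map_star, one_mul]
  have e2 : ∀ X, gᴴ * (g * X) = X := fun X => by
    rw [← mul_assoc, hg.unitary, one_mul]
  simp only [spinT, cliffProd, h, ← mulVec_mulVec, ← hg.cliff_mulVec, ← hg.cliffStar_mulVec,
    mul_assoc, e1, e2, smul_mul_assoc, mul_smul_comm]

theorem isoVec₅_castSucc (j : Fin 4) :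
    isoVec₅ j.castSucc ∘ Sum.inl = GaussianInt.toComplex ∘ gaussVec j := by
  have : isoVec₅ j.castSucc = isoVec (.inl j) := by
    rw [isoVec₅]; congr 1; fin_cases j <;> rfl
  rw [this]
  have hI : GaussianInt.toComplex ⟨0, 1⟩ = I := by
    rw [GaussianInt.toComplex_def₂]; apply Complex.ext <;> simp
  ext (i | i)
  · by_cases h : i = j <;> simp [isoVec, gaussVec, h]
  · by_cases h : i = j <;> simp [isoVec, gaussVec, h, hI]

theorem isoVec₅_castSucc_inr (j : Fin 4) (i : Fin 2) : isoVec₅ j.castSucc (.inr i) = 0 := by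
  have : isoVec₅ j.castSucc = isoVec (.inl j) := by
    rw [isoVec₅]; congr 1; fin_cases j <;> rfl
  rw [this]; rfl

theorem cliff_isoVec₅_castSucc (j : Fin 4) : cliff (isoVec₅ j.castSucc) =
    fromBlocks 0 ((octG (gaussVec j)).map GaussianInt.toComplex)
      ((octG (gaussVec j)).map GaussianInt.toComplex)ᵀ 0 := by
  rw [cliff, isoVec₅_castSucc, isoVec₅_castSucc_inr, isoVec₅_castSucc_inr, octG_map]
  simp

theorem cliffStar_isoVec₅_castSucc (j : Fin 4) : cliffStar (isoVec₅ j.castSucc) =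
    fromBlocks 0 ((octG (gaussVec j)).map GaussianInt.toComplex)
      ((octG (gaussVec j)).map GaussianInt.toComplex)ᵀ 0 := by
  rw [cliffStar, isoVec₅_castSucc, isoVec₅_castSucc_inr, isoVec₅_castSucc_inr, octG_map]
  simp

theorem isoVec₅_last : isoVec₅ (Fin.last 4) = isoVec (.inr 0) := by
  rw [isoVec₅]; congr 1

theorem octG_zero {R : Type*} [CommRing R] : octG (0 : OctIdx → R) = 0 := by
  simpa using octG_smul (0 : R) (0 : OctIdx → R)

theorem cliff_isoVec₅_last : cliff (isoVec₅ (Fin.last 4)) = fromBlocks 0 0 0 ((-2 : ℂ) • 1) := by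
  have h : isoVec (.inr 0) ∘ Sum.inl = 0 := rfl
  have h0 : isoVec (.inr 0) (.inr 0) = 1 := rfl
  have h1 : isoVec (.inr 0) (.inr 1) = I := rfl
  rw [cliff, isoVec₅_last, h, h0, h1, octG_zero, I_mul_I, add_neg_cancel, zero_smul]
  norm_num

theorem spinT_one : spinT 1 = vecMulVec spinor₀ spinor₀ := by
  have hprod := congrArg (fun M => M.map GaussianInt.toComplex) (ext (N := of fun i j =>
    -8 * (gaussSpinor i * gaussSpinor j)) gauss_prod)
  simp only [Matrix.map_mul, transpose_map] at hprod
  have e0 : (1 : Matrix VecIdx VecIdx ℝ).map ofReal = 1 := Matrix.map_one _ ofReal_zero ofReal_one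
  have hc0 := cliff_isoVec₅_castSucc 0
  have hc1 := cliffStar_isoVec₅_castSucc 1
  have hc2 := cliff_isoVec₅_castSucc 2
  have hc3 := cliffStar_isoVec₅_castSucc 3
  have hc4 := cliff_isoVec₅_last
  simp only [spinT, e0, one_mulVec, cliffProd]
  rw [show (0 : Fin 5) = Fin.castSucc 0 from rfl, show (1 : Fin 5) = Fin.castSucc 1 from rfl,
    show (2 : Fin 5) = Fin.castSucc 2 from rfl, show (3 : Fin 5) = Fin.castSucc 3 from rfl,
    show (4 : Fin 5) = Fin.last 4 from rfl, hc0, hc1, hc2, hc3, hc4]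
  simp only [fromBlocks_multiply, zero_mul, mul_zero, zero_add, add_zero, mul_smul_comm, mul_one,
    fromBlocks_smul, smul_zero]
  rw [mul_assoc (_ * _), hprod]
  have hI : GaussianInt.toComplex ⟨0, 1⟩ = I := by
    rw [GaussianInt.toComplex_def₂]; apply Complex.ext <;> simp
  have hs : ∀ i, GaussianInt.toComplex (gaussSpinor i) = spinor₀ (.inr i) := by
    rintro (i | i) <;> by_cases h : i = 0 <;> simp [gaussSpinor, spinor₀, h, hI]
  ext (i | i) (j | j)
  · simp [vecMulVec_apply, spinor₀]
  · simp [vecMulVec_apply, spinor₀]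
  · simp [vecMulVec_apply, spinor₀]
  · simp [vecMulVec_apply, ← hs, map_apply]
    rw [show GaussianInt.toComplex 8 = 8 from map_ofNat GaussianInt.toComplex 8]
    ring

section Determinant

theorem isoVec_dotProduct (j k : Fin 4 ⊕ Fin 1) : isoVec j ⬝ᵥ isoVec k = 0 := by
  rcases j with j | j <;> rcases k with k | k <;>
    simp [isoVec, dotProduct, Fintype.sum_sum_type]
  split_ifs <;> simp

/-- The Clifford action of a combination of the standard isotropic vectors on all spinors. -/
def isoAction : (Fin 5 → ℂ) →ₗ[ℂ]
    Matrix ((OctIdx ⊕ OctIdx) ⊕ (OctIdx ⊕ OctIdx)) ((OctIdx ⊕ OctIdx) ⊕ (OctIdx ⊕ OctIdx)) ℂ where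
  toFun m := fromBlocks 0 (cliff (∑ j, m j • isoVec₅ j)) (cliffStar (∑ j, m j • isoVec₅ j)) 0
  map_add' m n := by
    simp only [Pi.add_apply, add_smul, Finset.sum_add_distrib, cliff_add, cliffStar_add,
      fromBlocks_add, add_zero]
  map_smul' c m := by
    simp only [Pi.smul_apply, smul_assoc, ← Finset.smul_sum, cliff_smul, cliffStar_smul,
      fromBlocks_smul, smul_zero, RingHom.id_apply]

theorem isoAction_mul_self (m : Fin 5 → ℂ) : isoAction m * isoAction m = 0 := by
  have h : (∑ j, m j • isoVec₅ j) ⬝ᵥ (∑ j, m j • isoVec₅ j) = 0 := by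
    rw [sum_dotProduct]
    refine Finset.sum_eq_zero fun j _ => ?_
    rw [dotProduct_sum]
    refine Finset.sum_eq_zero fun k _ => ?_
    rw [smul_dotProduct, dotProduct_smul, isoVec₅, isoVec₅, isoVec_dotProduct, smul_zero, smul_zero]
  simp only [isoAction, LinearMap.coe_mk, AddHom.coe_mk, fromBlocks_multiply, cliff_mul_cliffStar,
    cliffStar_mul_cliff, h]
  simp

theorem cliffProd_sum_isoVec₅ (W : Matrix (Fin 5) (Fin 5) ℂ) :
    cliffProd (fun j => ∑ k, W j k • isoVec₅ k) = W.det • cliffProd isoVec₅ := by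
  let Φ := (ExteriorAlgebra.lift ℂ ⟨isoAction, isoAction_mul_self⟩).toLinearMap.compAlternatingMap
    (ExteriorAlgebra.ιMulti ℂ 5)
  have hΦ : ∀ W : Fin 5 → Fin 5 → ℂ, Φ W = fromBlocks 0
      (cliffProd (fun j => ∑ k, W j k • isoVec₅ k)) (Φ W).toBlocks₂₁ 0 := fun W => by
    have : Φ W = isoAction (W 0) * isoAction (W 1) * isoAction (W 2) * isoAction (W 3) *
        isoAction (W 4) := by
      simp [Φ, ExteriorAlgebra.ιMulti_apply, mul_assoc]
      rfl
    rw [this]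
    simp [isoAction, fromBlocks_multiply, cliffProd, mul_assoc]
  ext i j
  let ev : Matrix ((OctIdx ⊕ OctIdx) ⊕ (OctIdx ⊕ OctIdx)) ((OctIdx ⊕ OctIdx) ⊕ (OctIdx ⊕ OctIdx)) ℂ
      →ₗ[ℂ] ℂ := entryLinearMap ℂ ℂ (Sum.inl i) (Sum.inr j)
  have h := congrArg (fun f => f W) ((ev.compAlternatingMap Φ).eq_smul_basis_det (Pi.basisFun ℂ (Fin 5)))
  have hev : ∀ W : Fin 5 → Fin 5 → ℂ, (ev.compAlternatingMap Φ) W =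
      cliffProd (fun j => ∑ k, W j k • isoVec₅ k) i j := fun W => by
    rw [LinearMap.compAlternatingMap_apply, hΦ]; rfl
  change _ = (ev.compAlternatingMap Φ) (Pi.basisFun ℂ (Fin 5)) • (Pi.basisFun ℂ (Fin 5)).det W at h
  rw [hev] at h
  replace h := (hev W).symm.trans (h.trans (congrArg _ (Pi.basisFun_det_apply W)))
  have e : (fun j => ∑ k, (Pi.basisFun ℂ (Fin 5)) j k • isoVec₅ k) = isoVec₅ := by
    funext j
    simp [Pi.single_apply]
  rw [e] at h
  rw [h, smul_apply, smul_eq_mul, smul_eq_mul, mul_comm]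
  rfl

end Determinant

end Matrix

namespace Matrix

open Complex

/-- The standard isotropic vectors as the rows of a matrix, which represents the complex
coordinates on the ten-dimensional real space. -/
def isoMat : Matrix (Fin 4 ⊕ Fin 1) VecIdx ℂ := of isoVec

/-- The standard complex structure on an octonionic space. -/
def octJ : Matrix OctIdx OctIdx ℝ := fromBlocks 0 (-1) 1 0

/-- The standard complex structure on a plane. -/
def planeJ : Matrix (Fin 2) (Fin 2) ℝ := !![0, -1; 1, 0]

/-- The standard complex structure. -/
def stdJ : Matrix VecIdx VecIdx ℝ := fromBlocks octJ 0 0 planeJ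

theorem map_ofReal_mul {l m n : Type*} [Fintype m] (A : Matrix l m ℝ) (B : Matrix m n ℝ) :
    (A * B).map ofReal = A.map ofReal * B.map ofReal :=
  Matrix.map_mul (f := ofRealHom)

theorem map_ofReal_one {n : Type*} [DecidableEq n] : (1 : Matrix n n ℝ).map ofReal = 1 :=
  Matrix.map_one _ ofReal_zero ofReal_one

theorem conjTranspose_map_ofReal {m n : Type*} (A : Matrix m n ℝ) :
    (A.map ofReal)ᴴ = Aᵀ.map ofReal := by
  ext i j; simp

theorem isoMat_mul_stdJ : isoMat * stdJ.map ofReal = I • isoMat := by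
  ext (i | i) ((j | j) | j)
  · simp [isoMat, isoVec, stdJ, octJ, planeJ, mul_apply, Fintype.sum_sum_type, one_apply]
    split_ifs <;> simp_all
  · simp [isoMat, isoVec, stdJ, octJ, planeJ, mul_apply, Fintype.sum_sum_type, one_apply]
    split_ifs <;> simp_all
  · simp [isoMat, isoVec, stdJ, octJ, planeJ, mul_apply, Fintype.sum_sum_type]
  · simp [isoMat, isoVec, stdJ, octJ, planeJ, mul_apply, Fintype.sum_sum_type]
  · simp [isoMat, isoVec, stdJ, octJ, planeJ, mul_apply, Fintype.sum_sum_type]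
  · fin_cases j <;>
      simp [isoMat, isoVec, stdJ, octJ, planeJ, mul_apply, Fintype.sum_sum_type]

theorem isoMat_mul_conjTranspose : isoMat * isoMatᴴ = (2 : ℂ) • 1 := by
  ext (i | i) (j | j)
  · simp [isoMat, isoVec, mul_apply, Fintype.sum_sum_type, one_apply]
    split_ifs <;> simp_all; norm_num
  · simp [isoMat, isoVec, mul_apply, Fintype.sum_sum_type]
  · simp [isoMat, isoVec, mul_apply, Fintype.sum_sum_type]
  · simp [isoMat, isoVec, mul_apply, Fintype.sum_sum_type, one_apply]
    rw [if_pos (Subsingleton.elim _ _)]; norm_num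

theorem conjTranspose_mul_isoMat : isoMatᴴ * isoMat = 1 - I • stdJ.map ofReal := by
  ext ((i | i) | i) ((j | j) | j)
  · simp [isoMat, isoVec, stdJ, octJ, planeJ, mul_apply, Fintype.sum_sum_type, one_apply]
  · simp [isoMat, isoVec, stdJ, octJ, planeJ, mul_apply, Fintype.sum_sum_type, one_apply]
    split_ifs <;> simp_all
  · simp [isoMat, isoVec, stdJ, octJ, planeJ, mul_apply, Fintype.sum_sum_type]
  · simp [isoMat, isoVec, stdJ, octJ, planeJ, mul_apply, Fintype.sum_sum_type, one_apply]
    split_ifs <;> simp_all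
  · simp [isoMat, isoVec, stdJ, octJ, planeJ, mul_apply, Fintype.sum_sum_type, one_apply]
    split_ifs <;> simp_all
  · simp [isoMat, isoVec, stdJ, octJ, planeJ, mul_apply, Fintype.sum_sum_type]
  · simp [isoMat, isoVec, stdJ, octJ, planeJ, mul_apply, Fintype.sum_sum_type]
  · simp [isoMat, isoVec, stdJ, octJ, planeJ, mul_apply, Fintype.sum_sum_type]
  · fin_cases i <;> fin_cases j <;>
      simp [isoMat, isoVec, stdJ, octJ, planeJ, mul_apply, Fintype.sum_sum_type]

/-- The complex matrix of a real matrix that commutes with the complex structure. -/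
def cx (C : Matrix VecIdx VecIdx ℝ) : Matrix (Fin 4 ⊕ Fin 1) (Fin 4 ⊕ Fin 1) ℂ :=
  (1 / 2 : ℂ) • (isoMat * C.map ofReal * isoMatᴴ)

/-- The complex coordinates of a real vector. -/
def cxVec (x : VecIdx → ℝ) : Fin 4 ⊕ Fin 1 → ℂ := isoMat *ᵥ (ofReal ∘ x)

theorem cx_mul_isoMat {C : Matrix VecIdx VecIdx ℝ} (h : C * stdJ = stdJ * C) :
    cx C * isoMat = isoMat * C.map ofReal := by
  have h' : C.map ofReal * stdJ.map ofReal = stdJ.map ofReal * C.map ofReal := by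
    rw [← map_ofReal_mul, h, map_ofReal_mul]
  rw [cx, Matrix.smul_mul, Matrix.mul_assoc, conjTranspose_mul_isoMat, Matrix.mul_sub,
    Matrix.mul_one, Matrix.mul_smul, Matrix.mul_assoc isoMat, h', ← Matrix.mul_assoc,
    isoMat_mul_stdJ, Matrix.smul_mul, smul_smul, I_mul_I, sub_eq_add_neg,
    neg_one_smul, neg_neg, ← two_smul ℂ, smul_smul]
  norm_num

theorem cx_one : cx 1 = 1 := by
  rw [cx, map_ofReal_one, Matrix.mul_one, isoMat_mul_conjTranspose, smul_smul]
  norm_num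

theorem cx_mul {C D : Matrix VecIdx VecIdx ℝ} (h : C * stdJ = stdJ * C) :
    cx (C * D) = cx C * cx D := by
  rw [cx, map_ofReal_mul, ← Matrix.mul_assoc, ← cx_mul_isoMat h, cx.eq_1 D]
  simp only [Matrix.mul_assoc, Matrix.mul_smul]

theorem cx_transpose (C : Matrix VecIdx VecIdx ℝ) : cx Cᵀ = (cx C)ᴴ := by
  rw [cx, cx, conjTranspose_smul, conjTranspose_mul, conjTranspose_mul, conjTranspose_conjTranspose,
    conjTranspose_map_ofReal, Matrix.mul_assoc]
  simp

theorem cx_mulVec_cxVec {C : Matrix VecIdx VecIdx ℝ} (h : C * stdJ = stdJ * C) (x : VecIdx → ℝ) :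
    cx C *ᵥ cxVec x = cxVec (C *ᵥ x) := by
  rw [cxVec, cxVec, mulVec_mulVec, cx_mul_isoMat h, ← mulVec_mulVec]
  congr 1
  ext i
  simp [mulVec, dotProduct]

theorem cxVec_add (x y : VecIdx → ℝ) : cxVec (x + y) = cxVec x + cxVec y := by
  rw [cxVec, cxVec, cxVec, ← mulVec_add]
  congr 1; ext i; simp

theorem cxVec_smul (c : ℝ) (x : VecIdx → ℝ) : cxVec (c • x) = (c : ℂ) • cxVec x := by
  rw [cxVec, cxVec, ← mulVec_smul]
  congr 1; ext i; simp

theorem cxVec_stdJ (x : VecIdx → ℝ) : cxVec (stdJ *ᵥ x) = I • cxVec x := by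
  rw [cxVec, cxVec, ← smul_mulVec, ← isoMat_mul_stdJ, ← mulVec_mulVec]
  congr 1
  ext i
  simp [mulVec, dotProduct]

theorem cxVec_eq_zero {x : VecIdx → ℝ} (h : cxVec x = 0) : x = 0 := by
  have h1 := congrArg (fun w => isoMatᴴ *ᵥ w) h
  simp only [cxVec, mulVec_mulVec, conjTranspose_mul_isoMat, sub_mulVec, one_mulVec,
    mulVec_zero] at h1
  ext i
  have h2 := congrArg re (congrFun h1 i)
  simpa [mulVec, dotProduct] using h2

/-- The real matrix of multiplication by a complex number. -/
def realOf (ζ : ℂ) : Matrix VecIdx VecIdx ℝ := ζ.re • 1 + ζ.im • stdJ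

theorem cxVec_realOf (ζ : ℂ) (x : VecIdx → ℝ) : cxVec (realOf ζ *ᵥ x) = ζ • cxVec x := by
  rw [realOf, add_mulVec, smul_mulVec, smul_mulVec, one_mulVec, cxVec_add, cxVec_smul, cxVec_smul,
    cxVec_stdJ, smul_smul, ← add_smul, re_add_im]

theorem stdJ_mul_self : stdJ * stdJ = -1 := by
  rw [stdJ, octJ, fromBlocks_multiply, fromBlocks_multiply]
  ext ((i | i) | i) ((j | j) | j) <;> simp [one_apply, planeJ]
  fin_cases i <;> fin_cases j <;> simp

theorem stdJ_transpose : stdJᵀ = -stdJ := by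
  rw [stdJ, octJ, fromBlocks_transpose, fromBlocks_transpose]
  ext ((i | i) | i) ((j | j) | j) <;> simp [one_apply, planeJ]
  fin_cases i <;> fin_cases j <;> simp

theorem realOf_transpose_mul {ζ : ℂ} (h : Complex.normSq ζ = 1) : (realOf ζ)ᵀ * realOf ζ = 1 := by
  rw [realOf, transpose_add, transpose_smul, transpose_smul, transpose_one, stdJ_transpose]
  simp only [add_mul, mul_add, smul_mul_assoc, mul_smul_comm, one_mul, mul_one, neg_mul,
    stdJ_mul_self, neg_neg, smul_neg]
  rw [Complex.normSq_apply] at h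
  trans (ζ.re * ζ.re + ζ.im * ζ.im) • (1 : Matrix VecIdx VecIdx ℝ)
  · module
  · rw [h, one_smul]

theorem realOf_one : realOf 1 = 1 := by simp [realOf]

/-- Equal spinor tensors force the determinant of the complex matrix to be one. -/
theorem det_cx_of_spinT {C : Matrix VecIdx VecIdx ℝ} (h : C * stdJ = stdJ * C)
    (hT : spinT C = spinT 1) : (cx C).det = 1 := by
  let e : Fin 5 ≃ Fin 4 ⊕ Fin 1 := (finSumFinEquiv (m := 4) (n := 1)).symm
  let W : Matrix (Fin 5) (Fin 5) ℂ := ((cx C).map star).submatrix e e |>.transpose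
  have hCt : Cᵀ * stdJ = stdJ * Cᵀ := by
    have := congrArg transpose h
    rw [transpose_mul, transpose_mul, stdJ_transpose, neg_mul, mul_neg, neg_inj] at this
    exact this.symm
  have hf : ∀ j, C.map ofReal *ᵥ isoVec₅ j = ∑ k, W j k • isoVec₅ k := fun j => by
    have h1 := congrFun (cx_mul_isoMat hCt) (e j)
    rw [cx_transpose] at h1
    have h2 : (isoMat * Cᵀ.map ofReal) (e j) = C.map ofReal *ᵥ isoVec₅ j := by
      ext i
      simp [mul_apply, mulVec, dotProduct, isoMat, isoVec₅, e, mul_comm]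
    rw [← h2, ← h1]
    ext i
    rw [mul_apply, Finset.sum_apply, ← e.sum_comp]
    refine Finset.sum_congr rfl fun k _ => ?_
    simp [W, isoMat, isoVec₅, e]
  have hd : W.det = star (cx C).det := by
    rw [det_transpose, det_submatrix_equiv_self]
    exact (RingHom.map_det (starRingEnd ℂ) (cx C)).symm
  have h1 : spinT C = W.det • spinT 1 := by
    rw [spinT, spinT, map_ofReal_one]
    simp only [hf, one_mulVec]
    rw [cliffProd_sum_isoVec₅, smul_comm]
  have h2 : (spinT 1) (.inr (.inl 0)) (.inr (.inl 0)) = 1 := by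
    rw [spinT_one]; simp [vecMulVec_apply, spinor₀]
  have h3 := congrFun (congrFun h1 (.inr (.inl 0))) (.inr (.inl 0))
  rw [hT, smul_apply, h2, smul_eq_mul, mul_one, hd] at h3
  rw [← star_star (cx C).det, ← h3, star_one]

end Matrix

namespace Matrix

open Complex

section Semilinear

/-- The real matrix of the real linear map `w ↦ U w + V w̄`. -/
def semi (U V : Matrix (Fin 4) (Fin 4) ℂ) : Matrix OctIdx OctIdx ℝ :=
  fromBlocks (U.map re + V.map re) (V.map im - U.map im) (U.map im + V.map im)
    (U.map re - V.map re)

theorem map_re_mul (U V : Matrix (Fin 4) (Fin 4) ℂ) :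
    (U * V).map re = U.map re * V.map re - U.map im * V.map im := by
  ext i j; simp [mul_apply]

theorem map_im_mul (U V : Matrix (Fin 4) (Fin 4) ℂ) :
    (U * V).map im = U.map re * V.map im + U.map im * V.map re := by
  ext i j; simp [mul_apply, Finset.sum_add_distrib]

theorem map_star_re (U : Matrix (Fin 4) (Fin 4) ℂ) : (U.map star).map re = U.map re := by
  ext i j; simp

theorem map_star_im (U : Matrix (Fin 4) (Fin 4) ℂ) : (U.map star).map im = -U.map im := by
  ext i j; simp

theorem map_re_add (U V : Matrix (Fin 4) (Fin 4) ℂ) : (U + V).map re = U.map re + V.map re := by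
  ext i j; simp

theorem map_im_add (U V : Matrix (Fin 4) (Fin 4) ℂ) : (U + V).map im = U.map im + V.map im := by
  ext i j; simp

theorem semi_mul (U V U' V' : Matrix (Fin 4) (Fin 4) ℂ) : semi U V * semi U' V' =
    semi (U * U' + V * V'.map star) (U * V' + V * U'.map star) := by
  simp only [semi, fromBlocks_multiply, map_re_mul, map_im_mul, map_re_add, map_im_add,
    map_star_re, map_star_im]
  congr 1 <;> noncomm_ring

theorem semi_transpose (U V : Matrix (Fin 4) (Fin 4) ℂ) : (semi U V)ᵀ = semi Uᴴ Vᵀ := by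
  rw [semi, fromBlocks_transpose, semi]
  congr 1 <;> ext i j <;> simp [sub_eq_add_neg, add_comm]

theorem semi_one : semi 1 0 = 1 := by
  rw [semi, ← fromBlocks_one]
  congr 1 <;> ext i j <;> by_cases h : i = j <;> simp [one_apply, h]

theorem semi_I : semi (I • 1) 0 = octJ := by
  rw [semi, octJ]
  congr 1 <;> ext i j <;> by_cases h : i = j <;> simp [one_apply, h]

theorem semi_neg (U V : Matrix (Fin 4) (Fin 4) ℂ) : -semi U V = semi (-U) (-V) := by
  rw [semi, fromBlocks_neg, semi]
  congr 1 <;> ext i j <;> simp [sub_eq_add_neg, add_comm]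

end Semilinear

section Imaginary

/-- Left multiplication by the imaginary part of the first quaternion. -/
def imL (u : OctIdx → ℝ) : Matrix (Fin 4) (Fin 4) ℂ :=
  quatL ![0, (u (.inl 1) : ℂ), (u (.inl 2) : ℂ), (u (.inl 3) : ℂ)]

/-- Right multiplication by the imaginary part of the second quaternion. -/
def imR (u : OctIdx → ℝ) : Matrix (Fin 4) (Fin 4) ℂ :=
  quatR ![0, (u (.inr 1) : ℂ), (u (.inr 2) : ℂ), (u (.inr 3) : ℂ)]

/-- The antilinear part of octonionic multiplication by `u`. -/
def antiN (u : OctIdx → ℝ) : Matrix (Fin 4) (Fin 4) ℂ := imL u + I • imR u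

theorem imL_comm (u : OctIdx → ℝ) : imL u * imR u = imR u * imL u := quatL_mul_quatR _ _

theorem imL_transpose (u : OctIdx → ℝ) : (imL u)ᵀ = -imL u := by
  ext i j; fin_cases i <;> fin_cases j <;> simp [imL, quatL]

theorem imR_transpose (u : OctIdx → ℝ) : (imR u)ᵀ = -imR u := by
  ext i j; fin_cases i <;> fin_cases j <;> simp [imR, quatR]

theorem imL_map_star (u : OctIdx → ℝ) : (imL u).map star = imL u := by
  ext i j; fin_cases i <;> fin_cases j <;> simp [imL, quatL]

theorem imR_map_star (u : OctIdx → ℝ) : (imR u).map star = imR u := by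
  ext i j; fin_cases i <;> fin_cases j <;> simp [imR, quatR]

theorem imL_smul (c : ℝ) (u : OctIdx → ℝ) : imL (c • u) = (c : ℂ) • imL u := by
  ext i j; fin_cases i <;> fin_cases j <;> simp [imL, quatL]

theorem imR_smul (c : ℝ) (u : OctIdx → ℝ) : imR (c • u) = (c : ℂ) • imR u := by
  ext i j; fin_cases i <;> fin_cases j <;> simp [imR, quatR]

/-- The squared norm of the imaginary part of the first quaternion. -/
def nrmL (u : OctIdx → ℝ) : ℝ := u (.inl 1) ^ 2 + u (.inl 2) ^ 2 + u (.inl 3) ^ 2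

/-- The squared norm of the imaginary part of the second quaternion. -/
def nrmR (u : OctIdx → ℝ) : ℝ := u (.inr 1) ^ 2 + u (.inr 2) ^ 2 + u (.inr 3) ^ 2

theorem nrmL_nonneg (u : OctIdx → ℝ) : 0 ≤ nrmL u := by rw [nrmL]; positivity

theorem nrmR_nonneg (u : OctIdx → ℝ) : 0 ≤ nrmR u := by rw [nrmR]; positivity

theorem imL_mul_self (u : OctIdx → ℝ) : imL u * imL u = (-(nrmL u : ℂ)) • 1 := by
  have h := quatL_mul_transpose ![0, (u (.inl 1) : ℂ), (u (.inl 2) : ℂ), (u (.inl 3) : ℂ)]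
  rw [← imL, imL_transpose, mul_neg] at h
  rw [← neg_neg (imL u * imL u), h, ← neg_smul]
  congr 2
  simp [dotProduct, Fin.sum_univ_four, nrmL]; ring

theorem imR_mul_self (u : OctIdx → ℝ) : imR u * imR u = (-(nrmR u : ℂ)) • 1 := by
  have h := quatR_mul_transpose ![0, (u (.inr 1) : ℂ), (u (.inr 2) : ℂ), (u (.inr 3) : ℂ)]
  rw [← imR, imR_transpose, mul_neg] at h
  rw [← neg_neg (imR u * imR u), h, ← neg_smul]
  congr 2
  simp [dotProduct, Fin.sum_univ_four, nrmR]; ring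

theorem trace_imL (u : OctIdx → ℝ) : (imL u).trace = 0 := by
  simp [trace, imL, quatL, Fin.sum_univ_four]

theorem trace_imR (u : OctIdx → ℝ) : (imR u).trace = 0 := by
  simp [trace, imR, quatR, Fin.sum_univ_four]

theorem trace_imL_mul_imR (u : OctIdx → ℝ) : (imL u * imR u).trace = 0 := by
  simp [trace, imL, quatL, imR, quatR, Fin.sum_univ_four]; ring

theorem antiN_smul (c : ℝ) (u : OctIdx → ℝ) : antiN (c • u) = (c : ℂ) • antiN u := by
  rw [antiN, imL_smul, imR_smul, antiN, smul_add, smul_comm]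

theorem antiN_transpose (u : OctIdx → ℝ) : (antiN u)ᵀ = -antiN u := by
  rw [antiN, transpose_add, transpose_smul, imL_transpose, imR_transpose, smul_neg, neg_add]

theorem antiN_map_star (u : OctIdx → ℝ) : (antiN u).map star = imL u - I • imR u := by
  have h1 := imL_map_star u
  have h2 := imR_map_star u
  ext i j
  have e1 := congrFun (congrFun h1 i) j
  have e2 := congrFun (congrFun h2 i) j
  simp only [map_apply] at e1 e2
  simp [antiN, ← sub_eq_add_neg]
  rw [← e2]; simp [sub_eq_add_neg] at e1 e2 ⊢
  rw [e1, e2]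

theorem antiN_mul_map_star (u : OctIdx → ℝ) :
    antiN u * (antiN u).map star = (-((nrmL u + nrmR u : ℝ) : ℂ)) • 1 := by
  rw [antiN_map_star, antiN, add_mul, mul_sub, mul_sub, imL_mul_self, mul_smul_comm, smul_mul_assoc,
    smul_mul_assoc, mul_smul_comm, imR_mul_self, smul_smul, I_mul_I, imL_comm]
  push_cast
  module

theorem octB_eq_semi (u : OctIdx → ℝ) (hu : u (.inl 0) = 0) :
    octB u = -semi ((I * u (.inr 0)) • 1) (antiN u) := by
  ext (i | i) (j | j) <;> fin_cases i <;> fin_cases j <;>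
    simp [octB, semi, antiN, imL, imR, quatL, quatR, hu]

theorem dotProduct_self_eq (u : OctIdx → ℝ) : u ⬝ᵥ u =
    u (.inl 0) ^ 2 + u (.inr 0) ^ 2 + (nrmL u + nrmR u) := by
  simp [dotProduct, Fintype.sum_sum_type, Fin.sum_univ_four, nrmL, nrmR]; ring

end Imaginary

end Matrix

namespace Matrix

open Complex

theorem exists_eq_vecMulVec_of_idempotent {ι K : Type*} [Fintype ι] [DecidableEq ι] [Field K]
    [CharZero K] {E : Matrix ι ι K} (hE : E * E = E) (ht : E.trace = 1) :
    ∃ c d, E = vecMulVec c d := by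
  have h1 : IsIdempotentElem (toLin' E) := by
    rw [IsIdempotentElem, Module.End.mul_eq_comp, ← toLin'_mul, hE]
  have h2 := (LinearMap.IsIdempotentElem.isProj_range _ h1).trace
  rw [trace_toLin'_eq, ht] at h2
  have h3 : Module.finrank K (LinearMap.range (toLin' E)) = 1 := by exact_mod_cast h2.symm
  obtain ⟨c, -, hc⟩ := finrank_eq_one_iff'.1 h3
  choose d hd using fun j => hc ⟨toLin' E (Pi.single j 1), LinearMap.mem_range_self _ _⟩
  refine ⟨c, d, ?_⟩
  ext i j
  have := congrFun (congrArg Subtype.val (hd j)) i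
  simp only [toLin'_apply, mulVec_single_one, col_apply] at this
  rw [vecMulVec_apply, ← this]
  simp [mul_comm]

section Shift

variable {ι : Type*} [Fintype ι] [DecidableEq ι]

/-- The product of the unnormalised spectral projections of `A` and `B`. -/
def specProd (p q : ℝ) (A B : Matrix ι ι ℂ) : Matrix ι ι ℂ :=
  ((p : ℂ) • 1 + A) * ((q : ℂ) • 1 + B)

/-- A unitary perturbation of the identity along a joint eigenspace of `A` and `B`. -/
def tauMat (p q : ℝ) (A B : Matrix ι ι ℂ) : Matrix ι ι ℂ :=
  1 + (I * (p + I * q) ^ 2) • specProd p q A B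

variable {p q : ℝ} {A B : Matrix ι ι ℂ}

theorem specProd_mul_self (hAB : A * B = B * A) (hA : A * A = ((p ^ 2 : ℝ) : ℂ) • 1)
    (hB : B * B = ((q ^ 2 : ℝ) : ℂ) • 1) :
    specProd p q A B * specProd p q A B = ((4 * p * q : ℝ) : ℂ) • specProd p q A B := by
  have h1 : ((p : ℂ) • 1 + A) * ((p : ℂ) • 1 + A) = ((2 * p : ℝ) : ℂ) • ((p : ℂ) • 1 + A) := by
    simp only [add_mul, mul_add, smul_mul_assoc, mul_smul_comm, one_mul, mul_one, hA]
    push_cast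
    module
  have h2 : ((q : ℂ) • 1 + B) * ((q : ℂ) • 1 + B) = ((2 * q : ℝ) : ℂ) • ((q : ℂ) • 1 + B) := by
    simp only [add_mul, mul_add, smul_mul_assoc, mul_smul_comm, one_mul, mul_one, hB]
    push_cast
    module
  have h3 : Commute ((p : ℂ) • 1 + A) ((q : ℂ) • 1 + B) := by
    simp only [Commute, SemiconjBy, add_mul, mul_add, smul_mul_assoc, mul_smul_comm, one_mul,
      mul_one, hAB]
    module
  rw [specProd]
  calc _ = (((p : ℂ) • 1 + A) * ((p : ℂ) • 1 + A)) * (((q : ℂ) • 1 + B) * ((q : ℂ) • 1 + B)) := by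
        rw [mul_assoc, ← mul_assoc ((q : ℂ) • 1 + B), ← h3.eq]
        simp only [mul_assoc]
    _ = _ := by
        rw [h1, h2, smul_mul_smul_comm]
        congr 1
        push_cast
        ring

theorem conjTranspose_specProd (hAB : A * B = B * A) (hA' : Aᴴ = A) (hB' : Bᴴ = B) :
    (specProd p q A B)ᴴ = specProd p q A B := by
  simp only [specProd, conjTranspose_mul, conjTranspose_add, conjTranspose_smul, hA', hB',
    conjTranspose_one, star_def, conj_ofReal, add_mul, mul_add, smul_mul_assoc, mul_smul_comm,
    one_mul, mul_one, hAB]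

theorem conjTranspose_tauMat_mul (hpq : p ^ 2 + q ^ 2 = 1) (hAB : A * B = B * A)
    (hA : A * A = ((p ^ 2 : ℝ) : ℂ) • 1) (hB : B * B = ((q ^ 2 : ℝ) : ℂ) • 1) (hA' : Aᴴ = A)
    (hB' : Bᴴ = B) : (tauMat p q A B)ᴴ * tauMat p q A B = 1 := by
  have h1 : (p : ℂ) ^ 2 + q ^ 2 = 1 := by exact_mod_cast hpq
  rw [tauMat, conjTranspose_add, conjTranspose_one, conjTranspose_smul,
    conjTranspose_specProd hAB hA' hB']
  rw [add_mul, mul_add, one_mul, one_mul, mul_add, mul_one, smul_mul_smul_comm,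
    specProd_mul_self hAB hA hB, smul_smul, add_assoc, ← add_smul, ← add_smul, add_eq_left]
  convert zero_smul ℂ _
  simp only [star_def, map_mul, map_pow, map_add, conj_I, conj_ofReal]
  push_cast
  have h2 : I ^ 2 = -1 := I_sq
  have h3 : I ^ 4 = 1 := I_pow_four
  linear_combination (4 * p * q * (1 + p ^ 2 + q ^ 2) : ℂ) * h1 +
    (4 * p * q - 4 * p ^ 5 * q - 4 * p * q ^ 5 * (I ^ 4 - I ^ 2 + 1) : ℂ) * h2 +
    (8 * p ^ 3 * q ^ 3 : ℂ) * h3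

theorem exists_tauMat_eq_one_add (hAB : A * B = B * A)
    (hA : A * A = ((p ^ 2 : ℝ) : ℂ) • 1) (hB : B * B = ((q ^ 2 : ℝ) : ℂ) • 1) (hA' : Aᴴ = A)
    (hB' : Bᴴ = B) (tA : A.trace = 0) (tB : B.trace = 0) (tAB : (A * B).trace = 0)
    (hι : Fintype.card ι = 4) : ∃ c d, tauMat p q A B = 1 + vecMulVec c d := by
  rcases eq_or_ne (4 * p * q) 0 with h0 | h0
  · have h1 := specProd_mul_self hAB hA hB
    rw [h0, ofReal_zero, zero_smul] at h1
    have h2 : specProd p q A B = 0 := by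
      nth_rw 1 [← conjTranspose_specProd hAB hA' hB'] at h1
      open scoped ComplexOrder in exact conjTranspose_mul_self_eq_zero.1 h1
    exact ⟨0, 0, by simp [tauMat, h2]⟩
  · have h0' : ((4 * p * q : ℝ) : ℂ) ≠ 0 := ofReal_ne_zero.2 h0
    obtain ⟨c, d, h⟩ := exists_eq_vecMulVec_of_idempotent
      (E := ((4 * p * q : ℝ) : ℂ)⁻¹ • specProd p q A B)
      (by rw [smul_mul_smul_comm, specProd_mul_self hAB hA hB, smul_smul, mul_assoc,
        inv_mul_cancel₀ h0', mul_one])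
      (by
        have : (specProd p q A B).trace = ((4 * p * q : ℝ) : ℂ) := by
          simp only [specProd, add_mul, mul_add, smul_mul_assoc, mul_smul_comm, one_mul, mul_one,
            trace_add, trace_smul, tA, tB, tAB, trace_one, hι]
          push_cast
          simp only [smul_eq_mul]; ring
        rw [trace_smul, this, smul_eq_mul, inv_mul_cancel₀ h0'])
    refine ⟨((I * (p + I * q) ^ 2) * ((4 * p * q : ℝ) : ℂ)) • c, d, ?_⟩
    rw [smul_vecMulVec, ← h, smul_smul, mul_assoc, mul_inv_cancel₀ h0', mul_one, tauMat]

/-- The unit complex number `(1 + i) / √2`. -/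
def eighthRoot : ℂ := ((√2 / 2 : ℝ) : ℂ) * (1 + I)

/-- The scalar by which `tauMat p q A B + eighthRoot • (I • A - B)` acts on the joint
eigenspace `(εp, δq)` does not vanish. -/
theorem shift_scalar_ne_zero (hpq : p ^ 2 + q ^ 2 = 1) (hp : 0 ≤ p) (hq : 0 ≤ q) {ε δ : ℝ}
    (hε : ε = 1 ∨ ε = -1) (hδ : δ = 1 ∨ δ = -1) :
    (1 + I * (p + I * q) ^ 2 * ((p + ε * p) * (q + δ * q)) +
      eighthRoot * (I * ε * p - δ * q) : ℂ) ≠ 0 := by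
  intro h
  have hh : (√2 / 2) ^ 2 = (1 / 2 : ℝ) := by
    rw [div_pow, Real.sq_sqrt (by norm_num)]; norm_num
  have hh0 : 0 < √2 / 2 := by positivity
  rw [eighthRoot] at h
  set r := √2 / 2
  have h1 := congrArg re h
  have h2 := congrArg im h
  simp [pow_two] at h1 h2
  have hr : r * r = 1 / 2 := by rw [← hh, sq]
  obtain rfl | rfl := hε <;> obtain rfl | rfl := hδ
  · have h3 : p ^ 3 - 3 * p * q ^ 2 = r := by
      linear_combination p * h1 + q * h2 + (p + 4 * p * q ^ 2 + r) * hpq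
    have h4 : 3 * p ^ 2 * q - q ^ 3 = -r := by
      linear_combination p * h2 - q * h1 - (4 * p ^ 2 * q + r + q) * hpq
    have h5 : (p - q) * (1 + 4 * p * q) = 0 := by
      linear_combination h3 + h4 - (p - q) * hpq
    have h6 : p = q := by
      rcases mul_eq_zero.1 h5 with h | h
      · linarith
      · nlinarith [mul_nonneg hp hq]
    subst h6
    nlinarith [pow_nonneg hp 3]
  all_goals
    ring_nf at h1 h2
    nlinarith

theorem tauMat_add_det_ne_zero (hpq : p ^ 2 + q ^ 2 = 1) (hp : 0 ≤ p) (hq : 0 ≤ q)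
    (hAB : A * B = B * A) (hA : A * A = ((p ^ 2 : ℝ) : ℂ) • 1)
    (hB : B * B = ((q ^ 2 : ℝ) : ℂ) • 1) (hA' : Aᴴ = A) (hB' : Bᴴ = B) :
    (tauMat p q A B + eighthRoot • (I • A - B)).det ≠ 0 := by
  intro h0
  obtain ⟨w, hw, hw0⟩ := exists_mulVec_eq_zero_iff.2 h0
  have key : ∀ ε δ : ℝ, (ε = 1 ∨ ε = -1) → (δ = 1 ∨ δ = -1) →
      (((p : ℂ) • 1 + (ε : ℂ) • A) * ((q : ℂ) • 1 + (δ : ℂ) • B)) *ᵥ w = 0 := by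
    intro ε δ hε hδ
    have e1 : (ε : ℂ) * ε = 1 := by rcases hε with rfl | rfl <;> norm_num
    have e2 : (δ : ℂ) * δ = 1 := by rcases hδ with rfl | rfl <;> norm_num
    have f1 : ((p : ℂ) • 1 + (ε : ℂ) • A) * A = ((ε : ℂ) * p) • ((p : ℂ) • 1 + (ε : ℂ) • A) := by
      simp only [add_mul, smul_mul_assoc, one_mul, hA, smul_add, smul_smul]
      push_cast
      linear_combination (norm := module) (-e1) • (p : ℂ) • A
    have f2 : ((q : ℂ) • 1 + (δ : ℂ) • B) * B = ((δ : ℂ) * q) • ((q : ℂ) • 1 + (δ : ℂ) • B) := by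
      simp only [add_mul, smul_mul_assoc, one_mul, hB, smul_add, smul_smul]
      push_cast
      linear_combination (norm := module) (-e2) • (q : ℂ) • B
    have f3 : ((q : ℂ) • 1 + (δ : ℂ) • B) * A = A * ((q : ℂ) • 1 + (δ : ℂ) • B) := by
      simp only [add_mul, mul_add, smul_mul_assoc, mul_smul_comm, one_mul, mul_one, hAB]
    set X := (p : ℂ) • 1 + (ε : ℂ) • A
    set Y := (q : ℂ) • 1 + (δ : ℂ) • B
    have g1 : (X * Y) * A = ((ε : ℂ) * p) • (X * Y) := by
      rw [mul_assoc, f3, ← mul_assoc, f1, smul_mul_assoc]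
    have g2 : (X * Y) * B = ((δ : ℂ) * q) • (X * Y) := by
      rw [mul_assoc, f2, mul_smul_comm]
    have g3 : (X * Y) * (tauMat p q A B + eighthRoot • (I • A - B)) =
        (1 + I * (p + I * q) ^ 2 * ((p + ε * p) * (q + δ * q)) +
          eighthRoot * (I * ε * p - δ * q) : ℂ) • (X * Y) := by
      clear_value X Y
      have g4 : (X * Y) * specProd p q A B = (((p + ε * p) * (q + δ * q) : ℂ)) • (X * Y) := by
        have k1 : (X * Y) * ((p : ℂ) • 1 + A) = ((p : ℂ) + ε * p) • (X * Y) := by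
          rw [mul_add, g1, mul_smul_comm, mul_one, ← add_smul]
        have k2 : (X * Y) * ((q : ℂ) • 1 + B) = ((q : ℂ) + δ * q) • (X * Y) := by
          rw [mul_add, g2, mul_smul_comm, mul_one, ← add_smul]
        rw [specProd, ← mul_assoc, k1, smul_mul_assoc, k2, smul_smul]
      rw [tauMat, mul_add, mul_add, mul_smul_comm, mul_smul_comm, g4, mul_sub, mul_smul_comm,
        mul_one, g1, g2]
      module
    have g4 := congrArg ((X * Y) *ᵥ ·) hw0
    simp only [mulVec_mulVec, mulVec_zero, g3, smul_mulVec] at g4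
    exact (smul_eq_zero.1 g4).resolve_left (shift_scalar_ne_zero hpq hp hq hε hδ)
  have fin : ∀ (X : Matrix ι ι ℂ) (a : ℂ), a ≠ 0 → X = a • 1 → X *ᵥ w = 0 → False := by
    rintro X a ha rfl h
    rw [smul_mulVec, one_mulVec] at h
    exact hw ((smul_eq_zero.1 h).resolve_left ha)
  have hc2 : eighthRoot * eighthRoot = I := by
    have hh : ((√2 / 2 : ℝ) : ℂ) * ((√2 / 2 : ℝ) : ℂ) = 1 / 2 := by
      rw [← ofReal_mul, ← sq, div_pow, Real.sq_sqrt (by norm_num)]; norm_num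
    rw [eighthRoot]
    linear_combination (1 + I) ^ 2 * hh + I_sq / 2
  have hz : ∀ X : Matrix ι ι ℂ, Xᴴ = X → X * X = ((0 ^ 2 : ℝ) : ℂ) • 1 → X = 0 := by
    intro X hX h
    nth_rw 1 [← hX] at h
    open scoped ComplexOrder in exact conjTranspose_mul_self_eq_zero.1 (by simpa using h)
  rcases eq_or_ne p 0 with rfl | hp0
  · obtain rfl := hz A hA' hA
    have hq1 : q ^ 2 = 1 := by simpa using hpq
    rw [hq1, ofReal_one, one_smul] at hB
    have h := congrArg ((1 + eighthRoot • B) *ᵥ ·) hw0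
    simp only [mulVec_mulVec, mulVec_zero] at h
    refine fin _ (1 - I) (fun h => ?_) ?_ h
    · have := congrArg im h
      simp at this
    · simp [tauMat, specProd, add_mul, mul_add, hB, smul_smul, hc2]
      module
  rcases eq_or_ne q 0 with rfl | hq0
  · obtain rfl := hz B hB' hB
    have hp1 : p ^ 2 = 1 := by simpa using hpq
    rw [hp1, ofReal_one, one_smul] at hA
    have h := congrArg ((1 - (eighthRoot * I) • A) *ᵥ ·) hw0
    simp only [mulVec_mulVec, mulVec_zero] at h
    refine fin _ (1 + I) (fun h => ?_) ?_ h
    · have := congrArg im h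
      simp at this
    · simp only [tauMat, specProd, ofReal_zero, zero_smul, add_zero, mul_zero, smul_zero, sub_zero,
        sub_mul, mul_add, one_mul, mul_one, smul_mul_smul_comm, smul_smul, hA]
      rw [show eighthRoot * I * (eighthRoot * I) = -I by
        linear_combination I ^ 2 * hc2 + I * I_sq]
      module
  have h := congrArg₂ (· + ·)
    (congrArg₂ (· + ·) (key 1 1 (.inl rfl) (.inl rfl)) (key 1 (-1) (.inl rfl) (.inr rfl)))
    (congrArg₂ (· + ·) (key (-1) 1 (.inr rfl) (.inl rfl)) (key (-1) (-1) (.inr rfl) (.inr rfl)))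
  simp only [← add_mulVec, add_zero] at h
  refine fin _ (4 * p * q) (by simp [hp0, hq0]) ?_ h
  simp only [add_mul, mul_add, smul_mul_assoc, mul_smul_comm, one_mul, mul_one]
  push_cast
  module

end Shift

end Matrix

namespace Matrix

open Complex

section Rotations

theorem continuous_semi : Continuous fun z : Matrix (Fin 4) (Fin 4) ℂ × Matrix (Fin 4) (Fin 4) ℂ =>
    semi z.1 z.2 := by
  unfold semi
  refine Continuous.matrix_fromBlocks ?_ ?_ ?_ ?_ <;>
  first
  | exact (continuous_fst.matrix_map continuous_re).add (continuous_snd.matrix_map continuous_re)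
  | exact (continuous_snd.matrix_map continuous_im).sub (continuous_fst.matrix_map continuous_im)
  | exact (continuous_fst.matrix_map continuous_im).add (continuous_snd.matrix_map continuous_im)
  | exact (continuous_fst.matrix_map continuous_re).sub (continuous_snd.matrix_map continuous_re)

theorem _root_.ContinuousOn.semi {X : Type*} [TopologicalSpace X] {S : Set X}
    {U V : X → Matrix (Fin 4) (Fin 4) ℂ} (hU : ContinuousOn U S) (hV : ContinuousOn V S) :
    ContinuousOn (fun x => semi (U x) (V x)) S :=
  continuous_semi.comp_continuousOn (hU.prodMk hV)

theorem continuous_imL : Continuous imL := by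
  refine continuous_matrix fun i j => ?_
  fin_cases i <;> fin_cases j <;> simp [imL, quatL] <;> fun_prop

theorem continuous_imR : Continuous imR := by
  refine continuous_matrix fun i j => ?_
  fin_cases i <;> fin_cases j <;> simp [imR, quatR] <;> fun_prop

theorem continuous_antiN : Continuous antiN :=
  continuous_imL.add (continuous_imR.const_smul I)

theorem continuous_nrmL : Continuous nrmL := by unfold nrmL; fun_prop

theorem continuous_nrmR : Continuous nrmR := by unfold nrmR; fun_prop

/-- Imaginary unit octonions. -/
structure IsImUnit (u : OctIdx → ℝ) : Prop where
  re_eq_zero : u (.inl 0) = 0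
  unit : u ⬝ᵥ u = 1

theorem IsImUnit.nrm_add {u : OctIdx → ℝ} (hu : IsImUnit u) :
    nrmL u + nrmR u = 1 - u (.inr 0) ^ 2 := by
  have := dotProduct_self_eq u
  rw [hu.unit, hu.re_eq_zero] at this
  linarith

theorem IsImUnit.sq_le_one {u : OctIdx → ℝ} (hu : IsImUnit u) : u (.inr 0) ^ 2 ≤ 1 := by
  have := hu.nrm_add
  linarith [nrmL_nonneg u, nrmR_nonneg u]

/-- A rotation conjugating multiplication by the unit `e` to multiplication by `u`. -/
def rotP (u : OctIdx → ℝ) : Matrix OctIdx OctIdx ℝ :=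
  semi ((√((1 + u (.inr 0)) / 2) : ℂ) • 1) ((I / (2 * √((1 + u (.inr 0)) / 2) : ℂ)) • antiN u)

theorem smul_antiN_map_star (y : ℂ) (u : OctIdx → ℝ) :
    (y • antiN u).map star = star y • (antiN u).map star := by
  ext i j; simp

theorem smul_one_map_star (x : ℂ) :
    (x • (1 : Matrix (Fin 4) (Fin 4) ℂ)).map star = star x • 1 := by
  ext i j; by_cases h : i = j <;> simp [h]

theorem zero_map_star : (0 : Matrix (Fin 4) (Fin 4) ℂ).map star = 0 := by
  ext i j; simp

theorem IsImUnit.antiN_mul {u : OctIdx → ℝ} (hu : IsImUnit u) :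
    antiN u * (antiN u).map star = (-(1 - (u (.inr 0) : ℂ) ^ 2)) • 1 := by
  rw [antiN_mul_map_star, hu.nrm_add]
  push_cast
  rfl

theorem IsImUnit.antiN_mul' {u : OctIdx → ℝ} (hu : IsImUnit u) :
    (antiN u).map star * antiN u = (-(1 - (u (.inr 0) : ℂ) ^ 2)) • 1 := by
  rw [← hu.antiN_mul, antiN_map_star, antiN]
  simp only [add_mul, sub_mul, mul_sub, mul_add, smul_mul_assoc, mul_smul_comm, imL_comm]
  module

theorem semi_smul_one_transpose_mul {u : OctIdx → ℝ} (hu : IsImUnit u) {x y : ℂ}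
    (h : star x * x + star y * y * (1 - (u (.inr 0) : ℂ) ^ 2) = 1) :
    (semi (x • 1) (y • antiN u))ᵀ * semi (x • 1) (y • antiN u) = 1 := by
  rw [semi_transpose, semi_mul, ← semi_one, transpose_smul, antiN_transpose, smul_antiN_map_star,
    smul_one_map_star, conjTranspose_smul, conjTranspose_one]
  congr 1 <;> simp only [smul_mul_assoc, mul_smul_comm, mul_one, one_mul, smul_neg, neg_mul,
    hu.antiN_mul, smul_smul]
  · linear_combination (norm := module) h • (1 : Matrix (Fin 4) (Fin 4) ℂ)
  · module

theorem semi_smul_antiN_transpose_mul {u : OctIdx → ℝ} (hu : IsImUnit u) {y z : ℂ}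
    (h : star y * y * (1 - (u (.inr 0) : ℂ) ^ 2) + star z * z = 1) :
    (semi (y • antiN u) (z • 1))ᵀ * semi (y • antiN u) (z • 1) = 1 := by
  have e : (antiN u)ᴴ = -(antiN u).map star := by
    rw [conjTranspose, antiN_transpose]; ext i j; simp
  rw [semi_transpose, semi_mul, ← semi_one, smul_antiN_map_star, transpose_smul, transpose_one,
    smul_one_map_star, conjTranspose_smul, e]
  congr 1 <;> simp only [smul_mul_assoc, mul_smul_comm, mul_one, one_mul, smul_neg, neg_mul,
    hu.antiN_mul', smul_smul]
  · linear_combination (norm := module) h • (1 : Matrix (Fin 4) (Fin 4) ℂ)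
  · module

theorem octB_mul_semi_smul_one {u : OctIdx → ℝ} (hu : IsImUnit u) {x y : ℂ}
    (h : x = I * (1 + u (.inr 0)) * star y) :
    octB u * semi (x • 1) (y • antiN u) = -(semi (x • 1) (y • antiN u) * octJ) := by
  have h' : star x = -I * (1 + u (.inr 0)) * y := by rw [h]; simp
  rw [octB_eq_semi u hu.re_eq_zero, neg_mul, ← semi_I, semi_mul, semi_mul, smul_antiN_map_star,
    smul_one_map_star, smul_one_map_star, h']
  congr 2 <;> simp only [smul_mul_assoc, mul_smul_comm, mul_one, one_mul, smul_neg, neg_mul,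
    hu.antiN_mul, smul_smul, zero_map_star, Matrix.mul_zero, Matrix.zero_mul,
    add_zero, zero_add, show star I = -I from conj_I]
  · rw [h]
    linear_combination (norm := module)
      ((u (.inr 0) - 1 : ℂ) * (1 + u (.inr 0)) * star y * I_sq) • (1 : Matrix (Fin 4) (Fin 4) ℂ)
  · module

theorem octB_mul_semi_smul_antiN {u : OctIdx → ℝ} (hu : IsImUnit u) {y z : ℂ}
    (h : z = -I * (1 - u (.inr 0)) * star y) :
    octB u * semi (y • antiN u) (z • 1) = -(semi (y • antiN u) (z • 1) * octJ) := by
  have h' : star z = I * (1 - u (.inr 0)) * y := by rw [h]; simp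
  rw [octB_eq_semi u hu.re_eq_zero, neg_mul, ← semi_I, semi_mul, semi_mul, smul_antiN_map_star,
    smul_one_map_star, smul_one_map_star, h']
  congr 2 <;> simp only [smul_mul_assoc, mul_smul_comm, mul_one, one_mul, smul_neg, neg_mul,
    hu.antiN_mul, smul_smul, zero_map_star, Matrix.mul_zero, Matrix.zero_mul,
    add_zero, zero_add, show star I = -I from conj_I]
  · module
  · rw [h]
    linear_combination (norm := module)
      (-(u (.inr 0) + 1 : ℂ) * (1 - u (.inr 0)) * star y * I_sq) • (1 : Matrix (Fin 4) (Fin 4) ℂ)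

theorem ofReal_sqrt_mul_self {x : ℝ} (hx : 0 ≤ x) : ((√x : ℝ) : ℂ) * ((√x : ℝ) : ℂ) = x := by
  rw [← ofReal_mul, Real.mul_self_sqrt hx]

theorem rotP_transpose_mul {u : OctIdx → ℝ} (hu : IsImUnit u) (ht : -1 < u (.inr 0)) :
    (rotP u)ᵀ * rotP u = 1 := by
  have h0 : 0 < (1 + u (.inr 0)) / 2 := by linarith
  have h1 := ofReal_sqrt_mul_self h0.le
  have h2 : ((√((1 + u (.inr 0)) / 2) : ℝ) : ℂ) ≠ 0 := ofReal_ne_zero.2 (Real.sqrt_pos.2 h0).ne'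
  refine semi_smul_one_transpose_mul hu ?_
  push_cast at h1
  simp only [star_def, map_div₀, map_mul, conj_I, conj_ofReal, map_ofNat]
  field_simp
  generalize ((√((1 + u (.inr 0)) / 2) : ℝ) : ℂ) = r at *
  linear_combination (4 * r * r + 2 * (1 + u (.inr 0)) - 4) * h1 -
    (1 - (u (.inr 0) : ℂ) ^ 2) * I_sq

theorem octB_mul_rotP {u : OctIdx → ℝ} (hu : IsImUnit u) (ht : -1 < u (.inr 0)) :
    octB u * rotP u = -(rotP u * octJ) := by
  have h0 : 0 < (1 + u (.inr 0)) / 2 := by linarith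
  have h1 := ofReal_sqrt_mul_self h0.le
  have h2 : ((√((1 + u (.inr 0)) / 2) : ℝ) : ℂ) ≠ 0 := ofReal_ne_zero.2 (Real.sqrt_pos.2 h0).ne'
  refine octB_mul_semi_smul_one hu ?_
  push_cast at h1
  simp only [star_def, map_div₀, map_mul, conj_I, conj_ofReal, map_ofNat]
  field_simp
  generalize ((√((1 + u (.inr 0)) / 2) : ℝ) : ℂ) = r at *
  linear_combination 2 * h1 + (1 + (u (.inr 0) : ℂ)) * I_sq

/-- The part of `u` orthogonal to the complex plane, normalised. -/
def perpUnit (u : OctIdx → ℝ) : OctIdx → ℝ := (√(1 - u (.inr 0) ^ 2))⁻¹ • u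

/-- The unitary perturbation of the identity attached to `u`. -/
def tauU (u : OctIdx → ℝ) : Matrix (Fin 4) (Fin 4) ℂ :=
  tauMat (√(nrmL (perpUnit u))) (√(nrmR (perpUnit u))) (-I • imL (perpUnit u))
    (-I • imR (perpUnit u))

/-- A second rotation conjugating multiplication by `e` to multiplication by `u`, which extends
to the unit `u = -e`. -/
def rotM (u : OctIdx → ℝ) : Matrix OctIdx OctIdx ℝ :=
  if u (.inr 0) ≤ -(1 / 2) then
    semi ((eighthRoot / (2 * √((1 - u (.inr 0)) / 2) : ℂ)) • antiN u)
      ((-I * √((1 - u (.inr 0)) / 2) * star eighthRoot : ℂ) • 1)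
  else rotP u * semi (cayleyPath (tauU u) (eighthRoot • antiN (perpUnit u))
    (min (1 + 2 * u (.inr 0)) 1)) 0

theorem star_eighthRoot_mul : star eighthRoot * eighthRoot = 1 := by
  have hh : ((√2 / 2 : ℝ) : ℂ) * ((√2 / 2 : ℝ) : ℂ) = 1 / 2 := by
    rw [← ofReal_mul, ← sq, div_pow, Real.sq_sqrt (by norm_num)]; norm_num
  rw [eighthRoot, star_def, map_mul, conj_ofReal, map_add, map_one, conj_I]
  linear_combination (1 + I) * (1 - I) * hh - I_sq / 2

section

variable {u : OctIdx → ℝ}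

theorem nrmL_smul (c : ℝ) (u : OctIdx → ℝ) : nrmL (c • u) = c ^ 2 * nrmL u := by
  simp [nrmL]; ring

theorem nrmR_smul (c : ℝ) (u : OctIdx → ℝ) : nrmR (c • u) = c ^ 2 * nrmR u := by
  simp [nrmR]; ring

theorem IsImUnit.nrm_perpUnit (hu : IsImUnit u) (h1 : -1 < u (.inr 0)) (h2 : u (.inr 0) < 1) :
    nrmL (perpUnit u) + nrmR (perpUnit u) = 1 := by
  have h : 0 < 1 - u (.inr 0) ^ 2 := by nlinarith
  rw [perpUnit, nrmL_smul, nrmR_smul, ← mul_add, hu.nrm_add, inv_pow, Real.sq_sqrt h.le,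
    inv_mul_cancel₀ h.ne']

theorem neg_I_smul_imL_sq (u : OctIdx → ℝ) :
    (-I • imL u) * (-I • imL u) = ((√(nrmL u) ^ 2 : ℝ) : ℂ) • 1 := by
  rw [Real.sq_sqrt (nrmL_nonneg u), smul_mul_smul_comm, imL_mul_self, smul_smul]
  congr 1
  linear_combination -(nrmL u : ℂ) * I_sq

theorem neg_I_smul_imR_sq (u : OctIdx → ℝ) :
    (-I • imR u) * (-I • imR u) = ((√(nrmR u) ^ 2 : ℝ) : ℂ) • 1 := by
  rw [Real.sq_sqrt (nrmR_nonneg u), smul_mul_smul_comm, imR_mul_self, smul_smul]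
  congr 1
  linear_combination -(nrmR u : ℂ) * I_sq

theorem neg_I_smul_comm (u : OctIdx → ℝ) :
    (-I • imL u) * (-I • imR u) = (-I • imR u) * (-I • imL u) := by
  rw [smul_mul_smul_comm, imL_comm, smul_mul_smul_comm]

theorem conjTranspose_imL (u : OctIdx → ℝ) : (imL u)ᴴ = -imL u := by
  rw [conjTranspose, imL_transpose]
  ext i j
  have := congrFun (congrFun (imL_map_star u) i) j
  simpa using this

theorem conjTranspose_imR (u : OctIdx → ℝ) : (imR u)ᴴ = -imR u := by
  rw [conjTranspose, imR_transpose]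
  ext i j
  have := congrFun (congrFun (imR_map_star u) i) j
  simpa using this

theorem conjTranspose_neg_I_smul_imL (u : OctIdx → ℝ) : (-I • imL u)ᴴ = -I • imL u := by
  rw [conjTranspose_smul, conjTranspose_imL]; simp

theorem conjTranspose_neg_I_smul_imR (u : OctIdx → ℝ) : (-I • imR u)ᴴ = -I • imR u := by
  rw [conjTranspose_smul, conjTranspose_imR]; simp

theorem antiN_eq_sub (u : OctIdx → ℝ) : antiN u = I • (-I • imL u) - (-I • imR u) := by
  rw [antiN, smul_smul]; simp

theorem conjTranspose_tauU_mul (hu : IsImUnit u) (h1 : -1 < u (.inr 0)) (h2 : u (.inr 0) < 1) :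
    (tauU u)ᴴ * tauU u = 1 :=
  conjTranspose_tauMat_mul
    (by rw [Real.sq_sqrt (nrmL_nonneg _), Real.sq_sqrt (nrmR_nonneg _), hu.nrm_perpUnit h1 h2])
    (neg_I_smul_comm _) (neg_I_smul_imL_sq _) (neg_I_smul_imR_sq _)
    (conjTranspose_neg_I_smul_imL _) (conjTranspose_neg_I_smul_imR _)

theorem exists_tauU_eq (u : OctIdx → ℝ) : ∃ c d, tauU u = 1 + vecMulVec c d :=
  exists_tauMat_eq_one_add
    (neg_I_smul_comm _) (neg_I_smul_imL_sq _) (neg_I_smul_imR_sq _)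
    (conjTranspose_neg_I_smul_imL _) (conjTranspose_neg_I_smul_imR _)
    (by rw [trace_smul, trace_imL, smul_zero]) (by rw [trace_smul, trace_imR, smul_zero])
    (by rw [smul_mul_smul_comm, trace_smul, trace_imL_mul_imR, smul_zero]) (by simp)

theorem det_tauU_add_ne_zero (hu : IsImUnit u) (h1 : -1 < u (.inr 0)) (h2 : u (.inr 0) < 1) :
    (tauU u + eighthRoot • antiN (perpUnit u)).det ≠ 0 := by
  rw [antiN_eq_sub]
  exact tauMat_add_det_ne_zero
    (by rw [Real.sq_sqrt (nrmL_nonneg _), Real.sq_sqrt (nrmR_nonneg _), hu.nrm_perpUnit h1 h2])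
    (Real.sqrt_nonneg _) (Real.sqrt_nonneg _)
    (neg_I_smul_comm _) (neg_I_smul_imL_sq _) (neg_I_smul_imR_sq _)
    (conjTranspose_neg_I_smul_imL _) (conjTranspose_neg_I_smul_imR _)

theorem conjTranspose_antiN_mul (hu : IsImUnit u) (h1 : -1 < u (.inr 0)) (h2 : u (.inr 0) < 1) :
    (eighthRoot • antiN (perpUnit u))ᴴ * (eighthRoot • antiN (perpUnit u)) = 1 := by
  have h := antiN_mul_map_star (perpUnit u)
  rw [hu.nrm_perpUnit h1 h2] at h
  have e : (antiN (perpUnit u))ᴴ = -(antiN (perpUnit u)).map star := by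
    rw [conjTranspose, antiN_transpose]; ext i j; simp
  refine mul_eq_one_comm.1 ?_
  rw [conjTranspose_smul, smul_mul_smul_comm, e, mul_neg, h, mul_comm, star_eighthRoot_mul]
  simp

end

end Rotations

end Matrix

namespace Matrix

open Complex

section Rotations

variable {u : OctIdx → ℝ}

theorem semi_zero_transpose_mul {W : Matrix (Fin 4) (Fin 4) ℂ} (hW : Wᴴ * W = 1) :
    (semi W 0)ᵀ * semi W 0 = 1 := by
  rw [semi_transpose, semi_mul, transpose_zero, Matrix.zero_mul, Matrix.zero_mul, hW, add_zero,
    Matrix.mul_zero, add_zero, semi_one]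

theorem semi_zero_mul_octJ (W : Matrix (Fin 4) (Fin 4) ℂ) : semi W 0 * octJ = octJ * semi W 0 := by
  rw [← semi_I, semi_mul, semi_mul]
  simp [zero_map_star]

theorem transpose_mul_self_mul {A B : Matrix OctIdx OctIdx ℝ} (hA : Aᵀ * A = 1) (hB : Bᵀ * B = 1) :
    (A * B)ᵀ * (A * B) = 1 := by
  rw [transpose_mul, Matrix.mul_assoc, ← Matrix.mul_assoc Aᵀ, hA, Matrix.one_mul, hB]

theorem conjTranspose_cayley_mul (hu : IsImUnit u) (h1 : -(1 / 2) < u (.inr 0))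
    (h2 : u (.inr 0) < 1) :
    (cayleyPath (tauU u) (eighthRoot • antiN (perpUnit u)) (min (1 + 2 * u (.inr 0)) 1))ᴴ *
      cayleyPath (tauU u) (eighthRoot • antiN (perpUnit u)) (min (1 + 2 * u (.inr 0)) 1) = 1 :=
  conjTranspose_cayleyPath_mul (conjTranspose_tauU_mul hu (by linarith) h2)
    (conjTranspose_antiN_mul hu (by linarith) h2) (det_tauU_add_ne_zero hu (by linarith) h2)
    ⟨le_min (by linarith) zero_le_one, min_le_right _ _⟩

theorem rotM_transpose_mul (hu : IsImUnit u) (ht : u (.inr 0) < 1) : (rotM u)ᵀ * rotM u = 1 := by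
  rw [rotM]
  split_ifs with h
  · have h0 : 0 < (1 - u (.inr 0)) / 2 := by linarith
    have h1 := ofReal_sqrt_mul_self h0.le
    have h2 : ((√((1 - u (.inr 0)) / 2) : ℝ) : ℂ) ≠ 0 := ofReal_ne_zero.2 (Real.sqrt_pos.2 h0).ne'
    have h3 := star_eighthRoot_mul
    have h3' : (starRingEnd ℂ) eighthRoot * eighthRoot = 1 := h3
    have key : ∀ r c c' t : ℂ, r ≠ 0 → c' * c = 1 → r * r = (1 - t) / 2 →
        c' / (2 * r) * (c / (2 * r)) * (1 - t ^ 2) + I * r * c * (-I * r * c') = 1 := by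
      intro r c c' t hr hc h
      have : c' / (2 * r) * (c / (2 * r)) = c' * c / (4 * (r * r)) := by field_simp; ring
      have hr' : (1 - t) ≠ 0 := fun h0 => hr (by simpa [h0] using h)
      rw [this, hc, h]
      have : I * r * c * (-I * r * c') = (1 - t) / 2 := by
        linear_combination (-(c * c') * r * r) * I_sq + (c' * c) * h + (1 - t) / 2 * hc
      rw [this]
      field_simp
      ring
    refine semi_smul_antiN_transpose_mul hu ?_
    push_cast at h1
    simp only [star_def, map_div₀, map_mul, map_neg, conj_I, conj_ofReal, map_ofNat, conj_conj,
      neg_neg]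
    exact key _ _ _ _ h2 h3' h1
  · exact transpose_mul_self_mul (rotP_transpose_mul hu (by linarith))
      (semi_zero_transpose_mul (conjTranspose_cayley_mul hu (by linarith) ht))

theorem octB_mul_rotM (hu : IsImUnit u) :
    octB u * rotM u = -(rotM u * octJ) := by
  rw [rotM]
  split_ifs with h
  · have h0 : 0 < (1 - u (.inr 0)) / 2 := by linarith
    have h1 := ofReal_sqrt_mul_self h0.le
    have h2 : ((√((1 - u (.inr 0)) / 2) : ℝ) : ℂ) ≠ 0 := ofReal_ne_zero.2 (Real.sqrt_pos.2 h0).ne'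
    refine octB_mul_semi_smul_antiN hu ?_
    push_cast at h1
    simp only [star_def, map_div₀, map_mul, conj_ofReal, map_ofNat]
    generalize ((√((1 - u (.inr 0)) / 2) : ℝ) : ℂ) = r at *
    field_simp
    linear_combination -2 * (starRingEnd ℂ) eighthRoot * h1
  · rw [← Matrix.mul_assoc, octB_mul_rotP hu (by linarith), neg_mul, Matrix.mul_assoc,
      Matrix.mul_assoc, semi_zero_mul_octJ]

theorem rotM_eq_rotP_mul (hu : IsImUnit u) (h0 : 0 ≤ u (.inr 0)) (h1 : u (.inr 0) < 1) :
    rotM u = rotP u * semi (tauU u) 0 := by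
  rw [rotM, if_neg (by linarith), min_eq_right (by linarith),
    cayleyPath_one (det_tauU_add_ne_zero hu (by linarith) h1)]

theorem continuousOn_rotP : ContinuousOn rotP {u | -1 < u (.inr 0)} := by
  have h : ContinuousOn (fun u : OctIdx → ℝ => ((√((1 + u (.inr 0)) / 2) : ℝ) : ℂ))
      {u | -1 < u (.inr 0)} := by fun_prop
  have h0 : ∀ u ∈ {u : OctIdx → ℝ | -1 < u (.inr 0)},
      (2 * ((√((1 + u (.inr 0)) / 2) : ℝ) : ℂ)) ≠ 0 := fun u hu =>
    mul_ne_zero two_ne_zero (ofReal_ne_zero.2 (Real.sqrt_pos.2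
      (by have : -1 < u (.inr 0) := hu; linarith)).ne')
  exact (h.smul continuousOn_const).semi
    ((continuousOn_const.div (continuousOn_const.mul h) h0).smul continuous_antiN.continuousOn)

theorem continuousOn_perpUnit :
    ContinuousOn perpUnit {u | -1 < u (.inr 0) ∧ u (.inr 0) < 1} := by
  have h : Continuous fun u : OctIdx → ℝ => √(1 - u (.inr 0) ^ 2) := by fun_prop
  have h0 : ∀ u ∈ {u : OctIdx → ℝ | -1 < u (.inr 0) ∧ u (.inr 0) < 1},
      √(1 - u (.inr 0) ^ 2) ≠ 0 := fun u hu =>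
    (Real.sqrt_pos.2 (by nlinarith [hu.1, hu.2])).ne'
  exact (h.continuousOn.inv₀ h0).smul continuousOn_id

theorem continuous_tauMat {X ι : Type*} [TopologicalSpace X] [Fintype ι] [DecidableEq ι]
    {p q : X → ℝ} {A B : X → Matrix ι ι ℂ} (hp : Continuous p) (hq : Continuous q)
    (hA : Continuous A) (hB : Continuous B) :
    Continuous fun x => tauMat (p x) (q x) (A x) (B x) := by
  have c1 : Continuous fun x => (p x : ℂ) := continuous_ofReal.comp hp
  have c2 : Continuous fun x => (q x : ℂ) := continuous_ofReal.comp hq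
  have c3 : Continuous fun x => (p x : ℂ) • (1 : Matrix ι ι ℂ) + A x :=
    (c1.smul continuous_const).add hA
  have c4 : Continuous fun x => (q x : ℂ) • (1 : Matrix ι ι ℂ) + B x :=
    (c2.smul continuous_const).add hB
  have c5 : Continuous fun x => I * ((p x : ℂ) + I * q x) ^ 2 := by fun_prop
  exact continuous_const.add (c5.smul (c3.matrix_mul c4))

theorem continuousOn_tauU : ContinuousOn tauU {u | -1 < u (.inr 0) ∧ u (.inr 0) < 1} := by
  have hL : Continuous fun u => tauMat (√(nrmL u)) (√(nrmR u)) (-I • imL u) (-I • imR u) := by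
    have c1 : Continuous fun u => √(nrmL u) := Real.continuous_sqrt.comp continuous_nrmL
    have c2 : Continuous fun u => √(nrmR u) := Real.continuous_sqrt.comp continuous_nrmR
    have c3 : Continuous fun u => (-I • imL u) := continuous_imL.const_smul (-I)
    have c4 : Continuous fun u => (-I • imR u) := continuous_imR.const_smul (-I)
    exact continuous_tauMat c1 c2 c3 c4
  exact hL.comp_continuousOn continuousOn_perpUnit

theorem semi_eq_rotP_mul (hu : IsImUnit u) (h : u (.inr 0) = -(1 / 2)) :
    semi ((eighthRoot / (2 * √((1 - u (.inr 0)) / 2) : ℂ)) • antiN u)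
      ((-I * √((1 - u (.inr 0)) / 2) * star eighthRoot : ℂ) • 1) =
    rotP u * semi (cayleyPath (tauU u) (eighthRoot • antiN (perpUnit u))
      (min (1 + 2 * u (.inr 0)) 1)) 0 := by
  have e0 : min (1 + 2 * u (.inr 0)) 1 = 0 := by rw [h]; norm_num
  have e1 : √((1 - u (.inr 0)) / 2) = √3 / 2 := by
    rw [h, Real.sqrt_eq_iff_mul_self_eq_of_pos (by positivity)]
    have := Real.mul_self_sqrt (show (0 : ℝ) ≤ 3 by norm_num)
    linarith
  have e2 : √(1 - u (.inr 0) ^ 2) = √3 / 2 := by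
    rw [← e1]
    congr 1
    rw [h]
    norm_num
  have e3 : √((1 + u (.inr 0)) / 2) = 1 / 2 := by
    rw [h, Real.sqrt_eq_iff_mul_self_eq_of_pos (by positivity)]
    norm_num
  have h3 : ((√3 : ℝ) : ℂ) * ((√3 : ℝ) : ℂ) = 3 := by
    rw [ofReal_sqrt_mul_self (by norm_num)]
    norm_num
  have h0 : ((√3 : ℝ) : ℂ) ≠ 0 := ofReal_ne_zero.2 (by positivity)
  rw [e0, cayleyPath_zero (conjTranspose_tauU_mul hu (by linarith) (by linarith)), rotP, semi_mul,
    zero_map_star, smul_antiN_map_star, Matrix.mul_zero, Matrix.mul_zero, add_zero, zero_add,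
    perpUnit, antiN_smul, e1, e2, e3]
  congr 1
  · simp only [Matrix.smul_mul, Matrix.mul_smul, Matrix.one_mul, smul_smul]
    congr 1
    push_cast
    field_simp
  · rw [smul_antiN_map_star, smul_smul, smul_mul_smul_comm, hu.antiN_mul, h]
    simp only [smul_smul, star_def, conj_ofReal, map_mul]
    congr 1
    push_cast
    field_simp
    linear_combination (-(starRingEnd ℂ) eighthRoot) * h3

theorem continuousOn_rotM : ContinuousOn rotM {u | IsImUnit u ∧ u (.inr 0) < 1} := by
  have hc : ContinuousOn (fun u : OctIdx → ℝ => ((√((1 - u (.inr 0)) / 2) : ℝ) : ℂ))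
      {u | u (.inr 0) < 1} := by fun_prop
  have h0 : ∀ u ∈ {u : OctIdx → ℝ | u (.inr 0) < 1},
      (2 * ((√((1 - u (.inr 0)) / 2) : ℝ) : ℂ)) ≠ 0 := fun u hu =>
    mul_ne_zero two_ne_zero (ofReal_ne_zero.2 (Real.sqrt_pos.2
      (by have : u (.inr 0) < 1 := hu; linarith)).ne')
  have c1 : ContinuousOn (fun u : OctIdx → ℝ =>
      semi ((eighthRoot / (2 * √((1 - u (.inr 0)) / 2) : ℂ)) • antiN u)
      ((-I * √((1 - u (.inr 0)) / 2) * star eighthRoot : ℂ) • 1)) {u | u (.inr 0) < 1} :=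
    ContinuousOn.semi
      ((continuousOn_const.div (continuousOn_const.mul hc) h0).smul continuous_antiN.continuousOn)
      (((continuousOn_const.mul hc).mul continuousOn_const).smul continuousOn_const)
  have hsub : {u | IsImUnit u ∧ -(1 / 2) ≤ u (.inr 0) ∧ u (.inr 0) < 1} ⊆
      {u : OctIdx → ℝ | -1 < u (.inr 0) ∧ u (.inr 0) < 1} :=
    fun u hu => ⟨by linarith [hu.2.1], hu.2.2⟩
  have c2 : ContinuousOn (fun u : OctIdx → ℝ => rotP u * semi (cayleyPath (tauU u)
      (eighthRoot • antiN (perpUnit u)) (min (1 + 2 * u (.inr 0)) 1)) 0)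
      {u | IsImUnit u ∧ -(1 / 2) ≤ u (.inr 0) ∧ u (.inr 0) < 1} := by
    have hN : ContinuousOn (fun u => eighthRoot • antiN (perpUnit u))
        {u | IsImUnit u ∧ -(1 / 2) ≤ u (.inr 0) ∧ u (.inr 0) < 1} :=
      (continuous_antiN.comp_continuousOn (continuousOn_perpUnit.mono hsub)).const_smul eighthRoot
    refine ContinuousOn.mul (continuousOn_rotP.mono fun u hu => (hsub hu).1)
      (ContinuousOn.semi ?_ continuousOn_const)
    refine continuousOn_cayleyPath (continuousOn_tauU.mono hsub)
      hN
      (by fun_prop) (fun u hu => conjTranspose_tauU_mul hu.1 (hsub hu).1 hu.2.2)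
      (fun u hu => conjTranspose_antiN_mul hu.1 (hsub hu).1 hu.2.2)
      (fun u hu => det_tauU_add_ne_zero hu.1 (hsub hu).1 hu.2.2)
      (fun u hu => ⟨le_min (by linarith [hu.2.1]) zero_le_one, min_le_right _ _⟩)
  rw [continuousOn_iff_continuous_domRestrict]
  refine continuous_if_le (f := fun x : {u | IsImUnit u ∧ u (.inr 0) < 1} => x.1 (.inr 0))
    ((continuous_apply _).comp continuous_subtype_val) continuous_const
    (c1.comp continuous_subtype_val.continuousOn fun x _ => x.2.2)
    (c2.comp continuous_subtype_val.continuousOn fun x hx => ⟨x.2.1, hx, x.2.2⟩) ?_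
  rintro ⟨u, hu, hlt⟩ (h : u (.inr 0) = _)
  exact semi_eq_rotP_mul hu h

end Rotations

end Matrix

namespace Matrix

open Complex

section Lifting

variable {u : OctIdx → ℝ}

/-- The unit octonion. -/
def octOne : OctIdx → ℝ := Pi.single (.inl 0) 1

/-- The octonion whose multiplication is the standard complex structure. -/
def octI : OctIdx → ℝ := Pi.single (.inr 0) 1

theorem octOne_dotProduct (s : OctIdx → ℝ) : octOne ⬝ᵥ s = s (.inl 0) := by simp [octOne]

theorem octI_dotProduct (s : OctIdx → ℝ) : octI ⬝ᵥ s = s (.inr 0) := by simp [octI]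

theorem isImUnit_octI : IsImUnit octI :=
  ⟨by simp [octI], by rw [octI_dotProduct]; simp [octI]⟩

/-- The reflection fixing the unit octonion and `u` and negating their orthogonal complement. -/
def octE (u : OctIdx → ℝ) : Matrix OctIdx OctIdx ℝ :=
  (2 : ℝ) • vecMulVec octOne octOne + (2 : ℝ) • vecMulVec u u - 1

theorem octE_mulVec (u s : OctIdx → ℝ) :
    octE u *ᵥ s = (2 * s (.inl 0)) • octOne + (2 * (u ⬝ᵥ s)) • u - s := by
  rw [octE, sub_mulVec, add_mulVec, smul_mulVec, smul_mulVec, vecMulVec_mulVec, vecMulVec_mulVec,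
    one_mulVec, octOne_dotProduct]
  ext i
  simp
  ring

theorem octE_transpose (u : OctIdx → ℝ) : (octE u)ᵀ = octE u := by
  rw [octE, transpose_sub, transpose_add, transpose_smul, transpose_smul, transpose_vecMulVec,
    transpose_vecMulVec, transpose_one]

theorem octE_mul_self (hu : IsImUnit u) : octE u * octE u = 1 := by
  refine ext_of_mulVec fun s => ?_
  have h1 : u ⬝ᵥ octOne = 0 := by rw [dotProduct_comm, octOne_dotProduct, hu.re_eq_zero]
  rw [← mulVec_mulVec, octE_mulVec, octE_mulVec, dotProduct_sub, dotProduct_add, dotProduct_smul,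
    dotProduct_smul, hu.unit, h1, one_mulVec]
  have h2 : octOne (.inl 0) = 1 := by simp [octOne]
  ext i
  simp [hu.re_eq_zero, h2]
  ring

theorem octE_mulVec_octOne (hu : IsImUnit u) : octE u *ᵥ octOne = octOne := by
  have h1 : u ⬝ᵥ octOne = 0 := by rw [dotProduct_comm, octOne_dotProduct, hu.re_eq_zero]
  rw [octE_mulVec, h1]
  ext i
  simp [octOne]
  ring

theorem octB_transpose_of_re (hu : u (.inl 0) = 0) : (octB u)ᵀ = -octB u := by
  have := octB_add_transpose u
  rw [hu, mul_zero, zero_smul] at this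
  exact (neg_eq_of_add_eq_zero_right this).symm

theorem octB_mul_transpose_add (s t : OctIdx → ℝ) :
    octB s * (octB t)ᵀ + octB t * (octB s)ᵀ = (2 * (s ⬝ᵥ t)) • 1 := by
  have h := octB_mul_transpose (s + t)
  rw [octB_add, transpose_add, add_mul, mul_add, mul_add, octB_mul_transpose, octB_mul_transpose,
    dotProduct_add, add_dotProduct, add_dotProduct, dotProduct_comm t s] at h
  linear_combination (norm := module) h

theorem octB_mul_octB (hu : IsImUnit u) (s : OctIdx → ℝ) :
    octB u * octB s = octB (octE u *ᵥ s) * octB u := by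
  have h1 := octB_mul_transpose_add u s
  have h2 := octB_add_transpose s
  have h3 := octB_mul_transpose u
  rw [octB_transpose_of_re hu.re_eq_zero] at h1 h3
  rw [hu.unit, one_smul] at h3
  have e : octB octOne = (1 : Matrix OctIdx OctIdx ℝ) := octB_single
  have h4 : octB s = (2 * s (.inl 0)) • 1 - (octB s)ᵀ := by rw [← h2]; abel
  rw [octE_mulVec, sub_eq_add_neg, ← neg_one_smul ℝ s, octB_add, octB_add, octB_smul, octB_smul,
    octB_smul, e]
  nth_rw 1 [h4]
  simp only [mul_sub, add_mul, smul_mul_assoc, mul_smul_comm, mul_one, one_mul, mul_neg] at h1 h3 ⊢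
  linear_combination (norm := module) -h1 + (2 * (u ⬝ᵥ s)) • h3

theorem octB_octI : octB octI = (-octJ : Matrix OctIdx OctIdx ℝ) := by
  have h : antiN octI = 0 := by
    ext i j
    fin_cases i <;> fin_cases j <;> simp [antiN, imL, imR, octI, quatL, quatR]
  rw [octB_eq_semi octI (by simp [octI]), h, ← semi_I]
  simp [octI]

/-- The unit vector halfway between `u` and the standard unit. -/
def midUnit (u : OctIdx → ℝ) : OctIdx → ℝ := (2 * √((1 + u (.inr 0)) / 2))⁻¹ • (u + octI)

theorem isImUnit_midUnit (hu : IsImUnit u) (ht : -1 < u (.inr 0)) : IsImUnit (midUnit u) where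
  re_eq_zero := by simp [midUnit, hu.re_eq_zero, octI]
  unit := by
    have h0 : 0 < (1 + u (.inr 0)) / 2 := by linarith
    have h2 := (Real.sqrt_pos.2 h0).ne'
    rw [midUnit, smul_dotProduct, dotProduct_smul, add_dotProduct, dotProduct_add, hu.unit,
      octI_dotProduct, dotProduct_comm u, octI_dotProduct]
    have h1 := Real.mul_self_sqrt h0.le
    simp only [octI, Pi.add_apply, Pi.single_eq_same, smul_eq_mul]
    field_simp
    nlinarith

theorem rotP_eq (hu : IsImUnit u) (ht : -1 < u (.inr 0)) :
    rotP u = -(octB (midUnit u) * octB octI) := by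
  have h0 : 0 < (1 + u (.inr 0)) / 2 := by linarith
  have h2 : ((√((1 + u (.inr 0)) / 2) : ℝ) : ℂ) ≠ 0 := ofReal_ne_zero.2 (Real.sqrt_pos.2 h0).ne'
  have h1 := ofReal_sqrt_mul_self h0.le
  have h : antiN (midUnit u) = (1 / (2 * √((1 + u (.inr 0)) / 2)) : ℂ) • antiN u := by
    have : antiN (u + octI) = antiN u := by
      ext i j
      fin_cases i <;> fin_cases j <;> simp [antiN, imL, imR, octI, quatL, quatR]
    rw [midUnit, antiN_smul, this]
    push_cast
    rw [one_div]
  have h3 : ((midUnit u (.inr 0) : ℝ) : ℂ) = √((1 + u (.inr 0)) / 2) := by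
    simp only [midUnit, Pi.smul_apply, Pi.add_apply, octI, Pi.single_eq_same, smul_eq_mul]
    push_cast at h1 ⊢
    field_simp
    linear_combination -2 * h1
  rw [octB_eq_semi _ (isImUnit_midUnit hu ht).re_eq_zero, octB_octI, ← semi_I, neg_mul, mul_neg,
    neg_neg, semi_mul, h, h3, rotP, smul_one_map_star, zero_map_star]
  simp only [Matrix.mul_zero, zero_add, add_zero, smul_mul_smul_comm, Matrix.mul_one, 
    ← neg_smul, neg_zero, smul_zero, star_def, conj_I, mul_one]
  rw [semi_neg]
  simp only [← neg_smul]
  congr 2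
  · linear_combination (√((1 + u (.inr 0)) / 2) : ℂ) * I_sq
  · ring

theorem rotP_mul_octB (hu : IsImUnit u) (ht : -1 < u (.inr 0)) (s : OctIdx → ℝ) :
    rotP u * octB s = octB ((octE (midUnit u) * octE octI) *ᵥ s) * rotP u := by
  rw [rotP_eq hu ht, neg_mul, mul_neg, Matrix.mul_assoc, octB_mul_octB isImUnit_octI,
    ← Matrix.mul_assoc, octB_mul_octB (isImUnit_midUnit hu ht), mulVec_mulVec, Matrix.mul_assoc]

/-- Extension of an octonionic matrix by the identity of the plane. -/
def extendOct (b : Matrix OctIdx OctIdx ℝ) : Matrix VecIdx VecIdx ℝ := fromBlocks b 0 0 1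

theorem extendOct_mul (b c : Matrix OctIdx OctIdx ℝ) :
    extendOct (b * c) = extendOct b * extendOct c := by
  simp [extendOct, fromBlocks_multiply]

theorem extendOct_transpose (b : Matrix OctIdx OctIdx ℝ) : (extendOct b)ᵀ = extendOct bᵀ := by
  simp [extendOct, fromBlocks_transpose]

theorem extendOct_one : extendOct 1 = 1 := fromBlocks_one

theorem extendOct_transpose_mul {b : Matrix OctIdx OctIdx ℝ} (hb : bᵀ * b = 1) :
    (extendOct b)ᵀ * extendOct b = 1 := by
  rw [extendOct_transpose, ← extendOct_mul, hb, extendOct_one]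

theorem isLift_extendOct {b R : Matrix OctIdx OctIdx ℝ} (hb : bᵀ * b = 1) (hR : Rᵀ * R = 1)
    (h : ∀ s, b * octB s = octB (R *ᵥ s) * b) :
    IsLift ((fromBlocks b 0 0 R).map ofReal) (extendOct b) where
  unitary := by
    rw [conjTranspose_map_ofReal, ← map_ofReal_mul, fromBlocks_transpose, fromBlocks_multiply]
    simp [hb, hR, map_ofReal_one]
  cliff_mulVec z := by
    have hb' := mul_eq_one_comm.1 hb
    have hR' := mul_eq_one_comm.1 hR
    have hG : ∀ v : OctIdx → ℝ, b * octG v * Rᵀ = octG (b *ᵥ v) := fun v => by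
      refine ext_of_mulVec fun s => ?_
      rw [← mulVec_mulVec, ← mulVec_mulVec, octG_mulVec, octG_mulVec, mulVec_mulVec, h,
        mulVec_mulVec, hR', one_mulVec, mulVec_mulVec]
    have hGC : ∀ v : OctIdx → ℂ, b.map ofReal * octG v * Rᵀ.map ofReal =
        octG (b.map ofReal *ᵥ v) := fun v => by
      have hv : v = ofReal ∘ (fun i => (v i).re) + I • (ofReal ∘ fun i => (v i).im) := by
        ext i; simp [mul_comm I, re_add_im]
      have key : ∀ w : OctIdx → ℝ, b.map ofReal * octG (ofReal ∘ w) * Rᵀ.map ofReal =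
          octG (b.map ofReal *ᵥ (ofReal ∘ w)) := fun w => by
        have e1 : (octG (ofReal ∘ w) : Matrix OctIdx OctIdx ℂ) = (octG w).map ofReal :=
          octG_map ofRealHom w
        have e2 : b.map ofReal *ᵥ (ofReal ∘ w) = ofReal ∘ (b *ᵥ w) := by
          ext i; simp [mulVec, dotProduct]
        have e3 : (octG (ofReal ∘ (b *ᵥ w)) : Matrix OctIdx OctIdx ℂ) = (octG (b *ᵥ w)).map ofReal :=
          octG_map ofRealHom _
        rw [e1, e2, e3, ← map_ofReal_mul, ← map_ofReal_mul, hG]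
      rw [hv, mulVec_add, mulVec_smul, octG_add, octG_smul, octG_add, octG_smul, mul_add, add_mul,
        key, mul_smul_comm, smul_mul_assoc, key]
    have bC : b.map ofReal * bᵀ.map ofReal = 1 := by rw [← map_ofReal_mul, hb', map_ofReal_one]
    have RC : R.map ofReal * Rᵀ.map ofReal = 1 := by rw [← map_ofReal_mul, hR', map_ofReal_one]
    have hGT : ∀ v : OctIdx → ℂ, R.map ofReal * (octG v)ᵀ * bᵀ.map ofReal =
        (octG (b.map ofReal *ᵥ v))ᵀ := fun v => by
      rw [← hGC, transpose_mul, transpose_mul, ← Matrix.mul_assoc]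
      simp [transpose_map]
    have e0 : (extendOct b).map ofReal *ᵥ z = Sum.elim (b.map ofReal *ᵥ (z ∘ Sum.inl))
        (z ∘ Sum.inr) := by
      rw [extendOct, fromBlocks_map, map_ofReal_one, fromBlocks_mulVec]
      simp
    rw [e0, cliff, cliff, fromBlocks_map, fromBlocks_transpose, fromBlocks_multiply,
      fromBlocks_multiply]
    simp only [Matrix.map_zero _ ofReal_zero, transpose_zero, Matrix.zero_mul, Matrix.mul_zero, smul_zero,
      add_zero, zero_add, mul_smul_comm, smul_mul_assoc, Matrix.mul_one, ← transpose_map, bC, RC,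
      hGC, hGT]
    rfl

/-- The pure spinor attached to an imaginary unit. -/
def unitSpinor (u : OctIdx → ℝ) : OctIdx ⊕ OctIdx → ℂ :=
  Sum.elim 0 (ofReal ∘ octOne + I • (ofReal ∘ u))

theorem octE_midUnit_mulVec_octI (ht : -1 < u (.inr 0)) :
    octE (midUnit u) *ᵥ octI = u := by
  have h0 : 0 < (1 + u (.inr 0)) / 2 := by linarith
  have h2 := (Real.sqrt_pos.2 h0).ne'
  have h1 := Real.mul_self_sqrt h0.le
  rw [octE_mulVec, dotProduct_comm, octI_dotProduct, midUnit, smul_smul]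
  have e : 2 * ((2 * √((1 + u (.inr 0)) / 2))⁻¹ • (u + octI)) (.inr 0) *
      (2 * √((1 + u (.inr 0)) / 2))⁻¹ = 1 := by
    simp only [Pi.smul_apply, Pi.add_apply, octI, Pi.single_eq_same, smul_eq_mul]
    field_simp
    nlinarith
  rw [e]
  simp [octI]

theorem spinT_extendOct_rotP (hu : IsImUnit u) (ht : -1 < u (.inr 0)) :
    spinT (extendOct (rotP u)) = vecMulVec (unitSpinor u) (unitSpinor u) := by
  have hm := isImUnit_midUnit hu ht
  have hR : (octE (midUnit u) * octE octI)ᵀ * (octE (midUnit u) * octE octI) = 1 :=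
    transpose_mul_self_mul (by rw [octE_transpose, octE_mul_self hm])
      (by rw [octE_transpose, octE_mul_self isImUnit_octI])
  have hl := isLift_extendOct (rotP_transpose_mul hu ht) hR (rotP_mul_octB hu ht)
  have hs : ((fromBlocks (rotP u) 0 0 (octE (midUnit u) * octE octI)).map ofReal) *ᵥ spinor₀ =
      unitSpinor u := by
    have e0 : spinor₀ = unitSpinor octI := by
      ext (i | i | i)
      · simp [spinor₀, unitSpinor]
      · by_cases h : i = 0 <;> simp [spinor₀, unitSpinor, octOne, octI, Pi.single_apply, h]
      · by_cases h : i = 0 <;> simp [spinor₀, unitSpinor, octOne, octI, Pi.single_apply, h]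
    have eO : ∀ w : OctIdx → ℝ, (octE (midUnit u) * octE octI).map ofReal *ᵥ (ofReal ∘ w) =
        ofReal ∘ ((octE (midUnit u) * octE octI) *ᵥ w) := fun w => by
      ext i; simp [mulVec, dotProduct]
    have eI : octE octI *ᵥ octI = octI := by
      rw [octE_mulVec, isImUnit_octI.unit, isImUnit_octI.re_eq_zero]
      ext i
      simp
      ring
    rw [e0, unitSpinor, fromBlocks_map, fromBlocks_mulVec, Sum.elim_comp_inl, Sum.elim_comp_inr, Matrix.map_zero _ ofReal_zero, zero_mulVec,
      zero_mulVec, mulVec_zero, mulVec_add, mulVec_smul, eO, eO, ← mulVec_mulVec, ← mulVec_mulVec,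
      octE_mulVec_octOne isImUnit_octI, octE_mulVec_octOne hm, eI, octE_midUnit_mulVec_octI ht,
      unitSpinor]
    simp
  have := hl.spinT_mul 1
  rw [mul_one, spinT_one, mul_vecMulVec, vecMulVec_mul, vecMul_transpose, hs] at this
  exact this

end Lifting

end Matrix

namespace Matrix

open Complex

section Adapted

variable {u : OctIdx → ℝ} {A : Matrix VecIdx VecIdx ℝ}
  {g : Matrix (OctIdx ⊕ OctIdx) (OctIdx ⊕ OctIdx) ℂ}

/-- The complex structure attached to an imaginary unit. -/
def unitJ (u : OctIdx → ℝ) : Matrix VecIdx VecIdx ℝ := fromBlocks (-octB u) 0 0 planeJ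

theorem cliffStar_isoVec_mulVec_spinor₀ (j : Fin 4 ⊕ Fin 1) :
    cliffStar (isoVec j) *ᵥ spinor₀ = 0 := by
  have h0 : octI = Pi.single (Sum.inr 0) (1 : ℝ) := rfl
  rcases j with j | j
  · have e : isoVec (.inl j) ∘ Sum.inl = (Sum.elim (fun i => if i = j then 1 else 0)
      (fun i => if i = j then I else 0) : OctIdx → ℂ) := rfl
    have e8 : isoVec (.inl j) (.inr 0) = 0 := rfl
    have e9 : isoVec (.inl j) (.inr 1) = 0 := rfl
    rw [cliffStar, e8, e9, spinor₀, fromBlocks_mulVec, Sum.elim_comp_inl, Sum.elim_comp_inr,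
      octG_mulVec, e]
    ext (i | i)
    · fin_cases j <;> rcases i with i | i <;> fin_cases i <;>
        simp [octB, quatL, quatR, mulVec, dotProduct, Fintype.sum_sum_type, Fin.sum_univ_four]
    · simp
  · have e : isoVec (.inr j) ∘ Sum.inl = (0 : OctIdx → ℂ) := rfl
    have e8 : isoVec (.inr j) (.inr 0) = 1 := rfl
    have e9 : isoVec (.inr j) (.inr 1) = I := rfl
    rw [cliffStar, e8, e9, e, octG_zero, spinor₀, fromBlocks_mulVec]
    ext (i | i) <;> simp

theorem cliffStar_mulVec_eq_zero (hg : IsLift g A) {z : VecIdx → ℂ}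
    (hz : cliffStar z *ᵥ spinor₀ = 0) :
    cliffStar (A.map ofReal *ᵥ z) *ᵥ (g *ᵥ spinor₀) = 0 := by
  rw [← hg.cliffStar_mulVec, mulVec_mulVec, Matrix.mul_assoc, hg.unitary, Matrix.mul_one,
    ← mulVec_mulVec, hz, mulVec_zero]

theorem unitJ_mulVec {u : OctIdx → ℝ} {z : VecIdx → ℂ} (hu : IsImUnit u)
    (h : cliffStar z *ᵥ unitSpinor u = 0) : (unitJ u).map ofReal *ᵥ z = -I • z := by
  have e0 : octB (ofReal ∘ octOne : OctIdx → ℂ) = 1 := by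
    rw [show (ofReal ∘ octOne : OctIdx → ℂ) = Pi.single (.inl 0) 1 by
      ext i; by_cases hi : i = Sum.inl 0 <;> simp [octOne, Pi.single_apply, hi], octB_single]
  have e1 : octB (ofReal ∘ u : OctIdx → ℂ) = (octB u).map ofReal := octB_map ofRealHom u
  rw [cliffStar, unitSpinor, fromBlocks_mulVec, Sum.elim_comp_inl, Sum.elim_comp_inr, octG_mulVec,
    mulVec_zero, mulVec_zero, zero_add, zero_add, octB_add, octB_smul, e0, e1, add_mulVec,
    one_mulVec, smul_mulVec] at h
  have h1 : ∀ i, z (.inl i) + I * ((octB u).map ofReal *ᵥ (z ∘ Sum.inl)) i = 0 := fun i => by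
    simpa using congrFun h (.inl i)
  have h2 : -z (.inr 0) - I * z (.inr 1) = 0 := by
    simpa [octOne, hu.re_eq_zero, smul_mulVec] using congrFun h (.inr (.inl 0))
  rw [unitJ, fromBlocks_map, fromBlocks_mulVec]
  ext (i | i)
  · have e2 : (-octB u).map ofReal = -(octB u).map ofReal := by ext i j; simp
    simp only [Matrix.map_zero _ ofReal_zero, zero_mulVec, add_zero, e2, neg_mulVec, Sum.elim_inl,
      Pi.neg_apply, Pi.smul_apply, smul_eq_mul]
    linear_combination I * h1 i - ((octB u).map ofReal *ᵥ (z ∘ Sum.inl)) i * I_sq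
  · fin_cases i
    · simp [planeJ, mulVec, dotProduct]
      linear_combination I * h2 + z (.inr 1) * I_sq
    · simp [planeJ, mulVec, dotProduct]
      linear_combination -h2

theorem unitJ_mul (hg : IsLift g A) (hu : IsImUnit u) {s : ℂ} (hs : s ≠ 0)
    (h : g *ᵥ spinor₀ = s • unitSpinor u) : unitJ u * A = A * stdJ := by
  have h1 : ∀ j, (unitJ u * A).map ofReal *ᵥ isoVec j = (A * stdJ).map ofReal *ᵥ isoVec j := by
    intro j
    have e := cliffStar_mulVec_eq_zero hg (cliffStar_isoVec_mulVec_spinor₀ j)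
    rw [h, mulVec_smul, smul_eq_zero_iff_right hs] at e
    have e2 : stdJ.map ofReal *ᵥ isoVec j = -I • isoVec j := by
      have e3 := congrFun (congrArg (fun M => M) isoMat_mul_stdJ) j
      have e4 : stdJ.map ofReal = -((stdJ.map ofReal)ᵀ) := by
        rw [← transpose_map, stdJ_transpose]; ext i j; simp
      rw [e4, neg_mulVec, mulVec_transpose, neg_smul]
      exact congrArg Neg.neg e3
    rw [map_ofReal_mul, map_ofReal_mul, ← mulVec_mulVec, ← mulVec_mulVec, unitJ_mulVec hu e, e2,
      mulVec_smul]
  rw [← sub_eq_zero]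
  ext i k
  have h2 : cxVec ((unitJ u * A - A * stdJ) i) = 0 := by
    ext j
    have e := congrFun (h1 j) i
    rw [← sub_eq_zero] at e
    simp only [cxVec, isoMat, mulVec, dotProduct, map_apply, of_apply, Function.comp_apply,
      sub_apply, Pi.zero_apply, Pi.sub_apply] at e ⊢
    rw [← e, ← Finset.sum_sub_distrib]
    refine Finset.sum_congr rfl fun k _ => ?_
    push_cast
    ring
  exact congrFun (cxVec_eq_zero h2) k

/-- A rotation whose pure spinor is the standard one attached to `u`. -/
structure IsAdapted (A : Matrix VecIdx VecIdx ℝ) (u : OctIdx → ℝ) : Prop where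
  isImUnit : IsImUnit u
  spinT_eq : spinT A = vecMulVec (unitSpinor u) (unitSpinor u)
  unitJ_mul : unitJ u * A = A * stdJ

theorem dotProduct_cliffStar_spinor₀ (z : VecIdx → ℂ) :
    spinor₀ ⬝ᵥ (cliffStar z *ᵥ spinor₀) = 0 := by
  rw [cliffStar, spinor₀, fromBlocks_mulVec]
  simp [dotProduct, Fintype.sum_sum_type, smul_mulVec]
  ring_nf
  simp

theorem IsLift.dotProduct_cliffStar (hg : IsLift g A) (hA : Aᵀ * A = 1) (z : VecIdx → ℂ) :
    (g *ᵥ spinor₀) ⬝ᵥ (cliffStar z *ᵥ (g *ᵥ spinor₀)) = 0 := by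
  have e : A.map ofReal *ᵥ (Aᵀ.map ofReal *ᵥ z) = z := by
    rw [mulVec_mulVec, ← map_ofReal_mul, mul_eq_one_comm.1 hA, map_ofReal_one, one_mulVec]
  have h := hg.cliffStar_mulVec (Aᵀ.map ofReal *ᵥ z)
  rw [e] at h
  rw [← h, mulVec_mulVec, Matrix.mul_assoc, hg.unitary, Matrix.mul_one, ← mulVec_mulVec,
    dotProduct_mulVec, ← mulVec_transpose, mulVec_mulVec]
  have e2 : (g.map star)ᵀ * g = 1 := hg.unitary
  rw [e2, one_mulVec, dotProduct_cliffStar_spinor₀]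

theorem exists_isAdapted (hg : IsLift g A) (hA : Aᵀ * A = 1) {s : ℝ} (hs : s * s = 1)
    (hl : ∀ i, ((g *ᵥ spinor₀) (.inl i)).re = 0)
    (hr : ∀ i, ((g *ᵥ spinor₀) (.inr i)).re = s * octOne i) : ∃ u, IsAdapted A u := by
  set φ := g *ᵥ spinor₀ with hφ
  let p : OctIdx → ℝ := fun i => (φ (.inl i)).im
  let u : OctIdx → ℝ := fun i => s * (φ (.inr i)).im
  have hs0 : (s : ℂ) * s = 1 := by exact_mod_cast hs
  have eφ : φ = Sum.elim (I • (ofReal ∘ p)) ((s : ℂ) • (ofReal ∘ octOne + I • (ofReal ∘ u))) := by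
    ext (i | i)
    · rw [← re_add_im (φ (.inl i)), hl]; simp [p, mul_comm]
    · rw [← re_add_im (φ (.inr i)), hr]
      simp only [u, Sum.elim_inr, Pi.smul_apply, Pi.add_apply, Function.comp_apply, smul_eq_mul]
      push_cast
      linear_combination -I * (φ (.inr i)).im * hs0
  have hre : ∀ w : OctIdx → ℝ, (ofReal ∘ octOne : OctIdx → ℂ) ⬝ᵥ (ofReal ∘ w) = w (.inl 0) := by
    intro w
    rw [ofReal_comp_dotProduct, octOne_dotProduct]
  have key : ∀ z : VecIdx → ℂ, z ∘ Sum.inl = 0 →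
      -(z (.inr 0) - I * z (.inr 1)) * (p ⬝ᵥ p : ℝ) + (-z (.inr 0) - I * z (.inr 1)) *
        (1 + 2 * I * u (.inl 0) - (u ⬝ᵥ u : ℝ)) = 0 := by
    intro z hz
    have h := hg.dotProduct_cliffStar hA z
    have e1 : ((octOne (.inl 0) : ℝ) : ℂ) = 1 := by simp [octOne]
    rw [← hφ, eφ, cliffStar, hz, octG_zero, fromBlocks_mulVec, Sum.elim_comp_inl,
      Sum.elim_comp_inr, sumElim_dotProduct_sumElim] at h
    simp only [transpose_zero, zero_mulVec, add_zero, zero_add, smul_mulVec, one_mulVec,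
      dotProduct_smul, smul_dotProduct, smul_eq_mul, add_dotProduct, dotProduct_add, hre, e1,
      dotProduct_comm _ (ofReal ∘ octOne), ofReal_comp_dotProduct] at h
    linear_combination h - (z (.inr 0) - I * z (.inr 1)) * (p ⬝ᵥ p : ℝ) * I_sq -
      (-z (.inr 0) - I * z (.inr 1)) * (1 + 2 * I * u (.inl 0) + I ^ 2 * (u ⬝ᵥ u : ℝ)) * hs0 -
      (-z (.inr 0) - I * z (.inr 1)) * (u ⬝ᵥ u : ℝ) * I_sq
  have k8 := key (Pi.single (.inr 0) 1) (by ext i; simp)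
  have k9 := key (Pi.single (.inr 1) I) (by ext i; simp)
  simp only [Pi.single_eq_same, ne_eq, Sum.inr.injEq, Pi.single_eq_of_ne, zero_ne_one, one_ne_zero,
    not_false_eq_true, mul_zero, zero_sub, sub_zero, I_mul_I, neg_zero] at k8 k9
  have r8 := congrArg re k8
  have i8 := congrArg im k8
  have r9 := congrArg re k9
  simp at r8 i8 r9
  have hp : p = 0 := dotProduct_self_eq_zero.1 (by linarith)
  have hu : IsImUnit u := ⟨i8, by linarith⟩
  have eφ' : φ = (s : ℂ) • unitSpinor u := by
    rw [eφ, hp, unitSpinor]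
    ext (i | i) <;> simp [mul_add]
  have hsn : (s : ℂ) ≠ 0 := left_ne_zero_of_mul_eq_one hs0
  refine ⟨u, hu, ?_, Matrix.unitJ_mul hg hu hsn eφ'⟩
  have := hg.spinT_mul 1
  rw [mul_one, spinT_one, mul_vecMulVec, vecMulVec_mul, vecMul_transpose, ← hφ, eφ',
    smul_vecMulVec, vecMulVec_smul, smul_smul, hs0, one_smul] at this
  exact this

/-- The imaginary unit read off from a rotation. -/
def unitOf (A : Matrix VecIdx VecIdx ℝ) : OctIdx → ℝ :=
  fun i => (spinT A (.inr i) (.inr (.inl 0))).im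

theorem IsAdapted.eq_unitOf (h : IsAdapted A u) : u = unitOf A := by
  ext i
  rw [unitOf, h.spinT_eq, vecMulVec_apply]
  simp [unitSpinor, h.isImUnit.re_eq_zero, octOne]

variable {b : Matrix OctIdx OctIdx ℝ}

theorem IsAdapted.mul_stdJ (h : IsAdapted A u) (hb : bᵀ * b = 1)
    (hJ : octB u * b = -(b * octJ)) :
    (extendOct b)ᵀ * A * stdJ = stdJ * ((extendOct b)ᵀ * A) := by
  have h1 : unitJ u * extendOct b = extendOct b * stdJ := by
    rw [unitJ, extendOct, stdJ, fromBlocks_multiply, fromBlocks_multiply]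
    simp [hJ]
  have h2 : (extendOct b)ᵀ * unitJ u = stdJ * (extendOct b)ᵀ := by
    have e := mul_eq_one_comm.1 (extendOct_transpose_mul hb)
    calc _ = (extendOct b)ᵀ * unitJ u * (extendOct b * (extendOct b)ᵀ) := by rw [e, Matrix.mul_one]
      _ = (extendOct b)ᵀ * (unitJ u * extendOct b) * (extendOct b)ᵀ := by
        simp only [Matrix.mul_assoc]
      _ = _ := by
        rw [h1, ← Matrix.mul_assoc, extendOct_transpose_mul hb, Matrix.one_mul]
  rw [Matrix.mul_assoc, ← h.unitJ_mul, ← Matrix.mul_assoc, h2, Matrix.mul_assoc]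

theorem IsAdapted.det_cx (h : IsAdapted A u) (ht : -1 < u (.inr 0)) :
    (cx ((extendOct (rotP u))ᵀ * A)).det = 1 := by
  have hb := rotP_transpose_mul h.isImUnit ht
  have hm := isImUnit_midUnit h.isImUnit ht
  have hR : (octE (midUnit u) * octE octI)ᵀ * (octE (midUnit u) * octE octI) = 1 :=
    transpose_mul_self_mul (by rw [octE_transpose, octE_mul_self hm])
      (by rw [octE_transpose, octE_mul_self isImUnit_octI])
  have hl := (isLift_extendOct hb hR (rotP_mul_octB h.isImUnit ht)).inv (extendOct_transpose_mul hb)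
  refine det_cx_of_spinT (h.mul_stdJ hb (octB_mul_rotP h.isImUnit ht)) ?_
  rw [hl.spinT_mul, h.spinT_eq, ← spinT_extendOct_rotP h.isImUnit ht, ← hl.spinT_mul,
    extendOct_transpose_mul hb]

theorem cx_transpose_mul {C : Matrix VecIdx VecIdx ℝ} (h : C * stdJ = stdJ * C) (hC : Cᵀ * C = 1) :
    (cx C)ᴴ * cx C = 1 := by
  have h' : Cᵀ * stdJ = stdJ * Cᵀ := by
    have := congrArg transpose h
    rw [transpose_mul, transpose_mul, stdJ_transpose, neg_mul, mul_neg, neg_inj] at this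
    exact this.symm
  rw [← cx_transpose, ← cx_mul h', hC, cx_one]

theorem extendOct_semi_mul_stdJ (W : Matrix (Fin 4) (Fin 4) ℂ) :
    extendOct (semi W 0) * stdJ = stdJ * extendOct (semi W 0) := by
  rw [extendOct, stdJ, fromBlocks_multiply, fromBlocks_multiply]
  simp [semi_zero_mul_octJ]

theorem cx_extendOct_semi (W : Matrix (Fin 4) (Fin 4) ℂ) :
    cx (extendOct (semi W 0)) = fromBlocks W 0 0 1 := by
  ext (i | i) (j | j)
  · have h : ∀ x, (starRingEnd ℂ) (if x = j then I else 0) = if x = j then -I else 0 := fun x => by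
      split_ifs <;> simp
    simp [cx, extendOct, isoMat, isoVec, semi, mul_apply, Fintype.sum_sum_type, h]
    apply Complex.ext <;> simp <;> ring
  · simp [cx, extendOct, isoMat, isoVec, semi, mul_apply, Fintype.sum_sum_type]
  · simp [cx, extendOct, isoMat, isoVec, semi, mul_apply, Fintype.sum_sum_type]
  · simp [cx, extendOct, isoMat, isoVec, semi, mul_apply, Fintype.sum_sum_type, one_apply]
    norm_num [Subsingleton.elim i j]

end Adapted

end Matrix

namespace Matrix

open Complex

section Coincidence

variable {u : OctIdx → ℝ} {A : Matrix VecIdx VecIdx ℝ} {b : Matrix OctIdx OctIdx ℝ}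

theorem IsAdapted.cx_mulVec_of_mulVec_eq_zero (h : IsAdapted A u) (hb : bᵀ * b = 1)
    (hJ : octB u * b = -(b * octJ)) (W : Matrix (Fin 4) (Fin 4) ℂ) {ζ : ℂ} {w : VecIdx → ℝ}
    (hw : (A + extendOct (b * semi W 0) * realOf ζ) *ᵥ w = 0) :
    cx ((extendOct b)ᵀ * A) *ᵥ cxVec w =
      -ζ • ((fromBlocks W 0 0 1 : Matrix (Fin 4 ⊕ Fin 1) (Fin 4 ⊕ Fin 1) ℂ) *ᵥ cxVec w) := by
  have e1 : ((extendOct b)ᵀ * A) *ᵥ w = (-1 : ℝ) • (extendOct (semi W 0) *ᵥ (realOf ζ *ᵥ w)) := by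
    rw [add_mulVec, ← eq_neg_iff_add_eq_zero] at hw
    rw [← mulVec_mulVec, hw, mulVec_neg, mulVec_mulVec, extendOct_mul, Matrix.mul_assoc,
      ← Matrix.mul_assoc _ᵀ, extendOct_transpose_mul hb, Matrix.one_mul, ← mulVec_mulVec,
      neg_one_smul]
  rw [cx_mulVec_cxVec (h.mul_stdJ hb hJ), e1, cxVec_smul,
    ← cx_mulVec_cxVec (extendOct_semi_mul_stdJ W), cxVec_realOf, cx_extendOct_semi, mulVec_smul,
    smul_smul]
  simp

theorem fromBlocks_one_add_vecMulVec (c d : Fin 4 → ℂ) :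
    (fromBlocks (1 + vecMulVec c d) 0 0 1 : Matrix (Fin 4 ⊕ Fin 1) (Fin 4 ⊕ Fin 1) ℂ) =
      1 + vecMulVec (Sum.elim c 0) (Sum.elim d 0) := by
  rw [← fromBlocks_one]
  ext (i | i) (j | j) <;> simp [vecMulVec_apply, one_apply]

theorem fromBlocks_conjTranspose_mul {W : Matrix (Fin 4) (Fin 4) ℂ} (hW : Wᴴ * W = 1) :
    (fromBlocks W 0 0 1 : Matrix (Fin 4 ⊕ Fin 1) (Fin 4 ⊕ Fin 1) ℂ)ᴴ * fromBlocks W 0 0 1 = 1 := by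
  rw [fromBlocks_conjTranspose, fromBlocks_multiply]
  simp [hW]

/-- The reference rotation used at level `s`. -/
def rotAt (s : ℝ) (u : OctIdx → ℝ) : Matrix OctIdx OctIdx ℝ :=
  if s < u (.inr 0) then rotP u else rotM u

/-- An adapted rotation cannot be degenerate relative to six of the reference rotations. -/
theorem IsAdapted.false_of_six_degenerate (h : IsAdapted A u) (hA : Aᵀ * A = 1) {I : Type*}
    [Fintype I] [DecidableEq I] (hI : 6 ≤ Fintype.card I) {ζ : I → ℂ} (hζ : Function.Injective ζ)
    {s : I → ℝ} (h0 : ∀ i, 0 < s i) (h1 : ∀ i, s i < 1) (hs : ∀ i, s i ≠ u (.inr 0))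
    (hlt : ∀ i j, s i < s j → Complex.normSq (1 - ζ j) < Complex.normSq (1 - ζ i))
    (hsmall : ∀ i, Complex.normSq (1 - ζ i) ≤ 1 / 100)
    (hdet : ∀ i, (A + extendOct (rotAt (s i) u) * realOf (ζ i)).det = 0) : False := by
  have hex : ∀ i, ∃ w, w ≠ 0 ∧ (A + extendOct (rotAt (s i) u) * realOf (ζ i)) *ᵥ w = 0 := fun i =>
    exists_mulVec_eq_zero_iff.2 (hdet i)
  choose w hw0 hw using hex
  let P := Finset.univ.filter fun i => s i < u (.inr 0)
  let Q := Finset.univ.filter fun i => ¬ s i < u (.inr 0)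
  have hPQ : 6 ≤ P.card + Q.card := by
    rw [Finset.card_filter_add_card_filter_not]
    exact hI
  have hP : ∀ i ∈ P, s i < u (.inr 0) := fun i hi => (Finset.mem_filter.1 hi).2
  have hQ : ∀ i ∈ Q, u (.inr 0) < s i := fun i hi =>
    lt_of_le_of_ne (not_lt.1 (Finset.mem_filter.1 hi).2) (hs i).symm
  have hwP : ∀ i ∈ P, (A + extendOct (rotP u * semi 1 0) * realOf (ζ i)) *ᵥ w i = 0 := fun i hi => by
    rw [semi_one, Matrix.mul_one, ← hw i, rotAt, if_pos (hP i hi)]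
  have hwQ : ∀ i ∈ Q, (A + extendOct (rotM u) * realOf (ζ i)) *ᵥ w i = 0 := fun i hi => by
    rw [← hw i, rotAt, if_neg (not_lt.2 (hQ i hi).le)]
  have hx0 : ∀ i, cxVec (w i) ≠ 0 := fun i h => hw0 i (cxVec_eq_zero h)
  have hlt' : ∀ i ∈ P, ∀ j ∈ Q, Complex.normSq (1 - ζ j) < Complex.normSq (1 - ζ i) :=
    fun i hi j hj => hlt i j ((hP i hi).trans (hQ j hj))
  have hu := h.isImUnit
  have hκ : Fintype.card (Fin 4 ⊕ Fin 1) = 5 := by simp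
  have hU : ∀ {b : Matrix OctIdx OctIdx ℝ}, bᵀ * b = 1 → octB u * b = -(b * octJ) →
      (cx ((extendOct b)ᵀ * A))ᴴ * cx ((extendOct b)ᵀ * A) = 1 := fun {b} hb hJ =>
    cx_transpose_mul (h.mul_stdJ hb hJ) <| by
      rw [transpose_mul, transpose_transpose, Matrix.mul_assoc, ← Matrix.mul_assoc (extendOct b),
        mul_eq_one_comm.1 (extendOct_transpose_mul hb), Matrix.one_mul, hA]
  have hone : (1 : Matrix (Fin 4 ⊕ Fin 1) (Fin 4 ⊕ Fin 1) ℂ)ᴴ * 1 = 1 := by simp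
  have hone' : ∃ c d, (1 : Matrix (Fin 4 ⊕ Fin 1) (Fin 4 ⊕ Fin 1) ℂ) = 1 + vecMulVec c d :=
    ⟨0, 0, by simp⟩
  rcases lt_or_ge (u (.inr 0)) 0 with ht | ht
  · have hb := rotM_transpose_mul hu (ht.trans one_pos)
    have hJ := octB_mul_rotM hu
    have hP0 : ¬ P.Nonempty := fun ⟨i, hi⟩ => by linarith [hP i hi, h0 i]
    refine false_of_six_coincidences hκ (hU hb hJ) hone hPQ hζ hx0
      (fun i hi => (hP0 ⟨i, hi⟩).elim) (fun i hi => ?_) hlt' hsmall fun h => (hP0 h).elim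
    rw [h.cx_mulVec_of_mulVec_eq_zero hb hJ 1 (by rw [semi_one, Matrix.mul_one]; exact hwQ i hi),
      fromBlocks_one]
  · have hb := rotP_transpose_mul hu (by linarith)
    have hJ := octB_mul_rotP hu (by linarith)
    have hd := h.det_cx (by linarith)
    have hP' : ∀ i ∈ P, cx ((extendOct (rotP u))ᵀ * A) *ᵥ cxVec (w i) = -ζ i • cxVec (w i) :=
      fun i hi => by
        rw [h.cx_mulVec_of_mulVec_eq_zero hb hJ 1 (hwP i hi), fromBlocks_one, one_mulVec]
    rcases lt_or_ge (u (.inr 0)) 1 with ht1 | ht1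
    · obtain ⟨c, d, hcd⟩ := exists_tauU_eq u
      refine false_of_six_coincidences hκ (hU hb hJ)
        (fromBlocks_conjTranspose_mul (conjTranspose_tauU_mul hu (by linarith) ht1)) hPQ hζ hx0 hP'
        (fun i hi => h.cx_mulVec_of_mulVec_eq_zero hb hJ _ ?_) hlt' hsmall
        fun _ => ⟨hd, _, _, hcd ▸ fromBlocks_one_add_vecMulVec c d⟩
      rw [← rotM_eq_rotP_mul hu ht ht1]
      exact hwQ i hi
    · refine false_of_six_coincidences hκ (hU hb hJ) hone hPQ hζ hx0 hP'
        (fun i hi => ?_) hlt' hsmall fun _ => ⟨hd, hone'⟩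
      linarith [hQ i hi, h1 i]

end Coincidence

end Matrix

namespace Matrix

open Complex

section UnitPath

variable {u : OctIdx → ℝ} {e h : ℝ}

/-- The segment from `u` to `e • octI`. -/
def unitSeg (e : ℝ) (u : OctIdx → ℝ) (h : ℝ) : OctIdx → ℝ := (1 - h) • u + (h * e) • octI

/-- The great-circle arc from `u` to `e • octI`. -/
def unitPath (e : ℝ) (u : OctIdx → ℝ) (h : ℝ) : OctIdx → ℝ :=
  (√(unitSeg e u h ⬝ᵥ unitSeg e u h))⁻¹ • unitSeg e u h

theorem unitSeg_dotProduct (hu : IsImUnit u) (he : e * e = 1) :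
    unitSeg e u h ⬝ᵥ unitSeg e u h =
      (e * ((1 - h) * u (.inr 0)) + h) ^ 2 + (1 - h) ^ 2 * (1 - u (.inr 0) ^ 2) := by
  have h1 : octI ⬝ᵥ octI = 1 := isImUnit_octI.unit
  simp only [unitSeg, add_dotProduct, dotProduct_add, smul_dotProduct, dotProduct_smul, smul_eq_mul,
    octI_dotProduct, dotProduct_comm u octI, hu.unit, h1]
  linear_combination (h * h - (1 - h) ^ 2 * u (.inr 0) ^ 2) * he

theorem unitSeg_dotProduct_pos (hu : IsImUnit u) (he : e * e = 1) (ht : -1 < e * u (.inr 0))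
    (h0 : 0 ≤ h) : 0 < unitSeg e u h ⬝ᵥ unitSeg e u h ∧
      -√(unitSeg e u h ⬝ᵥ unitSeg e u h) < e * ((1 - h) * u (.inr 0)) + h := by
  rw [unitSeg_dotProduct hu he]
  set t := u (.inr 0)
  have hsq : t ^ 2 ≤ 1 := hu.sq_le_one
  have hsq' : (e * t) ^ 2 ≤ 1 := by rw [mul_pow, sq e, he, one_mul]; exact hsq
  have hN : 0 ≤ (1 - h) ^ 2 * (1 - t ^ 2) := mul_nonneg (sq_nonneg _) (by linarith)
  have het : (e * t) ^ 2 = t ^ 2 := by rw [mul_pow, sq e, he, one_mul]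
  have hc : 0 < e * ((1 - h) * t) + h ∨ 0 < (1 - h) ^ 2 * (1 - t ^ 2) := by
    by_cases h1 : 0 < (1 - h) ^ 2 * (1 - t ^ 2)
    · exact Or.inr h1
    · left
      have h2 : (1 - h) ^ 2 * (1 - t ^ 2) = 0 := le_antisymm (not_lt.1 h1) hN
      rcases mul_eq_zero.1 h2 with h3 | h3
      · have h4 : h = 1 := by nlinarith
        rw [h4]; norm_num
      · have h4 : (e * t - 1) * (e * t + 1) = 0 := by linear_combination -h3 + het
        rcases mul_eq_zero.1 h4 with h5 | h5
        · have : e * t = 1 := by linarith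
          nlinarith
        · linarith
  refine ⟨?_, ?_⟩
  · rcases hc with hc | hc
    · positivity
    · exact add_pos_of_nonneg_of_pos (sq_nonneg _) hc
  · rcases hc with hc | hc
    · exact (neg_nonpos.2 (Real.sqrt_nonneg _)).trans_lt hc
    · have := Real.lt_sqrt_of_sq_lt (x := -(e * ((1 - h) * t) + h))
        (y := (e * ((1 - h) * t) + h) ^ 2 + (1 - h) ^ 2 * (1 - t ^ 2)) (by nlinarith)
      linarith

theorem isImUnit_unitPath (hu : IsImUnit u) (he : e * e = 1) (ht : -1 < e * u (.inr 0))
    (h0 : 0 ≤ h) : IsImUnit (unitPath e u h) ∧ -1 < e * unitPath e u h (.inr 0) := by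
  obtain ⟨hp, hc⟩ := unitSeg_dotProduct_pos hu he ht h0
  have hs := Real.sqrt_pos.2 hp
  refine ⟨⟨?_, ?_⟩, ?_⟩
  · simp [unitPath, unitSeg, hu.re_eq_zero, octI]
  · rw [unitPath, smul_dotProduct, dotProduct_smul, smul_eq_mul, smul_eq_mul, ← mul_assoc,
      ← mul_inv, Real.mul_self_sqrt hp.le, inv_mul_cancel₀ hp.ne']
  · have e1 : e * unitPath e u h (.inr 0) =
        (e * ((1 - h) * u (.inr 0)) + h) / √(unitSeg e u h ⬝ᵥ unitSeg e u h) := by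
      rw [unitPath, Pi.smul_apply, smul_eq_mul, div_eq_inv_mul]
      generalize (√(unitSeg e u h ⬝ᵥ unitSeg e u h))⁻¹ = N
      simp only [unitSeg, Pi.add_apply, Pi.smul_apply, smul_eq_mul, octI, Pi.single_eq_same]
      linear_combination N * h * he
    rw [e1, lt_div_iff₀ hs]
    linarith

theorem unitPath_zero (hu : IsImUnit u) : unitPath e u 0 = u := by
  simp [unitPath, unitSeg, hu.unit]

theorem unitPath_one (he : e * e = 1) : unitPath e u 1 = e • octI := by
  simp [unitPath, unitSeg, octI_dotProduct, he, show octI (.inr 0) = 1 by simp [octI]]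

theorem continuous_unitSeg (e : ℝ) : Continuous fun p : (OctIdx → ℝ) × ℝ => unitSeg e p.1 p.2 := by
  unfold unitSeg
  fun_prop

theorem continuousOn_unitPath (he : e * e = 1) : ContinuousOn
    (fun p : (OctIdx → ℝ) × ℝ => unitPath e p.1 p.2)
    ({u | IsImUnit u ∧ -1 < e * u (.inr 0)} ×ˢ Set.Icc 0 1) := by
  have hc := continuous_unitSeg e
  refine ContinuousOn.smul (ContinuousOn.inv₀
    (f := fun p : (OctIdx → ℝ) × ℝ => √(unitSeg e p.1 p.2 ⬝ᵥ unitSeg e p.1 p.2)) ?_ ?_) hc.continuousOn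
  · exact (Real.continuous_sqrt.comp (hc.dotProduct hc)).continuousOn
  · rintro ⟨u, h⟩ ⟨⟨hu, ht⟩, h0, -⟩
    exact (Real.sqrt_pos.2 (unitSeg_dotProduct_pos hu he ht h0).1).ne'

/-- The contracting deformation of the reference rotations. -/
def rotPath (s : ℝ) (u : OctIdx → ℝ) (h : ℝ) : Matrix OctIdx OctIdx ℝ :=
  if s < u (.inr 0) then rotP (unitPath 1 u h) else rotM (unitPath (-1) u h)

theorem rotPath_zero (hu : IsImUnit u) (s : ℝ) : rotPath s u 0 = rotAt s u := by
  rw [rotPath, rotAt, unitPath_zero hu, unitPath_zero hu]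

theorem rotPath_transpose_mul (hu : IsImUnit u) {s : ℝ} (h0 : 0 < s) (h1 : s < 1) (hh : 0 ≤ h) :
    (rotPath s u h)ᵀ * rotPath s u h = 1 := by
  rw [rotPath]
  split_ifs with ht
  · obtain ⟨a, b⟩ := isImUnit_unitPath (e := 1) hu (by norm_num) (by linarith) hh
    exact rotP_transpose_mul a (by linarith)
  · obtain ⟨a, b⟩ := isImUnit_unitPath (e := -1) hu (by norm_num) (by linarith) hh
    exact rotM_transpose_mul a (by linarith)

theorem rotPath_one_of_lt {s : ℝ} (ht : s < u (.inr 0)) : rotPath s u 1 = rotP octI := by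
  rw [rotPath, if_pos ht, unitPath_one (by norm_num), one_smul]

theorem rotPath_one_of_gt {s : ℝ} (ht : u (.inr 0) < s) : rotPath s u 1 = rotM (-octI) := by
  rw [rotPath, if_neg ht.not_gt, unitPath_one (by norm_num), neg_one_smul]

theorem continuousOn_rotPath_of_lt {s : ℝ} (h0 : 0 < s) : ContinuousOn
    (fun p : (OctIdx → ℝ) × ℝ => rotPath s p.1 p.2)
    ({u | IsImUnit u ∧ s < u (.inr 0)} ×ˢ Set.Icc 0 1) := by
  have hsub : ({u | IsImUnit u ∧ s < u (.inr 0)} ×ˢ Set.Icc 0 1 : Set ((OctIdx → ℝ) × ℝ)) ⊆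
      {u | IsImUnit u ∧ -1 < 1 * u (.inr 0)} ×ˢ Set.Icc 0 1 :=
    Set.prod_mono_left fun u hu => ⟨hu.1, by linarith [hu.2]⟩
  refine ContinuousOn.congr (f := fun p : (OctIdx → ℝ) × ℝ => rotP (unitPath 1 p.1 p.2))
    (continuousOn_rotP.comp ((continuousOn_unitPath (by norm_num)).mono hsub) ?_) ?_
  · intro p hp
    have := (isImUnit_unitPath (e := 1) hp.1.1 (by norm_num) (hsub hp).1.2 hp.2.1).2
    simpa using this
  · intro p hp
    exact if_pos hp.1.2

theorem continuousOn_rotPath_of_gt {s : ℝ} (h1 : s < 1) : ContinuousOn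
    (fun p : (OctIdx → ℝ) × ℝ => rotPath s p.1 p.2)
    ({u | IsImUnit u ∧ u (.inr 0) < s} ×ˢ Set.Icc 0 1) := by
  have hsub : ({u | IsImUnit u ∧ u (.inr 0) < s} ×ˢ Set.Icc 0 1 : Set ((OctIdx → ℝ) × ℝ)) ⊆
      {u | IsImUnit u ∧ -1 < -1 * u (.inr 0)} ×ˢ Set.Icc 0 1 :=
    Set.prod_mono_left fun u hu => ⟨hu.1, by linarith [hu.2]⟩
  refine ContinuousOn.congr (f := fun p : (OctIdx → ℝ) × ℝ => rotM (unitPath (-1) p.1 p.2))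
    (continuousOn_rotM.comp ((continuousOn_unitPath (by norm_num)).mono hsub) ?_) ?_
  · intro p hp
    obtain ⟨a, b⟩ := isImUnit_unitPath (e := -1) hp.1.1 (by norm_num) (hsub hp).1.2 hp.2.1
    exact ⟨a, by simpa using b⟩
  · intro p hp
    exact if_neg hp.1.2.not_gt

end UnitPath

end Matrix

namespace Matrix

open Complex

theorem octD_neg {R : Type*} [CommRing R] (s : Fin 4 ⊕ Fin 4 → R) : octD (-s) = -octD s :=
  ext_of_mulVec fun v => by rw [neg_mulVec]; simp only [← octG_transpose_mulVec, mulVec_neg]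

theorem octB_neg {R : Type*} [CommRing R] (s : Fin 4 ⊕ Fin 4 → R) : octB (-s) = -octB s :=
  ext_of_mulVec fun v => by rw [neg_mulVec]; simp only [← octG_mulVec, mulVec_neg]

theorem octD_octOne : octD octOne = 1 := by
  ext (i | i) (j | j) <;> fin_cases i <;> fin_cases j <;>
    simp [octD, quatL, quatR, quatK, octOne]

theorem octB_octOne : octB octOne = 1 := octB_single

theorem continuous_octD : Continuous (octD : (OctIdx → ℝ) → Matrix OctIdx OctIdx ℝ) := by
  refine continuous_matrix fun i j => ?_
  have e : ∀ s : OctIdx → ℝ, octD s i j = ((octG (Pi.single j 1))ᵀ *ᵥ s) i := fun s => by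
    rw [octG_transpose_mulVec, mulVec_single_one, col_apply]
  simp only [e]
  exact (continuous_apply i).comp (continuous_const.matrix_mulVec continuous_id)

theorem continuous_octB : Continuous (octB : (OctIdx → ℝ) → Matrix OctIdx OctIdx ℝ) := by
  refine continuous_matrix fun i j => ?_
  have e : ∀ s : OctIdx → ℝ, octB s i j = (octG (Pi.single j 1) *ᵥ s) i := fun s => by
    rw [octG_mulVec, mulVec_single_one, col_apply]
  simp only [e]
  exact (continuous_apply i).comp (continuous_const.matrix_mulVec continuous_id)

section RealLift

/-- The vector of the nine-dimensional subspace with components `v` and `c`. -/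
def vec9 (v : OctIdx → ℝ) (c : ℝ) : VecIdx → ℝ := Sum.elim v ![c, 0]

/-- Clifford multiplication by `vec9 v c` on real spinors. -/
def realCliff (v : OctIdx → ℝ) (c : ℝ) : Matrix (OctIdx ⊕ OctIdx) (OctIdx ⊕ OctIdx) ℝ :=
  fromBlocks (c • 1) (octG v) (octG v)ᵀ (-c • 1)

variable {v : OctIdx → ℝ} {c : ℝ}

theorem vec9_dotProduct_self (v : OctIdx → ℝ) (c : ℝ) : vec9 v c ⬝ᵥ vec9 v c = v ⬝ᵥ v + c * c := by
  rw [vec_dotProduct, show vec9 v c ∘ Sum.inl = v from rfl]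
  simp [vec9]

theorem vec9_ne_zero (h : 0 < v ⬝ᵥ v + c * c) : vec9 v c ≠ 0 := fun h0 => by
  rw [← vec9_dotProduct_self, h0] at h
  simp at h

theorem smul_vec9 (t : ℝ) (v : OctIdx → ℝ) (c : ℝ) : t • vec9 v c = vec9 (t • v) (t * c) := by
  ext (i | i)
  · rfl
  · fin_cases i <;> simp [vec9]

theorem realCliff_smul (t : ℝ) (v : OctIdx → ℝ) (c : ℝ) :
    realCliff (t • v) (t * c) = t • realCliff v c := by
  rw [realCliff, realCliff, fromBlocks_smul, octG_smul, transpose_smul, smul_smul, smul_smul,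
    mul_neg]

theorem realCliff_mulVec (v : OctIdx → ℝ) (c : ℝ) (y x : OctIdx → ℝ) :
    realCliff v c *ᵥ Sum.elim y x = Sum.elim (c • y + octB x *ᵥ v) (octD y *ᵥ v - c • x) := by
  rw [realCliff, fromBlocks_mulVec, Sum.elim_comp_inl, Sum.elim_comp_inr, octG_mulVec,
    octG_transpose_mulVec, smul_mulVec, smul_mulVec, one_mulVec, one_mulVec, neg_smul,
    ← sub_eq_add_neg]

theorem map_realCliff (v : OctIdx → ℝ) (c : ℝ) :
    (realCliff v c).map ofReal = cliff (ofReal ∘ vec9 v c) ∧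
      (realCliff v c).map ofReal = cliffStar (ofReal ∘ vec9 v c) := by
  have e : octG (ofReal ∘ v) = (octG v).map ofReal := octG_map ofRealHom v
  have e1 : ((ofReal ∘ vec9 v c) ∘ Sum.inl : OctIdx → ℂ) = ofReal ∘ v := rfl
  have e2 : ∀ r : ℝ, (r • (1 : Matrix OctIdx OctIdx ℝ)).map ofReal = (r : ℂ) • 1 := fun r => by
    ext i j; by_cases h : i = j <;> simp [one_apply, h]
  rw [cliff, cliffStar, e1, e, realCliff, fromBlocks_map, e2, e2]
  constructor <;> simp [vec9, transpose_map]

theorem isLift_realCliff {v₁ v₂ : OctIdx → ℝ} {c₁ c₂ : ℝ} (h₁ : v₁ ⬝ᵥ v₁ + c₁ * c₁ = 1)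
    (h₂ : v₂ ⬝ᵥ v₂ + c₂ * c₂ = 1) :
    IsLift ((realCliff v₁ c₁ * realCliff v₂ c₂).map ofReal)
      (householder (vec9 v₁ c₁) * householder (vec9 v₂ c₂)) := by
  have e : (realCliff v₁ c₁ * realCliff v₂ c₂).map ofReal =
      (realCliff v₁ c₁).map ofReal * (realCliff v₂ c₂).map ofReal :=
    Matrix.map_mul (f := ofRealHom)
  rw [e, (map_realCliff v₁ c₁).1, (map_realCliff v₂ c₂).2]
  exact isLift_householder (by rwa [vec9_dotProduct_self]) (by rwa [vec9_dotProduct_self])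

/-- A product of four reflections, deforming to the identity. -/
def fourRefl (w v v' : OctIdx → ℝ) (c' h : ℝ) : Matrix VecIdx VecIdx ℝ :=
  householder (vec9 ((1 - h) • w) 1) * householder (vec9 0 1) *
    (householder (vec9 ((1 - h) • v) h) * householder (vec9 ((1 - h) • v') ((1 - h) * c' + h)))

theorem fourRefl_one (w v v' : OctIdx → ℝ) (c' : ℝ) : fourRefl w v v' c' 1 = 1 := by
  have h : vec9 0 1 ≠ 0 := vec9_ne_zero (by simp)
  simp [fourRefl, householder_mul_self h]

theorem vec9_segment_ne_zero {h : ℝ} (hv : 0 < v ⬝ᵥ v + c * c) (hc : 0 ≤ c) (h0 : 0 ≤ h)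
    (h1 : h ≤ 1) : vec9 ((1 - h) • v) ((1 - h) * c + h) ≠ 0 := by
  refine vec9_ne_zero ?_
  have hvv : 0 ≤ v ⬝ᵥ v := dotProduct_star_self_nonneg v
  rcases h0.eq_or_lt with rfl | h0
  · simpa using hv
  · have : 0 ≤ (1 - h) * c := mul_nonneg (by linarith) hc
    have h2 : 0 ≤ ((1 - h) • v) ⬝ᵥ ((1 - h) • v) := dotProduct_star_self_nonneg _
    positivity

theorem householder_transpose_mul {q : VecIdx → ℝ} (hq : q ≠ 0) :
    (householder q)ᵀ * householder q = 1 := by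
  rw [transpose_householder, householder_mul_self hq]

theorem transpose_mul_self_mul' {ι : Type*} [Fintype ι] [DecidableEq ι] {A B : Matrix ι ι ℝ}
    (hA : Aᵀ * A = 1) (hB : Bᵀ * B = 1) : (A * B)ᵀ * (A * B) = 1 := by
  rw [transpose_mul, Matrix.mul_assoc, ← Matrix.mul_assoc Aᵀ, hA, Matrix.one_mul, hB]

variable {w v' : OctIdx → ℝ} {c' h : ℝ}

theorem fourRefl_ne_zero (hv : v ≠ 0) (hv' : v' ⬝ᵥ v' + c' * c' = 1) (hc' : 0 ≤ c') (h0 : 0 ≤ h)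
    (h1 : h ≤ 1) : vec9 ((1 - h) • w) 1 ≠ 0 ∧ vec9 ((1 - h) • v) h ≠ 0 ∧
      vec9 ((1 - h) • v') ((1 - h) * c' + h) ≠ 0 := by
  have hvv : 0 < v ⬝ᵥ v := dotProduct_star_self_pos_iff.2 hv
  refine ⟨vec9_ne_zero ?_, ?_, vec9_segment_ne_zero (by linarith) hc' h0 h1⟩
  · have : 0 ≤ ((1 - h) • w) ⬝ᵥ ((1 - h) • w) := dotProduct_star_self_nonneg _
    linarith
  · simpa using vec9_segment_ne_zero (v := v) (c := 0) (by simpa using hvv) le_rfl h0 h1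

theorem fourRefl_transpose_mul (hv : v ≠ 0) (hv' : v' ⬝ᵥ v' + c' * c' = 1) (hc' : 0 ≤ c')
    (h0 : 0 ≤ h) (h1 : h ≤ 1) : (fourRefl w v v' c' h)ᵀ * fourRefl w v v' c' h = 1 := by
  obtain ⟨n1, n2, n3⟩ := fourRefl_ne_zero (w := w) hv hv' hc' h0 h1
  exact transpose_mul_self_mul' (transpose_mul_self_mul' (householder_transpose_mul n1)
    (householder_transpose_mul (vec9_ne_zero (by simp))))
    (transpose_mul_self_mul' (householder_transpose_mul n2) (householder_transpose_mul n3))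

theorem fourRefl_neg_zero (w v v' : OctIdx → ℝ) (c' : ℝ) :
    fourRefl w (-v) v' c' 0 = fourRefl w v v' c' 0 := by
  have e : vec9 (-v) 0 = -vec9 v 0 := by
    ext (i | i)
    · rfl
    · fin_cases i <;> simp [vec9]
  simp [fourRefl, e, householder_neg]

theorem isLift_fourRefl {κ : ℝ} (hκ : κ * κ * (w ⬝ᵥ w + 1) = 1) (hv : v ⬝ᵥ v = 1)
    (hv' : v' ⬝ᵥ v' + c' * c' = 1) :
    IsLift ((κ • (realCliff w 1 * realCliff 0 1 * (realCliff v 0 * realCliff v' c'))).map ofReal)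
      (fourRefl w v v' c' 0) := by
  have hκ0 : κ ≠ 0 := by rintro rfl; simp at hκ
  have h1 : IsLift ((realCliff (κ • w) (κ * 1) * realCliff 0 1).map ofReal)
      (householder (vec9 (κ • w) (κ * 1)) * householder (vec9 0 1)) :=
    isLift_realCliff (by simp only [smul_dotProduct, dotProduct_smul, smul_eq_mul]; linarith)
      (by simp)
  have h2 := (h1.mul (isLift_realCliff (v₁ := v) (c₁ := 0) (by simpa using hv) hv'))
  rw [← smul_vec9, householder_smul hκ0, realCliff_smul, ← map_ofReal_mul] at h2
  simpa [fourRefl, Matrix.smul_mul] using h2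

theorem continuousOn_fourRefl {Y : Type*} [TopologicalSpace Y] {S : Set Y} {w v : Y → OctIdx → ℝ}
    {v' : OctIdx → ℝ} {c' : ℝ} (cw : ContinuousOn w S) (cv : ContinuousOn v S)
    (hv : ∀ y ∈ S, v y ≠ 0) (hv' : v' ⬝ᵥ v' + c' * c' = 1) (hc' : 0 ≤ c') :
    ContinuousOn (fun p : Y × ℝ => fourRefl (w p.1) (v p.1) v' c' p.2) (S ×ˢ Set.Icc 0 1) := by
  have hmaps : Set.MapsTo Prod.fst (S ×ˢ Set.Icc (0 : ℝ) 1) S := fun p hp => hp.1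
  have cw' : ContinuousOn (fun p : Y × ℝ => w p.1) (S ×ˢ Set.Icc 0 1) :=
    cw.comp continuousOn_fst hmaps
  have cv' : ContinuousOn (fun p : Y × ℝ => v p.1) (S ×ˢ Set.Icc 0 1) :=
    cv.comp continuousOn_fst hmaps
  have hvec : Continuous fun p : (OctIdx → ℝ) × ℝ => vec9 p.1 p.2 := by
    refine continuous_pi fun i => ?_
    rcases i with i | i
    · exact (continuous_apply i).comp continuous_fst
    · fin_cases i
      · exact continuous_snd
      · exact continuous_const
  have hH : ∀ {f : Y × ℝ → OctIdx → ℝ} {g : Y × ℝ → ℝ}, ContinuousOn f (S ×ˢ Set.Icc 0 1) →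
      ContinuousOn g (S ×ˢ Set.Icc 0 1) → (∀ p ∈ S ×ˢ Set.Icc (0 : ℝ) 1, vec9 (f p) (g p) ≠ 0) →
      ContinuousOn (fun p => householder (vec9 (f p) (g p))) (S ×ˢ Set.Icc 0 1) :=
    fun {f g} cf cg hne p hp =>
      ContinuousAt.comp_continuousWithinAt (f := fun p => vec9 (f p) (g p))
        (continuousAt_householder (hne p hp)) ((hvec.comp_continuousOn (cf.prodMk cg)) p hp)
  have hne : ∀ p ∈ S ×ˢ Set.Icc (0 : ℝ) 1, vec9 ((1 - p.2) • w p.1) 1 ≠ 0 ∧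
      vec9 ((1 - p.2) • v p.1) p.2 ≠ 0 ∧ vec9 ((1 - p.2) • v') ((1 - p.2) * c' + p.2) ≠ 0 :=
    fun p hp => fourRefl_ne_zero (hv p.1 hp.1) hv' hc' hp.2.1 hp.2.2
  have c1 : ContinuousOn (fun p : Y × ℝ => 1 - p.2) (S ×ˢ Set.Icc 0 1) := by fun_prop
  have m : ∀ {f g : Y × ℝ → Matrix VecIdx VecIdx ℝ}, ContinuousOn f (S ×ˢ Set.Icc 0 1) →
      ContinuousOn g (S ×ˢ Set.Icc 0 1) → ContinuousOn (fun p => f p * g p) (S ×ˢ Set.Icc 0 1) :=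
    fun hf hg => hf.mul hg
  exact m (m (hH (c1.smul cw') continuousOn_const fun p hp => (hne p hp).1) continuousOn_const)
    (m (hH (c1.smul cv') continuousOn_snd fun p hp => (hne p hp).2.1)
      (hH (by fun_prop) (by fun_prop) fun p hp => (hne p hp).2.2))

end RealLift

end Matrix

namespace Matrix

open Complex

section Sections

theorem octD_zero {R : Type*} [CommRing R] : octD (0 : Fin 4 ⊕ Fin 4 → R) = 0 :=
  ext_of_mulVec fun v => by rw [← octG_transpose_mulVec, mulVec_zero, zero_mulVec]

theorem octB_zero {R : Type*} [CommRing R] : octB (0 : Fin 4 ⊕ Fin 4 → R) = 0 :=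
  ext_of_mulVec fun v => by rw [← octG_mulVec, mulVec_zero, zero_mulVec]

theorem octD_smul {R : Type*} [CommRing R] (c : R) (s : Fin 4 ⊕ Fin 4 → R) :
    octD (c • s) = c • octD s :=
  ext_of_mulVec fun v => by rw [smul_mulVec]; simp only [← octG_transpose_mulVec, mulVec_smul]

/-- The real spinor fixed by the standard section. -/
def realSpinor : OctIdx ⊕ OctIdx → ℝ := Sum.elim 0 octOne

/-- A continuous choice over `D` of a rotation whose lift sends the reference real spinor to the
given one up to sign, together with a deformation to the identity. -/
structure IsSpinorSection (D : Set (OctIdx ⊕ OctIdx → ℝ))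
    (a : (OctIdx ⊕ OctIdx → ℝ) → ℝ → Matrix VecIdx VecIdx ℝ) : Prop where
  continuousOn : ContinuousOn (fun p : (OctIdx ⊕ OctIdx → ℝ) × ℝ => a p.1 p.2) (D ×ˢ Set.Icc 0 1)
  transpose_mul : ∀ ψ ∈ D, ∀ h ∈ Set.Icc (0 : ℝ) 1, (a ψ h)ᵀ * a ψ h = 1
  one : ∀ ψ, a ψ 1 = 1
  neg_zero : ∀ ψ, a (-ψ) 0 = a ψ 0
  exists_lift : ∀ ψ ∈ D, ψ ⬝ᵥ ψ = 1 → ∃ (k : Matrix (OctIdx ⊕ OctIdx) (OctIdx ⊕ OctIdx) ℝ) (s : ℝ),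
    s * s = 1 ∧ IsLift (k.map ofReal) (a ψ 0) ∧ k *ᵥ realSpinor = s • ψ

theorem dotProduct_smul_transpose_mulVec {M : Matrix OctIdx OctIdx ℝ} {r : ℝ} (hr : r ≠ 0)
    (hM : M * Mᵀ = r • 1) (x : OctIdx → ℝ) :
    (r⁻¹ • (Mᵀ *ᵥ x)) ⬝ᵥ (r⁻¹ • (Mᵀ *ᵥ x)) = r⁻¹ * (x ⬝ᵥ x) := by
  rw [smul_dotProduct, dotProduct_smul, smul_eq_mul, smul_eq_mul, dotProduct_mulVec,
    vecMul_transpose, mulVec_mulVec, hM, smul_mulVec, one_mulVec, smul_dotProduct, smul_eq_mul,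
    inv_mul_cancel_left₀ hr]

theorem mulVec_smul_transpose_mulVec {M : Matrix OctIdx OctIdx ℝ} {r : ℝ} (hr : r ≠ 0)
    (hM : M * Mᵀ = r • 1) (x : OctIdx → ℝ) : M *ᵥ (r⁻¹ • (Mᵀ *ᵥ x)) = x := by
  rw [mulVec_smul, mulVec_mulVec, hM, smul_mulVec, one_mulVec, inv_smul_smul₀ hr]

theorem spinor_dotProduct_self (ψ : OctIdx ⊕ OctIdx → ℝ) :
    ψ ⬝ᵥ ψ = (ψ ∘ Sum.inl ⬝ᵥ ψ ∘ Sum.inl) + (ψ ∘ Sum.inr ⬝ᵥ ψ ∘ Sum.inr) := by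
  simp [dotProduct, Fintype.sum_sum_type]

/-- The normalization of a vector. -/
def unitVec (y : OctIdx → ℝ) : OctIdx → ℝ := (√(y ⬝ᵥ y))⁻¹ • y

theorem sqrt_dotProduct_self_pos {y : OctIdx → ℝ} (hy : y ≠ 0) : 0 < √(y ⬝ᵥ y) :=
  Real.sqrt_pos.2 (dotProduct_star_self_pos_iff.2 hy)

theorem unitVec_dotProduct_self {y : OctIdx → ℝ} (hy : y ≠ 0) : unitVec y ⬝ᵥ unitVec y = 1 := by
  have h : 0 < y ⬝ᵥ y := dotProduct_star_self_pos_iff.2 hy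
  rw [unitVec, smul_dotProduct, dotProduct_smul, smul_eq_mul, smul_eq_mul, ← mul_assoc,
    ← mul_inv, Real.mul_self_sqrt h.le, inv_mul_cancel₀ h.ne']

theorem unitVec_ne_zero {y : OctIdx → ℝ} (hy : y ≠ 0) : unitVec y ≠ 0 :=
  smul_ne_zero (inv_ne_zero (sqrt_dotProduct_self_pos hy).ne') hy

theorem unitVec_neg (y : OctIdx → ℝ) : unitVec (-y) = -unitVec y := by
  simp [unitVec]

theorem sqrt_smul_unitVec {y : OctIdx → ℝ} (hy : y ≠ 0) : √(y ⬝ᵥ y) • unitVec y = y :=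
  smul_inv_smul₀ (sqrt_dotProduct_self_pos hy).ne' y

theorem continuousOn_unitVec : ContinuousOn unitVec {y : OctIdx → ℝ | y ≠ 0} := by
  have hc : Continuous fun y : OctIdx → ℝ => √(y ⬝ᵥ y) :=
    Real.continuous_sqrt.comp (continuous_id.dotProduct continuous_id)
  exact (ContinuousOn.inv₀ hc.continuousOn fun y hy => (sqrt_dotProduct_self_pos hy).ne').smul
    continuousOn_id

/-- The section over real spinors with nonzero first component. -/
def sectionL (ψ : OctIdx ⊕ OctIdx → ℝ) (h : ℝ) : Matrix VecIdx VecIdx ℝ :=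
  fourRefl ((ψ ∘ Sum.inl ⬝ᵥ ψ ∘ Sum.inl)⁻¹ • ((octD (ψ ∘ Sum.inl))ᵀ *ᵥ (ψ ∘ Sum.inr)))
    (unitVec (ψ ∘ Sum.inl)) 0 1 h

/-- The section over real spinors with nonzero second component. -/
def sectionR (ψ : OctIdx ⊕ OctIdx → ℝ) (h : ℝ) : Matrix VecIdx VecIdx ℝ :=
  fourRefl (-((ψ ∘ Sum.inr ⬝ᵥ ψ ∘ Sum.inr)⁻¹ • ((octB (ψ ∘ Sum.inr))ᵀ *ᵥ (ψ ∘ Sum.inl))))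
    (unitVec (ψ ∘ Sum.inr)) octOne 0 h

theorem continuous_comp_right {α β γ : Type*} [TopologicalSpace γ] (f : α → β) :
    Continuous fun ψ : β → γ => ψ ∘ f :=
  continuous_pi fun i => continuous_apply (f i)

theorem continuousOn_sectionL : ContinuousOn
    (fun p : (OctIdx ⊕ OctIdx → ℝ) × ℝ => sectionL p.1 p.2)
    ({ψ | ψ ∘ Sum.inl ≠ 0} ×ˢ Set.Icc 0 1) := by
  have c1 : Continuous fun ψ : OctIdx ⊕ OctIdx → ℝ => ψ ∘ (Sum.inl : OctIdx → _) :=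
    continuous_comp_right _
  have c2 : Continuous fun ψ : OctIdx ⊕ OctIdx → ℝ => ψ ∘ (Sum.inr : OctIdx → _) :=
    continuous_comp_right _
  have hw : ContinuousOn (fun ψ : OctIdx ⊕ OctIdx → ℝ => (ψ ∘ Sum.inl ⬝ᵥ ψ ∘ Sum.inl)⁻¹ •
      ((octD (ψ ∘ Sum.inl))ᵀ *ᵥ (ψ ∘ Sum.inr))) {ψ | ψ ∘ Sum.inl ≠ 0} := by
    refine ContinuousOn.smul (ContinuousOn.inv₀ (c1.dotProduct c1).continuousOn ?_)
      ((continuous_octD.comp c1).matrix_transpose.matrix_mulVec c2).continuousOn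
    exact fun ψ hψ => (dotProduct_star_self_pos_iff.2 hψ).ne'
  have hv : ContinuousOn (fun ψ : OctIdx ⊕ OctIdx → ℝ => unitVec (ψ ∘ Sum.inl))
      {ψ | ψ ∘ Sum.inl ≠ 0} :=
    continuousOn_unitVec.comp c1.continuousOn fun ψ hψ => hψ
  have hc := continuousOn_fourRefl (v' := 0) (c' := 1) hw hv (fun ψ hψ => unitVec_ne_zero hψ)
    (by simp) zero_le_one
  exact hc

theorem exists_lift_sectionL {ψ : OctIdx ⊕ OctIdx → ℝ} (hψ : ψ ∘ Sum.inl ≠ 0) (hu : ψ ⬝ᵥ ψ = 1) :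
    ∃ (k : Matrix (OctIdx ⊕ OctIdx) (OctIdx ⊕ OctIdx) ℝ) (s : ℝ),
      s * s = 1 ∧ IsLift (k.map ofReal) (sectionL ψ 0) ∧ k *ᵥ realSpinor = s • ψ := by
  have hy : ψ ∘ Sum.inl ≠ 0 := hψ
  have hψ' : ψ = Sum.elim (ψ ∘ Sum.inl) (ψ ∘ Sum.inr) := (Sum.elim_comp_inl_inr ψ).symm
  rw [spinor_dotProduct_self] at hu
  rw [sectionL]
  set y := ψ ∘ Sum.inl
  set x := ψ ∘ Sum.inr
  have hyy : 0 < y ⬝ᵥ y := dotProduct_star_self_pos_iff.2 hy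
  have hM := octD_mul_transpose y
  refine ⟨_, -1, by norm_num, isLift_fourRefl (κ := √(y ⬝ᵥ y)) ?_ (unitVec_dotProduct_self hy)
    (by simp), ?_⟩
  · rw [Real.mul_self_sqrt hyy.le, dotProduct_smul_transpose_mulVec hyy.ne' hM]
    field_simp
    linarith
  · have e1 : √(y ⬝ᵥ y) • (octD (unitVec y) *ᵥ ((y ⬝ᵥ y)⁻¹ • ((octD y)ᵀ *ᵥ x))) = x := by
      rw [← smul_mulVec, ← octD_smul, sqrt_smul_unitVec hy, mulVec_smul_transpose_mulVec hyy.ne' hM]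
    rw [hψ', realSpinor, smul_mulVec, ← mulVec_mulVec, ← mulVec_mulVec, ← mulVec_mulVec,
      realCliff_mulVec, realCliff_mulVec, realCliff_mulVec, realCliff_mulVec]
    simp only [octB_neg, octB_octOne, octD_neg, octB_zero, octD_zero, zero_mulVec, mulVec_zero,
      smul_zero, one_smul, zero_smul, zero_add, add_zero, sub_zero, zero_sub, neg_mulVec,
      one_mulVec, neg_zero]
    ext (i | i)
    · simpa using congrFun (sqrt_smul_unitVec hy) i
    · simpa using congrFun e1 i

theorem isSpinorSection_sectionL : IsSpinorSection {ψ | ψ ∘ Sum.inl ≠ 0} sectionL where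
  continuousOn := continuousOn_sectionL
  transpose_mul ψ hψ h hh :=
    fourRefl_transpose_mul (unitVec_ne_zero hψ) (by simp) zero_le_one hh.1 hh.2
  one ψ := fourRefl_one _ _ _ _
  neg_zero ψ := by
    have e : ∀ f : OctIdx → OctIdx ⊕ OctIdx, (-ψ) ∘ f = -(ψ ∘ f) := fun f => rfl
    rw [sectionL, sectionL, e, e, unitVec_neg, fourRefl_neg_zero, octD_neg, transpose_neg,
      neg_mulVec_neg, neg_dotProduct_neg]
  exists_lift ψ hψ hu := exists_lift_sectionL hψ hu

theorem continuousOn_sectionR : ContinuousOn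
    (fun p : (OctIdx ⊕ OctIdx → ℝ) × ℝ => sectionR p.1 p.2)
    ({ψ | ψ ∘ Sum.inr ≠ 0} ×ˢ Set.Icc 0 1) := by
  have c1 : Continuous fun ψ : OctIdx ⊕ OctIdx → ℝ => ψ ∘ (Sum.inl : OctIdx → _) :=
    continuous_comp_right _
  have c2 : Continuous fun ψ : OctIdx ⊕ OctIdx → ℝ => ψ ∘ (Sum.inr : OctIdx → _) :=
    continuous_comp_right _
  have hw : ContinuousOn (fun ψ : OctIdx ⊕ OctIdx → ℝ => -((ψ ∘ Sum.inr ⬝ᵥ ψ ∘ Sum.inr)⁻¹ •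
      ((octB (ψ ∘ Sum.inr))ᵀ *ᵥ (ψ ∘ Sum.inl)))) {ψ | ψ ∘ Sum.inr ≠ 0} := by
    refine ContinuousOn.neg (ContinuousOn.smul (ContinuousOn.inv₀ (c2.dotProduct c2).continuousOn ?_)
      ((continuous_octB.comp c2).matrix_transpose.matrix_mulVec c1).continuousOn)
    exact fun ψ hψ => (dotProduct_star_self_pos_iff.2 hψ).ne'
  have hv : ContinuousOn (fun ψ : OctIdx ⊕ OctIdx → ℝ => unitVec (ψ ∘ Sum.inr))
      {ψ | ψ ∘ Sum.inr ≠ 0} :=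
    continuousOn_unitVec.comp c2.continuousOn fun ψ hψ => hψ
  have hc := continuousOn_fourRefl (v' := octOne) (c' := 0) hw hv (fun ψ hψ => unitVec_ne_zero hψ)
    (by simp [octOne]) le_rfl
  exact hc

theorem exists_lift_sectionR {ψ : OctIdx ⊕ OctIdx → ℝ} (hψ : ψ ∘ Sum.inr ≠ 0) (hu : ψ ⬝ᵥ ψ = 1) :
    ∃ (k : Matrix (OctIdx ⊕ OctIdx) (OctIdx ⊕ OctIdx) ℝ) (s : ℝ),
      s * s = 1 ∧ IsLift (k.map ofReal) (sectionR ψ 0) ∧ k *ᵥ realSpinor = s • ψ := by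
  have hx : ψ ∘ Sum.inr ≠ 0 := hψ
  have hψ' : ψ = Sum.elim (ψ ∘ Sum.inl) (ψ ∘ Sum.inr) := (Sum.elim_comp_inl_inr ψ).symm
  rw [spinor_dotProduct_self] at hu
  rw [sectionR]
  set y := ψ ∘ Sum.inl
  set x := ψ ∘ Sum.inr
  have hxx : 0 < x ⬝ᵥ x := dotProduct_star_self_pos_iff.2 hx
  have hM := octB_mul_transpose x
  refine ⟨_, 1, by norm_num, isLift_fourRefl (κ := √(x ⬝ᵥ x)) ?_ (unitVec_dotProduct_self hx)
    (by simp [octOne]), ?_⟩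
  · rw [neg_dotProduct_neg, Real.mul_self_sqrt hxx.le,
      dotProduct_smul_transpose_mulVec hxx.ne' hM]
    field_simp
    linarith
  · have e1 : √(x ⬝ᵥ x) • (octB (unitVec x) *ᵥ ((x ⬝ᵥ x)⁻¹ • ((octB x)ᵀ *ᵥ y))) = y := by
      have e2 : octB (√(x ⬝ᵥ x) • unitVec x) = √(x ⬝ᵥ x) • octB (unitVec x) :=
        ext_of_mulVec fun v => by
          rw [smul_mulVec]; simp only [← octG_mulVec, mulVec_smul]
      rw [← smul_mulVec, ← e2, sqrt_smul_unitVec hx, mulVec_smul_transpose_mulVec hxx.ne' hM]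
    rw [hψ', realSpinor, smul_mulVec, ← mulVec_mulVec, ← mulVec_mulVec, ← mulVec_mulVec,
      realCliff_mulVec, realCliff_mulVec, realCliff_mulVec, realCliff_mulVec]
    simp only [octB_neg, octB_octOne, octD_octOne, octD_neg, octB_zero, octD_zero, zero_mulVec,
      mulVec_zero, smul_zero, one_smul, zero_smul, zero_add, add_zero, sub_zero, zero_sub,
      neg_mulVec, one_mulVec, neg_zero, mulVec_neg, neg_neg, sub_neg_eq_add]
    ext (i | i)
    · simpa using congrFun e1 i
    · simpa using congrFun (sqrt_smul_unitVec hx) i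

theorem isSpinorSection_sectionR : IsSpinorSection {ψ | ψ ∘ Sum.inr ≠ 0} sectionR where
  continuousOn := continuousOn_sectionR
  transpose_mul ψ hψ h hh :=
    fourRefl_transpose_mul (unitVec_ne_zero hψ) (by simp [octOne]) le_rfl hh.1 hh.2
  one ψ := fourRefl_one _ _ _ _
  neg_zero ψ := by
    have e : ∀ f : OctIdx → OctIdx ⊕ OctIdx, (-ψ) ∘ f = -(ψ ∘ f) := fun f => rfl
    rw [sectionR, sectionR, e, e, unitVec_neg, fourRefl_neg_zero, octB_neg, transpose_neg,
      neg_mulVec_neg, neg_dotProduct_neg]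
  exists_lift ψ hψ hu := exists_lift_sectionR hψ hu

end Sections

end Matrix

namespace Matrix

open Complex

section RealSpinor

variable {A : Matrix VecIdx VecIdx ℝ} {ψ : OctIdx ⊕ OctIdx → ℝ}

/-- `ψ` is the real part of a pure spinor of the rotation `A`. -/
def IsRealSpinor (A : Matrix VecIdx VecIdx ℝ) (ψ : OctIdx ⊕ OctIdx → ℝ) : Prop :=
  ∃ g, IsLift g A ∧ ψ = re ∘ (g *ᵥ spinor₀)

theorem IsLift.neg {g : Matrix (OctIdx ⊕ OctIdx) (OctIdx ⊕ OctIdx) ℂ} (hg : IsLift g A) :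
    IsLift (-g) A where
  unitary := by rw [conjTranspose_neg, neg_mul_neg, hg.unitary]
  cliff_mulVec z := by
    rw [transpose_neg, mul_neg, neg_mul, neg_mul, neg_neg, hg.cliff_mulVec]

theorem IsRealSpinor.neg (h : IsRealSpinor A ψ) : IsRealSpinor A (-ψ) := by
  obtain ⟨g, hg, rfl⟩ := h
  refine ⟨-g, hg.neg, ?_⟩
  ext i
  simp [neg_mulVec]

theorem exists_isRealSpinor (hA : Aᵀ * A = 1) (hd : A.det = 1) : ∃ ψ, IsRealSpinor A ψ := by
  obtain ⟨g, hg⟩ := exists_isLift hA hd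
  exact ⟨_, g, hg, rfl⟩

theorem spinor₀_dotProduct_star : spinor₀ ⬝ᵥ star spinor₀ = 2 := by
  simp [spinor₀, dotProduct, Fintype.sum_sum_type]
  norm_num

theorem IsLift.dotProduct_star {g : Matrix (OctIdx ⊕ OctIdx) (OctIdx ⊕ OctIdx) ℂ}
    (hg : IsLift g A) : star (g *ᵥ spinor₀) ⬝ᵥ (g *ᵥ spinor₀) = 2 := by
  rw [star_mulVec_dotProduct_mulVec hg.unitary, dotProduct_comm, spinor₀_dotProduct_star]

theorem IsLift.dotProduct_self {g : Matrix (OctIdx ⊕ OctIdx) (OctIdx ⊕ OctIdx) ℂ}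
    (hg : IsLift g A) (hA : Aᵀ * A = 1) : (g *ᵥ spinor₀) ⬝ᵥ (g *ᵥ spinor₀) = 0 := by
  have h := hg.dotProduct_cliffStar hA (Pi.single (.inr 1) I)
  have e : cliffStar (Pi.single (.inr 1) I) = 1 := by
    rw [cliffStar, show (Pi.single (.inr 1) I : VecIdx → ℂ) ∘ Sum.inl = 0 by ext i; simp,
      octG_zero, ← fromBlocks_one]
    simp
  rwa [e, one_mulVec] at h

theorem IsRealSpinor.dotProduct_self (h : IsRealSpinor A ψ) (hA : Aᵀ * A = 1) : ψ ⬝ᵥ ψ = 1 := by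
  obtain ⟨g, hg, rfl⟩ := h
  have h1 := congrArg re hg.dotProduct_star
  have h2 := congrArg re (hg.dotProduct_self hA)
  simp only [dotProduct, Pi.star_apply, re_sum, mul_re, star_def, conj_re, conj_im, neg_mul,
    sub_neg_eq_add, Finset.sum_add_distrib, Finset.sum_sub_distrib, re_ofNat, zero_re] at h1 h2
  simp only [dotProduct, Function.comp_apply]
  linarith

theorem IsLift.spinT_eq {g : Matrix (OctIdx ⊕ OctIdx) (OctIdx ⊕ OctIdx) ℂ} (hg : IsLift g A) :
    spinT A = vecMulVec (g *ᵥ spinor₀) (g *ᵥ spinor₀) := by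
  have := hg.spinT_mul 1
  rwa [mul_one, spinT_one, mul_vecMulVec, vecMulVec_mul, vecMul_transpose] at this

/-- The square of the real part of the pure spinor of a rotation. -/
def spinM (A : Matrix VecIdx VecIdx ℝ) : Matrix (OctIdx ⊕ OctIdx) (OctIdx ⊕ OctIdx) ℝ :=
  ((1 / 2 : ℂ) • (spinT A + (1 / 2 : ℂ) • (spinT A * (spinT A)ᴴ))).map re

theorem IsRealSpinor.spinM_eq (h : IsRealSpinor A ψ) : spinM A = vecMulVec ψ ψ := by
  obtain ⟨g, hg, rfl⟩ := h
  have e : spinT A * (spinT A)ᴴ =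
      (2 : ℂ) • vecMulVec (g *ᵥ spinor₀) (star (g *ᵥ spinor₀)) := by
    rw [hg.spinT_eq, conjTranspose_vecMulVec, vecMulVec_mul_vecMulVec, dotProduct_comm,
      hg.dotProduct_star, vecMulVec_smul]
  rw [spinM, e, hg.spinT_eq]
  ext i j
  simp [vecMulVec_apply]
  ring

theorem continuous_spinT : Continuous spinT := by
  have cG : Continuous (octG : (OctIdx → ℂ) → Matrix OctIdx OctIdx ℂ) := by
    refine continuous_matrix fun i j => ?_
    have e : ∀ s : OctIdx → ℂ, octG s i j = (octB (Pi.single j 1) *ᵥ s) i := fun s => by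
      rw [← octG_mulVec, mulVec_single_one, col_apply]
    simp only [e]
    exact (continuous_apply i).comp (continuous_const.matrix_mulVec continuous_id)
  have c1 : Continuous fun z : VecIdx → ℂ => octG (z ∘ Sum.inl) := cG.comp (continuous_comp_right _)
  have cc : Continuous cliff :=
    Continuous.matrix_fromBlocks (by fun_prop) c1 c1.matrix_transpose (by fun_prop)
  have cs : Continuous cliffStar :=
    Continuous.matrix_fromBlocks (by fun_prop) c1 c1.matrix_transpose (by fun_prop)
  have cz : ∀ j, Continuous fun A : Matrix VecIdx VecIdx ℝ => A.map ofReal *ᵥ isoVec₅ j := fun j =>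
    (continuous_id.matrix_map continuous_ofReal).matrix_mulVec continuous_const
  exact (((((cc.comp (cz 0)).matrix_mul (cs.comp (cz 1))).matrix_mul (cc.comp (cz 2))).matrix_mul
    (cs.comp (cz 3))).matrix_mul (cc.comp (cz 4))).const_smul (1 / 16 : ℂ)

theorem continuous_spinM : Continuous spinM := by
  have c := continuous_spinT
  exact ((c.add ((c.matrix_mul c.matrix_conjTranspose).const_smul (1 / 2 : ℂ))).const_smul (1 / 2 : ℂ)).matrix_map
    continuous_re

theorem continuous_unitOf : Continuous unitOf :=
  continuous_pi fun i => continuous_im.comp (continuous_spinT.matrix_elem (.inr i) (.inr (.inl 0)))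

/-- The real spinor of a rotation, with the sign fixed by the probe `l`. -/
def probeSpinor (l : OctIdx ⊕ OctIdx → ℝ) (A : Matrix VecIdx VecIdx ℝ) : OctIdx ⊕ OctIdx → ℝ :=
  (√(l ⬝ᵥ (spinM A *ᵥ l)))⁻¹ • (spinM A *ᵥ l)

variable {l : OctIdx ⊕ OctIdx → ℝ}

theorem IsRealSpinor.spinM_mulVec (h : IsRealSpinor A ψ) (l : OctIdx ⊕ OctIdx → ℝ) :
    spinM A *ᵥ l = (l ⬝ᵥ ψ) • ψ := by
  rw [h.spinM_eq, vecMulVec_mulVec, op_smul_eq_smul, dotProduct_comm]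

theorem IsRealSpinor.probe_eq (h : IsRealSpinor A ψ) (l : OctIdx ⊕ OctIdx → ℝ) :
    l ⬝ᵥ (spinM A *ᵥ l) = (l ⬝ᵥ ψ) ^ 2 := by
  rw [h.spinM_mulVec, dotProduct_smul, smul_eq_mul, sq]

theorem IsRealSpinor.probeSpinor_eq (h : IsRealSpinor A ψ) (hl : l ⬝ᵥ ψ ≠ 0) :
    probeSpinor l A = ψ ∨ probeSpinor l A = -ψ := by
  rw [probeSpinor, h.probe_eq, h.spinM_mulVec, smul_smul, Real.sqrt_sq_eq_abs]
  rcases abs_choice (l ⬝ᵥ ψ) with e | e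
  · left; rw [e, inv_mul_cancel₀ hl, one_smul]
  · right; rw [e, inv_neg, neg_mul, inv_mul_cancel₀ hl, neg_one_smul]

theorem IsRealSpinor.probeSpinor (h : IsRealSpinor A ψ) (hl : l ⬝ᵥ ψ ≠ 0) :
    IsRealSpinor A (probeSpinor l A) := by
  rcases h.probeSpinor_eq hl with e | e <;> rw [e]
  exacts [h, h.neg]

theorem continuousOn_probeSpinor :
    ContinuousOn (Matrix.probeSpinor l) {A | l ⬝ᵥ (spinM A *ᵥ l) ≠ 0 ∧ ∃ ψ, IsRealSpinor A ψ} := by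
  have c : Continuous fun A => spinM A *ᵥ l := continuous_spinM.matrix_mulVec continuous_const
  have c' : Continuous fun A => √(l ⬝ᵥ (spinM A *ᵥ l)) :=
    Real.continuous_sqrt.comp (continuous_const.dotProduct c)
  refine ContinuousOn.smul (ContinuousOn.inv₀ c'.continuousOn ?_) c.continuousOn
  rintro A ⟨h, ψ, hψ⟩
  refine (Real.sqrt_pos.2 (lt_of_le_of_ne ?_ h.symm)).ne'
  rw [hψ.probe_eq]
  positivity

variable {D : Set (OctIdx ⊕ OctIdx → ℝ)} {a : (OctIdx ⊕ OctIdx → ℝ) → ℝ → Matrix VecIdx VecIdx ℝ}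

theorem IsSpinorSection.isAdapted (hs : IsSpinorSection D a) (h : IsRealSpinor A ψ)
    (hA : Aᵀ * A = 1) (hψ : ψ ∈ D) : IsAdapted ((a ψ 0)ᵀ * A) (unitOf ((a ψ 0)ᵀ * A)) := by
  have hu := h.dotProduct_self hA
  obtain ⟨k, s, hs1, hk, hks⟩ := hs.exists_lift ψ hψ hu
  have ha := hs.transpose_mul ψ hψ 0 ⟨le_rfl, zero_le_one⟩
  obtain ⟨g, hg, e⟩ := h
  have hk' := (hk.inv ha).mul hg
  have hkk : kᵀ * k = 1 := by
    have := hk.unitary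
    rw [conjTranspose_map_ofReal, ← map_ofReal_mul, ← map_ofReal_one] at this
    exact Matrix.map_injective ofReal_injective this
  have hre : ∀ i, ((((k.map ofReal)ᴴ * g) *ᵥ spinor₀) i).re = s * realSpinor i := by
    intro i
    have e1 : ((((k.map ofReal)ᴴ * g) *ᵥ spinor₀) i).re = (kᵀ *ᵥ ψ) i := by
      rw [← mulVec_mulVec, conjTranspose_map_ofReal, e]
      simp [mulVec, dotProduct]
    have e2 : ψ = s • (k *ᵥ realSpinor) := by rw [hks, smul_smul, hs1, one_smul]
    rw [e1, e2, mulVec_smul, mulVec_mulVec, hkk, one_mulVec, Pi.smul_apply, smul_eq_mul]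
  obtain ⟨u, hu⟩ := exists_isAdapted hk' (transpose_mul_self_mul'
    (by rw [transpose_transpose]; exact mul_eq_one_comm.1 ha) hA) hs1
    (fun i => by rw [hre]; simp [realSpinor]) (fun i => by rw [hre]; rfl)
  rwa [← hu.eq_unitOf]

end RealSpinor

end Matrix

namespace Matrix

open Complex

section Pieces

theorem _root_.ContinuousOn.det_add {X ι : Type*} [TopologicalSpace X] [Fintype ι] [DecidableEq ι]
    {f g : X → Matrix ι ι ℝ} {s : Set X} (hf : ContinuousOn f s) (hg : ContinuousOn g s) :
    ContinuousOn (fun x => (f x + g x).det) s :=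
  (Continuous.matrix_det continuous_id).comp_continuousOn (hf.add hg)

variable {D : Set (OctIdx ⊕ OctIdx → ℝ)} {a : (OctIdx ⊕ OctIdx → ℝ) → ℝ → Matrix VecIdx VecIdx ℝ}
  {l : OctIdx ⊕ OctIdx → ℝ} {V : Set (specialOrthogonalGroup VecIdx ℝ)} {s θ : ℝ}

theorem transpose_mul_self_of_specialOrthogonal (A : specialOrthogonalGroup VecIdx ℝ) :
    (A : Matrix VecIdx VecIdx ℝ)ᵀ * A = 1 :=
  mul_eq_one_comm.1 (mem_orthogonalGroup_iff VecIdx ℝ |>.1 (mem_specialOrthogonalGroup_iff.1 A.2).1)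

/-- The imaginary unit of a rotation after removing a section of the spinor map. -/
def localUnit (a : (OctIdx ⊕ OctIdx → ℝ) → ℝ → Matrix VecIdx VecIdx ℝ)
    (l : OctIdx ⊕ OctIdx → ℝ) (A : Matrix VecIdx VecIdx ℝ) : OctIdx → ℝ :=
  unitOf ((a (probeSpinor l A) 0)ᵀ * A)

/-- The reference rotation attached to a rotation, and its deformation to a constant. -/
def refRot (a : (OctIdx ⊕ OctIdx → ℝ) → ℝ → Matrix VecIdx VecIdx ℝ)
    (l : OctIdx ⊕ OctIdx → ℝ) (s θ : ℝ) (A : Matrix VecIdx VecIdx ℝ) (h : ℝ) :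
    Matrix VecIdx VecIdx ℝ :=
  a (probeSpinor l A) h * extendOct (rotPath s (localUnit a l A) h) *
    realOf (exp (((1 - h) * θ : ℝ) * I))

/-- The rotations of `V` on which the section `a` applies after fixing signs by the probe `l`. -/
def IsProbed (D : Set (OctIdx ⊕ OctIdx → ℝ)) (l : OctIdx ⊕ OctIdx → ℝ)
    (V : Set (specialOrthogonalGroup VecIdx ℝ)) : Prop :=
  ∀ A ∈ V, l ⬝ᵥ (spinM A *ᵥ l) ≠ 0 ∧ probeSpinor l A ∈ D

theorem IsProbed.isRealSpinor (hV : IsProbed D l V) {A : specialOrthogonalGroup VecIdx ℝ}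
    (hA : A ∈ V) : IsRealSpinor (A : Matrix VecIdx VecIdx ℝ) (probeSpinor l A) := by
  obtain ⟨ψ, hψ⟩ := exists_isRealSpinor (transpose_mul_self_of_specialOrthogonal A)
    (mem_specialOrthogonalGroup_iff.1 A.2).2
  refine hψ.probeSpinor fun h => (hV A hA).1 ?_
  rw [hψ.probe_eq, h, sq, zero_mul]

theorem IsProbed.isImUnit (hV : IsProbed D l V) (hs : IsSpinorSection D a)
    {A : specialOrthogonalGroup VecIdx ℝ} (hA : A ∈ V) : IsImUnit (localUnit a l A) :=
  (hs.isAdapted (hV.isRealSpinor hA) (transpose_mul_self_of_specialOrthogonal A)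
    (hV A hA).2).isImUnit

theorem IsProbed.continuousOn_section (hV : IsProbed D l V) (hs : IsSpinorSection D a) :
    ContinuousOn (fun p : specialOrthogonalGroup VecIdx ℝ × ℝ =>
      a (probeSpinor l (p.1 : Matrix VecIdx VecIdx ℝ)) p.2) (V ×ˢ Set.Icc 0 1) := by
  have h1 : ContinuousOn (fun A : specialOrthogonalGroup VecIdx ℝ =>
      probeSpinor l (A : Matrix VecIdx VecIdx ℝ)) V :=
    continuousOn_probeSpinor.comp continuous_subtype_val.continuousOn
      fun A hA => ⟨(hV A hA).1, _, hV.isRealSpinor hA⟩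
  exact hs.continuousOn.comp ((h1.comp continuousOn_fst fun p hp => hp.1).prodMk continuousOn_snd)
    fun p hp => ⟨(hV _ hp.1).2, hp.2⟩

theorem IsProbed.continuousOn_localUnit (hV : IsProbed D l V) (hs : IsSpinorSection D a) :
    ContinuousOn (fun A : specialOrthogonalGroup VecIdx ℝ =>
      localUnit a l (A : Matrix VecIdx VecIdx ℝ)) V := by
  have h1 : ContinuousOn (fun A : specialOrthogonalGroup VecIdx ℝ =>
      a (probeSpinor l (A : Matrix VecIdx VecIdx ℝ)) 0) V :=
    (hV.continuousOn_section hs).comp (f := fun A => (A, (0 : ℝ)))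
      (continuousOn_id.prodMk continuousOn_const)
          fun A hA => ⟨hA, le_rfl, zero_le_one⟩
  refine continuous_unitOf.comp_continuousOn (ContinuousOn.mul ?_ continuous_subtype_val.continuousOn)
  exact continuous_id.matrix_transpose.comp_continuousOn h1

theorem continuous_extendOct : Continuous extendOct :=
  Continuous.matrix_fromBlocks continuous_id continuous_const continuous_const continuous_const

theorem continuous_realOf : Continuous realOf := by
  unfold realOf
  fun_prop

theorem IsProbed.isOpen_and_contractsTo (hV : IsProbed D l V) (hs : IsSpinorSection D a)
    (oV : IsOpen V) (h0 : 0 < s) (h1 : s < 1) {O : Set ℝ} (hO : IsOpen O)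
    (hc : ContinuousOn (fun p : (OctIdx → ℝ) × ℝ => rotPath s p.1 p.2)
      ({u | IsImUnit u ∧ u (.inr 0) ∈ O} ×ˢ Set.Icc 0 1))
    {b : Matrix OctIdx OctIdx ℝ} (hb : ∀ u, u (.inr 0) ∈ O → rotPath s u 1 = b) :
    let W := {A ∈ V | localUnit a l (A : Matrix VecIdx VecIdx ℝ) (.inr 0) ∈ O ∧
      ((A : Matrix VecIdx VecIdx ℝ) + refRot a l s θ A 0).det ≠ 0}
    IsOpen W ∧ ContractsTo W 1 := by
  intro W
  have hu := hV.continuousOn_localUnit hs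
  set V' := {A ∈ V | localUnit a l (A : Matrix VecIdx VecIdx ℝ) (.inr 0) ∈ O} with hV'
  have oV' : IsOpen V' := ContinuousOn.isOpen_inter_preimage
    ((continuous_apply (Sum.inr 0)).comp_continuousOn hu) oV hO
  have hVV : V' ⊆ V := fun A hA => hA.1
  have cR : ContinuousOn (fun p : specialOrthogonalGroup VecIdx ℝ × ℝ =>
      refRot a l s θ (p.1 : Matrix VecIdx VecIdx ℝ) p.2) (V' ×ˢ Set.Icc 0 1) := by
    refine ((hV.continuousOn_section hs).mono (Set.prod_mono_left hVV)).mul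
      (continuous_extendOct.comp_continuousOn ?_) |>.mul
      (continuous_realOf.comp (by fun_prop)).continuousOn
    exact hc.comp (((hu.mono hVV).comp continuousOn_fst fun p hp => hp.1).prodMk continuousOn_snd)
      fun p hp => ⟨⟨hV.isImUnit hs hp.1.1, hp.1.2⟩, hp.2⟩
  have hWV : W ⊆ V' := fun A hA => ⟨hA.1, hA.2.1⟩
  have cW : ContinuousOn (Function.uncurry fun (A : specialOrthogonalGroup VecIdx ℝ) h =>
      refRot a l s θ (A : Matrix VecIdx VecIdx ℝ) h) (W ×ˢ Set.Icc 0 1) :=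
    cR.mono (Set.prod_mono_left hWV)
  refine ⟨?_, contractsTo_of_orthogonal_homotopy (D := extendOct b) cW ?_ ?_ ?_⟩
  · have cd : ContinuousOn (fun A : specialOrthogonalGroup VecIdx ℝ =>
        ((A : Matrix VecIdx VecIdx ℝ) + refRot a l s θ A 0).det) V' := by
      have h2 : ContinuousOn (fun A : specialOrthogonalGroup VecIdx ℝ =>
          refRot a l s θ (A : Matrix VecIdx VecIdx ℝ) 0) V' :=
        cR.comp (f := fun A => (A, (0 : ℝ))) (continuousOn_id.prodMk continuousOn_const)
          fun A hA => ⟨hA, le_rfl, zero_le_one⟩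
      have h3 : ContinuousOn (fun A : specialOrthogonalGroup VecIdx ℝ =>
          (A : Matrix VecIdx VecIdx ℝ)) V' := continuous_subtype_val.continuousOn
      exact h3.det_add h2
    have e : W = V' ∩ (fun A : specialOrthogonalGroup VecIdx ℝ =>
        ((A : Matrix VecIdx VecIdx ℝ) + refRot a l s θ A 0).det) ⁻¹' {0}ᶜ :=
      Set.ext fun A => ⟨fun h => ⟨⟨h.1, h.2.1⟩, h.2.2⟩, fun h => ⟨h.1.1, h.1.2, h.2⟩⟩
    rw [e]
    exact cd.isOpen_inter_preimage oV' isOpen_compl_singleton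
  · intro A hA t ht
    refine transpose_mul_self_mul' (transpose_mul_self_mul'
      (hs.transpose_mul _ (hV A hA.1).2 t ht) (extendOct_transpose_mul
        (rotPath_transpose_mul (hV.isImUnit hs hA.1) h0 h1 ht.1))) (realOf_transpose_mul ?_)
    rw [normSq_eq_norm_sq, norm_exp_ofReal_mul_I, one_pow]
  · exact fun A hA => hA.2.2
  · intro A hA
    rw [refRot, hs.one, hb _ hA.2.1, sub_self, zero_mul, ofReal_zero, zero_mul, Complex.exp_zero,
      realOf_one, Matrix.one_mul, Matrix.mul_one]

/-- The rotations of `V` that are separated from the level `s` and from the reference rotation. -/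
def probePiece (a : (OctIdx ⊕ OctIdx → ℝ) → ℝ → Matrix VecIdx VecIdx ℝ)
    (l : OctIdx ⊕ OctIdx → ℝ) (s θ : ℝ) (V : Set (specialOrthogonalGroup VecIdx ℝ)) :
    Set (specialOrthogonalGroup VecIdx ℝ) :=
  {A ∈ V | localUnit a l (A : Matrix VecIdx VecIdx ℝ) (.inr 0) ≠ s ∧
    ((A : Matrix VecIdx VecIdx ℝ) + refRot a l s θ A 0).det ≠ 0}

theorem IsProbed.probePiece (hV : IsProbed D l V) (hs : IsSpinorSection D a)
    (oV : IsOpen V) (h0 : 0 < s) (h1 : s < 1) :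
    IsOpen (probePiece a l s θ V) ∧ ContractsTo (probePiece a l s θ V) 1 := by
  obtain ⟨o1, c1⟩ := hV.isOpen_and_contractsTo (θ := θ) hs oV h0 h1 isOpen_Ioi
    (continuousOn_rotPath_of_lt h0) fun u hu => rotPath_one_of_lt hu
  obtain ⟨o2, c2⟩ := hV.isOpen_and_contractsTo (θ := θ) hs oV h0 h1 isOpen_Iio
    (continuousOn_rotPath_of_gt h1) fun u hu => rotPath_one_of_gt hu
  have e : Matrix.probePiece a l s θ V =
      {A ∈ V | localUnit a l (A : Matrix VecIdx VecIdx ℝ) (.inr 0) ∈ Set.Ioi s ∧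
        ((A : Matrix VecIdx VecIdx ℝ) + refRot a l s θ A 0).det ≠ 0} ∪
      {A ∈ V | localUnit a l (A : Matrix VecIdx VecIdx ℝ) (.inr 0) ∈ Set.Iio s ∧
        ((A : Matrix VecIdx VecIdx ℝ) + refRot a l s θ A 0).det ≠ 0} := by
    ext A
    simp only [Matrix.probePiece, Set.mem_ofPred_eq, Set.mem_union, Set.mem_Ioi, Set.mem_Iio,
      ne_iff_lt_or_gt, gt_iff_lt]
    tauto
  rw [e]
  refine ⟨o1.union o2, c1.union c2 o1 o2 (Set.disjoint_left.2 fun A h h' => ?_)⟩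
  exact lt_asymm (Set.mem_Ioi.1 h.2.1) (Set.mem_Iio.1 h'.2.1)

end Pieces

end Matrix

namespace Matrix

open Complex

section Probes

/-- The ordering of the spinor coordinates in which the second component comes first. -/
def spinorEquiv : OctIdx ⊕ OctIdx ≃ Fin (8 + 8) :=
  (Equiv.sumComm _ _).trans ((Equiv.sumCongr finSumFinEquiv finSumFinEquiv).trans finSumFinEquiv)

/-- The points of the moment curve. -/
def probe (c : ℝ) : OctIdx ⊕ OctIdx → ℝ := fun i => c ^ (spinorEquiv i : ℕ)

variable {ψ : OctIdx ⊕ OctIdx → ℝ}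

theorem eq_zero_of_probe {c : Fin (8 + 8) → ℝ} (hc : Function.Injective c)
    (h : ∀ j, probe (c j) ⬝ᵥ ψ = 0) : ψ = 0 := by
  have h0 : ψ ∘ spinorEquiv.symm = 0 := by
    refine eq_zero_of_forall_index_sum_pow_mul_eq_zero hc fun j => ?_
    rw [← h j, dotProduct, ← spinorEquiv.sum_comp]
    simp [probe]
  ext i
  simpa using congrFun h0 (spinorEquiv i)

theorem eq_zero_of_probe_of_inl {c : Fin (4 + 4) → ℝ} (hc : Function.Injective c)
    (h : ∀ j, probe (c j) ⬝ᵥ ψ = 0) (hψ : ψ ∘ Sum.inl = 0) : ψ = 0 := by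
  have hl : ∀ i, ψ (.inl i) = 0 := congrFun hψ
  have h0 : (ψ ∘ Sum.inr) ∘ finSumFinEquiv.symm = 0 := by
    refine eq_zero_of_forall_index_sum_pow_mul_eq_zero hc fun j => ?_
    have h1 := h j
    simp only [dotProduct, Fintype.sum_sum_type (α₁ := OctIdx), probe, hl, mul_zero,
      Finset.sum_const_zero, zero_add] at h1
    rw [← h1, ← finSumFinEquiv.sum_comp]
    refine Finset.sum_congr rfl fun i _ => ?_
    rw [Function.comp_apply, Function.comp_apply, Equiv.symm_apply_apply]
    rfl
  ext (i | i)
  · exact hl i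
  · simpa using congrFun h0 (finSumFinEquiv i)

theorem exists_injective_of_le_card {n m : ℕ} {S : Finset (Fin n)} (h : m ≤ S.card) :
    ∃ c : Fin m → ℝ, Function.Injective c ∧ ∀ j, ∃ k ∈ S, c j = ((k : ℕ) : ℝ) := by
  let f := (Fin.castLEEmb h).trans (S.orderEmbOfFin rfl).toEmbedding
  exact ⟨fun j => ((f j : ℕ) : ℝ), fun i j hij => f.injective (Fin.ext (Nat.cast_injective hij)),
    fun j => ⟨f j, S.orderEmbOfFin_mem rfl _, rfl⟩⟩

/-- The indices whose probes vanish on `ψ`. -/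
def blindSpots (ψ : OctIdx ⊕ OctIdx → ℝ) : Finset (Fin 22) :=
  Finset.univ.filter fun k => probe ((k : ℕ) : ℝ) ⬝ᵥ ψ = 0

theorem card_blindSpots_lt (hψ : ψ ≠ 0) : (blindSpots ψ).card < 16 := by
  by_contra! h
  obtain ⟨c, hc, hc'⟩ := exists_injective_of_le_card h
  refine hψ (eq_zero_of_probe hc fun j => ?_)
  obtain ⟨k, hk, e⟩ := hc' j
  rw [e]
  exact (Finset.mem_filter.1 hk).2

theorem exists_pos_le_of_blindSpots : ∃ δ : ℝ, 0 < δ ∧ δ ≤ 1 ∧ ∀ ψ : OctIdx ⊕ OctIdx → ℝ,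
    ψ ⬝ᵥ ψ = 1 → 8 ≤ (blindSpots ψ).card → δ ≤ ψ ∘ Sum.inl ⬝ᵥ ψ ∘ Sum.inl := by
  have hK : IsCompact {ψ : OctIdx ⊕ OctIdx → ℝ | ψ ⬝ᵥ ψ = 1 ∧ 8 ≤ (blindSpots ψ).card} := by
    refine (isCompact_Icc (a := -1) (b := 1)).of_isClosed_subset (IsClosed.and
      (isClosed_eq (continuous_id.dotProduct continuous_id) continuous_const) ?_) ?_
    · have e : {ψ : OctIdx ⊕ OctIdx → ℝ | 8 ≤ (blindSpots ψ).card} =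
          ⋃ S : {S : Finset (Fin 22) // 8 ≤ S.card},
            ⋂ k ∈ S.1, {ψ | probe ((k : ℕ) : ℝ) ⬝ᵥ ψ = 0} := by
        ext ψ
        simp only [Set.mem_ofPred_eq, Set.mem_iUnion, Set.mem_iInter]
        refine ⟨fun h => ⟨⟨_, h⟩, fun k hk => (Finset.mem_filter.1 hk).2⟩, fun ⟨S, hS⟩ =>
          S.2.trans (Finset.card_le_card fun k hk => Finset.mem_filter.2 ⟨Finset.mem_univ _, hS k hk⟩)⟩
      rw [e]
      exact isClosed_iUnion_of_finite fun S => isClosed_biInter fun k _ =>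
        isClosed_eq (continuous_const.dotProduct continuous_id) continuous_const
    · rintro ψ ⟨h, -⟩
      have hi : ∀ i, |ψ i| ≤ 1 := fun i => by
        rw [← sq_le_one_iff_abs_le_one, ← h, sq]
        exact Finset.single_le_sum (f := fun i => ψ i * ψ i) (fun i _ => mul_self_nonneg _)
          (Finset.mem_univ i)
      exact ⟨fun i => (abs_le.1 (hi i)).1, fun i => (abs_le.1 (hi i)).2⟩
  have hpos : ∀ ψ ∈ {ψ : OctIdx ⊕ OctIdx → ℝ | ψ ⬝ᵥ ψ = 1 ∧ 8 ≤ (blindSpots ψ).card},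
      0 < ψ ∘ Sum.inl ⬝ᵥ ψ ∘ Sum.inl := by
    rintro ψ ⟨h1, h2⟩
    refine lt_of_le_of_ne (Finset.sum_nonneg fun i _ => mul_self_nonneg _) fun h => ?_
    obtain ⟨c, hc, hc'⟩ := exists_injective_of_le_card (m := 4 + 4) h2
    have : ψ = 0 := eq_zero_of_probe_of_inl hc (fun j => by
      obtain ⟨k, hk, e⟩ := hc' j
      rw [e]
      exact (Finset.mem_filter.1 hk).2) (dotProduct_self_eq_zero.1 h.symm)
    rw [this, zero_dotProduct] at h1
    exact zero_ne_one h1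
  obtain ⟨δ, h0, hδ⟩ := hK.exists_forall_le' (f := fun ψ => ψ ∘ Sum.inl ⬝ᵥ ψ ∘ Sum.inl) (a := 0)
    ((continuous_comp_right _).dotProduct (continuous_comp_right _)).continuousOn hpos
  exact ⟨min δ 1, lt_min h0 one_pos, min_le_right _ _, fun ψ h1 h2 =>
    (min_le_left _ _).trans (hδ ψ ⟨h1, h2⟩)⟩

/-- The level at which the pieces of index `k` are separated. -/
def level (k : Fin 22) : ℝ := ((k : ℕ) + 1) / 23

/-- The angle of the reference rotations of index `k`. -/
def angle (k : Fin 22) : ℝ := (22 - (k : ℕ)) / 220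

theorem level_pos (k : Fin 22) : 0 < level k := by unfold level; positivity

theorem level_lt_one (k : Fin 22) : level k < 1 := by
  have : ((k : ℕ) : ℝ) + 1 ≤ 22 := by exact_mod_cast k.2
  unfold level
  linarith

theorem level_lt_level {i j : Fin 22} : level i < level j ↔ i < j := by
  rw [level, level, div_lt_div_iff_of_pos_right (by norm_num), add_lt_add_iff_right, Nat.cast_lt,
    Fin.lt_def]

theorem level_injective : Function.Injective level :=
  StrictMono.injective fun _ _ => level_lt_level.2

theorem exists_many_probes {δ : ℝ} (h0 : 0 < δ) (hu : ψ ⬝ᵥ ψ = 1)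
    (hδ : 8 ≤ (blindSpots ψ).card → δ ≤ ψ ∘ Sum.inl ⬝ᵥ ψ ∘ Sum.inl) :
    7 ≤ (Finset.univ.filter fun k : Fin 22 => probe ((k : ℕ) : ℝ) ⬝ᵥ ψ ≠ 0 ∧
      δ * level k < ψ ∘ Sum.inl ⬝ᵥ ψ ∘ Sum.inl).card ∨
    7 ≤ (Finset.univ.filter fun k : Fin 22 => probe ((k : ℕ) : ℝ) ⬝ᵥ ψ ≠ 0 ∧
      ψ ∘ Sum.inl ⬝ᵥ ψ ∘ Sum.inl < δ * level k).card := by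
  classical
  set r := ψ ∘ Sum.inl ⬝ᵥ ψ ∘ Sum.inl
  set L := Finset.univ.filter fun k : Fin 22 => probe ((k : ℕ) : ℝ) ⬝ᵥ ψ ≠ 0 ∧ δ * level k < r
  set R := Finset.univ.filter fun k : Fin 22 => probe ((k : ℕ) : ℝ) ⬝ᵥ ψ ≠ 0 ∧ r < δ * level k
  set E := Finset.univ.filter fun k : Fin 22 => δ * level k = r
  have hE : E.card ≤ 1 := Finset.card_le_one.2 fun i hi j hj =>
    level_injective (mul_left_cancel₀ h0.ne'
      ((Finset.mem_filter.1 hi).2.trans (Finset.mem_filter.1 hj).2.symm))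
  have hcov : (Finset.univ : Finset (Fin 22)) ⊆ blindSpots ψ ∪ (E ∪ (L ∪ R)) := fun k _ => by
    simp only [blindSpots, E, L, R, Finset.mem_union, Finset.mem_filter, Finset.mem_univ, true_and]
    rcases lt_trichotomy (δ * level k) r with h | h | h <;> tauto
  have h22 := (Finset.card_le_card hcov).trans ((Finset.card_union_le _ _).trans
    (Nat.add_le_add_left ((Finset.card_union_le _ _).trans
      (Nat.add_le_add_left (Finset.card_union_le _ _) _)) _))
  rw [Finset.card_univ, Fintype.card_fin] at h22
  by_cases h8 : 8 ≤ (blindSpots ψ).card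
  · have hr := hδ h8
    have hk : ∀ k, δ * level k < r := fun k =>
      (mul_lt_of_lt_one_right h0 (level_lt_one k)).trans_le hr
    have hE' : E = ∅ := Finset.filter_eq_empty_iff.2 fun k _ => (hk k).ne
    have hR' : R = ∅ := Finset.filter_eq_empty_iff.2 fun k _ h => (hk k).not_gt h.2
    have := card_blindSpots_lt (ψ := ψ) (by rintro rfl; simp at hu)
    rw [hE', hR', Finset.card_empty] at h22
    omega
  · omega

theorem normSq_one_sub_exp (θ : ℝ) : Complex.normSq (1 - exp (θ * I)) = 2 - 2 * Real.cos θ := by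
  rw [normSq_apply, sub_re, sub_im, exp_ofReal_mul_I_re, exp_ofReal_mul_I_im, one_re, one_im]
  nlinarith [Real.sin_sq_add_cos_sq θ]

theorem angle_pos (k : Fin 22) : 0 < angle k := by
  have : ((k : ℕ) : ℝ) < 22 := by exact_mod_cast k.2
  unfold angle
  linarith

theorem angle_le (k : Fin 22) : angle k ≤ 1 / 10 := by
  have : (0 : ℝ) ≤ ((k : ℕ) : ℝ) := Nat.cast_nonneg _
  unfold angle
  linarith

theorem normSq_one_sub_exp_angle_lt {i j : Fin 22} (h : i < j) :
    Complex.normSq (1 - exp (angle j * I)) < Complex.normSq (1 - exp (angle i * I)) := by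
  have hπ := Real.pi_gt_three
  have hij : ((i : ℕ) : ℝ) < ((j : ℕ) : ℝ) := Nat.cast_lt.2 h
  have := Real.cos_lt_cos_of_nonneg_of_le_pi (angle_pos j).le (by linarith [angle_le i])
    (show angle j < angle i by unfold angle; linarith)
  rw [normSq_one_sub_exp, normSq_one_sub_exp]
  linarith

theorem exp_angle_injective : Function.Injective fun k => exp (angle k * I) := by
  intro i j h
  by_contra hne
  dsimp only at h
  rcases lt_or_gt_of_ne hne with h' | h' <;>
  · have := normSq_one_sub_exp_angle_lt h'
    rw [h] at this
    exact lt_irrefl _ this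

theorem normSq_one_sub_exp_angle_le (k : Fin 22) : Complex.normSq (1 - exp (angle k * I)) ≤ 1 / 100 := by
  rw [normSq_one_sub_exp]
  nlinarith [Real.one_sub_sq_div_two_le_cos (x := angle k), angle_pos k, angle_le k]

variable {D : Set (OctIdx ⊕ OctIdx → ℝ)} {a : (OctIdx ⊕ OctIdx → ℝ) → ℝ → Matrix VecIdx VecIdx ℝ}
  {A : Matrix VecIdx VecIdx ℝ}

theorem IsSpinorSection.exists_det_ne_zero (hs : IsSpinorSection D a) (h : IsRealSpinor A ψ)
    (hA : Aᵀ * A = 1) (hψ : ψ ∈ D) {K : Finset (Fin 22)} (hK : 7 ≤ K.card)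
    (hl : ∀ k ∈ K, probe ((k : ℕ) : ℝ) ⬝ᵥ ψ ≠ 0) :
    ∃ k ∈ K, localUnit a (probe ((k : ℕ) : ℝ)) A (.inr 0) ≠ level k ∧
      (A + refRot a (probe ((k : ℕ) : ℝ)) (level k) (angle k) A 0).det ≠ 0 := by
  classical
  by_contra! hdeg
  have hB := hs.transpose_mul ψ hψ 0 ⟨le_rfl, zero_le_one⟩
  have had := hs.isAdapted h hA hψ
  set B := a ψ 0 with hBdef
  set u := unitOf (Bᵀ * A) with hu
  have ha : ∀ k ∈ K, a (probeSpinor (probe ((k : ℕ) : ℝ)) A) 0 = B := fun k hk => by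
    rcases h.probeSpinor_eq (hl k hk) with e | e <;> rw [e]
    exact hs.neg_zero ψ
  have hloc : ∀ k ∈ K, localUnit a (probe ((k : ℕ) : ℝ)) A = u := fun k hk => by
    rw [localUnit, ha k hk]
  let K' := K.filter fun k => u (.inr 0) ≠ level k
  have hcard : 6 ≤ K'.card := by
    have h1 : (K.filter fun k => u (.inr 0) = level k).card ≤ 1 :=
      Finset.card_le_one.2 fun i hi j hj => level_injective
        ((Finset.mem_filter.1 hi).2.symm.trans (Finset.mem_filter.1 hj).2)
    have h2 := K.card_filter_add_card_filter_not fun k => u (.inr 0) = level k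
    have h3 : (K.filter fun k => u (.inr 0) = level k).card + K'.card = K.card := h2
    omega
  have hm : ∀ i : K', (i : Fin 22) ∈ K ∧ u (.inr 0) ≠ level i := fun i => Finset.mem_filter.1 i.2
  refine had.false_of_six_degenerate (I := K') (ζ := fun i => exp (angle i * I))
    (s := fun i => level i) (transpose_mul_self_mul'
      (by rw [transpose_transpose]; exact mul_eq_one_comm.1 hB) hA)
    (by rwa [Fintype.card_coe]) (exp_angle_injective.comp Subtype.val_injective)
    (fun i => level_pos i) (fun i => level_lt_one i) (fun i => (hm i).2.symm)
    (fun i j hij => normSq_one_sub_exp_angle_lt (level_lt_level.1 hij))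
    (fun i => normSq_one_sub_exp_angle_le i) fun i => ?_
  have hd := hdeg i (hm i).1 (by rw [hloc _ (hm i).1]; exact (hm i).2)
  rw [refRot, ha _ (hm i).1, hloc _ (hm i).1, rotPath_zero had.isImUnit, sub_zero, one_mul] at hd
  rw [← mul_zero (Bᵀ).det, ← hd, ← det_mul, Matrix.mul_add, ← Matrix.mul_assoc, ← Matrix.mul_assoc,
    hB, Matrix.one_mul]

end Probes

end Matrix

namespace Matrix

open Complex

section Cover

variable {A : Matrix VecIdx VecIdx ℝ} {ψ l : OctIdx ⊕ OctIdx → ℝ} {c : ℝ}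

/-- The squared norm of the first component of the real spinor of a rotation. -/
def leftNorm (A : Matrix VecIdx VecIdx ℝ) : ℝ := ∑ i, spinM A (.inl i) (.inl i)

theorem IsRealSpinor.leftNorm_eq (h : IsRealSpinor A ψ) :
    leftNorm A = ψ ∘ Sum.inl ⬝ᵥ ψ ∘ Sum.inl := by
  simp [leftNorm, h.spinM_eq, vecMulVec_apply, dotProduct]

theorem continuous_leftNorm : Continuous leftNorm :=
  continuous_finsetSum _ fun i _ => continuous_spinM.matrix_elem (.inl i) (.inl i)

/-- The rotations seen by the probe `l` whose first spinor component is longer than `√c`. -/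
def leftDom (l : OctIdx ⊕ OctIdx → ℝ) (c : ℝ) : Set (specialOrthogonalGroup VecIdx ℝ) :=
  {A | l ⬝ᵥ (spinM (A : Matrix VecIdx VecIdx ℝ) *ᵥ l) ≠ 0 ∧
    c < leftNorm (A : Matrix VecIdx VecIdx ℝ)}

/-- The rotations seen by the probe `l` whose first spinor component is shorter than `√c`. -/
def rightDom (l : OctIdx ⊕ OctIdx → ℝ) (c : ℝ) : Set (specialOrthogonalGroup VecIdx ℝ) :=
  {A | l ⬝ᵥ (spinM (A : Matrix VecIdx VecIdx ℝ) *ᵥ l) ≠ 0 ∧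
    leftNorm (A : Matrix VecIdx VecIdx ℝ) < c}

theorem isOpen_probe_ne_zero : IsOpen {A : specialOrthogonalGroup VecIdx ℝ |
    l ⬝ᵥ (spinM (A : Matrix VecIdx VecIdx ℝ) *ᵥ l) ≠ 0} := by
  have h : Continuous fun A : specialOrthogonalGroup VecIdx ℝ =>
      spinM (A : Matrix VecIdx VecIdx ℝ) := continuous_spinM.comp continuous_subtype_val
  exact isOpen_ne_fun (continuous_const.dotProduct (h.matrix_mulVec continuous_const))
    continuous_const

theorem isOpen_leftDom : IsOpen (leftDom l c) :=
  isOpen_probe_ne_zero.inter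
    (isOpen_lt continuous_const (continuous_leftNorm.comp continuous_subtype_val))

theorem isOpen_rightDom : IsOpen (rightDom l c) :=
  isOpen_probe_ne_zero.inter
    (isOpen_lt (continuous_leftNorm.comp continuous_subtype_val) continuous_const)

theorem exists_isRealSpinor_of_specialOrthogonal (A : specialOrthogonalGroup VecIdx ℝ) :
    ∃ ψ, IsRealSpinor (A : Matrix VecIdx VecIdx ℝ) ψ :=
  exists_isRealSpinor (transpose_mul_self_of_specialOrthogonal A)
    (mem_specialOrthogonalGroup_iff.1 A.2).2

theorem isRealSpinor_probeSpinor {A : specialOrthogonalGroup VecIdx ℝ}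
    (h : l ⬝ᵥ (spinM (A : Matrix VecIdx VecIdx ℝ) *ᵥ l) ≠ 0) :
    IsRealSpinor (A : Matrix VecIdx VecIdx ℝ) (probeSpinor l A) := by
  obtain ⟨ψ, hψ⟩ := exists_isRealSpinor_of_specialOrthogonal A
  exact hψ.probeSpinor fun h0 => h (by rw [hψ.probe_eq, h0, sq, zero_mul])

theorem isProbed_leftDom (hc : 0 ≤ c) : IsProbed {ψ | ψ ∘ Sum.inl ≠ 0} l (leftDom l c) := by
  rintro A ⟨h1, h2⟩
  refine ⟨h1, fun h => ?_⟩
  rw [(isRealSpinor_probeSpinor h1).leftNorm_eq, h, zero_dotProduct] at h2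
  exact hc.not_gt h2

theorem isProbed_rightDom (hc : c ≤ 1) : IsProbed {ψ | ψ ∘ Sum.inr ≠ 0} l (rightDom l c) := by
  rintro A ⟨h1, h2⟩
  have hψ := isRealSpinor_probeSpinor h1
  refine ⟨h1, fun h => ?_⟩
  have hu := hψ.dotProduct_self (transpose_mul_self_of_specialOrthogonal A)
  rw [spinor_dotProduct_self, h, zero_dotProduct, add_zero, ← hψ.leftNorm_eq] at hu
  exact hc.not_gt (hu ▸ h2)

/-- The members of the categorical cover. -/
def coverSet (δ : ℝ) (k : Fin 22) : Set (specialOrthogonalGroup VecIdx ℝ) :=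
  probePiece sectionL (probe ((k : ℕ) : ℝ)) (level k) (angle k)
    (leftDom (probe ((k : ℕ) : ℝ)) (δ * level k)) ∪
  probePiece sectionR (probe ((k : ℕ) : ℝ)) (level k) (angle k)
    (rightDom (probe ((k : ℕ) : ℝ)) (δ * level k))

theorem isOpen_and_contractsTo_coverSet {δ : ℝ} (h0 : 0 < δ) (h1 : δ ≤ 1) (k : Fin 22) :
    IsOpen (coverSet δ k) ∧ ContractsTo (coverSet δ k) 1 := by
  have hk := level_pos k
  have hk' := level_lt_one k
  obtain ⟨o1, c1⟩ := (isProbed_leftDom (l := probe ((k : ℕ) : ℝ)) (mul_pos h0 hk).le).probePiece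
    (θ := angle k) isSpinorSection_sectionL isOpen_leftDom hk hk'
  obtain ⟨o2, c2⟩ := (isProbed_rightDom (l := probe ((k : ℕ) : ℝ))
    (mul_le_one₀ h1 hk.le hk'.le)).probePiece
    (θ := angle k) isSpinorSection_sectionR isOpen_rightDom hk hk'
  exact ⟨o1.union o2, c1.union c2 o1 o2 (Set.disjoint_left.2 fun A h h' =>
    lt_asymm h.1.2 h'.1.2)⟩

theorem catLE_specialOrthogonalGroup_vecIdx : catLE (specialOrthogonalGroup VecIdx ℝ) 21 := by
  obtain ⟨δ, h0, h1, hδ⟩ := exists_pos_le_of_blindSpots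
  refine ⟨coverSet δ, fun k => (isOpen_and_contractsTo_coverSet h0 h1 k).1, fun A => ?_,
    fun k => (isOpen_and_contractsTo_coverSet h0 h1 k).2.contractibleIn⟩
  obtain ⟨ψ, hψ⟩ := exists_isRealSpinor_of_specialOrthogonal A
  have hA := transpose_mul_self_of_specialOrthogonal A
  have hu := hψ.dotProduct_self hA
  have hp : ∀ k : Fin 22, probe ((k : ℕ) : ℝ) ⬝ᵥ ψ ≠ 0 → probe ((k : ℕ) : ℝ) ⬝ᵥ
      (spinM (A : Matrix VecIdx VecIdx ℝ) *ᵥ probe ((k : ℕ) : ℝ)) ≠ 0 := fun k hk => by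
    rw [hψ.probe_eq]
    exact pow_ne_zero 2 hk
  rcases exists_many_probes h0 hu (hδ ψ hu) with h7 | h7
  · obtain ⟨k₀, hk₀⟩ := Finset.card_pos.1 (Nat.zero_lt_of_lt h7)
    have hmem : ψ ∈ {ψ : OctIdx ⊕ OctIdx → ℝ | ψ ∘ Sum.inl ≠ 0} := fun h => by
      have := (Finset.mem_filter.1 hk₀).2.2
      rw [h, zero_dotProduct] at this
      exact this.not_gt (mul_pos h0 (level_pos k₀))
    obtain ⟨k, hk, hn⟩ := isSpinorSection_sectionL.exists_det_ne_zero hψ hA hmem h7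
      fun k hk => (Finset.mem_filter.1 hk).2.1
    have hk' := (Finset.mem_filter.1 hk).2
    exact ⟨k, Or.inl ⟨⟨hp k hk'.1, hψ.leftNorm_eq ▸ hk'.2⟩, hn⟩⟩
  · obtain ⟨k₀, hk₀⟩ := Finset.card_pos.1 (Nat.zero_lt_of_lt h7)
    have hmem : ψ ∈ {ψ : OctIdx ⊕ OctIdx → ℝ | ψ ∘ Sum.inr ≠ 0} := fun h => by
      have := (Finset.mem_filter.1 hk₀).2.2
      rw [spinor_dotProduct_self, h, zero_dotProduct, add_zero] at hu
      rw [hu] at this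
      exact this.not_ge (mul_le_one₀ h1 (level_pos k₀).le (level_lt_one k₀).le)
    obtain ⟨k, hk, hn⟩ := isSpinorSection_sectionR.exists_det_ne_zero hψ hA hmem h7
      fun k hk => (Finset.mem_filter.1 hk).2.1
    have hk' := (Finset.mem_filter.1 hk).2
    exact ⟨k, Or.inr ⟨⟨hp k hk'.1, hψ.leftNorm_eq ▸ hk'.2⟩, hn⟩⟩

theorem reindex_mem_specialOrthogonalGroup {m n : Type*} [Fintype m] [DecidableEq m] [Fintype n]
    [DecidableEq n] (e : m ≃ n) {B : Matrix m m ℝ} (hB : B ∈ specialOrthogonalGroup m ℝ) :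
    reindex e e B ∈ specialOrthogonalGroup n ℝ := by
  rw [mem_specialOrthogonalGroup_iff, mem_orthogonalGroup_iff] at hB ⊢
  rw [det_reindex_self]
  refine ⟨?_, hB.2⟩
  have := congrArg (reindex e e) hB.1
  rwa [reindex_apply, reindex_apply, ← submatrix_mul_equiv _ _ e.symm e.symm e.symm,
    submatrix_one_equiv] at this

/-- Reindexing as a homeomorphism between special orthogonal groups. -/
def reindexSpecialOrthogonal {m n : Type*} [Fintype m] [DecidableEq m] [Fintype n]
    [DecidableEq n] (e : m ≃ n) :
    specialOrthogonalGroup m ℝ ≃ₜ specialOrthogonalGroup n ℝ where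
  toFun B := ⟨reindex e e B, reindex_mem_specialOrthogonalGroup e B.2⟩
  invFun B := ⟨reindex e.symm e.symm B, reindex_mem_specialOrthogonalGroup e.symm B.2⟩
  left_inv B := Subtype.ext (by simp)
  right_inv B := Subtype.ext (by simp)
  continuous_toFun := (continuous_subtype_val.matrix_reindex e e).subtype_mk _
  continuous_invFun := (continuous_subtype_val.matrix_reindex e.symm e.symm).subtype_mk _

end Cover

end Matrix

theorem catLE_SO10 : catLE SO10 21 :=
  catLE_of_homeomorph (Matrix.reindexSpecialOrthogonal
    (Fintype.equivFinOfCardEq (by simp))) Matrix.catLE_specialOrthogonalGroup_vecIdx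

theorem catNat_SO10 : catNat SO10 = 21 :=
  le_antisymm (Nat.sInf_le catLE_SO10)
    (le_csInf ⟨21, catLE_SO10⟩ fun n hn => by
      by_contra! h
      exact not_catLE_SO10 (Nat.le_of_lt_succ h) hn)

/-- cat(SO(10)) = 21, and 21 is also the F₂-cup-length of SO(10), namely the greatest `k`
such that some `k`-fold product of positive-degree classes in `H^*(SO(10); F₂)` is nonzero. -/
theorem cat_SO10_eq_21_eq_cupLength :
    catNat SO10 = 21 ∧
      IsGreatest {k : ℕ | ∃ a : Fin k → CohSO10,
        (∀ i, IsHomogPos (a i)) ∧ ∏ i, a i ≠ 0} 21 :=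
  ⟨catNat_SO10, isGreatest_cupLength_CohSO10⟩

end
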